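/- Let l > 5 be a prime with l ≡ 4 (mod 5). Let N be the number of pairs (u,v) ∈ 𝔽_l × 𝔽_l such that the quadratic x² + u·x + v is irreducible in 𝔽_l[x], divides the Hasse invariant Ĥ_{5,l}(x) in 𝔽_l[x], and u = e⁵·(v−1) for some e ∈ 𝔽_l with e² + e = 1. Then: if l ≡ 1 (mod 4), 2·N = h(−5l); if l ≡ 3 (mod 8), N = h(−5l) − 3; and if l ≡ 7 (mod 8), N = 2·h(−5l) − 3. -/

import Mathlib

section
open Polynomial

/-- The Hasse invariant `Ĥ_{5,l}(x)` of the Tate normal form `E₅` in characteristic `l`. -/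
noncomputable def hasseInvariant5 (l : ℕ) : Polynomial (ZMod l) :=
  let n := l / 12
  let r := if l % 3 = 2 then 1 else 0
  let s := if l % 4 = 3 then 1 else 0
  let c4 : Polynomial (ZMod l) := X ^ 4 + 12 * X ^ 3 + 14 * X ^ 2 - 12 * X + 1
  let D : Polynomial (ZMod l) := X ^ 5 * (1 - 11 * X - X ^ 2)
  c4 ^ r * ((X ^ 2 + 1) * (X ^ 4 + 18 * X ^ 3 + 74 * X ^ 2 - 18 * X + 1)) ^ s *
    ∑ k ∈ Finset.range (n + 1),
      (Nat.choose (2 * n + s) (2 * k + s) : Polynomial (ZMod l)) *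
        (Nat.choose (2 * n - 2 * k) (n - k) : Polynomial (ZMod l)) *
        (-432 : Polynomial (ZMod l)) ^ (n - k) *
        (c4 ^ 3 - 1728 * D) ^ k * D ^ (n - k)
end

section
open PowerSeries in
def SRep (p : PowerSeries ℂ) (f : ℂ → ℂ) : Prop :=
  ∀ z : ℂ, ‖z‖ < 1 → HasSum (fun n => coeff n p * z ^ n) (f z)

namespace SRep
open PowerSeries

lemma congr {p : ℂ⟦X⟧} {f g : ℂ → ℂ} (h : SRep p f) (hfg : ∀ z, ‖z‖ < 1 → f z = g z) :
    SRep p g := fun z hz => hfg z hz ▸ h z hz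

lemma add {p p' : ℂ⟦X⟧} {f g : ℂ → ℂ} (h : SRep p f) (h' : SRep p' g) :
    SRep (p + p') (fun z => f z + g z) := fun z hz => by
  simpa [add_mul] using (h z hz).add (h' z hz)

lemma neg {p : ℂ⟦X⟧} {f : ℂ → ℂ} (h : SRep p f) :
    SRep (-p) (fun z => - f z) := fun z hz => by
  simpa using (h z hz).neg

lemma sub {p p' : ℂ⟦X⟧} {f g : ℂ → ℂ} (h : SRep p f) (h' : SRep p' g) :
    SRep (p - p') (fun z => f z - g z) := fun z hz => by
  simpa [sub_mul] using (h z hz).sub (h' z hz)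

lemma mul {p p' : ℂ⟦X⟧} {f g : ℂ → ℂ} (h : SRep p f) (h' : SRep p' g) :
    SRep (p * p') (fun z => f z * g z) := fun z hz => by
  have h1 := (h z hz).summable.norm
  have h2 := (h' z hz).summable.norm
  have e := tsum_mul_tsum_eq_tsum_sum_antidiagonal_of_summable_norm h1 h2
  have s := (summable_norm_sum_mul_antidiagonal_of_summable_norm h1 h2).of_norm
  rw [(h z hz).tsum_eq, (h' z hz).tsum_eq] at e
  have := s.hasSum
  rw [← e] at this
  have e2 : (fun n => coeff n (p * p') * z ^ n) = fun n => ∑ kl ∈ Finset.HasAntidiagonal.antidiagonal n,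
      (coeff kl.1 p * z ^ kl.1) * (coeff kl.2 p' * z ^ kl.2) := by
    funext n
    rw [coeff_mul, Finset.sum_mul]
    exact Finset.sum_congr rfl fun x hx => by
      rw [← Finset.HasAntidiagonal.mem_antidiagonal.mp hx, pow_add]; ring
  rw [e2]
  exact this

lemma const (c : ℂ) : SRep (C c) (fun _ => c) := fun z hz => by
  have := hasSum_single (f := fun n => coeff n (C c : ℂ⟦X⟧) * z ^ n) 0
    (fun n hn => by simp [coeff_C, hn])
  simpa using this

lemma one : SRep 1 (fun _ => 1) := by simpa using const 1

lemma xpow (m : ℕ) : SRep (X ^ m) (fun z => z ^ m) := fun z hz => by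
  have := hasSum_single (f := fun n => coeff n (X ^ m : ℂ⟦X⟧) * z ^ n) m
    (fun n hn => by simp [coeff_X_pow, hn])
  simpa using this

lemma pow {p : ℂ⟦X⟧} {f : ℂ → ℂ} (h : SRep p f) (m : ℕ) :
    SRep (p ^ m) (fun z => f z ^ m) := by
  induction m with
  | zero => simpa using one
  | succ k ih => simpa [pow_succ] using ih.mul h

lemma prod {ι : Type*} (s : Finset ι) {p : ι → ℂ⟦X⟧} {f : ι → ℂ → ℂ}
    (h : ∀ i ∈ s, SRep (p i) (f i)) : SRep (∏ i ∈ s, p i) (fun z => ∏ i ∈ s, f i z) := by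
  classical
  induction s using Finset.induction_on with
  | empty => simpa using one
  | insert a s ha ih =>
    simp only [Finset.prod_insert ha]
    exact (h a (by simp)).mul (ih fun i hi => h i (by simp [hi]))

lemma sum {ι : Type*} (s : Finset ι) {p : ι → ℂ⟦X⟧} {f : ι → ℂ → ℂ}
    (h : ∀ i ∈ s, SRep (p i) (f i)) : SRep (∑ i ∈ s, p i) (fun z => ∑ i ∈ s, f i z) := by
  classical
  induction s using Finset.induction_on with
  | empty => simpa using const 0
  | insert a s ha ih =>
    simp only [Finset.sum_insert ha]
    exact (h a (by simp)).add (ih fun i hi => h i (by simp [hi]))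

lemma rescale {p : ℂ⟦X⟧} {f : ℂ → ℂ} (h : SRep p f) {a : ℂ} (ha : ‖a‖ ≤ 1) :
    SRep (PowerSeries.rescale a p) (fun z => f (a * z)) := fun z hz => by
  have : ‖a * z‖ < 1 := by
    rw [norm_mul]; nlinarith [norm_nonneg a, norm_nonneg z]
  convert h _ this using 2 with n
  simp [coeff_rescale, mul_pow]; ring

lemma expand {p : ℂ⟦X⟧} {f : ℂ → ℂ} (h : SRep p f) {m : ℕ} (hm : m ≠ 0) :
    SRep (PowerSeries.expand m hm p) (fun z => f (z ^ m)) := fun z hz => by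
  have h1 : ‖z ^ m‖ < 1 := by
    rw [norm_pow]; exact pow_lt_one₀ (norm_nonneg _) hz hm
  have := h _ h1
  have inj : Function.Injective (fun n : ℕ => m * n) := fun a b hab => by
    simpa [hm] using hab
  refine (Function.Injective.hasSum_iff inj (f := fun n => coeff n (PowerSeries.expand m hm p) * z ^ n) ?_).mp ?_
  · intro n hn
    rw [coeff_expand_of_not_dvd, zero_mul]
    rintro ⟨k, rfl⟩
    exact hn ⟨k, rfl⟩
  · convert this using 2 with n
    simp [coeff_expand_mul, pow_mul]

lemma hasFPS {p : ℂ⟦X⟧} {f : ℂ → ℂ} (h : SRep p f) :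
    HasFPowerSeriesOnBall f (FormalMultilinearSeries.ofScalars ℂ (fun n => coeff n p)) 0 1 where
  r_le := by
    refine ENNReal.le_of_forall_nnreal_lt fun r hr => ?_
    refine FormalMultilinearSeries.le_radius_of_summable_norm _ ?_
    have := (h (r : ℝ) (by simpa using hr)).summable.norm
    convert this using 2 with n
    simp
  r_pos := by simp
  hasSum := by
    intro z hz
    have : ‖z‖ < 1 := by simpa [enorm_eq_nnnorm, ← NNReal.coe_lt_one] using hz
    simpa [FormalMultilinearSeries.ofScalars_apply_eq, mul_comm] using h z this

lemma unique {p p' : ℂ⟦X⟧} {f g : ℂ → ℂ} (h : SRep p f) (h' : SRep p' g)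
    (e : ∀ z, ‖z‖ < 1 → z ≠ 0 → f z = g z) : p = p' := by
  have hf := h.hasFPS.hasFPowerSeriesAt
  have hg := h'.hasFPS.hasFPowerSeriesAt
  have ev : ∀ᶠ z in nhdsWithin (0:ℂ) {0}ᶜ, f z = g z := by
    rw [eventually_nhdsWithin_iff]
    filter_upwards [Metric.ball_mem_nhds (0:ℂ) one_pos] with z hz hz0
    exact e z (by simpa using hz) hz0
  have := (AnalyticAt.frequently_eq_iff_eventually_eq hf.analyticAt hg.analyticAt).mp ev.frequently
  have h3 := HasFPowerSeriesAt.eq_formalMultilinearSeries_of_eventually hf hg this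
  have := FormalMultilinearSeries.ofScalars_series_injective (𝕜 := ℂ) (E := ℂ) h3
  ext n
  exact congrFun this n

lemma taylor {f : ℂ → ℂ} (h : DifferentiableOn ℂ f (Metric.ball 0 1)) :
    SRep (PowerSeries.mk fun n => (n.factorial : ℂ)⁻¹ * iteratedDeriv n f 0) f := fun z hz => by
  have := Complex.hasSum_taylorSeries_on_ball (c := 0) (r := 1) (f := f) (by simpa using h)
    (z := z) (by simpa using hz)
  have e : (fun n => coeff n (PowerSeries.mk fun n => (n.factorial : ℂ)⁻¹ * iteratedDeriv n f 0) * z ^ n)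
      = fun n : ℕ => (n.factorial : ℂ)⁻¹ • (z - 0) ^ n • iteratedDeriv n f 0 := by
    funext n
    rw [coeff_mk, sub_zero, smul_eq_mul, smul_eq_mul]; ring
  rw [e]; exact this

lemma ex {f : ℂ → ℂ} (h : DifferentiableOn ℂ f (Metric.ball 0 1)) : ∃ p, SRep p f :=
  ⟨_, taylor h⟩

lemma analyticAt {p : ℂ⟦X⟧} {f : ℂ → ℂ} (h : SRep p f) {z : ℂ} (hz : ‖z‖ < 1) :
    AnalyticAt ℂ f z := h.hasFPS.analyticAt_of_mem (by simpa [enorm_eq_nnnorm, ← NNReal.coe_lt_one] using hz)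

lemma diffOn {p : ℂ⟦X⟧} {f : ℂ → ℂ} (h : SRep p f) : DifferentiableOn ℂ f (Metric.ball 0 1) :=
  fun z hz => (h.analyticAt (by simpa using hz)).differentiableAt.differentiableWithinAt

lemma apply_zero {p : ℂ⟦X⟧} {f : ℂ → ℂ} (h : SRep p f) : f 0 = constantCoeff p := by
  have h1 := h 0 (by simp)
  have := hasSum_single (f := fun n => coeff n p * (0:ℂ) ^ n) 0
    (fun n hn => by simp [hn])
  rw [h1.unique this]; simp

lemma coeff_eq {p : ℂ⟦X⟧} {f : ℂ → ℂ} (h : SRep p f) (n : ℕ) :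
    coeff n p = (n.factorial : ℂ)⁻¹ * iteratedDeriv n f 0 := by
  rw [h.unique (taylor h.diffOn) (fun _ _ _ => rfl)]; simp

end SRep
end

section
open PowerSeries

/-- Euler product -/
noncomputable def ep (q : ℂ) : ℂ := ∏' n : ℕ, (1 - q ^ (n + 1))

lemma tendsto_iteratedDeriv_zero {F : ℕ → ℂ → ℂ} {f : ℂ → ℂ}
    (h : TendstoLocallyUniformlyOn F f Filter.atTop (Metric.ball 0 1))
    (hF : ∀ N, DifferentiableOn ℂ (F N) (Metric.ball 0 1)) (n : ℕ) :
    TendstoLocallyUniformlyOn (fun N => iteratedDeriv n (F N)) (iteratedDeriv n f) Filter.atTop (Metric.ball 0 1) := by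
  induction n with
  | zero => simpa using h
  | succ k ih =>
    simp only [iteratedDeriv_succ]
    refine ih.deriv (Filter.Eventually.of_forall fun N => ?_) Metric.isOpen_ball
    exact (((hF N).contDiffOn Metric.isOpen_ball).differentiableOn_iteratedDerivWithin (n := ⊤) (m := k) (WithTop.coe_lt_top _)
      Metric.isOpen_ball.uniqueDiffOn).congr (fun z hz => (iteratedDerivWithin_of_isOpen Metric.isOpen_ball hz).symm)

lemma isInt_of_tendsto {u : ℕ → ℤ} {a : ℂ} (h : Filter.Tendsto (fun n => (u n : ℂ)) Filter.atTop (nhds a)) :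
    ∃ m : ℤ, (m : ℂ) = a := by
  have hc : IsClosed (Set.range ((↑) : ℤ → ℂ)) := by
    have : Topology.IsClosedEmbedding ((↑) : ℤ → ℂ) := by
      have h1 := Complex.isometry_ofReal.isClosedEmbedding.comp Int.isClosedEmbedding_coe_real
      have e : ((↑) : ℤ → ℂ) = Complex.ofReal ∘ ((↑) : ℤ → ℝ) := by ext; simp
      rwa [e]
    exact this.isClosed_range
  exact hc.mem_of_tendsto h (Filter.Eventually.of_forall fun n => ⟨u n, rfl⟩)

noncomputable abbrev zc : ℤ⟦X⟧ →+* ℂ⟦X⟧ := PowerSeries.map (Int.castRingHom ℂ)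

lemma zc_inj : Function.Injective zc := PowerSeries.map_injective _ (RingHom.injective_int _)

lemma int_of_limit {F : ℕ → ℂ → ℂ} {f : ℂ → ℂ}
    (h : TendstoLocallyUniformlyOn F f Filter.atTop (Metric.ball 0 1))
    (P : ℕ → ℤ⟦X⟧) (hP : ∀ N, SRep (zc (P N)) (F N)) :
    ∃ p : ℤ⟦X⟧, SRep (zc p) f := by
  have hd : DifferentiableOn ℂ f (Metric.ball 0 1) :=
    h.differentiableOn (Filter.Eventually.of_forall fun N => (hP N).diffOn) Metric.isOpen_ball
  have key : ∀ n, ∃ m : ℤ, (m : ℂ) = (n.factorial : ℂ)⁻¹ * iteratedDeriv n f 0 := by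
    intro n
    refine isInt_of_tendsto (u := fun N => coeff n (P N)) ?_
    have := (tendsto_iteratedDeriv_zero h (fun N => (hP N).diffOn) n).tendsto_at (by simp : (0:ℂ) ∈ Metric.ball 0 1)
    have := this.const_mul (n.factorial : ℂ)⁻¹
    refine this.congr fun N => ?_
    rw [← (hP N).coeff_eq n]; simp
  choose m hm using key
  refine ⟨PowerSeries.mk m, ?_⟩
  convert SRep.taylor hd using 1
  ext n
  simp [hm]

lemma ep_tlu : TendstoLocallyUniformlyOn (fun N q => ∏ n ∈ Finset.range N, (1 - q ^ (n + 1))) ep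
    Filter.atTop (Metric.ball (0:ℂ) 1) := by
  have h := ModularForm.multipliableLocallyUniformlyOn_one_sub_pow.hasProdLocallyUniformlyOn
  rw [hasProdLocallyUniformlyOn_iff_tendstoLocallyUniformlyOn] at h
  intro u hu x hx
  obtain ⟨t, ht, h2⟩ := h u hu x hx
  exact ⟨t, ht, Filter.tendsto_finset_range.eventually h2⟩

lemma exists_epZ : ∃ p : ℤ⟦X⟧, SRep (zc p) ep := by
  refine int_of_limit ep_tlu (fun N => ∏ n ∈ Finset.range N, (1 - X ^ (n + 1))) fun N => ?_
  rw [map_prod]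
  refine SRep.prod _ fun i _ => ?_
  simp only [map_sub, map_one, map_pow, map_X]
  exact SRep.one.sub (SRep.xpow _)

noncomputable def epZ : ℤ⟦X⟧ := exists_epZ.choose
lemma epZ_rep : SRep (zc epZ) ep := exists_epZ.choose_spec

lemma epZ_coeff (n : ℕ) : coeff n epZ = coeff n (∏ i ∈ Finset.range n, (1 - X ^ (i + 1)) : ℤ⟦X⟧) := by
  have hP : ∀ N, SRep (zc (∏ i ∈ Finset.range N, (1 - X ^ (i + 1))))
      (fun q => ∏ n ∈ Finset.range N, (1 - q ^ (n + 1))) := fun N => by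
    rw [map_prod]
    refine SRep.prod _ fun i _ => ?_
    simp only [map_sub, map_one, map_pow, map_X]
    exact SRep.one.sub (SRep.xpow _)
  have h1 := (tendsto_iteratedDeriv_zero ep_tlu (fun N => (hP N).diffOn) n).tendsto_at (by simp : (0:ℂ) ∈ Metric.ball 0 1)
  have h2 := h1.const_mul (n.factorial : ℂ)⁻¹
  rw [← epZ_rep.coeff_eq n] at h2
  have h3 : ∀ N, n ≤ N → coeff n (∏ i ∈ Finset.range N, (1 - X ^ (i + 1)) : ℤ⟦X⟧)
      = coeff n (∏ i ∈ Finset.range n, (1 - X ^ (i + 1)) : ℤ⟦X⟧) := by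
    intro N hN
    induction N, hN using Nat.le_induction with
    | base => rfl
    | succ N hN ih =>
      rw [Finset.prod_range_succ, mul_sub, mul_one, map_sub, ih, coeff_mul_X_pow', if_neg (by omega), sub_zero]
  have h4 : (coeff n (zc epZ) : ℂ) = coeff n (zc (∏ i ∈ Finset.range n, (1 - X ^ (i + 1)))) := by
    refine tendsto_nhds_unique h2 (tendsto_const_nhds.congr' ?_)
    filter_upwards [Filter.eventually_ge_atTop n] with N hN
    rw [← (hP N).coeff_eq n]
    simp only [coeff_map, h3 N hN]
  simpa only [coeff_map, eq_intCast, Int.cast_inj] using h4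

lemma ep_zero : ep 0 = 1 := by simp [ep]

lemma epZ_const : constantCoeff epZ = 1 := by
  have := epZ_coeff 0
  simpa using this

lemma epZ_one : coeff 1 epZ = -1 := by
  rw [epZ_coeff]
  simp [Finset.prod_range_succ]

lemma epZ_two : coeff 2 epZ = -1 := by
  rw [epZ_coeff]
  have : (∏ i ∈ Finset.range 2, (1 - X ^ (i + 1)) : ℤ⟦X⟧) = 1 - X ^ 1 - X ^ 2 + X ^ 3 := by
    simp [Finset.prod_range_succ]; ring
  rw [this]
  simp [coeff_X_pow, coeff_one, coeff_X]

lemma ep_ne_zero {q : ℂ} (hq : ‖q‖ < 1) : ep q ≠ 0 := by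
  refine tprod_one_add_ne_zero_of_summable (f := fun n : ℕ ↦ -q ^ (n + 1)) (fun n => ?_) ?_
  · intro h
    have : q ^ (n+1) = 1 := by linear_combination -h
    have h2 := congrArg norm this
    rw [norm_pow, norm_one] at h2
    exact absurd h2 (pow_lt_one₀ (norm_nonneg _) hq (by omega)).ne
  · simpa using (summable_nat_add_iff 1).mpr (summable_geometric_of_lt_one (norm_nonneg _) hq)
end

section
open PowerSeries Complex
open UpperHalfPlane hiding I

abbrev M2 := Matrix (Fin 2) (Fin 2) ℤ

noncomputable def dn (A : M2) (z : ℂ) : ℂ := A 1 0 * z + A 1 1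
noncomputable def mo (A : M2) (z : ℂ) : ℂ := (A 0 0 * z + A 0 1) / (A 1 0 * z + A 1 1)

lemma mo_def (A : M2) (z : ℂ) : mo A z = (A 0 0 * z + A 0 1) / dn A z := rfl

lemma dn_ne {A : M2} (hA : 0 < A.det) {z : ℂ} (hz : 0 < z.im) : dn A z ≠ 0 := by
  intro h
  have h1 := congrArg Complex.im h
  have h2 := congrArg Complex.re h
  simp [dn] at h1 h2
  have hc : A 1 0 = 0 := by rcases h1 with h | h; exact h; exact absurd h hz.ne'
  rw [hc] at h2
  simp at h2
  rw [Matrix.det_fin_two, hc, h2] at hA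
  simp at hA

lemma mo_im {A : M2} {z : ℂ} (h : dn A z ≠ 0) :
    (mo A z).im = A.det * z.im / Complex.normSq (dn A z) := by
  rw [mo_def, Complex.div_im, Matrix.det_fin_two]
  have : Complex.normSq (dn A z) ≠ 0 := by simpa using h
  field_simp
  simp [dn]
  ring

lemma mo_up {A : M2} (hA : 0 < A.det) {z : ℂ} (hz : 0 < z.im) : 0 < (mo A z).im := by
  rw [mo_im (dn_ne hA hz)]
  have : 0 < Complex.normSq (dn A z) := Complex.normSq_pos.mpr (dn_ne hA hz)
  have : (0:ℝ) < A.det := by exact_mod_cast hA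
  positivity

lemma dn_mul {A B : M2} {z : ℂ} (h : dn B z ≠ 0) :
    dn (A * B) z = dn A (mo B z) * dn B z := by
  have e : mo B z * dn B z = B 0 0 * z + B 0 1 := by rw [mo_def, div_mul_cancel₀ _ h]
  have e2 : dn A (mo B z) * dn B z = A 1 0 * (mo B z * dn B z) + A 1 1 * dn B z := by
    simp only [dn]; ring
  rw [e2, e]
  simp only [dn, Matrix.mul_apply, Fin.sum_univ_two]
  push_cast
  ring

lemma mo_mul {A B : M2} (hA : 0 < A.det) (hB : 0 < B.det) {z : ℂ} (hz : 0 < z.im) :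
    mo (A * B) z = mo A (mo B z) := by
  have h := dn_ne hB hz
  have h2 := dn_ne hA (mo_up hB hz)
  have e : mo B z * dn B z = B 0 0 * z + B 0 1 := by rw [mo_def, div_mul_cancel₀ _ h]
  rw [mo_def, mo_def A, dn_mul h, ← mul_div_mul_right (A 0 0 * mo B z + A 0 1) _ h]
  congr 1
  rw [add_mul (A 0 0 * mo B z) (A 0 1 : ℂ), mul_assoc (A 0 0 : ℂ), e]
  simp only [Matrix.mul_apply, Fin.sum_univ_two, dn]
  push_cast
  ring

lemma mo_one (z : ℂ) : mo 1 z = z := by simp [mo]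
lemma dn_one (z : ℂ) : dn 1 z = 1 := by simp [dn]

lemma mo_deriv {A : M2} (hA : 0 < A.det) {z : ℂ} (hz : 0 < z.im) :
    HasDerivAt (mo A) (A.det / dn A z ^ 2) z := by
  have h := dn_ne hA hz
  have h1 : HasDerivAt (fun z : ℂ => A 0 0 * z + A 0 1) (A 0 0) z := by
    simpa using ((hasDerivAt_id z).const_mul (A 0 0 : ℂ)).add_const (A 0 1 : ℂ)
  have h2 : HasDerivAt (fun z : ℂ => A 1 0 * z + A 1 1) (A 1 0) z := by
    simpa using ((hasDerivAt_id z).const_mul (A 1 0 : ℂ)).add_const (A 1 1 : ℂ)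
  refine (h1.div h2 h).congr_deriv ?_
  rw [Matrix.det_fin_two]; simp only [dn]; push_cast; ring

noncomputable def qf (z : ℂ) : ℂ := cexp (2 * Real.pi * I * z)

lemma qf_ne (z : ℂ) : qf z ≠ 0 := Complex.exp_ne_zero _

lemma qf_norm (z : ℂ) : ‖qf z‖ = Real.exp (-2 * Real.pi * z.im) := by
  rw [qf, Complex.norm_exp]; simp

lemma qf_lt {z : ℂ} (hz : 0 < z.im) : ‖qf z‖ < 1 := by
  rw [qf_norm, Real.exp_lt_one_iff]; have := Real.pi_pos; nlinarith [mul_pos this hz]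

lemma qf_add (z w : ℂ) : qf (z + w) = qf z * qf w := by
  simp only [qf, mul_add, Complex.exp_add]

lemma qf_nat (n : ℕ) (z : ℂ) : qf (n * z) = qf z ^ n := by
  rw [qf, qf, ← Complex.exp_nat_mul]; ring_nf

lemma qf_int (n : ℤ) : qf n = 1 := by
  rw [qf, Complex.exp_eq_one_iff]; exact ⟨n, by ring⟩

lemma qf_surj {q : ℂ} (h0 : q ≠ 0) (h1 : ‖q‖ < 1) : ∃ z : ℂ, 0 < z.im ∧ qf z = q := by
  refine ⟨Complex.log q / (2 * Real.pi * I), ?_, ?_⟩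
  · have : Complex.log q / (2 * Real.pi * I) = -(I * Complex.log q) / (2 * Real.pi : ℝ) := by
      have := Real.pi_ne_zero
      push_cast; field_simp; simp
    rw [this, Complex.div_ofReal_im]
    have h2 : Real.log ‖q‖ < 0 := Real.log_neg (by positivity) h1
    have := Real.pi_pos
    refine div_pos ?_ (by positivity)
    simp [Complex.log_re]
    linarith
  · rw [qf, mul_div_cancel₀, Complex.exp_log h0]
    simp [Real.pi_ne_zero]

lemma qf_eq_iff {z w : ℂ} : qf z = qf w ↔ ∃ n : ℤ, z = w + n := by
  rw [qf, qf, Complex.exp_eq_exp_iff_exists_int]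
  have h : (2 * Real.pi * I : ℂ) ≠ 0 := by simp [Real.pi_ne_zero]
  refine exists_congr fun n => ?_
  rw [show (2 * Real.pi * I * w + n * (2 * Real.pi * I) : ℂ) = 2 * Real.pi * I * (w + n) by ring, mul_right_inj' h]

lemma qf_deriv (z : ℂ) : HasDerivAt qf (2 * Real.pi * I * qf z) z := by
  have := ((hasDerivAt_id z).const_mul (2 * Real.pi * I : ℂ)).cexp
  refine this.congr_deriv ?_
  simp [qf, mul_comm]

noncomputable def DC (z : ℂ) : ℂ := qf z * ep (qf z) ^ 24

lemma DC_eq (τ : ℍ) : ModularForm.discriminant τ = DC τ := by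
  rw [ModularForm.discriminant_eq_q_prod, DC]
  have h : Function.Periodic.qParam 1 (τ:ℂ) = qf τ := by
    simp [Function.Periodic.qParam, qf]
  have h2 : ‖qf τ‖ < 1 := qf_lt τ.2
  rw [h, ep, ← (ModularForm.multipliable_one_sub_pow h2).tprod_pow]
  simp only [ModularForm.eta_q, h]

lemma DC_ne {z : ℂ} (hz : 0 < z.im) : DC z ≠ 0 :=
  mul_ne_zero (qf_ne _) (pow_ne_zero _ (ep_ne_zero (qf_lt hz)))

def toSL (A : M2) (h : A.det = 1) : Matrix.SpecialLinearGroup (Fin 2) ℤ := ⟨A, h⟩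

lemma coe_toSL_smul (A : M2) (h : A.det = 1) (τ : ℍ) : ((toSL A h • τ : ℍ) : ℂ) = mo A τ := by
  rw [UpperHalfPlane.coe_specialLinearGroup_apply]
  simp [mo, toSL]

lemma DC_mo {A : M2} (h : A.det = 1) {z : ℂ} (hz : 0 < z.im) :
    DC (mo A z) = dn A z ^ 12 * DC z := by
  have := SlashInvariantForm.slash_action_eqn'' (CuspForm.discriminant) (γ := (toSL A h : GL (Fin 2) ℝ))
    (by exact ⟨toSL A h, rfl⟩) ⟨z, hz⟩
  have e : (CuspForm.discriminant : ℍ → ℂ) = ModularForm.discriminant := rfl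
  rw [e] at this
  have e2 : (((toSL A h : GL (Fin 2) ℝ) • (⟨z, hz⟩ : ℍ) : ℍ) : ℂ) = mo A z := coe_toSL_smul A h ⟨z, hz⟩
  rw [DC_eq, DC_eq, e2] at this
  rw [this]
  have e3 : denom (toSL A h : GL (Fin 2) ℝ) z = dn A z := by
    simp only [denom, dn]
    rfl
  congr 1

lemma DC_diff {z : ℂ} (hz : 0 < z.im) : DifferentiableAt ℂ DC z := by
  have h1 : DifferentiableAt ℂ ep (qf z) := (epZ_rep.analyticAt (qf_lt hz)).differentiableAt
  have h2 := (qf_deriv z).differentiableAt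
  exact h2.mul ((h1.comp z h2).pow 24)

lemma ep_comp_diff {z : ℂ} (hz : 0 < z.im) : DifferentiableAt ℂ (fun z => ep (qf z)) z :=
  DifferentiableAt.comp z (epZ_rep.analyticAt (qf_lt hz)).differentiableAt (qf_deriv z).differentiableAt

/-- `(η(τ)/η(5τ))^6` -/
noncomputable def yf (z : ℂ) : ℂ := (ep (qf z) / ep (qf z ^ 5)) ^ 6 / qf z

/-- `η(τ)^10/η(5τ)^2` -/
noncomputable def gf (z : ℂ) : ℂ := ep (qf z) ^ 10 / ep (qf z ^ 5) ^ 2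

lemma qf5_lt {z : ℂ} (hz : 0 < z.im) : ‖qf z ^ 5‖ < 1 := by
  rw [norm_pow]; exact pow_lt_one₀ (norm_nonneg _) (qf_lt hz) (by norm_num)

lemma ep5_diff {z : ℂ} (hz : 0 < z.im) : DifferentiableAt ℂ (fun z => ep (qf z ^ 5)) z := by
  have h2 := ((qf_deriv z).differentiableAt).pow 5
  exact DifferentiableAt.comp (g := ep) z (epZ_rep.analyticAt (qf5_lt hz)).differentiableAt h2

lemma yf_diff {z : ℂ} (hz : 0 < z.im) : DifferentiableAt ℂ yf z :=
  (((ep_comp_diff hz).div (ep5_diff hz) (ep_ne_zero (qf5_lt hz))).pow 6).div (qf_deriv z).differentiableAt (qf_ne z)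

lemma gf_diff {z : ℂ} (hz : 0 < z.im) : DifferentiableAt ℂ gf z :=
  ((ep_comp_diff hz).pow 10).div ((ep5_diff hz).pow 2) (pow_ne_zero _ (ep_ne_zero (qf5_lt hz)))

lemma yf_ne {z : ℂ} (hz : 0 < z.im) : yf z ≠ 0 := by
  have := ep_ne_zero (qf_lt hz)
  have := ep_ne_zero (qf5_lt hz)
  have := qf_ne z
  unfold yf; positivity

lemma gf_ne {z : ℂ} (hz : 0 < z.im) : gf z ≠ 0 := by
  have := ep_ne_zero (qf_lt hz)
  have := ep_ne_zero (qf5_lt hz)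
  unfold gf; positivity

lemma up5 {z : ℂ} (hz : 0 < z.im) : 0 < (5 * z).im := by simpa using hz

lemma qf_five (z : ℂ) : qf (5 * z) = qf z ^ 5 := by exact_mod_cast qf_nat 5 z

lemma yf_pow {z : ℂ} (hz : 0 < z.im) : yf z ^ 4 = DC z / DC (5 * z) := by
  have := ep_ne_zero (qf_lt hz)
  have := ep_ne_zero (qf5_lt hz)
  have := qf_ne z
  rw [yf, DC, DC, qf_five]; field_simp

lemma gf_pow {z : ℂ} (hz : 0 < z.im) : gf z ^ 3 = DC (5 * z) * yf z ^ 5 := by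
  have := ep_ne_zero (qf_lt hz)
  have := ep_ne_zero (qf5_lt hz)
  have := qf_ne z
  rw [gf, yf, DC, qf_five]; field_simp
end

section
open Complex

def Tm (k : ℤ) : M2 := !![1, k; 0, 1]
def Um (k : ℤ) : M2 := !![1, 0; 5 * k, 1]
def e1m : M2 := !![2, -1; 5, -2]
def e2m : M2 := !![-2, -1; 5, 2]
def Wm : M2 := !![0, -1; 5, 0]

lemma Tm_det (k : ℤ) : (Tm k).det = 1 := by simp [Tm, Matrix.det_fin_two]
lemma Um_det (k : ℤ) : (Um k).det = 1 := by simp [Um, Matrix.det_fin_two]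
lemma e1m_det : e1m.det = 1 := by simp [e1m, Matrix.det_fin_two]
lemma e2m_det : e2m.det = 1 := by simp [e2m, Matrix.det_fin_two]
lemma Wm_det : Wm.det = 5 := by simp [Wm, Matrix.det_fin_two]

def G5 (A : M2) : Prop := A.det = 1 ∧ 5 ∣ A 1 0

lemma G5.mul {A B : M2} (hA : G5 A) (hB : G5 B) : G5 (A * B) := by
  refine ⟨by rw [Matrix.det_mul, hA.1, hB.1, mul_one], ?_⟩
  rw [Matrix.mul_apply, Fin.sum_univ_two]
  exact dvd_add (hA.2.mul_right _) (hB.2.mul_left _)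

lemma G5_one : G5 1 := ⟨by simp, by simp⟩
lemma G5_T (k : ℤ) : G5 (Tm k) := ⟨Tm_det k, by simp [Tm]⟩
lemma G5_U (k : ℤ) : G5 (Um k) := ⟨Um_det k, by simp [Um]⟩
lemma G5_e1 : G5 e1m := ⟨e1m_det, by simp [e1m]⟩
lemma G5_e2 : G5 e2m := ⟨e2m_det, by simp [e2m]⟩

lemma G5.adj {A : M2} (hA : G5 A) : G5 A.adjugate := by
  refine ⟨by rw [Matrix.det_adjugate]; simp [hA.1], ?_⟩
  simp [Matrix.adjugate_fin_two, hA.2]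

lemma adj_T (k : ℤ) : (Tm k).adjugate = Tm (-k) := by simp [Tm, Matrix.adjugate_fin_two]
lemma adj_U (k : ℤ) : (Um k).adjugate = Um (-k) := by simp [Um, Matrix.adjugate_fin_two]
lemma adj_e1 : e1m.adjugate = -1 * e1m := by
  simp [e1m, Matrix.adjugate_fin_two]
lemma adj_e2 : e2m.adjugate = -1 * e2m := by
  simp [e2m, Matrix.adjugate_fin_two]

lemma G5_ind (P : M2 → Prop) (hneg : P (-1))
    (hmul : ∀ A B, G5 A → G5 B → P A → P B → P (A * B))
    (hT : ∀ k, P (Tm k)) (hU : ∀ k, P (Um k)) (h1 : P e1m) (h2 : P e2m) :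
    ∀ A, G5 A → P A := by
  have hm1 : G5 (-1) := ⟨by simp [Matrix.det_fin_two], by simp⟩
  have step : ∀ A B : M2, G5 A → G5 B → P (B.adjugate) → P (A * B) → P A := by
    intro A B hA hB hPB h
    have := hmul _ _ (hA.mul hB) hB.adj h hPB
    rwa [mul_assoc, Matrix.mul_adjugate, hB.1, one_smul, mul_one] at this
  suffices H : ∀ n : ℕ, ∀ A : M2, G5 A → (A 1 0).natAbs = n → P A from fun A hA => H _ A hA rfl
  intro n
  induction n using Nat.strong_induction_on with
  | _ n ih =>
  intro A hA hn
  have hdet := hA.1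
  rw [Matrix.det_fin_two] at hdet
  by_cases hc : A 1 0 = 0
  · rw [hc, mul_zero, sub_zero] at hdet
    rcases Int.mul_eq_one_iff_eq_one_or_neg_one.mp hdet with ⟨ha, hd⟩ | ⟨ha, hd⟩
    · have : A = Tm (A 0 1) := by
        ext i j; fin_cases i <;> fin_cases j <;> simp [Tm, ha, hd, hc]
      rw [this]; exact hT _
    · have : A = -1 * Tm (-A 0 1) := by
        ext i j; fin_cases i <;> fin_cases j <;> simp [Tm, ha, hd, hc]
      rw [this]; exact hmul _ _ hm1 (G5_T _) hneg (hT _)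
  · -- reduce d
    obtain ⟨k, hk⟩ : ∃ k : ℤ, 2 * |A 1 0 * k + A 1 1| ≤ |A 1 0| := by
      refine ⟨-round ((A 1 1 : ℚ) / (A 1 0 : ℚ)), ?_⟩
      have h := abs_sub_round ((A 1 1 : ℚ) / (A 1 0 : ℚ))
      have hc' : ((A 1 0 : ℤ) : ℚ) ≠ 0 := by exact_mod_cast hc
      have : ((A 1 0 * -round ((A 1 1 : ℚ) / (A 1 0 : ℚ)) + A 1 1 : ℤ) : ℚ) =
          (A 1 0 : ℚ) * ((A 1 1 : ℚ) / (A 1 0 : ℚ) - round ((A 1 1 : ℚ) / (A 1 0 : ℚ))) := by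
        push_cast; field_simp; ring
      have h3 : ((2 * |A 1 0 * -round ((A 1 1 : ℚ) / (A 1 0 : ℚ)) + A 1 1| : ℤ) : ℚ) ≤ ((|A 1 0| : ℤ) : ℚ) := by
        push_cast [Int.cast_abs]
        push_cast at this
        rw [this, abs_mul]
        nlinarith [abs_nonneg ((A 1 0 : ℤ) : ℚ)]
      exact_mod_cast h3
    refine step A (Tm k) hA (G5_T k) (by rw [adj_T]; exact hT _) ?_
    set B := A * Tm k with hB
    have hB5 : G5 B := hA.mul (G5_T k)
    have hB10 : B 1 0 = A 1 0 := by simp [hB, Tm, Matrix.mul_apply, Fin.sum_univ_two]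
    have hB11 : B 1 1 = A 1 0 * k + A 1 1 := by simp [hB, Tm, Matrix.mul_apply, Fin.sum_univ_two]
    rw [← hB11] at hk
    rw [← hB10] at hk hn hc
    obtain ⟨c, hc5⟩ := hB5.2
    set d := B 1 1 with hd
    have hdetB := hB5.1
    rw [Matrix.det_fin_two, hc5] at hdetB
    have hd0 : d ≠ 0 := by
      intro h0
      rw [← hd, h0] at hdetB
      have : (5:ℤ) ∣ 1 := ⟨-(B 0 1 * c), by linarith⟩
      norm_num at this
    have hc0 : c ≠ 0 := by rintro rfl; simp at hc5; exact hc hc5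
    rw [hc5] at hk hn
    have cases : (|d| ≤ |c| ∧ 0 < c * d) ∨ (|d| ≤ |c| ∧ c * d < 0) ∨ (|c| < |d| ∧ 0 < c * d) ∨ (|c| < |d| ∧ c * d < 0) := by
      have : c * d ≠ 0 := mul_ne_zero hc0 hd0
      rcases lt_or_gt_of_ne this with h | h <;> rcases le_or_gt |d| |c| with h' | h' <;> tauto
    have hk' : 2 * |d| ≤ 5 * |c| := by rw [abs_mul] at hk; simpa using hk
    have sgn : ∀ x y : ℤ, (0 < x * y → (0 < x ∧ 0 < y) ∨ (x < 0 ∧ y < 0)) := fun x y h => by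
      rcases pos_and_pos_or_neg_and_neg_of_mul_pos h with h | h <;> tauto
    have sgn2 : ∀ x y : ℤ, (x * y < 0 → (0 < x ∧ y < 0) ∨ (x < 0 ∧ 0 < y)) := fun x y h => by
      rcases mul_neg_iff.mp h with h | h <;> tauto
    rcases cases with ⟨h, h'⟩ | ⟨h, h'⟩ | ⟨h, h'⟩ | ⟨h, h'⟩
    · refine step B (Um (-1)) hB5 (G5_U _) (by rw [adj_U]; exact hU _) (ih _ ?_ _ (hB5.mul (G5_U _)) rfl)
      have : (B * Um (-1)) 1 0 = 5 * (c - d) := by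
        simp [Um, Matrix.mul_apply, Fin.sum_univ_two, hc5, ← hd]; ring
      rw [this, ← hn]
      rcases sgn _ _ h' with h'' | h'' <;> rcases abs_cases c with hx | hx <;> rcases abs_cases d with hz | hz <;> omega
    · refine step B (Um 1) hB5 (G5_U _) (by rw [adj_U]; exact hU _) (ih _ ?_ _ (hB5.mul (G5_U _)) rfl)
      have : (B * Um 1) 1 0 = 5 * (c + d) := by
        simp [Um, Matrix.mul_apply, Fin.sum_univ_two, hc5, ← hd]; ring
      rw [this, ← hn]
      rcases sgn2 _ _ h' with h'' | h'' <;> rcases abs_cases c with hx | hx <;> rcases abs_cases d with hz | hz <;> omega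
    · refine step B e2m hB5 G5_e2 (by rw [adj_e2]; exact hmul _ _ hm1 G5_e2 hneg h2) (ih _ ?_ _ (hB5.mul G5_e2) rfl)
      have : (B * e2m) 1 0 = 5 * (d - 2 * c) := by
        simp [e2m, Matrix.mul_apply, Fin.sum_univ_two, hc5, ← hd]; ring
      rw [this, ← hn]
      rcases sgn _ _ h' with h'' | h'' <;> rcases abs_cases c with hx | hx <;> rcases abs_cases d with hz | hz <;> omega
    · refine step B e1m hB5 G5_e1 (by rw [adj_e1]; exact hmul _ _ hm1 G5_e1 hneg h1) (ih _ ?_ _ (hB5.mul G5_e1) rfl)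
      have : (B * e1m) 1 0 = 5 * (d + 2 * c) := by
        simp [e1m, Matrix.mul_apply, Fin.sum_univ_two, hc5, ← hd]; ring
      rw [this, ← hn]
      rcases sgn2 _ _ h' with h'' | h'' <;> rcases abs_cases c with hx | hx <;> rcases abs_cases d with hz | hz <;> omega
end

section
open Complex

def UH : Set ℂ := {z | 0 < z.im}
lemma UH_open : IsOpen UH := isOpen_lt continuous_const Complex.continuous_im
lemma UH_conn : IsPreconnected UH := (convex_halfSpace_im_gt 0).isPreconnected

lemma const_of_pow {f : ℂ → ℂ} {n : ℕ} (hn : n ≠ 0) {c : ℂ} (hc : c ≠ 0)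
    (hd : ∀ z, 0 < z.im → DifferentiableAt ℂ f z) (hf : ∀ z, 0 < z.im → f z ^ n = c) :
    ∀ z w, 0 < z.im → 0 < w.im → f z = f w := by
  have hder : UH.EqOn (deriv f) 0 := by
    intro z hz
    have h1 := ((hd z hz).hasDerivAt.pow n)
    have h2 : HasDerivAt (f ^ n) 0 z := by
      refine (hasDerivAt_const z c).congr_of_eventuallyEq ?_
      filter_upwards [UH_open.mem_nhds hz] with w hw using hf w hw
    have h3 := h1.unique h2
    have h0 : f z ≠ 0 := by
      intro h; have := hf z hz; rw [h, zero_pow hn] at this; exact hc this.symm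
    simpa [hn, h0] using h3
  intro z w hz hw
  exact UH_open.is_const_of_deriv_eq_zero UH_conn (fun z hz => (hd z hz).differentiableWithinAt) hder hz hw

/-- conjugation of `G5` by `5` -/
def cj (A : M2) : M2 := !![A 0 0, 5 * A 0 1; A 1 0 / 5, A 1 1]

lemma cj_det {A : M2} (h : 5 ∣ A 1 0) : (cj A).det = A.det := by
  obtain ⟨c, hc⟩ := h
  simp [cj, Matrix.det_fin_two, hc]; ring

lemma dn_cj {A : M2} (h : 5 ∣ A 1 0) (z : ℂ) : dn (cj A) (5 * z) = dn A z := by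
  obtain ⟨c, hc⟩ := h
  simp [cj, dn, hc]; ring

lemma mo_cj {A : M2} (h : 5 ∣ A 1 0) (z : ℂ) : mo (cj A) (5 * z) = 5 * mo A z := by
  rw [mo_def, dn_cj h, mo_def, ← mul_div_assoc]
  congr 1
  simp [cj]; ring

lemma yf_pow_inv {A : M2} (hA : G5 A) {z : ℂ} (hz : 0 < z.im) : yf (mo A z) ^ 4 = yf z ^ 4 := by
  have hA' : 0 < A.det := by rw [hA.1]; norm_num
  rw [yf_pow (mo_up hA' hz), yf_pow hz, ← mo_cj hA.2, DC_mo hA.1 hz,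
    DC_mo (by rw [cj_det hA.2, hA.1]) (up5 hz), dn_cj hA.2]
  have := dn_ne hA' hz
  have := DC_ne (up5 hz)
  field_simp

lemma mo_diff {A : M2} (hA : 0 < A.det) {z : ℂ} (hz : 0 < z.im) : DifferentiableAt ℂ (mo A) z :=
  (mo_deriv hA hz).differentiableAt

lemma dn_diff (A : M2) (z : ℂ) : DifferentiableAt ℂ (dn A) z := by
  unfold dn; fun_prop

lemma G5.pos {A : M2} (hA : G5 A) : 0 < A.det := by rw [hA.1]; norm_num

lemma yf_chi {A : M2} (hA : G5 A) {z w : ℂ} (hz : 0 < z.im) (hw : 0 < w.im) :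
    yf (mo A z) / yf z = yf (mo A w) / yf w := by
  refine const_of_pow (f := fun z => yf (mo A z) / yf z) (n := 4) (by norm_num) one_ne_zero
    (fun z hz => ?_) (fun z hz => ?_) z w hz hw
  · exact (DifferentiableAt.comp z (yf_diff (mo_up hA.pos hz)) (mo_diff hA.pos hz)).div (yf_diff hz) (yf_ne hz)
  · show (yf (mo A z) / yf z) ^ 4 = 1
    rw [div_pow, yf_pow_inv hA hz, div_self (pow_ne_zero _ (yf_ne hz))]

lemma mo_W (z : ℂ) : mo Wm z = -1 / (5 * z) := by simp [mo, Wm]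
lemma dn_W (z : ℂ) : dn Wm z = 5 * z := by simp [dn, Wm]
lemma Wm_pos : 0 < Wm.det := by rw [Wm_det]; norm_num
lemma W_up {z : ℂ} (hz : 0 < z.im) : 0 < (mo Wm z).im := mo_up Wm_pos hz
lemma ne_of_up {z : ℂ} (hz : 0 < z.im) : z ≠ 0 := by rintro rfl; simp at hz
lemma W_W {z : ℂ} (hz : 0 < z.im) : mo Wm (mo Wm z) = z := by
  have := ne_of_up hz
  rw [mo_W, mo_W]; field_simp

def Sm : M2 := !![0, -1; 1, 0]
lemma Sm_det : Sm.det = 1 := by simp [Sm, Matrix.det_fin_two]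
lemma mo_S (z : ℂ) : mo Sm z = -1 / z := by simp [mo, Sm]
lemma dn_S (z : ℂ) : dn Sm z = z := by simp [dn, Sm]

lemma DC_S {z : ℂ} (hz : 0 < z.im) : DC (-1 / z) = z ^ 12 * DC z := by
  rw [← mo_S, DC_mo Sm_det hz, dn_S]

lemma five_W {z : ℂ} (hz : 0 < z.im) : 5 * mo Wm z = -1 / z := by
  have := ne_of_up hz
  rw [mo_W]; field_simp

lemma yW_pow {z : ℂ} (hz : 0 < z.im) : (yf (mo Wm z) * yf z) ^ 4 = 125 ^ 4 := by
  have h0 := ne_of_up hz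
  have := DC_ne hz
  have := DC_ne (up5 hz)
  rw [mul_pow, yf_pow hz, yf_pow (W_up hz), five_W hz, DC_S hz, mo_W, DC_S (up5 hz)]
  field_simp; norm_num

lemma ep_real (x : ℝ) (h0 : 0 ≤ x) (h : x < 1) : ∃ r : ℝ, ep x = r := by
  have h2 : ‖(x:ℂ)‖ < 1 := by rwa [Complex.norm_real, Real.norm_of_nonneg h0]
  have h1 := (ModularForm.multipliable_one_sub_pow h2).hasProd
  have h3 := h1.map (starRingEnd ℂ) Complex.continuous_conj
  have e : (starRingEnd ℂ) ∘ (fun n : ℕ => 1 - (x:ℂ) ^ (n + 1)) = fun n : ℕ => 1 - (x:ℂ) ^ (n + 1) := by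
    ext n; simp
  rw [e] at h3
  have h4 := h3.unique h1
  exact ⟨(ep x).re, (Complex.conj_eq_iff_re.mp h4).symm⟩

noncomputable def z5 : ℂ := I / (Real.sqrt 5 : ℝ)
lemma z5_im : z5.im = 1 / Real.sqrt 5 := by
  simp [z5, Complex.div_ofReal_im]
lemma z5_up : 0 < z5.im := by rw [z5_im]; positivity
lemma sq5 : ((Real.sqrt 5 : ℝ) : ℂ) ^ 2 = 5 := by
  rw [← Complex.ofReal_pow, Real.sq_sqrt (by norm_num)]; norm_num
lemma sq5_ne : ((Real.sqrt 5 : ℝ) : ℂ) ≠ 0 := by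
  intro h; have := sq5; rw [h] at this; norm_num at this
lemma z5_W : mo Wm z5 = z5 := by
  have h1 := sq5
  have h2 := sq5_ne
  rw [mo_W, z5]
  field_simp
  rw [h1]; simp

lemma yf_z5_pos : ∃ r : ℝ, 0 < r ∧ yf z5 = r := by
  have hq : qf z5 = ((Real.exp (-2 * Real.pi * (1 / Real.sqrt 5)) : ℝ) : ℂ) := by
    rw [qf, z5, Complex.ofReal_exp]
    congr 1
    push_cast
    have := sq5_ne
    field_simp
    simp
  set x := Real.exp (-2 * Real.pi * (1 / Real.sqrt 5)) with hx
  have hx0 : 0 < x := Real.exp_pos _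
  have hx1 : x < 1 := by
    have := qf_lt z5_up; rw [hq, Complex.norm_real, Real.norm_of_nonneg hx0.le] at this; exact this
  obtain ⟨r, hr⟩ := ep_real x hx0.le hx1
  obtain ⟨s, hs⟩ := ep_real (x ^ 5) (by positivity) (pow_lt_one₀ hx0.le hx1 (by norm_num))
  have hy : yf z5 = (((r / s) ^ 6 / x : ℝ) : ℂ) := by
    rw [yf, hq]; push_cast at hs ⊢; rw [hr, hs]
  refine ⟨_, ?_, hy⟩
  have h0 := yf_ne z5_up
  rw [hy] at h0
  have h1 : (r / s) ^ 6 / x ≠ 0 := by exact_mod_cast h0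
  have : 0 ≤ (r / s) ^ 6 / x := div_nonneg (by positivity) hx0.le
  exact lt_of_le_of_ne this (Ne.symm h1)

lemma yW_const {z : ℂ} (hz : 0 < z.im) : yf (mo Wm z) * yf z = yf z5 ^ 2 := by
  have := const_of_pow (f := fun z => yf (mo Wm z) * yf z) (n := 4) (c := 125 ^ 4) (by norm_num) (by norm_num)
    (fun z hz => ?_) (fun z hz => yW_pow hz) z z5 hz z5_up
  · rw [this, z5_W]; ring
  · exact (DifferentiableAt.comp z (yf_diff (W_up hz)) (mo_diff Wm_pos hz)).mul (yf_diff hz)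

lemma yf_z5 : yf z5 ^ 2 = 125 := by
  obtain ⟨r, hr, h⟩ := yf_z5_pos
  have := yW_pow z5_up
  rw [z5_W, h] at this
  have h2 : (r * r) ^ 4 = 125 ^ 4 := by exact_mod_cast this
  have h3 : r * r = 125 := (pow_left_inj₀ (by positivity) (by norm_num) (by norm_num)).mp h2
  rw [h]; rw [pow_two]; exact_mod_cast h3

lemma yf_W {z : ℂ} (hz : 0 < z.im) : yf (mo Wm z) * yf z = 125 := by rw [yW_const hz, yf_z5]

lemma yf_W' {z : ℂ} (hz : 0 < z.im) : yf (mo Wm z) = 125 / yf z := by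
  rw [eq_div_iff (yf_ne hz), yf_W hz]

lemma mo_T (k : ℤ) (z : ℂ) : mo (Tm k) z = z + k := by simp [mo, Tm]
lemma qf_T (k : ℤ) (z : ℂ) : qf (z + k) = qf z := by rw [qf_add, qf_int, mul_one]
lemma yf_T (k : ℤ) (z : ℂ) : yf (z + k) = yf z := by rw [yf, qf_T, yf]
lemma gf_T (k : ℤ) (z : ℂ) : gf (z + k) = gf z := by rw [gf, qf_T, gf]
lemma UW (k : ℤ) : Um (-k) * Wm = Wm * Tm k := by
  ext i j; fin_cases i <;> fin_cases j <;> simp [Um, Wm, Tm, Matrix.mul_apply, Fin.sum_univ_two]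

lemma T_up (k : ℤ) {z : ℂ} (hz : 0 < z.im) : 0 < (z + k).im := by simpa using hz

lemma U_W_eq (k : ℤ) {z : ℂ} (hz : 0 < z.im) : mo (Um (-k)) (mo Wm z) = mo Wm (z + k) := by
  rw [← mo_mul (G5_U _).pos Wm_pos hz, UW, mo_mul Wm_pos (G5_T _).pos hz, mo_T]

lemma yf_U (k : ℤ) {z : ℂ} (hz : 0 < z.im) : yf (mo (Um k) z) = yf z := by
  obtain ⟨w, hw, rfl⟩ : ∃ w : ℂ, 0 < w.im ∧ mo Wm w = z := ⟨mo Wm z, W_up hz, W_W hz⟩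
  have := U_W_eq (-k) hw
  rw [neg_neg] at this
  rw [this, yf_W' (T_up _ hw), yf_T, yf_W' hw]

lemma e1_fix : 0 < ((2 + I) / 5).im ∧ mo e1m ((2 + I) / 5) = (2 + I) / 5 ∧ dn e1m ((2 + I) / 5) = I := by
  have h : (5 * ((2 + I) / 5) - 2 : ℂ) = I := by ring
  have : dn e1m ((2 + I) / 5) = I := by rw [← h]; simp [dn, e1m]; ring
  refine ⟨by norm_num, ?_, this⟩
  rw [mo_def, this, div_eq_iff I_ne_zero]
  simp [e1m]; ring_nf; simp; ring

lemma e2_fix : 0 < ((-2 + I) / 5).im ∧ mo e2m ((-2 + I) / 5) = (-2 + I) / 5 ∧ dn e2m ((-2 + I) / 5) = I := by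
  have : dn e2m ((-2 + I) / 5) = I := by simp [dn, e2m]; ring
  refine ⟨by norm_num, ?_, this⟩
  rw [mo_def, this, div_eq_iff I_ne_zero]
  simp [e2m]; ring_nf; simp; ring

lemma mo_neg1 (z : ℂ) : mo (-1) z = z := by simp [mo]
lemma dn_neg1 (z : ℂ) : dn (-1) z = -1 := by simp [dn]

lemma yf_inv {A : M2} (hA : G5 A) : ∀ {z : ℂ}, 0 < z.im → yf (mo A z) = yf z := by
  refine G5_ind (fun A => ∀ {z : ℂ}, 0 < z.im → yf (mo A z) = yf z) ?_ ?_ ?_ ?_ ?_ ?_ A hA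
  · intro z hz; rw [mo_neg1]
  · intro A B hA hB h1 h2 z hz
    rw [mo_mul hA.pos hB.pos hz, h1 (mo_up hB.pos hz), h2 hz]
  · intro k z hz; rw [mo_T, yf_T]
  · intro k z hz; exact yf_U k hz
  · intro z hz
    have := yf_chi G5_e1 hz e1_fix.1
    rwa [e1_fix.2.1, div_self (yf_ne e1_fix.1), div_eq_one_iff_eq (yf_ne hz)] at this
  · intro z hz
    have := yf_chi G5_e2 hz e2_fix.1
    rwa [e2_fix.2.1, div_self (yf_ne e2_fix.1), div_eq_one_iff_eq (yf_ne hz)] at this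

lemma gf_pow_inv {A : M2} (hA : G5 A) {z : ℂ} (hz : 0 < z.im) :
    (gf (mo A z) / (dn A z ^ 4 * gf z)) ^ 3 = 1 := by
  have h1 := dn_ne hA.pos hz
  have h2 := DC_ne (up5 hz)
  have h3 := yf_ne hz
  rw [div_pow, mul_pow, gf_pow hz, gf_pow (mo_up hA.pos hz), yf_inv hA hz, ← mo_cj hA.2,
    DC_mo (by rw [cj_det hA.2, hA.1]) (up5 hz), dn_cj hA.2]
  field_simp

lemma gf_chi {A : M2} (hA : G5 A) {z w : ℂ} (hz : 0 < z.im) (hw : 0 < w.im) :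
    gf (mo A z) / (dn A z ^ 4 * gf z) = gf (mo A w) / (dn A w ^ 4 * gf w) := by
  refine const_of_pow (f := fun z => gf (mo A z) / (dn A z ^ 4 * gf z)) (n := 3) (by norm_num) one_ne_zero
    (fun z hz => ?_) (fun z hz => gf_pow_inv hA hz) z w hz hw
  exact (DifferentiableAt.comp z (gf_diff (mo_up hA.pos hz)) (mo_diff hA.pos hz)).div
    (((dn_diff A z).pow 4).mul (gf_diff hz)) (mul_ne_zero (pow_ne_zero _ (dn_ne hA.pos hz)) (gf_ne hz))

lemma gfW_const : ∃ c : ℂ, c ≠ 0 ∧ ∀ z : ℂ, 0 < z.im → gf (mo Wm z) = c * z ^ 4 * gf z / yf z ^ 2 := by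
  set f := fun z => gf (mo Wm z) * yf z ^ 2 / (z ^ 4 * gf z) with hf
  have hp : ∀ z : ℂ, 0 < z.im → f z ^ 3 = 125 ^ 5 := by
    intro z hz
    have h1 := ne_of_up hz
    have h2 := DC_ne (up5 hz)
    have h3 := yf_ne hz
    have h4 := yf_pow hz
    rw [eq_div_iff h2] at h4
    simp only [hf]
    rw [div_pow, mul_pow, mul_pow, gf_pow hz, gf_pow (W_up hz), yf_W' hz, five_W hz, DC_S hz, ← h4]
    generalize DC (5 * z) = D at *
    field_simp
  have hd : ∀ z : ℂ, 0 < z.im → DifferentiableAt ℂ f z := fun z hz =>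
    ((DifferentiableAt.comp z (gf_diff (W_up hz)) (mo_diff Wm_pos hz)).mul ((yf_diff hz).pow 2)).div
    ((differentiableAt_id.pow 4).mul (gf_diff hz)) (mul_ne_zero (pow_ne_zero _ (ne_of_up hz)) (gf_ne hz))
  refine ⟨f z5, ?_, fun z hz => ?_⟩
  · intro h; have := hp z5 z5_up; rw [h] at this; norm_num at this
  · have := const_of_pow (f := f) (n := 3) (by norm_num) (by norm_num) hd hp z z5 hz z5_up
    rw [← this]
    simp only [hf]
    have h1 := ne_of_up hz
    have h3 := yf_ne hz
    have h4 := gf_ne hz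
    field_simp

lemma gf_U (k : ℤ) {z : ℂ} (hz : 0 < z.im) : gf (mo (Um k) z) = dn (Um k) z ^ 4 * gf z := by
  obtain ⟨w, hw, rfl⟩ : ∃ w : ℂ, 0 < w.im ∧ mo Wm w = z := ⟨mo Wm z, W_up hz, W_W hz⟩
  obtain ⟨c, -, hc⟩ := gfW_const
  have := U_W_eq (-k) hw
  rw [neg_neg] at this
  rw [this, hc _ (T_up _ hw), hc _ hw, yf_T, gf_T]
  have h1 := ne_of_up hw
  have h3 := yf_ne hw
  have : dn (Um k) (mo Wm w) = (w - k) / w := by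
    rw [mo_W]; simp [dn, Um]; field_simp; ring
  rw [this]
  push_cast
  field_simp; ring

lemma gf_inv {A : M2} (hA : G5 A) : ∀ {z : ℂ}, 0 < z.im → gf (mo A z) = dn A z ^ 4 * gf z := by
  refine G5_ind (fun A => ∀ {z : ℂ}, 0 < z.im → gf (mo A z) = dn A z ^ 4 * gf z) ?_ ?_ ?_ ?_ ?_ ?_ A hA
  · intro z hz; rw [mo_neg1, dn_neg1]; ring
  · intro A B hA hB h1 h2 z hz
    rw [mo_mul hA.pos hB.pos hz, h1 (mo_up hB.pos hz), h2 hz, dn_mul (dn_ne hB.pos hz)]; ring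
  · intro k z hz; rw [mo_T, gf_T]; simp [dn, Tm]
  · intro k z hz; exact gf_U k hz
  · intro z hz
    have := gf_chi G5_e1 hz e1_fix.1
    rw [e1_fix.2.1, e1_fix.2.2, I_pow_four, one_mul, div_self (gf_ne e1_fix.1),
      div_eq_one_iff_eq (mul_ne_zero (pow_ne_zero _ (dn_ne G5_e1.pos hz)) (gf_ne hz))] at this
    exact this
  · intro z hz
    have := gf_chi G5_e2 hz e2_fix.1
    rw [e2_fix.2.1, e2_fix.2.2, I_pow_four, one_mul, div_self (gf_ne e2_fix.1),
      div_eq_one_iff_eq (mul_ne_zero (pow_ne_zero _ (dn_ne G5_e2.pos hz)) (gf_ne hz))] at this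
    exact this
end

section
open Complex
open UpperHalfPlane hiding I
open scoped MatrixGroups Manifold ModularForm

/-- bounded near `i∞` -/
def BI (h : ℂ → ℂ) : Prop := ∃ C Y : ℝ, ∀ z : ℂ, Y ≤ z.im → 0 < z.im → ‖h z‖ ≤ C

lemma mo_SL (γ : SL(2, ℤ)) (τ : ℍ) : ((γ • τ : ℍ) : ℂ) = mo γ.1 τ := coe_toSL_smul γ.1 γ.2 τ

lemma liouville (Γ : Subgroup SL(2, ℤ)) [Γ.FiniteIndex] {h : ℂ → ℂ}
    (hd : ∀ z, 0 < z.im → DifferentiableAt ℂ h z)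
    (hinv : ∀ γ ∈ Γ, ∀ z, 0 < z.im → h (mo γ.1 z) = h z)
    (hb : ∀ γ : SL(2, ℤ), BI (fun z => h (mo γ.1 z))) {z w : ℂ} (hz : 0 < z.im) (hw : 0 < w.im) :
    h z = h w := by
  have slash : ∀ γ : SL(2, ℤ), ((fun τ : ℍ => h τ) ∣[(0:ℤ)] γ) = fun τ : ℍ => h (mo γ.1 τ) := by
    intro γ
    ext τ
    rw [ModularForm.SL_slash_apply]
    simp only [neg_zero, zpow_zero, mul_one]
    rw [mo_SL]
  let f : ModularForm (Γ : Subgroup (GL (Fin 2) ℝ)) 0 :=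
    { toFun := fun τ => h τ
      slash_action_eq' := by
        rintro _ ⟨γ, hγ, rfl⟩
        refine (slash γ).trans ?_
        ext τ
        exact hinv γ hγ τ τ.2
      holo' := by
        rw [UpperHalfPlane.mdifferentiable_iff]
        intro z hz
        refine DifferentiableAt.differentiableWithinAt ?_
        refine (hd z hz).congr_of_eventuallyEq ?_
        filter_upwards [UH_open.mem_nhds hz] with w hw
        simp [ofComplex_apply_of_im_pos hw]
      bdd_at_cusps' := by
        intro c hc
        rw [Subgroup.IsArithmetic.isCusp_iff_isCusp_SL2Z] at hc
        rw [OnePoint.isBoundedAt_iff_forall_SL2Z hc]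
        intro γ _
        rw [UpperHalfPlane.isBoundedAtImInfty_iff]
        obtain ⟨C, Y, hC⟩ := hb γ
        refine ⟨C, Y, fun τ hτ => ?_⟩
        have := slash γ
        refine (congrArg norm (congrFun this τ)).trans_le ?_
        exact hC τ hτ τ.2 }
  obtain ⟨c, hc⟩ := ModularForm.eq_const_of_weight_zero f
  have h1 := congrFun hc ⟨z, hz⟩
  have h2 := congrFun hc ⟨w, hw⟩
  exact h1.trans h2.symm

instance : Fact (Nat.Prime 5) := ⟨by norm_num⟩

lemma mem_G0 (γ : SL(2, ℤ)) : γ ∈ CongruenceSubgroup.Gamma0 5 ↔ G5 γ.1 := by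
  rw [CongruenceSubgroup.Gamma0_mem, ZMod.intCast_zmod_eq_zero_iff_dvd]
  simp [G5, γ.2]

lemma BI.comp_add {h : ℂ → ℂ} (hh : BI h) (r : ℝ) : BI (fun z => h (z + r)) := by
  obtain ⟨C, Y, hC⟩ := hh
  exact ⟨C, Y, fun z h1 h2 => hC _ (by simpa using h1) (by simpa using h2)⟩

lemma BI.comp_div {h : ℂ → ℂ} (hh : BI h) (n : ℕ) (hn : 0 < n) : BI (fun z => h (z / n)) := by
  obtain ⟨C, Y, hC⟩ := hh
  have e : ∀ z : ℂ, (z / n).im = z.im / n := fun z => Complex.div_natCast_im z n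
  have hn' : (0:ℝ) < n := by exact_mod_cast hn
  refine ⟨C, n * Y, fun z h1 h2 => hC _ ?_ ?_⟩
  · rw [e, le_div_iff₀ hn']; linarith
  · rw [e]; positivity

lemma BI.comp_mul {h : ℂ → ℂ} (hh : BI h) (n : ℕ) (hn : 0 < n) : BI (fun z => h (n * z)) := by
  obtain ⟨C, Y, hC⟩ := hh
  have hn' : (0:ℝ) < n := by exact_mod_cast hn
  have hn1 : (1:ℝ) ≤ n := by exact_mod_cast hn
  refine ⟨C, max Y 0, fun z h1 h2 => hC _ ?_ ?_⟩
  · have : Y ≤ z.im := (le_max_left _ _).trans h1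
    simp; nlinarith
  · rw [← Complex.ofReal_natCast, Complex.im_ofReal_mul]
    positivity

/-- coset decomposition of `SL2(Z)` modulo `Γ_0(5)` -/
lemma coset5 (A : M2) (hA : A.det = 1) (h5 : ¬ 5 ∣ A 1 0) :
    ∃ (B : M2) (k : ℤ), G5 B ∧ A = B * Sm * Tm k := by
  have h1 : IsUnit ((A 1 0 : ℤ) : ZMod 5) := by
    rw [isUnit_iff_ne_zero, Ne, ZMod.intCast_zmod_eq_zero_iff_dvd]; exact h5
  obtain ⟨u, hu⟩ := h1.exists_right_inv
  obtain ⟨k, hk⟩ : ∃ k : ℤ, (5:ℤ) ∣ A 1 1 - A 1 0 * k := by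
    obtain ⟨k, hk⟩ := ZMod.intCast_surjective ((A 1 1 : ZMod 5) * u)
    refine ⟨k, ?_⟩
    refine (ZMod.intCast_zmod_eq_zero_iff_dvd (A 1 1 - A 1 0 * k) 5).mp ?_
    push_cast; rw [hk]
    linear_combination -(A 1 1 : ZMod 5) * hu
  refine ⟨A * Tm (-k) * !![0, 1; -1, 0], k, ⟨?_, ?_⟩, ?_⟩
  · rw [Matrix.det_mul, Matrix.det_mul, hA, Tm_det]; simp [Matrix.det_fin_two]
  · simp [Matrix.mul_apply, Fin.sum_univ_two, Tm]
    have : A 1 0 * k - A 1 1 = -(A 1 1 - A 1 0 * k) := by ring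
    try omega
  · ext i j; fin_cases i <;> fin_cases j <;> simp [Matrix.mul_apply, Fin.sum_univ_two, Tm, Sm]

lemma S_T_eq (k : ℤ) {z : ℂ} (hz : 0 < z.im) : mo (Sm * Tm k) z = mo Wm ((z + k) / 5) := by
  rw [mo_mul (by rw [Sm_det]; norm_num) (G5_T k).pos hz, mo_T, mo_S, mo_W]
  congr 1; ring

lemma div5_up {z : ℂ} (hz : 0 < z.im) : 0 < (z / 5).im := by
  have : (z / 5).im = z.im / 5 := by exact_mod_cast Complex.div_natCast_im z 5
  rw [this]; positivity

lemma liouville5 {h : ℂ → ℂ}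
    (hd : ∀ z, 0 < z.im → DifferentiableAt ℂ h z)
    (hinv : ∀ A, G5 A → ∀ z, 0 < z.im → h (mo A z) = h z)
    (hb : BI h) (hb' : BI (fun z => h (mo Wm z))) {z w : ℂ} (hz : 0 < z.im) (hw : 0 < w.im) :
    h z = h w := by
  refine liouville (CongruenceSubgroup.Gamma0 5) hd (fun γ hγ z hz => hinv _ ((mem_G0 γ).mp hγ) z hz)
    (fun γ => ?_) hz hw
  by_cases h5 : 5 ∣ γ.1 1 0
  · obtain ⟨C, Y, hC⟩ := hb
    refine ⟨C, Y, fun z h1 h2 => ?_⟩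
    exact (congrArg norm (hinv _ ⟨γ.2, h5⟩ z h2)).trans_le (hC z h1 h2)
  · obtain ⟨B, k, hB, e⟩ := coset5 γ.1 γ.2 h5
    obtain ⟨C, Y, hC⟩ := (hb'.comp_div 5 (by norm_num)).comp_add k
    refine ⟨C, Y, fun z h1 h2 => ?_⟩
    have h3 : 0 < (Sm * Tm k).det := by rw [Matrix.det_mul, Sm_det, Tm_det]; norm_num
    show ‖h (mo γ.1 z)‖ ≤ C
    rw [e, mul_assoc, mo_mul hB.pos h3 h2, hinv _ hB _ (mo_up h3 h2), S_T_eq k h2]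
    have := hC z h1 h2
    push_cast at this
    exact this

lemma liouville1 {h : ℂ → ℂ}
    (hd : ∀ z, 0 < z.im → DifferentiableAt ℂ h z)
    (hinv : ∀ A : M2, A.det = 1 → ∀ z, 0 < z.im → h (mo A z) = h z)
    (hb : BI h) {z w : ℂ} (hz : 0 < z.im) (hw : 0 < w.im) :
    h z = h w := by
  refine liouville ⊤ hd (fun γ _ z hz => hinv _ γ.2 z hz) (fun γ => ?_) hz hw
  obtain ⟨C, Y, hC⟩ := hb
  refine ⟨C, Y, fun z h1 h2 => ?_⟩
  exact (congrArg norm (hinv _ γ.2 z h2)).trans_le (hC z h1 h2)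
end

section
open Complex PowerSeries
open UpperHalfPlane hiding I

lemma SRep.inv {p : ℂ⟦X⟧} {f : ℂ → ℂ} (h : SRep p f) (h0 : ∀ z, ‖z‖ < 1 → f z ≠ 0) :
    SRep p⁻¹ (fun z => (f z)⁻¹) := by
  have hd : DifferentiableOn ℂ (fun z => (f z)⁻¹) (Metric.ball 0 1) :=
    h.diffOn.inv (fun z hz => h0 z (by simpa using hz))
  obtain ⟨p', hp'⟩ := SRep.ex hd
  have e : p * p' = 1 := (h.mul hp').unique SRep.one
    (fun z hz _ => mul_inv_cancel₀ (h0 z hz))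
  have hc : constantCoeff p ≠ 0 := by rw [← h.apply_zero]; exact h0 0 (by simp)
  have : p' = p⁻¹ := by
    rw [PowerSeries.eq_inv_iff_mul_eq_one hc, mul_comm, e]
  rwa [← this]

lemma zc_inv {p : ℤ⟦X⟧} (hp : constantCoeff p = 1) : zc (invOfUnit p 1) = (zc p)⁻¹ := by
  have hc : constantCoeff (zc p) ≠ 0 := by
    rw [← coeff_zero_eq_constantCoeff_apply, coeff_map, coeff_zero_eq_constantCoeff_apply, hp]; simp
  rw [PowerSeries.eq_inv_iff_mul_eq_one hc, ← map_mul, mul_comm, mul_invOfUnit _ _ (by simpa using hp), map_one]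

/-- `h` has `q`-expansion `p` -/
def QR (p : ℂ⟦X⟧) (h : ℂ → ℂ) : Prop :=
  ∀ z : ℂ, 0 < z.im → HasSum (fun n => coeff n p * qf z ^ n) (h z)

lemma SRep.toQ {p : ℂ⟦X⟧} {f : ℂ → ℂ} (h : SRep p f) : QR p (fun z => f (qf z)) :=
  fun z hz => h _ (qf_lt hz)

namespace QR

lemma congr {p : ℂ⟦X⟧} {f g : ℂ → ℂ} (h : QR p f) (hfg : ∀ z, 0 < z.im → f z = g z) :
    QR p g := fun z hz => hfg z hz ▸ h z hz

lemma toS {p : ℂ⟦X⟧} {h : ℂ → ℂ} (hp : QR p h) :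
    ∃ f, SRep p f ∧ ∀ z, 0 < z.im → h z = f (qf z) := by
  have hs : ∀ q : ℂ, ‖q‖ < 1 → Summable (fun n => coeff n p * q ^ n) := by
    intro q hq
    by_cases h0 : q = 0
    · subst h0
      exact (hasSum_single (f := fun n => coeff n p * (0:ℂ) ^ n) 0 (fun n hn => by simp [hn])).summable
    · obtain ⟨z, hz, rfl⟩ := qf_surj h0 hq
      exact (hp z hz).summable
  refine ⟨fun q => ∑' n, coeff n p * q ^ n, fun q hq => (hs q hq).hasSum, fun z hz => ?_⟩
  exact (hp z hz).tsum_eq.symm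

lemma add {p p' : ℂ⟦X⟧} {f g : ℂ → ℂ} (h : QR p f) (h' : QR p' g) :
    QR (p + p') (fun z => f z + g z) := fun z hz => by
  simpa [add_mul] using (h z hz).add (h' z hz)

lemma sub {p p' : ℂ⟦X⟧} {f g : ℂ → ℂ} (h : QR p f) (h' : QR p' g) :
    QR (p - p') (fun z => f z - g z) := fun z hz => by
  simpa [sub_mul] using (h z hz).sub (h' z hz)

lemma mul {p p' : ℂ⟦X⟧} {f g : ℂ → ℂ} (h : QR p f) (h' : QR p' g) :
    QR (p * p') (fun z => f z * g z) := by
  obtain ⟨F, hF, eF⟩ := h.toS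
  obtain ⟨G, hG, eG⟩ := h'.toS
  exact (hF.mul hG).toQ.congr fun z hz => by rw [eF z hz, eG z hz]

lemma const (c : ℂ) : QR (C c) (fun _ => c) := (SRep.const c).toQ
lemma one : QR 1 (fun _ => 1) := SRep.one.toQ
lemma X : QR X qf := by simpa using (SRep.xpow 1).toQ

lemma pow {p : ℂ⟦X⟧} {f : ℂ → ℂ} (h : QR p f) (m : ℕ) : QR (p ^ m) (fun z => f z ^ m) := by
  obtain ⟨F, hF, eF⟩ := h.toS
  exact (hF.pow m).toQ.congr fun z hz => by rw [eF z hz]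

lemma prod {ι : Type*} (s : Finset ι) {p : ι → ℂ⟦X⟧} {f : ι → ℂ → ℂ}
    (h : ∀ i ∈ s, QR (p i) (f i)) : QR (∏ i ∈ s, p i) (fun z => ∏ i ∈ s, f i z) := by
  classical
  induction s using Finset.induction_on with
  | empty => simpa using one
  | insert a s ha ih =>
    simp only [Finset.prod_insert ha]
    exact (h a (by simp)).mul (ih fun i hi => h i (by simp [hi]))

lemma sum {ι : Type*} (s : Finset ι) {p : ι → ℂ⟦X⟧} {f : ι → ℂ → ℂ}
    (h : ∀ i ∈ s, QR (p i) (f i)) : QR (∑ i ∈ s, p i) (fun z => ∑ i ∈ s, f i z) := by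
  classical
  induction s using Finset.induction_on with
  | empty => simpa using const 0
  | insert a s ha ih =>
    simp only [Finset.sum_insert ha]
    exact (h a (by simp)).add (ih fun i hi => h i (by simp [hi]))

lemma unique {p p' : ℂ⟦X⟧} {f g : ℂ → ℂ} (h : QR p f) (h' : QR p' g)
    (e : ∀ z, 0 < z.im → f z = g z) : p = p' := by
  obtain ⟨F, hF, eF⟩ := h.toS
  obtain ⟨G, hG, eG⟩ := h'.toS
  refine hF.unique hG fun q hq h0 => ?_
  obtain ⟨z, hz, rfl⟩ := qf_surj h0 hq
  rw [← eF z hz, ← eG z hz, e z hz]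

lemma expand {p : ℂ⟦X⟧} {f : ℂ → ℂ} (h : QR p f) {m : ℕ} (hm : m ≠ 0) :
    QR (PowerSeries.expand m hm p) (fun z => f (m * z)) := by
  obtain ⟨F, hF, eF⟩ := h.toS
  refine (hF.expand hm).toQ.congr fun z hz => ?_
  rw [eF, qf_nat]
  rw [← Complex.ofReal_natCast, Complex.im_ofReal_mul]
  have : (0:ℝ) < m := by exact_mod_cast Nat.pos_of_ne_zero hm
  positivity

lemma shift {p : ℂ⟦X⟧} {f : ℂ → ℂ} (h : QR p f) (r : ℝ) :
    QR (PowerSeries.rescale (qf r) p) (fun z => f (z + r)) := by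
  obtain ⟨F, hF, eF⟩ := h.toS
  refine (hF.rescale (a := qf r) (by rw [qf_norm]; simp)).toQ.congr fun z hz => ?_
  rw [eF _ (by simpa using hz), qf_add, mul_comm]

lemma diff {p : ℂ⟦X⟧} {f : ℂ → ℂ} (h : QR p f) {z : ℂ} (hz : 0 < z.im) : DifferentiableAt ℂ f z := by
  obtain ⟨F, hF, eF⟩ := h.toS
  have h1 : DifferentiableAt ℂ (fun z => F (qf z)) z :=
    DifferentiableAt.comp z (hF.analyticAt (qf_lt hz)).differentiableAt (qf_deriv z).differentiableAt
  refine h1.congr_of_eventuallyEq ?_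
  filter_upwards [UH_open.mem_nhds hz] with w hw using eF w hw

lemma per {p : ℂ⟦X⟧} {f : ℂ → ℂ} (h : QR p f) {z : ℂ} (hz : 0 < z.im) (k : ℤ) : f (z + k) = f z := by
  obtain ⟨F, hF, eF⟩ := h.toS
  rw [eF _ (T_up k hz), eF _ hz, qf_T]

/-- the limit at `i∞` -/
lemma tendsto {p : ℂ⟦X⟧} {f : ℂ → ℂ} (h : QR p f) {ε : ℝ} (hε : 0 < ε) :
    ∃ Y : ℝ, 0 < Y ∧ ∀ z : ℂ, Y ≤ z.im → ‖f z - constantCoeff p‖ ≤ ε := by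
  obtain ⟨F, hF, eF⟩ := h.toS
  have hc : ContinuousAt F 0 := (hF.analyticAt (z := 0) (by simp)).continuousAt
  rw [Metric.continuousAt_iff] at hc
  obtain ⟨δ, hδ, H⟩ := hc ε hε
  have : Filter.Tendsto (fun Y : ℝ => Real.exp (-2 * Real.pi * Y)) Filter.atTop (nhds 0) := by
    refine Real.tendsto_exp_atBot.comp ?_
    exact Filter.tendsto_id.const_mul_atTop_of_neg (by have := Real.pi_pos; linarith)
  obtain ⟨Y, hY⟩ := Filter.eventually_atTop.mp (this.eventually (gt_mem_nhds hδ))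
  refine ⟨max Y 1, by positivity, fun z hz => ?_⟩
  have hz0 : 0 < z.im := lt_of_lt_of_le (by norm_num) ((le_max_right _ _).trans hz)
  rw [eF z hz0, ← hF.apply_zero, ← dist_eq_norm]
  refine (H ?_).le
  rw [dist_zero_right, qf_norm]
  exact hY _ ((le_max_left _ _).trans hz)

lemma BI {p : ℂ⟦X⟧} {f : ℂ → ℂ} (h : QR p f) : BI f := by
  obtain ⟨Y, _, hY⟩ := h.tendsto one_pos
  refine ⟨‖constantCoeff p‖ + 1, Y, fun z hz _ => ?_⟩
  have := hY z hz
  calc ‖f z‖ = ‖constantCoeff p + (f z - constantCoeff p)‖ := by congr 1; ring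
    _ ≤ _ := norm_add_le _ _
    _ ≤ _ := by linarith

lemma of_BI {h : ℂ → ℂ} (hd : ∀ z, 0 < z.im → DifferentiableAt ℂ h z)
    (hper : ∀ z, 0 < z.im → h (z + 1) = h z) (hb : _root_.BI h) : ∃ p, QR p h := by
  classical
  -- make it globally periodic
  let h' : ℂ → ℂ := fun z => if 0 < z.im then h z else 0
  have e' : ∀ z, 0 < z.im → h' z = h z := fun z hz => if_pos hz
  have hper' : Function.Periodic h' (1:ℝ) := by
    intro z
    by_cases hz : 0 < z.im
    · have hz' : 0 < (z + 1).im := by simpa using hz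
      simp only [h', ofReal_one, if_pos hz, if_pos hz', hper z hz]
    · have hz' : ¬ 0 < (z + 1).im := by simpa using hz
      simp only [h', ofReal_one, if_neg hz, if_neg hz']
  have hd' : ∀ z, 0 < z.im → DifferentiableAt ℂ h' z := fun z hz => by
    refine (hd z hz).congr_of_eventuallyEq ?_
    filter_upwards [UH_open.mem_nhds hz] with w hw using e' w hw
  have hq : ∀ z, Function.Periodic.qParam 1 z = qf z := fun z => by simp [Function.Periodic.qParam, qf]
  have hdiff : DifferentiableOn ℂ (Function.Periodic.cuspFunction 1 h') (Metric.ball 0 1) := by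
    intro q hq1
    refine DifferentiableAt.differentiableWithinAt ?_
    by_cases h0 : q = 0
    · subst h0
      obtain ⟨C, Y, hC⟩ := hb
      have hev : ∀ Y : ℝ, ∀ᶠ z in Filter.comap Complex.im Filter.atTop, Y ≤ z.im := fun Y =>
        Filter.tendsto_comap.eventually (Filter.eventually_ge_atTop Y)
      refine Function.Periodic.differentiableAt_cuspFunction_zero one_pos hper' ?_ ?_
      · filter_upwards [hev 1] with z hz using hd' z (by linarith)
      · refine Asymptotics.IsBigO.of_bound C ?_
        filter_upwards [hev 1, hev Y] with z hz hz2
        rw [e' z (by linarith)]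
        simpa using hC z hz2 (by linarith)
    · obtain ⟨z, hz, rfl⟩ := qf_surj h0 (by simpa using hq1)
      rw [← hq]
      exact Function.Periodic.differentiableAt_cuspFunction one_ne_zero hper' (hd' z hz)
  obtain ⟨p, hp⟩ := SRep.ex hdiff
  refine ⟨p, hp.toQ.congr fun z hz => ?_⟩
  rw [← hq]
  have := Function.Periodic.eq_cuspFunction one_ne_zero hper' z
  rw [this, e' z hz]

lemma theta {p : ℂ⟦X⟧} {f : ℂ → ℂ} (h : QR p f) :
    QR (PowerSeries.X * PowerSeries.derivative ℂ p) (fun z => deriv f z / (2 * Real.pi * I)) := by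
  obtain ⟨F, hF, eF⟩ := h.toS
  have hpi : (2 * Real.pi * I : ℂ) ≠ 0 := by simp [Real.pi_ne_zero]
  have hF' : DifferentiableOn ℂ (deriv F) (Metric.ball 0 1) :=
    hF.diffOn.deriv Metric.isOpen_ball
  have h2 := SRep.taylor hF'
  have e : PowerSeries.derivative ℂ p = PowerSeries.mk fun n => (n.factorial : ℂ)⁻¹ * iteratedDeriv n (deriv F) 0 := by
    ext n
    rw [coeff_derivative, hF.coeff_eq, coeff_mk, iteratedDeriv_succ', Nat.factorial_succ]
    push_cast
    have : (n:ℂ) + 1 ≠ 0 := by exact_mod_cast n.succ_ne_zero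
    field_simp
  rw [← e] at h2
  refine (X.mul h2.toQ).congr fun z hz => ?_
  have h1 : HasDerivAt f (deriv F (qf z) * (2 * Real.pi * I * qf z)) z := by
    refine ((hF.analyticAt (qf_lt hz)).differentiableAt.hasDerivAt.comp z (qf_deriv z)).congr_of_eventuallyEq ?_
    filter_upwards [UH_open.mem_nhds hz] with w hw using eF w hw
  rw [h1.deriv]
  field_simp

/-- vanishing constant coefficient: divide by `q` -/
lemma divX {p : ℂ⟦X⟧} {f : ℂ → ℂ} (h : QR p f) (h0 : constantCoeff p = 0) :
    ∃ p', p = PowerSeries.X * p' ∧ QR p' (fun z => f z / qf z) := by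
  obtain ⟨p', hp'⟩ := X_dvd_iff.mpr h0
  refine ⟨p', hp', fun z hz => ?_⟩
  have h1 := h z hz
  have hq := qf_ne z
  rw [hp', ← hasSum_nat_add_iff' 1] at h1
  simp only [Finset.sum_range_one, coeff_zero_X_mul, zero_mul, sub_zero, coeff_succ_X_mul] at h1
  have := h1.div_const (qf z)
  exact this.congr_fun (fun x => by rw [pow_succ]; field_simp)
end QR

lemma poly_of (y : ℂ → ℂ) {py : ℂ⟦X⟧} (hy : QR py (fun z => y z * qf z)) (hy1 : constantCoeff py = 1)
    (S : (ℂ → ℂ) → Prop)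
    (hsub : ∀ h, S h → ∀ (c : ℂ) (a : ℕ), S (fun z => h z - c * y z ^ a))
    (hconst : ∀ h, S h → BI h → ∀ z w : ℂ, 0 < z.im → 0 < w.im → h z = h w)
    (hdif : ∀ h, S h → ∀ z : ℂ, 0 < z.im → DifferentiableAt ℂ h z)
    (hper : ∀ h, S h → ∀ z : ℂ, 0 < z.im → h (z + 1) = h z) :
    ∀ (a : ℕ) (h : ℂ → ℂ), S h → BI (fun z => h z * qf z ^ a) →
      ∃ P : Polynomial ℂ, P.natDegree ≤ a ∧ ∀ z : ℂ, 0 < z.im → h z = P.eval (y z) := by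
  intro a
  induction a with
  | zero =>
    intro h hS hb
    simp only [pow_zero, mul_one] at hb
    exact ⟨Polynomial.C (h z5), by simp, fun z hz => by simpa using hconst h hS hb z z5 hz z5_up⟩
  | succ a ih =>
    intro h hS hb
    obtain ⟨p, hp⟩ := QR.of_BI (h := fun z => h z * qf z ^ (a + 1))
      (fun z hz => (hdif h hS z hz).mul ((qf_deriv z).differentiableAt.pow _))
      (fun z hz => by
        have := qf_T 1 z
        rw [Int.cast_one] at this
        simp only [hper h hS z hz, this]) hb
    have h2 := hp.sub ((QR.const (constantCoeff p)).mul (hy.pow (a + 1)))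
    obtain ⟨p', -, hp'⟩ := h2.divX (by simp [hy1])
    obtain ⟨P, hP, hPe⟩ := ih (fun z => h z - constantCoeff p * y z ^ (a + 1)) (hsub h hS _ _)
      ((hp'.congr fun z hz => by
        have := qf_ne z
        rw [pow_succ (qf z)]; field_simp; ring).BI)
    refine ⟨P + Polynomial.C (constantCoeff p) * Polynomial.X ^ (a + 1), ?_, fun z hz => ?_⟩
    · refine (Polynomial.natDegree_add_le _ _).trans (max_le (by omega) ?_)
      exact Polynomial.natDegree_C_mul_X_pow_le _ _
    · have := hPe z hz
      simp only [Polynomial.eval_add, Polynomial.eval_mul, Polynomial.eval_C, Polynomial.eval_pow, Polynomial.eval_X]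
      rw [← this]; ring

noncomputable def ep5Z : ℤ⟦X⟧ := PowerSeries.expand 5 (by norm_num) epZ

lemma ep5Z_const : constantCoeff ep5Z = 1 := by
  rw [ep5Z, ← coeff_zero_eq_constantCoeff_apply, PowerSeries.coeff_expand]
  simp [epZ_const]

lemma zc_expand (m : ℕ) (hm : m ≠ 0) (p : ℤ⟦X⟧) :
    zc (PowerSeries.expand m hm p) = PowerSeries.expand m hm (zc p) := by
  rw [zc, PowerSeries.map_expand]

lemma ep5Z_rep : SRep (zc ep5Z) (fun z => ep (z ^ 5)) := by
  rw [ep5Z, zc_expand]; exact epZ_rep.expand _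

noncomputable def PZ : ℤ⟦X⟧ := epZ ^ 6 * invOfUnit ep5Z 1 ^ 6

lemma pow5_lt {z : ℂ} (h : ‖z‖ < 1) : ‖z ^ 5‖ < 1 := by
  rw [norm_pow]; exact pow_lt_one₀ (norm_nonneg _) h (by norm_num)

lemma ep5inv_rep : SRep (zc (invOfUnit ep5Z 1)) (fun z => (ep (z ^ 5))⁻¹) := by
  rw [zc_inv ep5Z_const]
  exact ep5Z_rep.inv fun z hz => ep_ne_zero (pow5_lt hz)

lemma PZ_rep : QR (zc PZ) (fun z => yf z * qf z) := by
  rw [PZ, map_mul, map_pow, map_pow]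
  refine ((epZ_rep.pow 6).mul (ep5inv_rep.pow 6)).toQ.congr fun z hz => ?_
  have := qf_ne z
  have := ep_ne_zero (qf5_lt hz)
  rw [yf]; field_simp

lemma const_inv {p : ℤ⟦X⟧} : constantCoeff (invOfUnit p 1) = 1 := by
  simp

lemma PZ_const : constantCoeff PZ = 1 := by
  rw [PZ, map_mul, map_pow, map_pow, epZ_const, const_inv]; norm_num

lemma zc_const {p : ℤ⟦X⟧} : constantCoeff (zc p) = ((constantCoeff p : ℤ) : ℂ) := by
  rw [← coeff_zero_eq_constantCoeff_apply, coeff_map, coeff_zero_eq_constantCoeff_apply]; simp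

/-- functions on X_0(5) with poles only at `∞` -/
def S5 (h : ℂ → ℂ) : Prop := (∀ z, 0 < z.im → DifferentiableAt ℂ h z) ∧
  (∀ A, G5 A → ∀ z, 0 < z.im → h (mo A z) = h z) ∧ BI (fun z => h (mo Wm z))

lemma yfinv_rep : ∃ p, QR p (fun z => (yf z)⁻¹) := by
  refine ⟨X * (zc PZ)⁻¹, ?_⟩
  have h1 : SRep ((zc PZ)⁻¹) _ := (((epZ_rep.pow 6).mul (ep5inv_rep.pow 6)).inv (fun z hz => by
    have := ep_ne_zero hz
    have := ep_ne_zero (pow5_lt hz)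
    positivity)).congr (g := fun z => ((ep z / ep (z ^ 5)) ^ 6)⁻¹) (fun z hz => by
      congr 1; rw [div_pow]; field_simp) |> (by rw [PZ, map_mul, map_pow, map_pow]; exact ·)
  refine (QR.X.mul h1.toQ).congr fun z hz => ?_
  rw [yf]
  have := qf_ne z
  field_simp

lemma BI.mul {f g : ℂ → ℂ} (hf : BI f) (hg : BI g) : BI (fun z => f z * g z) := by
  obtain ⟨C, Y, h⟩ := hf
  obtain ⟨C', Y', h'⟩ := hg
  refine ⟨C * C', max Y Y', fun z hz h0 => ?_⟩
  have h1 := h z ((le_max_left _ _).trans hz) h0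
  have h2 := h' z ((le_max_right _ _).trans hz) h0
  rw [norm_mul]
  exact mul_le_mul h1 h2 (norm_nonneg _) ((norm_nonneg _).trans h1)

lemma BI.sub {f g : ℂ → ℂ} (hf : BI f) (hg : BI g) : BI (fun z => f z - g z) := by
  obtain ⟨C, Y, h⟩ := hf
  obtain ⟨C', Y', h'⟩ := hg
  refine ⟨C + C', max Y Y', fun z hz h0 => ?_⟩
  have h1 := h z ((le_max_left _ _).trans hz) h0
  have h2 := h' z ((le_max_right _ _).trans hz) h0
  exact (norm_sub_le _ _).trans (add_le_add h1 h2)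

lemma BI.const (c : ℂ) : BI (fun _ => c) := ⟨‖c‖, 0, fun _ _ _ => le_rfl⟩

lemma BI.congr {f g : ℂ → ℂ} (hf : BI f) (h : ∀ z, 0 < z.im → f z = g z) : BI g := by
  obtain ⟨C, Y, hC⟩ := hf
  exact ⟨C, Y, fun z hz h0 => h z h0 ▸ hC z hz h0⟩

lemma BI.pow {f : ℂ → ℂ} (hf : BI f) (n : ℕ) : BI (fun z => f z ^ n) := by
  induction n with
  | zero => simpa using BI.const 1
  | succ n ih => simpa only [pow_succ] using ih.mul hf

lemma BI.prod {ι : Type*} (s : Finset ι) {f : ι → ℂ → ℂ} (hf : ∀ i ∈ s, BI (f i)) :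
    BI (fun z => ∏ i ∈ s, f i z) := by
  classical
  induction s using Finset.induction_on with
  | empty => simpa using BI.const 1
  | insert a s ha ih =>
    simp only [Finset.prod_insert ha]
    exact (hf a (by simp)).mul (ih fun i hi => hf i (by simp [hi]))

lemma BI.sum {ι : Type*} (s : Finset ι) {f : ι → ℂ → ℂ} (hf : ∀ i ∈ s, BI (f i)) :
    BI (fun z => ∑ i ∈ s, f i z) := by
  classical
  induction s using Finset.induction_on with
  | empty => simpa using BI.const 0
  | insert a s ha ih =>
    simp only [Finset.sum_insert ha]
    have h1 := (hf a (by simp)).sub ((BI.const 0).sub (ih fun i hi => hf i (by simp [hi])))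
    simpa using h1

lemma yfW_BI : BI (fun z => yf (mo Wm z)) := by
  obtain ⟨p, hp⟩ := yfinv_rep
  exact ((BI.const 125).mul hp.BI).congr fun z hz => by rw [yf_W' hz, div_eq_mul_inv]

lemma S5_y : S5 yf := ⟨fun z hz => yf_diff hz, fun A hA z hz => yf_inv hA hz, yfW_BI⟩

lemma poly5 {h : ℂ → ℂ} (hS : S5 h) {a : ℕ} (hb : BI (fun z => h z * qf z ^ a)) :
    ∃ P : Polynomial ℂ, P.natDegree ≤ a ∧ ∀ z : ℂ, 0 < z.im → h z = P.eval (yf z) := by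
  refine poly_of yf PZ_rep (by rw [zc_const, PZ_const]; norm_num) S5 ?_ ?_ ?_ ?_ a h hS hb
  · intro h hS c a
    refine ⟨fun z hz => (hS.1 z hz).sub (((yf_diff hz).pow a).const_mul c), fun A hA z hz => ?_, ?_⟩
    · simp only [hS.2.1 A hA z hz, yf_inv hA hz]
    · exact hS.2.2.sub ((BI.const c).mul (yfW_BI.pow a))
  · intro h hS hb z w hz hw
    exact liouville5 hS.1 hS.2.1 hb hS.2.2 hz hw
  · intro h hS; exact hS.1
  · intro h hS z hz
    have := hS.2.1 (Tm 1) (G5_T 1) z hz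
    rwa [mo_T, Int.cast_one] at this
end

section
open Complex PowerSeries
open UpperHalfPlane hiding I

/-- the operator `q d/dq` on functions of `τ` -/
noncomputable def th (f : ℂ → ℂ) (z : ℂ) : ℂ := deriv f z / (2 * Real.pi * I)

/-- the operator `X d/dX` on power series -/
noncomputable def thS {R : Type*} [CommRing R] (p : R⟦X⟧) : R⟦X⟧ := X * PowerSeries.derivative R p

lemma pi2_ne : (2 * Real.pi * I : ℂ) ≠ 0 := by simp [Real.pi_ne_zero]

section
variable {R S : Type*} [CommRing R] [CommRing S]
lemma thS_add (p q : R⟦X⟧) : thS (p + q) = thS p + thS q := by simp [thS, mul_add]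
lemma thS_sub (p q : R⟦X⟧) : thS (p - q) = thS p - thS q := by simp [thS, mul_sub]
lemma thS_mul (p q : R⟦X⟧) : thS (p * q) = p * thS q + q * thS p := by
  simp only [thS, Derivation.leibniz, smul_eq_mul]; ring
lemma thS_pow (p : R⟦X⟧) (n : ℕ) : thS (p ^ n) = n * p ^ (n - 1) * thS p := by
  simp only [thS, Derivation.leibniz_pow, smul_eq_mul, nsmul_eq_mul]; ring
lemma thS_natCast (n : ℕ) : thS (n : R⟦X⟧) = 0 := by simp [thS]
lemma thS_X : thS (X : R⟦X⟧) = X := by simp [thS]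
lemma thS_map (f : R →+* S) (p : R⟦X⟧) : PowerSeries.map f (thS p) = thS (PowerSeries.map f p) := by
  ext n
  rcases n with _ | n
  · simp [thS]
  · simp [thS, PowerSeries.coeff_succ_X_mul, PowerSeries.coeff_derivative]
lemma thS_coeff (p : R⟦X⟧) (n : ℕ) : coeff n (thS p) = n * coeff n p := by
  rcases n with _ | n
  · simp [thS]
  · simp [thS, PowerSeries.coeff_succ_X_mul, PowerSeries.coeff_derivative, mul_comm]
lemma thS_const (p : R⟦X⟧) : constantCoeff (thS p) = 0 := by simp [thS]
end

lemma QR.th {p : ℂ⟦X⟧} {f : ℂ → ℂ} (h : QR p f) : QR (thS p) (th f) := h.theta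

noncomputable def DCZ : ℤ⟦X⟧ := X * epZ ^ 24
noncomputable def E2Z : ℤ⟦X⟧ := 1 + 24 * thS epZ * invOfUnit epZ 1
noncomputable def E4Z : ℤ⟦X⟧ := E2Z ^ 2 - 12 * thS E2Z
noncomputable def E6Z : ℤ⟦X⟧ := E2Z * E4Z - 3 * thS E4Z

lemma epZ_inv : epZ * invOfUnit epZ 1 = 1 := PowerSeries.mul_invOfUnit _ _ (by simp [epZ_const])

lemma th_DCZ : thS DCZ = DCZ * E2Z := by
  rw [DCZ, thS_mul, thS_X, thS_pow, E2Z]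
  linear_combination (-24 * X * epZ ^ 23 * thS epZ) * epZ_inv

noncomputable def E2f (z : ℂ) : ℂ := th DC z / DC z
noncomputable def E4f (z : ℂ) : ℂ := E2f z ^ 2 - 12 * th E2f z
noncomputable def E6f (z : ℂ) : ℂ := E2f z * E4f z - 3 * th E4f z

lemma DCZ_rep : QR (zc DCZ) DC := by
  rw [DCZ, map_mul, map_pow]
  have : zc X = X := by simp [zc]
  rw [this]
  exact QR.X.mul (epZ_rep.toQ.pow 24)

lemma zc_thS (p : ℤ⟦X⟧) : zc (thS p) = thS (zc p) := thS_map _ _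

lemma zc_nat (n : ℕ) : zc (n : ℤ⟦X⟧) = C (n : ℂ) := by simp

lemma E2Z_rep : QR (zc E2Z) E2f := by
  have h1 : QR (zc E2Z) (fun z => 1 + 24 * th (fun z => ep (qf z)) z * (ep (qf z))⁻¹) := by
    rw [E2Z, map_add, map_one, map_mul, map_mul, zc_inv epZ_const, zc_thS]
    have : zc (24 : ℤ⟦X⟧) = C (24 : ℂ) := by simpa using zc_nat 24
    rw [this]
    exact QR.one.add (((QR.const 24).mul epZ_rep.toQ.th).mul (epZ_rep.inv fun z hz => ep_ne_zero hz).toQ)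
  refine h1.congr fun z hz => ?_
  have h2 := (DCZ_rep.mul h1) z hz
  have h3 := DCZ_rep.th z hz
  rw [← zc_thS, th_DCZ, map_mul] at h3
  rw [E2f, ← h2.unique h3]
  rw [mul_div_cancel_left₀ _ (DC_ne hz)]

lemma E4Z_rep : QR (zc E4Z) E4f := by
  rw [E4Z, map_sub, map_pow, map_mul, zc_thS]
  have : zc (12 : ℤ⟦X⟧) = C (12 : ℂ) := by simpa using zc_nat 12
  rw [this]
  exact (E2Z_rep.pow 2).sub ((QR.const 12).mul E2Z_rep.th)

lemma E6Z_rep : QR (zc E6Z) E6f := by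
  rw [E6Z, map_sub, map_mul, map_mul, zc_thS]
  have : zc (3 : ℤ⟦X⟧) = C (3 : ℂ) := by simpa using zc_nat 3
  rw [this]
  exact (E2Z_rep.mul E4Z_rep).sub ((QR.const 3).mul E4Z_rep.th)

lemma inv1_const {p : ℤ⟦X⟧} : constantCoeff (invOfUnit p 1) = 1 := by simp

lemma E2Z_0 : constantCoeff E2Z = 1 := by simp [E2Z, thS_const]
lemma E2Z_1 : coeff 1 E2Z = -24 := by
  have : (24 : ℤ⟦X⟧) = C 24 := by simp
  rw [E2Z, this, map_add, mul_assoc, coeff_C_mul, PowerSeries.coeff_mul]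
  simp [Finset.Nat.antidiagonal_succ, thS_coeff, epZ_one, coeff_one]
lemma E4Z_0 : constantCoeff E4Z = 1 := by simp [E4Z, thS_const, E2Z_0]
lemma E4Z_1 : coeff 1 E4Z = 240 := by
  have : (12 : ℤ⟦X⟧) = C 12 := by simp
  rw [E4Z, this, map_sub, coeff_C_mul, pow_two, PowerSeries.coeff_mul]
  simp [Finset.Nat.antidiagonal_succ, thS_coeff, E2Z_0, E2Z_1]
lemma E6Z_0 : constantCoeff E6Z = 1 := by simp [E6Z, thS_const, E2Z_0, E4Z_0]
lemma E6Z_1 : coeff 1 E6Z = -504 := by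
  have : (3 : ℤ⟦X⟧) = C 3 := by simp
  rw [E6Z, this, map_sub, coeff_C_mul, PowerSeries.coeff_mul]
  simp [Finset.Nat.antidiagonal_succ, thS_coeff, E2Z_0, E2Z_1, E4Z_0, E4Z_1]

lemma dn_deriv (A : M2) (z : ℂ) : HasDerivAt (dn A) (A 1 0) z := by
  unfold dn
  simpa using ((hasDerivAt_id z).const_mul (A 1 0 : ℂ)).add_const (A 1 1 : ℂ)

/-- chain rule for `θ` along a unimodular substitution -/
lemma th_mo {f F : ℂ → ℂ} {A : M2} (hA : A.det = 1) (hd : ∀ z, 0 < z.im → DifferentiableAt ℂ f z)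
    (hF : ∀ z, 0 < z.im → f (mo A z) = F z) {z F' : ℂ} (hz : 0 < z.im) (h : HasDerivAt F F' z) :
    th f (mo A z) = dn A z ^ 2 * F' / (2 * Real.pi * I) := by
  have hp : 0 < A.det := by omega
  have h1 : HasDerivAt (fun z => f (mo A z)) (deriv f (mo A z) * (A.det / dn A z ^ 2)) z :=
    HasDerivAt.comp z (hd _ (mo_up hp hz)).hasDerivAt (mo_deriv hp hz)
  have h2 : HasDerivAt (fun z => f (mo A z)) F' z := by
    refine h.congr_of_eventuallyEq ?_
    filter_upwards [UH_open.mem_nhds hz] with w hw using hF w hw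
  have h3 := h1.unique h2
  have := dn_ne hp hz
  rw [th, ← h3, hA]
  push_cast
  field_simp

lemma th_def (f : ℂ → ℂ) (z : ℂ) : deriv f z = 2 * Real.pi * I * th f z := by
  rw [th]; field_simp [pi2_ne]

lemma E2f_diff {z : ℂ} (hz : 0 < z.im) : DifferentiableAt ℂ E2f z := E2Z_rep.diff hz
lemma E4f_diff {z : ℂ} (hz : 0 < z.im) : DifferentiableAt ℂ E4f z := E4Z_rep.diff hz
lemma E6f_diff {z : ℂ} (hz : 0 < z.im) : DifferentiableAt ℂ E6f z := E6Z_rep.diff hz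

lemma E2f_mo {A : M2} (hA : A.det = 1) {z : ℂ} (hz : 0 < z.im) :
    E2f (mo A z) = dn A z ^ 2 * E2f z + 12 * (A 1 0 / (2 * Real.pi * I)) * dn A z := by
  have hp : 0 < A.det := by omega
  have := dn_ne hp hz
  have h0 := DC_ne hz
  have hpi := pi2_ne
  rw [E2f, th_mo hA (fun z hz => DC_diff hz) (fun z hz => DC_mo hA hz) hz
    (((dn_deriv A z).pow 12).mul (DC_diff hz).hasDerivAt), DC_mo hA hz, E2f, th]
  simp only [Pi.pow_apply]
  field_simp
  push_cast
  ring

lemma E4f_mo {A : M2} (hA : A.det = 1) {z : ℂ} (hz : 0 < z.im) :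
    E4f (mo A z) = dn A z ^ 4 * E4f z := by
  have hp : 0 < A.det := by omega
  have := dn_ne hp hz
  have hpi := pi2_ne
  rw [E4f, th_mo hA (fun z hz => E2f_diff hz) (fun z hz => E2f_mo hA hz) hz
    ((((dn_deriv A z).pow 2).mul (E2f_diff hz).hasDerivAt).add
      ((dn_deriv A z).const_mul (12 * (A 1 0 / (2 * Real.pi * I)) : ℂ))), E2f_mo hA hz, E4f, th]
  simp only [Pi.pow_apply]
  field_simp
  push_cast
  ring

lemma E6f_mo {A : M2} (hA : A.det = 1) {z : ℂ} (hz : 0 < z.im) :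
    E6f (mo A z) = dn A z ^ 6 * E6f z := by
  have hp : 0 < A.det := by omega
  have := dn_ne hp hz
  have hpi := pi2_ne
  rw [E6f, th_mo hA (fun z hz => E4f_diff hz) (fun z hz => E4f_mo hA hz) hz
    (((dn_deriv A z).pow 4).mul (E4f_diff hz).hasDerivAt), E2f_mo hA hz, E4f_mo hA hz, E6f, th]
  simp only [Pi.pow_apply]
  field_simp
  push_cast
  ring

lemma QR.BI_divDC {p : ℂ⟦X⟧} {f : ℂ → ℂ} (h : QR p f) (h0 : constantCoeff p = 0) :
    _root_.BI (fun z => f z / DC z) := by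
  obtain ⟨p', -, hp'⟩ := h.divX h0
  have h2 := hp'.mul ((epZ_rep.inv fun z hz => ep_ne_zero hz).toQ.pow 24)
  refine h2.BI.congr fun z hz => ?_
  have := ep_ne_zero (qf_lt hz)
  have := qf_ne z
  show f z / qf z * (ep (qf z))⁻¹ ^ 24 = _
  rw [DC]; field_simp

lemma DC_E4_E6 {z : ℂ} (hz : 0 < z.im) : 1728 * DC z = E4f z ^ 3 - E6f z ^ 2 := by
  have hq : QR (zc (E4Z ^ 3 - E6Z ^ 2)) (fun z => E4f z ^ 3 - E6f z ^ 2) := by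
    rw [map_sub, map_pow, map_pow]
    exact (E4Z_rep.pow 3).sub (E6Z_rep.pow 2)
  have hc : constantCoeff (zc (E4Z ^ 3 - E6Z ^ 2)) = 0 := by
    rw [zc_const]; simp [E4Z_0, E6Z_0]
  have key : ∀ w : ℂ, 0 < w.im → (E4f w ^ 3 - E6f w ^ 2) / DC w = (E4f z ^ 3 - E6f z ^ 2) / DC z := by
    intro w hw
    refine liouville1 (h := fun z => (E4f z ^ 3 - E6f z ^ 2) / DC z) (fun z hz => ?_) (fun A hA z hz => ?_)
      (hq.BI_divDC hc) hw hz
    · exact (((E4f_diff hz).pow 3).sub ((E6f_diff hz).pow 2)).div (DC_diff hz) (DC_ne hz)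
    · have := dn_ne (by omega : 0 < A.det) hz
      have := DC_ne hz
      simp only [E4f_mo hA hz, E6f_mo hA hz, DC_mo hA hz]
      field_simp
  set c := (E4f z ^ 3 - E6f z ^ 2) / DC z with hcdef
  have h1 : zc (E4Z ^ 3 - E6Z ^ 2) = C c * zc DCZ := by
    refine hq.unique ((QR.const c).mul DCZ_rep) fun w hw => ?_
    have := DC_ne hw
    rw [← key w hw]; field_simp
  have h2 := congrArg (coeff 1) h1
  have e1 : coeff 1 (E4Z ^ 3 - E6Z ^ 2) = 1728 := by
    rw [map_sub, pow_succ, pow_two, pow_two, PowerSeries.coeff_mul]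
    simp [Finset.Nat.antidiagonal_succ, PowerSeries.coeff_mul, E4Z_0, E4Z_1, E6Z_0, E6Z_1]
  have e2 : coeff 1 DCZ = 1 := by
    rw [DCZ, coeff_succ_X_mul]; simp [epZ_const]
  rw [coeff_C_mul, zc, coeff_map, coeff_map, e1, e2] at h2
  have := DC_ne hz
  have h3 : c = 1728 := by simpa using h2.symm
  rw [hcdef, div_eq_iff this] at h3
  exact h3.symm

lemma DCZ_E : 1728 * DCZ = E4Z ^ 3 - E6Z ^ 2 := by
  apply zc_inj
  have : zc (1728 : ℤ⟦X⟧) = C (1728 : ℂ) := by simpa using zc_nat 1728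
  rw [map_mul, this, map_sub, map_pow, map_pow]
  exact ((QR.const 1728).mul DCZ_rep).unique ((E4Z_rep.pow 3).sub (E6Z_rep.pow 2)) fun z hz => DC_E4_E6 hz

lemma th_E2Z : 12 * thS E2Z = E2Z ^ 2 - E4Z := by rw [E4Z]; ring
lemma th_E4Z : 3 * thS E4Z = E2Z * E4Z - E6Z := by rw [E6Z]; ring
lemma th_E6Z : 2 * thS E6Z = E2Z * E6Z - E4Z ^ 2 := by
  have h := congrArg thS DCZ_E
  have e : thS (1728 : ℤ⟦X⟧) = 0 := by simpa using thS_natCast (R := ℤ) 1728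
  rw [thS_mul, e, thS_sub, thS_pow, thS_pow, th_DCZ] at h
  have h6 : E6Z ≠ 0 := by
    intro h0; have := E6Z_0; rw [h0] at this; simp at this
  apply mul_left_cancel₀ h6
  push_cast at h
  linear_combination h + E4Z ^ 2 * th_E4Z - E2Z * DCZ_E
end

section
open Complex PowerSeries
open UpperHalfPlane hiding I

lemma trunc3 (p : ℤ⟦X⟧) : ∃ r : ℤ⟦X⟧, p = C (constantCoeff p) + C (coeff 1 p) * X + C (coeff 2 p) * X ^ 2 + X ^ 3 * r := by
  have h : (X : ℤ⟦X⟧) ^ 3 ∣ p - (C (constantCoeff p) + C (coeff 1 p) * X + C (coeff 2 p) * X ^ 2) := by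
    rw [PowerSeries.X_pow_dvd_iff]
    intro m hm
    interval_cases m
    · simp
    · simp only [map_sub, map_add, coeff_C_mul, coeff_C, coeff_X, coeff_X_pow]; simp
    · simp only [map_sub, map_add, coeff_C_mul, coeff_C, coeff_X, coeff_X_pow]; simp
  obtain ⟨r, hr⟩ := h
  exact ⟨r, by rw [← hr]; ring⟩

lemma zc_C (n : ℤ) : zc (C n) = C (n : ℂ) := by simp [zc]
lemma zc_X : zc X = X := by simp [zc]

lemma ep_trunc : ∃ r : ℂ⟦X⟧, zc epZ = 1 - X - X ^ 2 + X ^ 3 * r := by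
  obtain ⟨r, hr⟩ := trunc3 epZ
  refine ⟨zc r, ?_⟩
  rw [hr, epZ_const, epZ_one, epZ_two]
  simp only [map_add, map_mul, map_pow, zc_X, zc_C]
  simp
  ring

/-- an inverse fifth-power series is `1` modulo `X^3` -/
lemma inv5_trunc : ∃ r : ℂ⟦X⟧, zc (invOfUnit ep5Z 1) = 1 + X ^ 3 * r := by
  obtain ⟨r, hr⟩ := trunc3 ep5Z
  have h5 : ep5Z = 1 + X ^ 3 * r := by
    rw [hr, ep5Z_const]
    have e1 : coeff 1 ep5Z = 0 := by rw [ep5Z, PowerSeries.coeff_expand]; simp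
    have e2 : coeff 2 ep5Z = 0 := by rw [ep5Z, PowerSeries.coeff_expand]; simp
    rw [e1, e2]; simp
  have h1 : ep5Z * invOfUnit ep5Z 1 = 1 := PowerSeries.mul_invOfUnit _ _ (by simp [ep5Z_const])
  refine ⟨zc (- r * invOfUnit ep5Z 1), ?_⟩
  rw [← zc_X, ← map_one zc, ← map_pow, ← map_mul, ← map_add]
  congr 1
  linear_combination h1 - (invOfUnit ep5Z 1) * h5

lemma trunc_mul_pow {a b u v : ℂ⟦X⟧} (m n : ℕ) {r s : ℂ⟦X⟧} (ha : a = u + X ^ 3 * r) (hb : b = 1 + X ^ 3 * s)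
    (hv : X ^ 3 ∣ u ^ m - v) : ∃ t, a ^ m * b ^ n = v + X ^ 3 * t := by
  have h1 : (X : ℂ⟦X⟧) ^ 3 ∣ a ^ m - u ^ m := dvd_trans ⟨r, by rw [ha]; ring⟩ (sub_dvd_pow_sub_pow _ _ _)
  have h2 : (X : ℂ⟦X⟧) ^ 3 ∣ b ^ n - 1 ^ n := dvd_trans ⟨s, by rw [hb]; ring⟩ (sub_dvd_pow_sub_pow _ _ _)
  obtain ⟨x, hx⟩ := h1
  obtain ⟨y, hy⟩ := h2
  obtain ⟨z, hz⟩ := hv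
  rw [one_pow] at hy
  exact ⟨a ^ m * y + x + z, by linear_combination a ^ m * hy + hx + hz⟩

lemma PZ_trunc : ∃ r : ℂ⟦X⟧, zc PZ = 1 - 6 * X + 9 * X ^ 2 + X ^ 3 * r := by
  obtain ⟨r, hr⟩ := ep_trunc
  obtain ⟨s, hs⟩ := inv5_trunc
  rw [PZ, map_mul, map_pow, map_pow]
  exact trunc_mul_pow 6 6 hr hs ⟨10 - 30 * X - 6 * X ^ 2 + 41 * X ^ 3 + 6 * X ^ 4 - 30 * X ^ 5 - 10 * X ^ 6 + 9 * X ^ 7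
    + 6 * X ^ 8 + X ^ 9, by ring⟩

noncomputable def GZ : ℤ⟦X⟧ := epZ ^ 10 * invOfUnit ep5Z 1 ^ 2

lemma GZ_rep : QR (zc GZ) gf := by
  rw [GZ, map_mul, map_pow, map_pow]
  refine ((epZ_rep.pow 10).mul (ep5inv_rep.pow 2)).toQ.congr fun z hz => ?_
  have := ep_ne_zero (qf5_lt hz)
  rw [gf]; field_simp

lemma gfinv_rep : ∃ p, QR p (fun z => (gf z)⁻¹) := by
  refine ⟨_, (((epZ_rep.inv fun z hz => ep_ne_zero hz).pow 10).mul (ep5Z_rep.pow 2)).toQ.congr fun z hz => ?_⟩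
  have := ep_ne_zero (qf5_lt hz)
  have := ep_ne_zero (qf_lt hz)
  rw [gf]; field_simp

lemma GZ_trunc : ∃ r : ℂ⟦X⟧, zc GZ = 1 - 10 * X + 35 * X ^ 2 + X ^ 3 * r := by
  obtain ⟨r, hr⟩ := ep_trunc
  obtain ⟨s, hs⟩ := inv5_trunc
  rw [GZ, map_mul, map_pow, map_pow]
  exact trunc_mul_pow 10 2 hr hs ⟨-30 - 105 * X + 228 * X ^ 2 + 90 * X ^ 3 - 540 * X ^ 4 + 45 * X ^ 5 + 770 * X ^ 6
    - 131 * X ^ 7 - 770 * X ^ 8 + 45 * X ^ 9 + 540 * X ^ 10 + 90 * X ^ 11 - 228 * X ^ 12 - 105 * X ^ 13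
    + 30 * X ^ 14 + 35 * X ^ 15 + 10 * X ^ 16 + X ^ 17, by ring⟩

lemma coeff3 {a b c : ℂ} {t : ℂ⟦X⟧} (h : C a + C b * X + C c * X ^ 2 + X ^ 3 * t = 0) :
    a = 0 ∧ b = 0 ∧ c = 0 := by
  have h0 := congrArg (coeff 0) h
  have h1 := congrArg (coeff 1) h
  have h2 := congrArg (coeff 2) h
  simp only [map_add, coeff_C_mul, coeff_C, coeff_X, coeff_X_pow, coeff_X_pow_mul'] at h0 h1 h2
  simp at h0 h1 h2
  exact ⟨h0, h1, h2⟩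

lemma natDegree_two_eval {p : Polynomial ℂ} (h : p.natDegree ≤ 2) (x : ℂ) :
    p.eval x = p.coeff 2 * x ^ 2 + p.coeff 1 * x + p.coeff 0 := by
  rw [Polynomial.eval_eq_sum_range' (n := 3) (by omega)]
  simp [Finset.sum_range_succ]; ring

/-- weight four relation at level five -/
lemma rel5 {h : ℂ → ℂ} {p : ℂ⟦X⟧} (hS : S5 (fun z => h z / gf z)) (hp : QR p (fun z => h z * qf z ^ 2)) :
    ∃ c0 c1 c2 : ℂ, (∀ z, 0 < z.im → h z = gf z * (c2 * yf z ^ 2 + c1 * yf z + c0)) ∧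
      p = zc GZ * (C c2 * zc PZ ^ 2 + C c1 * zc PZ * X + C c0 * X ^ 2) := by
  obtain ⟨pg, hg⟩ := gfinv_rep
  obtain ⟨Q, hQ, hQe⟩ := poly5 hS (a := 2) ((hp.mul hg).BI.congr fun z hz => by
    show h z * qf z ^ 2 * (gf z)⁻¹ = _
    field_simp)
  have h1 : ∀ z, 0 < z.im → h z = gf z * (Q.coeff 2 * yf z ^ 2 + Q.coeff 1 * yf z + Q.coeff 0) := by
    intro z hz
    have := hQe z hz
    rw [natDegree_two_eval hQ] at this
    have hg := gf_ne hz
    rw [← this]; field_simp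
  refine ⟨_, _, _, h1, ?_⟩
  refine hp.unique (GZ_rep.mul ((((QR.const (Q.coeff 2)).mul (PZ_rep.pow 2)).add
    (((QR.const (Q.coeff 1)).mul PZ_rep).mul QR.X)).add ((QR.const (Q.coeff 0)).mul (QR.X.pow 2)))) fun z hz => ?_
  rw [h1 z hz]; ring

lemma E45_trunc : ∃ r, PowerSeries.expand 5 (by norm_num) (zc E4Z) = 1 + X ^ 3 * r := by
  rw [← zc_expand]
  obtain ⟨r, hr⟩ := trunc3 (PowerSeries.expand 5 (by norm_num) E4Z)
  have e0 : constantCoeff (PowerSeries.expand 5 (by norm_num) E4Z) = 1 := by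
    rw [← coeff_zero_eq_constantCoeff_apply, PowerSeries.coeff_expand]; simp [E4Z_0]
  have e1 : coeff 1 (PowerSeries.expand 5 (by norm_num) E4Z) = 0 := by rw [PowerSeries.coeff_expand]; simp
  have e2 : coeff 2 (PowerSeries.expand 5 (by norm_num) E4Z) = 0 := by rw [PowerSeries.coeff_expand]; simp
  rw [e0, e1, e2] at hr
  refine ⟨zc r, ?_⟩
  rw [hr]
  simp only [map_add, map_mul, map_pow, zc_X, zc_C]
  simp

lemma mo_S_eq {z : ℂ} : mo Sm z = -1 / z := by rw [mo_S]

lemma E45_S5 : S5 (fun z => E4f (5 * z) * yf z ^ 2 / gf z) := by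
  refine ⟨fun z hz => ?_, fun A hA z hz => ?_, ?_⟩
  · have : DifferentiableAt ℂ (fun z => E4f (5 * z)) z :=
      DifferentiableAt.comp (g := E4f) z (E4f_diff (up5 hz)) (by fun_prop)
    exact (this.mul ((yf_diff hz).pow 2)).div (gf_diff hz) (gf_ne hz)
  · have h1 := dn_ne hA.pos hz
    have h2 := gf_ne hz
    simp only
    rw [← mo_cj hA.2, E4f_mo (by rw [cj_det hA.2, hA.1]) (up5 hz), dn_cj hA.2, yf_inv hA hz, gf_inv hA hz]
    generalize E4f (5 * z) = E
    field_simp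
  · obtain ⟨c, hc, hcW⟩ := gfW_const
    obtain ⟨pg, hg⟩ := gfinv_rep
    refine (((QR.const (125 ^ 2 / c)).mul E4Z_rep).mul hg).BI.congr fun z hz => ?_
    have h0 := ne_of_up hz
    have h2 := gf_ne hz
    have h3 := yf_ne hz
    show _ = E4f (5 * mo Wm z) * yf (mo Wm z) ^ 2 / gf (mo Wm z)
    rw [five_W hz, ← mo_S, E4f_mo Sm_det hz, yf_W' hz, hcW z hz, dn_S]
    field_simp

lemma E4_five {z : ℂ} (hz : 0 < z.im) : E4f (5 * z) * yf z ^ 2 = gf z * (yf z ^ 2 + 10 * yf z + 5) := by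
  obtain ⟨c0, c1, c2, h, hp⟩ := rel5 (h := fun z => E4f (5 * z) * yf z ^ 2) E45_S5
    (((E4Z_rep.expand (m := 5) (by norm_num)).mul (PZ_rep.pow 2)).congr fun z hz => by push_cast; ring)
  obtain ⟨r, hr⟩ := PZ_trunc
  obtain ⟨s, hs⟩ := GZ_trunc
  obtain ⟨e, he⟩ := E45_trunc
  rw [hr, hs, he] at hp
  have := coeff3 (a := 1 - c2) (b := -12 + 22 * c2 - c1) (c := 54 - 209 * c2 + 16 * c1 - c0)
    (t := 1 * e + (-12) * X * e + 54 * X^2 * e + 2 * X^3 * e * r + (-108) * X^3 * e + (-12) * X^4 * e * r + 81 * X^4 * e + 18 * X^5 * e * r + 1 * X^6 * e * r^2 + 2 * r + (-108) + (-12) * X * r + 81 * X + 18 * X^2 * r + 1 * X^3 * r^2 + (-2) * C c2 * r + 1068 * C c2 + 32 * C c2 * X * r + (-3051) * C c2 * X + (-208) * C c2 * X^2 * r + (-1) * C c2 * X^3 * r^2 + (-104) * C c1 + (-1) * C c1 * X * r + 4590 * C c2 * X^2 + 600 * C c2 * X^3 * r + 10 * C c2 * X^4 * r^2 + 300 * C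 c1 * X + 10 * C c1 * X^2 * r + 10 * C c0 + (-2835) * C c2 * X^3 + (-630) * C c2 * X^4 * r + (-35) * C c2 * X^5 * r^2 + (-315) * C c1 * X^2 + (-35) * C c1 * X^3 * r + (-35) * C c0 * X + (-1) * C c2 * s + 12 * C c2 * X * s + (-54) * C c2 * X^2 * s + (-2) * C c2 * X^3 * r * s + 108 * C c2 * X^3 * s + 12 * C c2 * X^4 * r * s + (-81) * C c2 * X^4 * s + (-18) * C c2 * X^5 * r * s + (-1) * C c2 * X^6 * r^2 * s + (-1) * C c1 * X * s + 6 * C c1 * X^2 * s + (-9) * C c1 * X^3 * s + (-1) * C c1 * X^4 * r * s + (-1) * C c0 * X^2 * s) (by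
      simp only [map_sub, map_add, map_mul, map_neg, map_one, map_ofNat]
      linear_combination hp)
  obtain ⟨a1, a2, a3⟩ := this
  have d2 : c2 = 1 := by linear_combination -a1
  subst d2
  have d1 : c1 = 10 := by linear_combination -a2
  subst d1
  have d0 : c0 = 5 := by linear_combination -a3
  subst d0
  simpa using h z hz

lemma thy_rep : QR (thS (zc PZ) - zc PZ) (fun z => th yf z * qf z) := by
  refine (PZ_rep.th.sub PZ_rep).congr fun z hz => ?_
  have hpi := pi2_ne
  have h1 := ((yf_diff hz).hasDerivAt.mul (qf_deriv z)).deriv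
  have h2 : th (fun z => yf z * qf z) z = (deriv yf z * qf z + yf z * (2 * Real.pi * I * qf z)) / (2 * Real.pi * I) := by
    rw [th, ← h1]; rfl
  rw [h2, th]
  field_simp
  ring

lemma thy_mo {A : M2} (hA : G5 A) {z : ℂ} (hz : 0 < z.im) : th yf (mo A z) = dn A z ^ 2 * th yf z := by
  rw [th_mo hA.1 (fun z hz => yf_diff hz) (fun z hz => yf_inv hA hz) hz (yf_diff hz).hasDerivAt, th]
  ring

lemma thy_W {z : ℂ} (hz : 0 < z.im) : th yf (mo Wm z) = - 625 * z ^ 2 * th yf z / yf z ^ 2 := by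
  have h1 : HasDerivAt (fun z => yf (mo Wm z)) (deriv yf (mo Wm z) * (Wm.det / dn Wm z ^ 2)) z :=
    HasDerivAt.comp z (yf_diff (W_up hz)).hasDerivAt (mo_deriv Wm_pos hz)
  have h2 : HasDerivAt (fun z => yf (mo Wm z)) (125 * (- deriv yf z / yf z ^ 2)) z := by
    refine (((yf_diff hz).hasDerivAt.inv (yf_ne hz)).const_mul 125).congr_of_eventuallyEq ?_
    filter_upwards [UH_open.mem_nhds hz] with w hw
    rw [yf_W' hw, div_eq_mul_inv]; rfl
  have h3 := h1.unique h2
  have h0 := ne_of_up hz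
  have hy := yf_ne hz
  have hpi := pi2_ne
  have hdet : Wm.det = 5 := by simp [Wm, Matrix.det_fin_two]
  rw [dn_W, hdet] at h3
  have h4 : deriv yf (mo Wm z) = - 625 * z ^ 2 * deriv yf z / yf z ^ 2 := by
    push_cast at h3
    field_simp at h3 ⊢
    linear_combination h3
  rw [th, th, h4]
  field_simp

lemma yqinv_rep : ∃ p, QR p (fun z => (yf z * qf z)⁻¹) := by
  refine ⟨_, (((epZ_rep.pow 6).mul (ep5inv_rep.pow 6)).inv (fun z hz => by
    have := ep_ne_zero hz
    have := ep_ne_zero (pow5_lt hz)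
    positivity)).toQ.congr fun z hz => ?_⟩
  have := qf_ne z
  have := ep_ne_zero (qf5_lt hz)
  have := ep_ne_zero (qf_lt hz)
  rw [yf]
  field_simp

lemma thy_S5 : S5 (fun z => th yf z ^ 2 / gf z) := by
  refine ⟨fun z hz => ?_, fun A hA z hz => ?_, ?_⟩
  · have h1 : DifferentiableAt ℂ (th yf) z := by
      have h2 : DifferentiableAt ℂ (fun z => th yf z * qf z * (qf z)⁻¹) z :=
        (thy_rep.diff hz).mul ((qf_deriv z).differentiableAt.inv (qf_ne z))
      refine h2.congr_of_eventuallyEq (Filter.Eventually.of_forall fun w => ?_)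
      have := qf_ne w
      field_simp
    exact (h1.pow 2).div (gf_diff hz) (gf_ne hz)
  · have h1 := dn_ne hA.pos hz
    have h2 := gf_ne hz
    simp only
    rw [thy_mo hA hz, gf_inv hA hz]
    field_simp
  · obtain ⟨c, hc, hcW⟩ := gfW_const
    obtain ⟨pg, hg⟩ := gfinv_rep
    obtain ⟨py, hy⟩ := yqinv_rep
    refine ((QR.const (625 ^ 2 / c)).mul (((thy_rep.mul hy).pow 2).mul hg)).BI.congr fun z hz => ?_
    have h0 := ne_of_up hz
    have h2 := gf_ne hz
    have h3 := yf_ne hz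
    have h4 := qf_ne z
    show _ = th yf (mo Wm z) ^ 2 / gf (mo Wm z)
    rw [thy_W hz, hcW z hz]
    field_simp

lemma thy_sq {z : ℂ} (hz : 0 < z.im) : th yf z ^ 2 = gf z * (yf z ^ 2 + 22 * yf z + 125) := by
  obtain ⟨c0, c1, c2, h, hp⟩ := rel5 (h := fun z => th yf z ^ 2) thy_S5
    ((thy_rep.pow 2).congr fun z hz => by ring)
  obtain ⟨r, hr⟩ := PZ_trunc
  obtain ⟨s, hs⟩ := GZ_trunc
  have : ∃ e, thS (zc PZ) - zc PZ = 9 * X ^ 2 - 1 + X ^ 3 * e := by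
    refine ⟨2 * r + thS r, ?_⟩
    rw [hr, thS_add, thS_add, thS_sub, thS_mul, thS_mul, thS_mul, thS_pow, thS_pow, thS_X]
    have e1 : thS (6 : ℂ⟦X⟧) = 0 := by simpa using thS_natCast (R := ℂ) 6
    have e2 : thS (9 : ℂ⟦X⟧) = 0 := by simpa using thS_natCast (R := ℂ) 9
    have e3 : thS (1 : ℂ⟦X⟧) = 0 := by simpa using thS_natCast (R := ℂ) 1
    rw [e1, e2, e3]
    push_cast
    ring
  obtain ⟨e, he⟩ := this
  rw [he, hr, hs] at hp
  have := coeff3 (a := 1 - c2) (b := 22 * c2 - c1) (c := -18 - 209 * c2 + 16 * c1 - c0)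
    (t := 81 * X + 18 * X^2 * e + (-2) * e + 1 * X^3 * e^2 + (-2) * C c2 * r + 1068 * C c2 + 32 * C c2 * X * r + (-3051) * C c2 * X + (-208) * C c2 * X^2 * r + (-1) * C c2 * X^3 * r^2 + (-104) * C c1 + (-1) * C c1 * X * r + 4590 * C c2 * X^2 + 600 * C c2 * X^3 * r + 10 * C c2 * X^4 * r^2 + 300 * C c1 * X + 10 * C c1 * X^2 * r + 10 * C c0 + (-2835) * C c2 * X^3 + (-630) * C c2 * X^4 * r + (-35) * C c2 * X^5 * r^2 + (-315) * C c1 * X^2 + (-35) * C c1 * X^3 * r + (-35) * C c0 * X + (-1) * C c2 * s + 12 * C c2 * X * s + (-54) * C c2 * X^2 * s + (-2) * C c2 * X^3 * r * s + 108 * C c2 * X^3 * s + 12 * C c2 * X^4 * r * s + (-81) * C c2 * X^4 * s + (-18) * C c2 * X^5 * r * s + (-1) * C c2 * X^6 * r^2 * s + (-1) * C c1 * X * s + 6 * C c1 * X^2 * s + (-9) * C c1 * X^3 * s + (-1) * C c1 * X^4 * r * s + (-1) * C c0 * X^2 * s) (by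
      simp only [map_sub, map_add, map_mul, map_neg, map_one, map_ofNat]
      linear_combination hp)
  obtain ⟨a1, a2, a3⟩ := this
  have d2 : c2 = 1 := by linear_combination -a1
  subst d2
  have d1 : c1 = 22 := by linear_combination -a2
  subst d1
  have d0 : c0 = 125 := by linear_combination -a3
  subst d0
  simpa using h z hz
end

section
open Complex PowerSeries
open UpperHalfPlane hiding I
open scoped MatrixGroups ModularForm Topology

/-- equivalence under `Γ₀(5)` -/
def Eq5 (z w : ℂ) : Prop := ∃ A, G5 A ∧ mo A z = w

lemma Eq5.refl (z : ℂ) : Eq5 z z := ⟨1, G5_one, by rw [mo_one]⟩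
lemma Eq5.trans {x y z : ℂ} (hx : 0 < x.im) (h : Eq5 x y) (h' : Eq5 y z) : Eq5 x z := by
  obtain ⟨A, hA, rfl⟩ := h
  obtain ⟨B, hB, rfl⟩ := h'
  exact ⟨B * A, hB.mul hA, mo_mul hB.pos hA.pos hx⟩
lemma Eq5.symm {x y : ℂ} (hx : 0 < x.im) (h : Eq5 x y) : Eq5 y x := by
  obtain ⟨A, hA, rfl⟩ := h
  refine ⟨A.adjugate, hA.adj, ?_⟩
  rw [← mo_mul hA.adj.pos hA.pos hx, Matrix.adjugate_mul, hA.1, one_smul, mo_one]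
lemma Eq5.up {x y : ℂ} (hx : 0 < x.im) (h : Eq5 x y) : 0 < y.im := by
  obtain ⟨A, hA, rfl⟩ := h
  exact mo_up hA.pos hx
lemma Eq5.y {x y : ℂ} (hx : 0 < x.im) (h : Eq5 x y) : yf y = yf x := by
  obtain ⟨A, hA, rfl⟩ := h
  exact yf_inv hA hx

lemma sep5 {z w : ℂ} (hz : 0 < z.im) (hw : 0 < w.im) (h : ¬ Eq5 z w) :
    ∃ V ∈ 𝓝 z, ∃ V' ∈ 𝓝 w, ∀ z' ∈ V, ∀ w' ∈ V', 0 < z'.im → 0 < w'.im → ¬ Eq5 z' w' := by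
  let Γ : Subgroup (GL (Fin 2) ℝ) := (CongruenceSubgroup.Gamma0 5).map (Matrix.SpecialLinearGroup.mapGL ℝ)
  haveI : T2Space (Quotient (MulAction.orbitRel Γ ℍ)) := by
    infer_instance
  have key : ∀ x y : ℍ, Quotient.mk (MulAction.orbitRel Γ ℍ) y = Quotient.mk (MulAction.orbitRel Γ ℍ) x ↔ Eq5 x y := by
    intro x y
    rw [Quotient.eq]
    show y ∈ MulAction.orbit Γ x ↔ _
    constructor
    · rintro ⟨⟨_, ⟨γ, hγ, rfl⟩⟩, rfl⟩
      exact ⟨γ.1, (mem_G0 γ).mp hγ, (mo_SL γ x).symm⟩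
    · rintro ⟨A, hA, h⟩
      refine ⟨⟨_, ⟨toSL A hA.1, (mem_G0 _).mpr hA, rfl⟩⟩, ?_⟩
      apply UpperHalfPlane.ext
      rw [← h]
      exact coe_toSL_smul A hA.1 x
  have hne : Quotient.mk (MulAction.orbitRel Γ ℍ) ⟨w, hw⟩ ≠ Quotient.mk (MulAction.orbitRel Γ ℍ) ⟨z, hz⟩ := by
    intro h'; exact h ((key ⟨z, hz⟩ ⟨w, hw⟩).mp h')
  obtain ⟨U, U', hU, hU', hwU, hzU, hd⟩ := t2_separation hne
  have hcont : Continuous (Quotient.mk (MulAction.orbitRel Γ ℍ)) := continuous_quotient_mk'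
  have n1 := (hU'.preimage hcont).mem_nhds (show (⟨z, hz⟩ : ℍ) ∈ _ from hzU)
  have n2 := (hU.preimage hcont).mem_nhds (show (⟨w, hw⟩ : ℍ) ∈ _ from hwU)
  have e : ∀ x : ℍ, 𝓝 (x : ℂ) = Filter.map UpperHalfPlane.coe (𝓝 x) := fun x =>
    (UpperHalfPlane.isOpenEmbedding_coe.map_nhds_eq x).symm
  refine ⟨UpperHalfPlane.coe '' _, (by rw [e ⟨z, hz⟩]; exact Filter.image_mem_map n1),
    UpperHalfPlane.coe '' _, (by rw [e ⟨w, hw⟩]; exact Filter.image_mem_map n2), ?_⟩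
  rintro _ ⟨x, hx, rfl⟩ _ ⟨y, hy, rfl⟩ - - hE
  have := (key x y).mpr hE
  have h3 : Quotient.mk (MulAction.orbitRel Γ ℍ) y ∈ U' := by rw [this]; exact hx
  exact Set.disjoint_left.mp hd hy h3
end

section
open Complex PowerSeries
open UpperHalfPlane hiding I
open scoped MatrixGroups ModularForm Topology

/-- reduction to a Siegel set -/
lemma red5 {z : ℂ} (hz : 0 < z.im) :
    ∃ u : ℂ, 1 / 10 ≤ u.im ∧ |u.re| ≤ 1 / 2 ∧ (Eq5 z u ∨ Eq5 z (mo Wm u)) := by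
  obtain ⟨γ, hγ⟩ := ModularGroup.exists_smul_mem_fd ⟨z, hz⟩
  have him := ModularGroup.three_le_four_mul_im_sq_of_mem_fd hγ
  have hre := hγ.2
  set t : ℂ := ((γ • (⟨z, hz⟩ : ℍ) : ℍ) : ℂ) with ht
  have hmo : t = mo γ.1 z := mo_SL γ ⟨z, hz⟩
  have htu : 0 < t.im := (γ • (⟨z, hz⟩ : ℍ)).2
  have him1 : 3 ≤ 4 * t.im ^ 2 := him
  have him2 : 1 / 2 ≤ t.im := by nlinarith
  have hdet : Matrix.det γ.1 = 1 := γ.2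
  by_cases h5 : 5 ∣ γ.1 1 0
  · exact ⟨t, by linarith, hre, Or.inl ⟨γ.1, ⟨hdet, h5⟩, hmo.symm⟩⟩
  · have hadj : (Matrix.adjugate γ.1).det = 1 := by rw [Matrix.det_adjugate, hdet]; simp
    have h5' : ¬ 5 ∣ (Matrix.adjugate γ.1) 1 0 := by
      rw [Matrix.adjugate_fin_two]; simpa using h5
    obtain ⟨B, k, hB, he⟩ := coset5 _ hadj h5'
    have hz2 : z = mo (Matrix.adjugate γ.1) t := by
      rw [hmo, ← mo_mul (by rw [hadj]; norm_num) (by rw [hdet]; norm_num) hz, Matrix.adjugate_mul, hdet,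
        one_smul, mo_one]
    have hSm : 0 < Sm.det := by rw [Sm_det]; norm_num
    have hTm : 0 < (Tm k).det := by simp [Tm, Matrix.det_fin_two]
    have hST : 0 < (Sm * Tm k).det := by rw [Matrix.det_mul]; positivity
    have hu0 : 0 < ((t + k) / 5).im := div5_up (T_up k htu)
    have hz3 : z = mo B (mo Wm ((t + k) / 5)) := by
      rw [hz2, he, mul_assoc, mo_mul hB.pos hST htu, S_T_eq k htu]
    set u0 := (t + k) / 5 with hu0d
    have huim : u0.im = t.im / 5 := by
      have : u0 = (t + k) / ((5:ℕ) : ℂ) := by simp [hu0d]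
      rw [this, Complex.div_natCast_im]; simp
    have hm : mo (Um (- -round u0.re)) (mo Wm u0) = mo Wm (u0 + ((-round u0.re : ℤ) : ℂ)) := U_W_eq (-round u0.re) hu0
    refine ⟨u0 + ((-round u0.re : ℤ) : ℂ), ?_, ?_, Or.inr ?_⟩
    · simp only [Complex.add_im, Complex.intCast_im, add_zero]; rw [huim]; linarith
    · have := abs_sub_round u0.re
      simp only [Complex.add_re, Complex.intCast_re]
      push_cast
      rwa [← sub_eq_add_neg]
    · have hWu := W_up hu0
      refine Eq5.trans hz (Eq5.symm hWu ⟨B, hB, hz3.symm⟩) ⟨_, G5_U _, hm⟩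

lemma y_large (R : ℝ) : ∃ Y : ℝ, 0 < Y ∧ ∀ z : ℂ, Y ≤ z.im → R ≤ ‖yf z‖ := by
  obtain ⟨Y, hY, h⟩ := PZ_rep.tendsto (ε := 1 / 2) (by norm_num)
  rw [zc_const, PZ_const] at h
  refine ⟨max Y |R|, lt_of_lt_of_le hY (le_max_left _ _), fun z hz => ?_⟩
  have h1 := h z ((le_max_left _ _).trans hz)
  have h2 : |R| ≤ z.im := (le_max_right _ _).trans hz
  have h3 : 1 / 2 ≤ ‖yf z * qf z‖ := by
    have : ‖((1 : ℤ) : ℂ)‖ ≤ ‖yf z * qf z‖ + ‖yf z * qf z - ((1 : ℤ) : ℂ)‖ := by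
      rw [← norm_neg (yf z * qf z - _)]
      refine le_trans (le_of_eq ?_) (norm_add_le _ _)
      congr 1; ring
    simp only [Int.cast_one, norm_one] at this h1
    linarith
  rw [norm_mul, qf_norm] at h3
  have h4 : Real.exp (-2 * Real.pi * z.im) * Real.exp (2 * Real.pi * z.im) = 1 := by
    rw [← Real.exp_add]; simp
  have h5 : 2 * Real.pi * z.im + 1 ≤ Real.exp (2 * Real.pi * z.im) := Real.add_one_le_exp _
  have h6 : 1 / 2 * Real.exp (2 * Real.pi * z.im) ≤ ‖yf z‖ := by
    calc 1 / 2 * Real.exp (2 * Real.pi * z.im) ≤ ‖yf z‖ * Real.exp (-2 * Real.pi * z.im) * Real.exp (2 * Real.pi * z.im) := by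
          gcongr
      _ = ‖yf z‖ := by rw [mul_assoc, h4, mul_one]
  have h7 := Real.pi_gt_three
  have h8 : R ≤ |R| := le_abs_self R
  have h9 : 0 ≤ z.im := (abs_nonneg R).trans h2
  nlinarith

lemma local_inj {f : ℂ → ℂ} {f' a : ℂ} (h : HasStrictDerivAt f f' a) (h0 : f' ≠ 0) :
    ∃ V ∈ 𝓝 a, Set.InjOn f V := by
  have h2 := h.hasStrictFDerivAt_equiv h0
  refine ⟨(h2.toOpenPartialHomeomorph f).source, ?_, ?_⟩
  · exact (h2.toOpenPartialHomeomorph f).open_source.mem_nhds h2.mem_toOpenPartialHomeomorph_source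
  · exact (h2.toOpenPartialHomeomorph f).injOn

lemma inj_cusp : ∃ Y : ℝ, 0 < Y ∧ ∀ u v : ℂ, Y ≤ u.im → Y ≤ v.im → yf u = yf v → ∃ k : ℤ, u = v + k := by
  obtain ⟨p, hp⟩ := yqinv_rep
  have h1 : p * zc PZ = 1 := by
    refine (hp.mul PZ_rep).unique QR.one fun z hz => ?_
    have := yf_ne hz
    have := qf_ne z
    field_simp
  obtain ⟨f, hf, hfe⟩ := hp.toS
  have hp0 : f 0 ≠ 0 := by
    rw [hf.apply_zero]
    intro h
    have := congrArg constantCoeff h1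
    rw [map_mul, h] at this
    simp at this
  have ha : AnalyticAt ℂ (fun q => q * f q) 0 := analyticAt_id.mul (hf.analyticAt (by simp))
  have hd : HasDerivAt (fun q => q * f q) (f 0) 0 := by
    have := (hasDerivAt_id (0:ℂ)).mul (hf.analyticAt (z := 0) (by simp)).differentiableAt.hasDerivAt
    refine this.congr_deriv ?_
    simp
  have hs : HasStrictDerivAt (fun q => q * f q) (f 0) 0 := by
    have := ha.hasStrictDerivAt
    rwa [hd.deriv] at this
  obtain ⟨V, hV, hinj⟩ := local_inj hs hp0
  obtain ⟨r, hr, hrV⟩ := Metric.mem_nhds_iff.mp hV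
  obtain ⟨Y, hY, hYq⟩ := QR.X.tendsto (ε := r / 2) (by linarith)
  refine ⟨Y, hY, fun u v hu hv huv => ?_⟩
  have hu0 : 0 < u.im := by linarith
  have hv0 : 0 < v.im := by linarith
  have e : ∀ w : ℂ, Y ≤ w.im → qf w ∈ V := fun w hw => hrV (by
    have := hYq w hw
    simp only [constantCoeff_X, sub_zero] at this
    rw [Metric.mem_ball, dist_zero_right]; linarith)
  have g : ∀ w : ℂ, 0 < w.im → qf w * f (qf w) = (yf w)⁻¹ := fun w hw => by
    rw [← hfe w hw]
    have := yf_ne hw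
    have := qf_ne w
    field_simp
  exact qf_eq_iff.mp (hinj (e u hu) (e v hv) (by simp only [g u hu0, g v hv0, huv]))

lemma yf_an {z : ℂ} (hz : 0 < z.im) : AnalyticAt ℂ yf z := by
  have : DifferentiableOn ℂ yf UH := fun w hw => (yf_diff hw).differentiableWithinAt
  exact this.analyticAt (UH_open.mem_nhds hz)

lemma yf_open {z : ℂ} (hz : 0 < z.im) {V : Set ℂ} (hV : V ∈ 𝓝 z) : yf '' V ∈ 𝓝 (yf z) := by
  have hA : AnalyticOnNhd ℂ yf UH := fun w hw => yf_an hw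
  rcases hA.is_constant_or_isOpen UH_conn with ⟨w, hw⟩ | h
  · exfalso
    obtain ⟨Y, hY, h⟩ := y_large (‖w‖ + 1)
    have h1 : (Y * I).im = Y := by simp
    have := h (Y * I) h1.ge
    rw [hw (Y * I) (by show 0 < (Y * I).im; rw [h1]; exact hY)] at this
    linarith
  · have hi : z ∈ interior V ∩ UH := ⟨mem_interior_iff_mem_nhds.mpr hV, hz⟩
    have := h (interior V ∩ UH) Set.inter_subset_right (isOpen_interior.inter UH_open)
    exact Filter.mem_of_superset (this.mem_nhds ⟨z, hi, rfl⟩)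
      (Set.image_mono (Set.inter_subset_left.trans interior_subset))

lemma thy_ne {z : ℂ} (hz : 0 < z.im) (h : yf z ^ 2 + 22 * yf z + 125 ≠ 0) : deriv yf z ≠ 0 := by
  intro h0
  have := thy_sq hz
  rw [th, h0] at this
  simp at this
  rcases this with h' | h'
  · exact gf_ne hz h'
  · exact h h'

/-- the values with two inequivalent preimages -/
def Bset : Set ℂ := {c | ∃ z w : ℂ, 0 < z.im ∧ 0 < w.im ∧ ¬ Eq5 z w ∧ yf z = c ∧ yf w = c}

lemma Bset_open : IsOpen Bset := by
  rw [isOpen_iff_mem_nhds]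
  rintro c ⟨z, w, hz, hw, hE, rfl, h2⟩
  obtain ⟨V, hV, V', hV', h⟩ := sep5 hz hw hE
  have n1 := yf_open hz (Filter.inter_mem hV (UH_open.mem_nhds hz))
  have n2 := yf_open hw (Filter.inter_mem hV' (UH_open.mem_nhds hw))
  rw [h2] at n2
  refine Filter.mem_of_superset (Filter.inter_mem n1 n2) ?_
  rintro _ ⟨⟨z', ⟨h1, h1'⟩, rfl⟩, ⟨w', ⟨h3, h3'⟩, h4⟩⟩
  exact ⟨z', w', h1', h3', h z' h1 w' h3 h1' h3', rfl, h4⟩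

def Box (Y : ℝ) : Set ℂ := Set.Icc (-1 / 2 : ℝ) (1 / 2) ×ℂ Set.Icc (1 / 10 : ℝ) Y

lemma Box_compact (Y : ℝ) : IsCompact (Box Y) := isCompact_Icc.reProdIm isCompact_Icc

/-- compactness of the fibres -/
lemma red_box (r R : ℝ) (hr : 0 < r) : ∃ Y : ℝ, ∀ z : ℂ, 0 < z.im → r ≤ ‖yf z‖ → ‖yf z‖ ≤ R →
    ∃ u ∈ Box Y, Eq5 z u ∨ Eq5 z (mo Wm u) := by
  obtain ⟨Y1, hY1, h1⟩ := y_large (R + 1)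
  obtain ⟨Y2, hY2, h2⟩ := y_large (125 / r + 1)
  refine ⟨max Y1 Y2, fun z hz hr' hR => ?_⟩
  obtain ⟨u, hu, hur, hE⟩ := red5 hz
  have hu0 : 0 < u.im := by linarith
  have hur' := abs_le.mp hur
  refine ⟨u, ⟨⟨by linarith, by linarith⟩, ⟨hu, ?_⟩⟩, hE⟩
  show u.im ≤ _
  by_contra hcon
  push Not at hcon
  have c1 := h1 u ((le_max_left _ _).trans hcon.le)
  have c2 := h2 u ((le_max_right _ _).trans hcon.le)
  rcases hE with hE | hE
  · have := hE.y hz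
    rw [this] at c1; linarith
  · have := hE.y hz
    rw [yf_W' hu0] at this
    rw [← this, norm_div] at hr'
    have hy : 0 < ‖yf u‖ := norm_pos_iff.mpr (yf_ne hu0)
    rw [le_div_iff₀ hy] at hr'
    have e : ‖(125:ℂ)‖ = 125 := by norm_num
    rw [e] at hr'
    have : ‖yf u‖ ≤ 125 / r := by rw [le_div_iff₀ hr]; linarith
    linarith

lemma Box_up {Y : ℝ} {u : ℂ} (hu : u ∈ Box Y) : 0 < u.im := by
  have := hu.2.1
  have h : 1 / 10 ≤ u.im := this
  linarith

lemma cont_W {u : ℂ} (hu : 0 < u.im) : ContinuousAt (mo Wm) u := (mo_diff Wm_pos hu).continuousAt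

/-- a sequence of points over a convergent sequence of values can be made convergent -/
lemma lift_seq {z : ℕ → ℂ} (hz : ∀ n, 0 < (z n).im) {c : ℂ} (hc : c ≠ 0)
    (h : Filter.Tendsto (fun n => yf (z n)) Filter.atTop (𝓝 c)) :
    ∃ (w : ℕ → ℂ) (x : ℂ) (φ : ℕ → ℕ), StrictMono φ ∧ 0 < x.im ∧ (∀ n, Eq5 (z (φ n)) (w n)) ∧
      Filter.Tendsto w Filter.atTop (𝓝 x) := by
  have hpos : 0 < ‖c‖ := norm_pos_iff.mpr hc
  obtain ⟨Y, hY⟩ := red_box (‖c‖ / 2) (‖c‖ + 1) (by linarith)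
  have hn := h.norm
  have e1 : ∀ᶠ n in Filter.atTop, ‖c‖ / 2 ≤ ‖yf (z n)‖ ∧ ‖yf (z n)‖ ≤ ‖c‖ + 1 := by
    have a := hn.eventually (eventually_ge_nhds (show ‖c‖ / 2 < ‖c‖ by linarith))
    have b := hn.eventually (eventually_le_nhds (show ‖c‖ < ‖c‖ + 1 by linarith))
    exact a.and b
  obtain ⟨n0, hn0⟩ := Filter.eventually_atTop.mp e1
  have hex : ∀ n, ∃ u ∈ Box Y, Eq5 (z (n + n0)) u ∨ Eq5 (z (n + n0)) (mo Wm u) := fun n =>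
    hY _ (hz _) (hn0 _ (by omega)).1 (hn0 _ (by omega)).2
  choose u hu hE using hex
  obtain ⟨x, hx, φ, hφ, hlim⟩ := (Box_compact Y).tendsto_subseq hu
  have hxu := Box_up hx
  by_cases hfreq : ∃ᶠ n in Filter.atTop, Eq5 (z (φ n + n0)) (u (φ n))
  · obtain ⟨ψ, hψ, hψe⟩ := Filter.extraction_of_frequently_atTop hfreq
    refine ⟨fun n => u (φ (ψ n)), x, fun n => φ (ψ n) + n0, ?_, hxu, hψe, hlim.comp hψ.tendsto_atTop⟩
    intro a b hab
    have := hφ (hψ hab)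
    show φ (ψ a) + n0 < φ (ψ b) + n0
    omega
  · rw [Filter.not_frequently] at hfreq
    obtain ⟨n1, hn1⟩ := Filter.eventually_atTop.mp hfreq
    refine ⟨fun n => mo Wm (u (φ (n + n1))), mo Wm x, fun n => φ (n + n1) + n0, ?_, W_up hxu, fun n => ?_, ?_⟩
    · intro a b hab
      have := hφ (show a + n1 < b + n1 by omega)
      show φ (a + n1) + n0 < φ (b + n1) + n0
      omega
    · exact (hE _).resolve_left (hn1 _ (by omega))
    · have := hlim.comp (Filter.tendsto_add_atTop_nat n1)
      exact (cont_W hxu).tendsto.comp this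
end

section
open Complex PowerSeries
open UpperHalfPlane hiding I
open scoped MatrixGroups ModularForm Topology

/-- the finitely many excluded values -/
def Exc : Set ℂ := {0, -11 + 2 * I, -11 - 2 * I}

lemma Exc_iff (c : ℂ) : c ∈ Exc ↔ c = 0 ∨ c ^ 2 + 22 * c + 125 = 0 := by
  have : c ^ 2 + 22 * c + 125 = (c - (-11 + 2 * I)) * (c - (-11 - 2 * I)) := by
    linear_combination 4 * I_sq
  rw [this, mul_eq_zero, sub_eq_zero, sub_eq_zero]
  rfl

lemma Exc_fin : Exc.Finite := by unfold Exc; exact Set.toFinite _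

lemma Bset_closed {c : ℂ} (hc : c ∉ Exc) (h : c ∈ closure Bset) : c ∈ Bset := by
  rw [Exc_iff, not_or] at hc
  obtain ⟨hc0, hc1⟩ := hc
  obtain ⟨s, hs, hlim⟩ := mem_closure_iff_seq_limit.mp h
  choose z w hz hw hE hyz hyw using hs
  have l1 : Filter.Tendsto (fun n => yf (z n)) Filter.atTop (𝓝 c) := by simpa [hyz] using hlim
  obtain ⟨z', x, φ, hφ, hx, hEz, hzl⟩ := lift_seq hz hc0 l1
  have l2 : Filter.Tendsto (fun n => yf (w (φ n))) Filter.atTop (𝓝 c) := by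
    exact (hlim.comp hφ.tendsto_atTop).congr fun n => (hyw (φ n)).symm
  obtain ⟨w', x', ψ, hψ, hx', hEw, hwl⟩ := lift_seq (fun n => hw (φ n)) hc0 l2
  have hzl2 := hzl.comp hψ.tendsto_atTop
  have hzu : ∀ n, 0 < (z' n).im := fun n => (hEz n).up (hz _)
  have hwu : ∀ n, 0 < (w' n).im := fun n => (hEw n).up (hw _)
  have ey : ∀ n, yf (z' (ψ n)) = yf (w' n) := fun n => by
    rw [(hEz _).y (hz _), (hEw _).y (hw _), hyz, hyw]
  have hEn : ∀ n, ¬ Eq5 (z' (ψ n)) (w' n) := fun n hn =>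
    hE (φ (ψ n)) ((Eq5.trans (hz _) ((hEz _).trans (hz _) hn) ((hEw n).symm (hw _))))
  have yx : yf x = c := by
    refine tendsto_nhds_unique (((yf_diff hx).continuousAt.tendsto.comp hzl)) ?_
    refine (l1.comp hφ.tendsto_atTop).congr fun n => ?_
    exact ((hEz n).y (hz _)).symm
  have yx' : yf x' = c := by
    refine tendsto_nhds_unique (((yf_diff hx').continuousAt.tendsto.comp hwl)) ?_
    refine (l2.comp hψ.tendsto_atTop).congr fun n => ?_
    exact ((hEw n).y (hw _)).symm
  by_cases hxx : Eq5 x x'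
  · exfalso
    obtain ⟨A, hA, rfl⟩ := hxx
    have hcont : Filter.Tendsto (fun n => mo A (z' (ψ n))) Filter.atTop (𝓝 (mo A x)) :=
      (mo_diff hA.pos hx).continuousAt.tendsto.comp hzl2
    obtain ⟨V, hV, hinj⟩ := local_inj (yf_an hx').hasStrictDerivAt (thy_ne hx' (by rw [yx']; exact hc1))
    obtain ⟨n, hn1, hn2⟩ := ((hcont.eventually hV).and (hwl.eventually hV)).exists
    refine hEn n ⟨A, hA, hinj hn1 hn2 ?_⟩
    rw [yf_inv hA (hzu _), ey]
  · exact ⟨x, x', hx, hx', hxx, yx, yx'⟩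

lemma Bset_bdd : ∃ R : ℝ, ∀ c ∈ Bset, ‖c‖ ≤ R := by
  obtain ⟨Y, hY, hinj⟩ := inj_cusp
  -- on the compact part of the Siegel set everything is bounded
  have b1 : ∃ M, ∀ u ∈ Box Y, ‖yf u‖ ≤ M := by
    have hcont : ContinuousOn yf (Box Y) := fun u hu => (yf_diff (Box_up hu)).continuousAt.continuousWithinAt
    exact (Box_compact Y).exists_bound_of_continuousOn hcont
  obtain ⟨M, hM⟩ := b1
  have b2 : ∃ M, ∀ u : ℂ, 1 / 10 ≤ u.im → |u.re| ≤ 1 / 2 → ‖yf (mo Wm u)‖ ≤ M := by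
    obtain ⟨Y', hY', h'⟩ := y_large 1
    have hcont : ContinuousOn (fun u => yf (mo Wm u)) (Box Y') := fun u hu =>
      (((yf_diff (W_up (Box_up hu))).continuousAt).comp (cont_W (Box_up hu))).continuousWithinAt
    obtain ⟨M', hM'⟩ := (Box_compact Y').exists_bound_of_continuousOn hcont
    refine ⟨max M' 125, fun u hu hur => ?_⟩
    have hu0 : 0 < u.im := by linarith
    have hur' := abs_le.mp hur
    rcases le_total u.im Y' with hle | hle
    · exact (hM' u ⟨⟨by linarith, by linarith⟩, ⟨hu, hle⟩⟩).trans (le_max_left _ _)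
    · rw [yf_W' hu0, norm_div]
      have := h' u hle
      have e : ‖(125:ℂ)‖ = 125 := by norm_num
      rw [e]
      refine le_trans ?_ (le_max_right _ _)
      rw [div_le_iff₀ (by linarith)]; linarith
  obtain ⟨M', hM'⟩ := b2
  refine ⟨max M M', ?_⟩
  rintro c ⟨z, w, hz, hw, hE, rfl, hyw⟩
  by_contra hcon
  push Not at hcon
  have hc1 := (le_max_left _ _).trans_lt hcon
  have hc2 := (le_max_right _ _).trans_lt hcon
  have key : ∀ x : ℂ, 0 < x.im → yf x = yf z → ∃ u, Y ≤ u.im ∧ Eq5 x u := by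
    intro x hx hxz
    obtain ⟨u, hu, hur, h⟩ := red5 hx
    have hur' := abs_le.mp hur
    rcases h with h | h
    · refine ⟨u, ?_, h⟩
      by_contra hlt
      push Not at hlt
      have := hM u ⟨⟨by linarith, by linarith⟩, ⟨hu, hlt.le⟩⟩
      rw [h.y hx, hxz] at this
      linarith
    · have := hM' u hu hur
      rw [h.y hx, hxz] at this
      linarith
  obtain ⟨u, hu, hEu⟩ := key z hz rfl
  obtain ⟨v, hv, hEv⟩ := key w hw hyw
  obtain ⟨k, hk⟩ := hinj u v hu hv (by rw [hEu.y hz, hEv.y hw, hyw])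
  apply hE
  refine (hEu.trans hz ?_).trans hz (hEv.symm hw)
  refine Eq5.symm (by linarith) ⟨Tm k, G5_T k, by rw [mo_T, hk]⟩

lemma Bset_empty : Bset = ∅ := by
  have hcnt : Exc.Countable := Exc_fin.countable
  have hconn : IsPreconnected Excᶜ :=
    (hcnt.isConnected_compl_of_one_lt_rank (by rw [Complex.rank_real_complex]; norm_num)).isPreconnected
  have h1 : Bset ⊆ Exc := by
    intro c hc
    by_contra hcE
    have hcl : Excᶜ ∩ closure Bset ⊆ Bset := fun x hx => Bset_closed hx.1 hx.2
    have hsub : Excᶜ ⊆ Bset := by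
      refine hconn.subset_of_closure_inter_subset Bset_open ⟨c, hcE, hc⟩ ?_
      intro x hx
      exact hcl ⟨hx.2, hx.1⟩
    obtain ⟨R, hR⟩ := Bset_bdd
    have hx : ((|R| + 1 : ℝ) : ℂ) ∈ Excᶜ := by
      intro hx
      rw [Exc_iff] at hx
      rcases hx with hx | hx
      · have : (|R| + 1 : ℝ) = 0 := by exact_mod_cast hx
        have := abs_nonneg R
        linarith
      · have : (|R| + 1 : ℝ) ^ 2 + 22 * (|R| + 1 : ℝ) + 125 = 0 := by exact_mod_cast hx
        have := abs_nonneg R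
        nlinarith
    have := hR _ (hsub hx)
    rw [Complex.norm_real, Real.norm_of_nonneg (by positivity)] at this
    have := le_abs_self R
    linarith
  by_contra hne
  obtain ⟨c, hc⟩ := Set.nonempty_iff_ne_empty.mpr hne
  have : Exc ∈ 𝓝 c := Filter.mem_of_superset (Bset_open.mem_nhds hc) h1
  exact (infinite_of_mem_nhds c this) Exc_fin

/-- `y` separates `Γ₀(5)`-orbits -/
lemma y_inj {z w : ℂ} (hz : 0 < z.im) (hw : 0 < w.im) (h : yf z = yf w) : Eq5 z w := by
  by_contra hE
  have : yf z ∈ Bset := ⟨z, w, hz, hw, hE, rfl, h.symm⟩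
  rw [Bset_empty] at this
  exact this

/-- `y` takes every nonzero value -/
lemma y_surj {c : ℂ} (hc : c ≠ 0) : ∃ z : ℂ, 0 < z.im ∧ yf z = c := by
  by_contra hcon
  push Not at hcon
  have hne : ∀ z : ℂ, 0 < z.im → yf z - c ≠ 0 := fun z hz h => hcon z hz (sub_eq_zero.mp h)
  have hB : ∀ (f : ℂ → ℂ) (L δ : ℝ), 0 < δ → (∃ Y : ℝ, ∀ z : ℂ, Y ≤ z.im → δ ≤ ‖f z - c‖) → BI (fun z => (f z - c)⁻¹) := by
    rintro f L δ hδ ⟨Y, hY⟩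
    refine ⟨δ⁻¹, Y, fun z hz _ => ?_⟩
    rw [norm_inv]
    exact inv_anti₀ hδ (hY z hz)
  have hpos : 0 < ‖c‖ := norm_pos_iff.mpr hc
  have key : ∀ z w : ℂ, 0 < z.im → 0 < w.im → (yf z - c)⁻¹ = (yf w - c)⁻¹ := fun z w hz hw => liouville5 (h := fun z => (yf z - c)⁻¹)
    (fun z hz => ((yf_diff hz).sub_const c).inv (hne z hz))
    (fun A hA z hz => by simp only [yf_inv hA hz])
    (hB _ 0 1 one_pos (by
      obtain ⟨Y, -, h⟩ := y_large (‖c‖ + 1)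
      refine ⟨Y, fun z hz => ?_⟩
      have := h z hz
      have := norm_sub_norm_le (yf z) c
      linarith))
    (hB (fun z => yf (mo Wm z)) 0 (‖c‖ / 2) (by linarith) (by
      obtain ⟨Y, hY, h⟩ := y_large (250 / ‖c‖)
      refine ⟨Y, fun z hz => ?_⟩
      have h1 := h z hz
      have h3 : 0 < ‖yf z‖ := lt_of_lt_of_le (by positivity) h1
      have h2 := norm_sub_norm_le c (yf (mo Wm z))
      rw [norm_sub_rev] at h2
      refine le_trans ?_ h2
      rw [yf_W' (by linarith : 0 < z.im), norm_div]
      have e : ‖(125:ℂ)‖ = 125 := by norm_num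
      rw [e]
      have h4 : 125 / ‖yf z‖ ≤ ‖c‖ / 2 := by
        rw [div_le_iff₀ hpos] at h1
        rw [div_le_iff₀ h3]
        linarith
      linarith)) hz hw
  obtain ⟨Y, hY, h⟩ := y_large (‖yf z5‖ + 1)
  have h1 : (Y * I).im = Y := by simp
  have h2 := key (Y * I) z5 (by rw [h1]; exact hY) z5_up
  have h3 : yf (Y * I) = yf z5 := by
    have := inv_injective h2
    linear_combination this
  have := h (Y * I) h1.ge
  rw [h3] at this
  linarith
end

section
open Complex PowerSeries
open UpperHalfPlane hiding I
open scoped MatrixGroups ModularForm Topology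

/-- the inverse of the `q`-product -/
noncomputable def epI : ℤ⟦X⟧ := invOfUnit epZ 1

lemma epI_mul : epZ * epI = 1 := mul_invOfUnit _ _ (by simp [epZ_const])

lemma epI_const : constantCoeff epI = 1 := const_inv

lemma epI_rep : QR (zc epI) (fun z => (ep (qf z))⁻¹) := by
  rw [epI, zc_inv epZ_const]
  exact (epZ_rep.inv fun z hz => ep_ne_zero hz).toQ

/-- the modular invariant -/
noncomputable def jf (z : ℂ) : ℂ := E4f z ^ 3 / DC z

/-- the series of `q * j` -/
noncomputable def JZ : ℤ⟦X⟧ := E4Z ^ 3 * epI ^ 24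

lemma JZ_const : constantCoeff JZ = 1 := by
  simp [JZ, E4Z_0, epI_const]

lemma epq_ne {z : ℂ} (hz : 0 < z.im) : ep (qf z) ≠ 0 := ep_ne_zero (qf_lt hz)

lemma JZ_rep : QR (zc JZ) (fun z => jf z * qf z) := by
  rw [JZ, map_mul, map_pow, map_pow]
  refine ((E4Z_rep.pow 3).mul (epI_rep.pow 24)).congr fun z hz => ?_
  have h1 := qf_ne z
  have h2 := epq_ne hz
  rw [jf, DC]
  field_simp

lemma jf_diff {z : ℂ} (hz : 0 < z.im) : DifferentiableAt ℂ jf z :=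
  ((E4f_diff hz).pow 3).div (DC_diff hz) (DC_ne hz)

lemma jf_inv {A : M2} (hA : A.det = 1) {z : ℂ} (hz : 0 < z.im) : jf (mo A z) = jf z := by
  have h1 : dn A z ≠ 0 := dn_ne (by omega) hz
  have h2 := DC_ne hz
  rw [jf, E4f_mo hA hz, DC_mo hA hz, jf]
  field_simp

/-- holomorphic functions invariant under the full modular group -/
def S1 (h : ℂ → ℂ) : Prop := (∀ z, 0 < z.im → DifferentiableAt ℂ h z) ∧
  (∀ A : M2, A.det = 1 → ∀ z, 0 < z.im → h (mo A z) = h z)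

lemma poly1 {h : ℂ → ℂ} (hS : S1 h) {a : ℕ} (hb : BI (fun z => h z * qf z ^ a)) :
    ∃ P : Polynomial ℂ, P.natDegree ≤ a ∧ ∀ z : ℂ, 0 < z.im → h z = P.eval (jf z) := by
  refine poly_of jf JZ_rep (by rw [zc_const, JZ_const]; norm_num) S1 ?_ ?_ ?_ ?_ a h hS hb
  · intro h hS c a
    refine ⟨fun z hz => (hS.1 z hz).sub (((jf_diff hz).pow a).const_mul c), fun A hA z hz => ?_⟩
    simp only [hS.2 A hA z hz, jf_inv hA hz]
  · intro h hS hb z w hz hw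
    exact liouville1 hS.1 hS.2 hb hz hw
  · intro h hS; exact hS.1
  · intro h hS z hz
    have := hS.2 (Tm 1) (Tm_det 1) z hz
    rwa [mo_T, Int.cast_one] at this

lemma jf_five {z : ℂ} (hz : 0 < z.im) : jf (5 * z) * yf z = (yf z ^ 2 + 10 * yf z + 5) ^ 3 := by
  have h1 := E4_five hz
  have h2 := gf_pow hz
  have h3 := DC_ne (up5 hz)
  have h4 := yf_ne hz
  have h5 : E4f (5 * z) ^ 3 * yf z ^ 6 = gf z ^ 3 * (yf z ^ 2 + 10 * yf z + 5) ^ 3 := by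
    linear_combination (E4f (5 * z) ^ 2 * yf z ^ 4 + E4f (5 * z) * yf z ^ 2 * (gf z * (yf z ^ 2 + 10 * yf z + 5)) + (gf z * (yf z ^ 2 + 10 * yf z + 5)) ^ 2) * h1
  rw [h2] at h5
  rw [jf]
  generalize E4f (5 * z) = a at *
  generalize DC (5 * z) = d at *
  generalize yf z = y at *
  have : a ^ 3 * y = d * (y ^ 2 + 10 * y + 5) ^ 3 := by
    have : y ^ 5 * (a ^ 3 * y) = y ^ 5 * (d * (y ^ 2 + 10 * y + 5) ^ 3) := by linear_combination h5
    exact mul_left_cancel₀ (pow_ne_zero 5 h4) this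
  rw [div_mul_eq_mul_div, this, mul_div_cancel_left₀ _ h3]
end

section
open Complex PowerSeries
open UpperHalfPlane hiding I
open scoped MatrixGroups ModularForm Topology

/-- representatives of integral matrices of determinant `l` -/
def Hm (l : ℕ) : Option (Fin l) → M2
  | none => !![(l : ℤ), 0; 0, 1]
  | some b => !![1, ((b : ℕ) : ℤ); 0, (l : ℤ)]

lemma Hm_det (l : ℕ) (i : Option (Fin l)) : (Hm l i).det = l := by
  cases i <;> simp [Hm, Matrix.det_fin_two]

lemma Hm_10 (l : ℕ) (i : Option (Fin l)) : Hm l i 1 0 = 0 := by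
  cases i <;> simp [Hm]

lemma ext2 {A B : M2} (h1 : A 0 0 = B 0 0) (h2 : A 0 1 = B 0 1) (h3 : A 1 0 = B 1 0) (h4 : A 1 1 = B 1 1) :
    A = B := by
  ext i j; fin_cases i <;> fin_cases j <;> assumption

lemma hecke_rep {l : ℕ} (hl : l.Prime) {B : M2} (hB : B.det = l) :
    ∃ (γ : M2) (i : Option (Fin l)), γ.det = 1 ∧ B = γ * Hm l i := by
  have hl0 : (l : ℤ) ≠ 0 := by exact_mod_cast hl.ne_zero
  have hp : Prime (l : ℤ) := Nat.prime_iff_prime_int.mp hl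
  have hd := hB
  rw [Matrix.det_fin_two] at hd
  have key : ∃ (γ : M2) (i : Option (Fin l)), B = γ * Hm l i := by
    by_cases h : (l : ℤ) ∣ B 0 0 ∧ (l : ℤ) ∣ B 1 0
    · obtain ⟨⟨a, ha⟩, ⟨c, hc⟩⟩ := h
      refine ⟨!![a, B 0 1; c, B 1 1], none, ext2 ?_ ?_ ?_ ?_⟩ <;>
        simp [Hm, Matrix.mul_apply, Fin.sum_univ_two, ha, hc, mul_comm]
    · have hb : ∃ b : ℤ, (l : ℤ) ∣ B 0 1 - b * B 0 0 ∧ (l : ℤ) ∣ B 1 1 - b * B 1 0 := by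
        by_cases h0 : (l : ℤ) ∣ B 0 0
        · have h1 : ¬ (l : ℤ) ∣ B 1 0 := fun h1 => h ⟨h0, h1⟩
          obtain ⟨u, v, huv⟩ := (hp.coprime_iff_not_dvd.mpr h1 : IsCoprime (l : ℤ) (B 1 0))
          refine ⟨v * B 1 1, ?_, ⟨u * B 1 1, by linear_combination -(B 1 1) * huv⟩⟩
          refine (hp.dvd_or_dvd (a := B 1 0) ?_).resolve_left h1
          refine ⟨-1 + B 0 0 * B 1 1 * u, ?_⟩
          linear_combination -hd - B 0 0 * B 1 1 * huv
        · obtain ⟨u, v, huv⟩ := (hp.coprime_iff_not_dvd.mpr h0 : IsCoprime (l : ℤ) (B 0 0))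
          refine ⟨v * B 0 1, ⟨u * B 0 1, by linear_combination -(B 0 1) * huv⟩, ?_⟩
          refine (hp.dvd_or_dvd (a := B 0 0) ?_).resolve_left h0
          refine ⟨1 + B 1 0 * B 0 1 * u, ?_⟩
          linear_combination hd - B 1 0 * B 0 1 * huv
      obtain ⟨b, h1, h2⟩ := hb
      have hm := Int.emod_add_mul_ediv b l
      have hm0 := Int.emod_nonneg b hl0
      have hml := Int.emod_lt_of_pos b (by positivity : (0:ℤ) < l)
      obtain ⟨m, hm'⟩ := Int.eq_ofNat_of_zero_le hm0
      have hlt : m < l := by have : (m : ℤ) < l := by rw [← hm']; exact hml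
                             exact_mod_cast this
      obtain ⟨x, hx⟩ := h1
      obtain ⟨y, hy⟩ := h2
      rw [hm'] at hm
      refine ⟨!![B 0 0, x + (b / l) * B 0 0; B 1 0, y + (b / l) * B 1 0], some ⟨m, hlt⟩, ext2 ?_ ?_ ?_ ?_⟩ <;>
        simp [Hm, Matrix.mul_apply, Fin.sum_univ_two]
      · linear_combination hx - B 0 0 * hm
      · linear_combination hy - B 1 0 * hm
  obtain ⟨γ, i, e⟩ := key
  refine ⟨γ, i, ?_, e⟩
  have := congrArg Matrix.det e
  rw [Matrix.det_mul, hB, Hm_det] at this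
  exact mul_right_cancel₀ hl0 (by rw [← this, one_mul])

lemma hecke_uniq {l : ℕ} (hl : l.Prime) {γ : M2} {i j : Option (Fin l)}
    (h : Hm l i = γ * Hm l j) : i = j := by
  have hl1 : ∀ x : ℤ, (l : ℤ) * x ≠ 1 := fun x hx => by
    have : (l : ℤ) ∣ 1 := ⟨x, hx.symm⟩
    exact hl.one_lt.ne' (by exact_mod_cast Int.eq_one_of_dvd_one (by positivity) this)
  have h00 := congrFun (congrFun h 0) 0
  have h01 := congrFun (congrFun h 0) 1
  have h10 := congrFun (congrFun h 1) 0
  have h11 := congrFun (congrFun h 1) 1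
  rcases i with _ | b <;> rcases j with _ | b' <;>
    simp [Hm, Matrix.mul_apply, Fin.sum_univ_two] at h00 h01 h10 h11
  · rfl
  · rw [← h10] at h11; exact absurd (by linarith) (hl1 (γ 1 1))
  · exact absurd (by linarith) (hl1 (γ 0 0))
  · rw [← h00] at h01
    have hb := b.2
    have hb' := b'.2
    have : ((b : ℕ) : ℤ) % l = ((b' : ℕ) : ℤ) % l := by
      rw [h01, one_mul, mul_comm (γ 0 1), Int.add_mul_emod_self_left]
    rw [Int.emod_eq_of_lt (by positivity) (by exact_mod_cast hb), Int.emod_eq_of_lt (by positivity) (by exact_mod_cast hb')] at this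
    have : (b : ℕ) = b' := by exact_mod_cast this
    rw [Fin.ext this]

lemma hecke_perm {l : ℕ} (hl : l.Prime) (B : Option (Fin l) → M2) (hB : ∀ i, (B i).det = l)
    (hinj : ∀ i j γ, γ.det = 1 → B i = γ * B j → i = j) :
    ∃ σ : Equiv.Perm (Option (Fin l)), ∀ i, ∃ γ : M2, γ.det = 1 ∧ B i = γ * Hm l (σ i) := by
  choose γ σ h1 h2 using fun i => hecke_rep hl (hB i)
  have hσ : Function.Injective σ := by
    intro i j hij
    refine hinj i j (γ i * (γ j).adjugate) ?_ ?_
    · rw [Matrix.det_mul, Matrix.det_adjugate, h1, h1]; simp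
    · rw [h2 i, h2 j, hij, mul_assoc, ← mul_assoc (γ j).adjugate, Matrix.adjugate_mul, h1]; simp
  exact ⟨Equiv.ofBijective σ (Finite.injective_iff_bijective.mp hσ), fun i => ⟨γ i, h1 i, h2 i⟩⟩

lemma five_of {l : ℕ} (hl : l.Prime) (h5 : l ≠ 5) {B γ : M2} {i : Option (Fin l)} (hB : 5 ∣ B 1 0)
    (e : B = γ * Hm l i) : 5 ∣ γ 1 0 := by
  rw [e] at hB
  have hc : IsCoprime (5 : ℤ) (l : ℤ) := by
    rw [Int.isCoprime_iff_gcd_eq_one]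
    have : Nat.Coprime 5 l := (Nat.coprime_primes (by norm_num) hl).mpr (Ne.symm h5)
    exact_mod_cast this
  rcases i with _ | b <;> simp [Hm, Matrix.mul_apply, Fin.sum_univ_two] at hB
  · exact hc.dvd_of_dvd_mul_right hB
  · exact hB

lemma hecke_right {l : ℕ} (hl : l.Prime) {δ : M2} (hδ : δ.det = 1) :
    ∃ σ : Equiv.Perm (Option (Fin l)), ∀ i, ∃ γ : M2, γ.det = 1 ∧ Hm l i * δ = γ * Hm l (σ i) := by
  refine hecke_perm hl (fun i => Hm l i * δ) (fun i => by rw [Matrix.det_mul, hδ, Hm_det, mul_one]) ?_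
  intro i j γ _ e
  refine hecke_uniq hl (γ := γ) ?_
  have := congrArg (· * δ.adjugate) e
  simpa [mul_assoc, Matrix.mul_adjugate, hδ] using this

/-- conjugation by the Fricke matrix -/
def wj (A : M2) : M2 := !![A 1 1, -(A 1 0 / 5); -5 * A 0 1, A 0 0]

lemma wj_mul {A : M2} (h : 5 ∣ A 1 0) : Wm * wj A = A * Wm := by
  obtain ⟨c, hc⟩ := h
  apply ext2 <;> simp [wj, Wm, Matrix.mul_apply, Fin.sum_univ_two, hc, mul_comm]

lemma wj_det {A : M2} (h : 5 ∣ A 1 0) : (wj A).det = A.det := by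
  obtain ⟨c, hc⟩ := h
  simp [wj, Matrix.det_fin_two, hc]; ring

lemma hecke_W {l : ℕ} (hl : l.Prime) (hl5 : l ≠ 5) :
    ∃ σ : Equiv.Perm (Option (Fin l)), ∀ i, ∃ γ : M2, γ.det = 1 ∧ wj (Hm l i) = γ * Hm l (σ i) := by
  have h5 : ∀ i, (5 : ℤ) ∣ Hm l i 1 0 := fun i => by rw [Hm_10]; exact dvd_zero _
  refine hecke_perm hl (fun i => wj (Hm l i)) (fun i => by rw [wj_det (h5 i), Hm_det]) ?_
  have hl0 : (l : ℤ) ≠ 0 := by exact_mod_cast hl.ne_zero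
  have hl1 : ∀ x : ℤ, (l : ℤ) * x ≠ 1 := fun x hx => by
    have : (l : ℤ) ∣ 1 := ⟨x, hx.symm⟩
    exact hl.one_lt.ne' (by exact_mod_cast Int.eq_one_of_dvd_one (by positivity) this)
  intro i j γ _ h
  have h00 := congrFun (congrFun h 0) 0
  have h01 := congrFun (congrFun h 0) 1
  have h10 := congrFun (congrFun h 1) 0
  have h11 := congrFun (congrFun h 1) 1
  have h01' : γ 0 1 * Hm l j 0 0 = 0 := by
    simpa [wj, Hm_10, Matrix.mul_apply, Fin.sum_univ_two] using h01.symm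
  have h01'' : γ 0 1 = 0 := by
    rcases mul_eq_zero.mp h01' with h | h
    · exact h
    · rcases j with _ | b
      · exact absurd h (by simpa [Hm] using hl.ne_zero)
      · simp [Hm] at h
  refine hecke_uniq hl (γ := !![γ 1 1, -(γ 1 0 / 5); 0, γ 0 0]) ?_
  have e00 : Hm l i 1 1 = γ 0 0 * Hm l j 1 1 := by
    simpa [wj, h01'', Matrix.mul_apply, Fin.sum_univ_two] using h00
  have e11 : Hm l i 0 0 = γ 1 1 * Hm l j 0 0 := by
    simpa [wj, Hm_10, Matrix.mul_apply, Fin.sum_univ_two] using h11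
  have e10 : -5 * Hm l i 0 1 = γ 1 0 * Hm l j 1 1 + γ 1 1 * (-5 * Hm l j 0 1) := by
    simpa [wj, Matrix.mul_apply, Fin.sum_univ_two] using h10
  have h5g : (5 : ℤ) ∣ γ 1 0 := by
    have hd : (5 : ℤ) ∣ γ 1 0 * Hm l j 1 1 :=
      ⟨-Hm l i 0 1 + γ 1 1 * Hm l j 0 1, by linear_combination -e10⟩
    have hc : IsCoprime (5 : ℤ) (l : ℤ) := by
      rw [Int.isCoprime_iff_gcd_eq_one]
      have : Nat.Coprime 5 l := (Nat.coprime_primes (by norm_num) hl).mpr (Ne.symm hl5)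
      exact_mod_cast this
    rcases j with _ | b <;> simp [Hm] at hd
    · exact hd
    · exact hc.dvd_of_dvd_mul_right hd
  obtain ⟨c, hc⟩ := h5g
  rw [hc] at e10
  apply ext2 <;> simp [Matrix.mul_apply, Fin.sum_univ_two, Hm_10, hc]
  · exact e11
  · linarith
  · exact e00
end

section
open Complex PowerSeries
open UpperHalfPlane hiding I
open scoped MatrixGroups ModularForm Topology

/-- the homogenised substitution of the series `J / X` in a polynomial -/
noncomputable def hmg {R : Type*} [CommRing R] (n : ℕ) (f : Polynomial R) (J : R⟦X⟧) : R⟦X⟧ :=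
  ∑ i ∈ Finset.range (n + 1), C (f.coeff i) * J ^ i * X ^ (n - i)

lemma hmg_map {R S : Type*} [CommRing R] [CommRing S] (φ : R →+* S) (n : ℕ) (f : Polynomial R) (J : R⟦X⟧) :
    PowerSeries.map φ (hmg n f J) = hmg n (f.map φ) (PowerSeries.map φ J) := by
  simp only [hmg, map_sum, map_mul, map_pow, PowerSeries.map_C, PowerSeries.map_X, Polynomial.coeff_map]

lemma hmg_sub {R : Type*} [CommRing R] (n : ℕ) (f g : Polynomial R) (J : R⟦X⟧) :
    hmg n (f - g) J = hmg n f J - hmg n g J := by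
  simp only [hmg, Polynomial.coeff_sub, map_sub, sub_mul, Finset.sum_sub_distrib]

/-- triangularity -/
lemma tri {A R : Type*} [CommRing A] [CommRing R] [Algebra A R] (N : Submodule A R) {J : A⟦X⟧}
    (hJ : constantCoeff J = 1) {n : ℕ} {f : Polynomial R}
    (h : ∀ m ≤ n, coeff m (hmg n f (PowerSeries.map (algebraMap A R) J)) ∈ N) :
    ∀ i ≤ n, f.coeff i ∈ N := by
  have key : ∀ m ≤ n, f.coeff (n - m) ∈ N := by
    intro m
    induction m using Nat.strong_induction_on with
    | _ m ih =>
      intro hm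
      have h1 := h m hm
      rw [hmg, map_sum, ← Finset.add_sum_erase _ _ (Finset.mem_range.mpr (by omega : n - m < n + 1))] at h1
      have h2 : coeff m (C (f.coeff (n - m)) * (PowerSeries.map (algebraMap A R) J) ^ (n - m) * X ^ (n - (n - m))) = f.coeff (n - m) := by
        rw [show n - (n - m) = m by omega, coeff_mul_X_pow', if_pos le_rfl, Nat.sub_self, coeff_C_mul,
          coeff_zero_eq_constantCoeff_apply, map_pow, ← coeff_zero_eq_constantCoeff_apply, coeff_map,
          coeff_zero_eq_constantCoeff_apply, hJ]
        simp
      rw [h2] at h1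
      refine (Submodule.add_mem_iff_left N ?_).mp h1
      refine Submodule.sum_mem _ fun i hi => ?_
      rw [Finset.mem_erase, Finset.mem_range] at hi
      rw [coeff_mul_X_pow']
      split_ifs with hle
      · rw [coeff_C_mul, ← map_pow, coeff_map, mul_comm, ← Algebra.smul_def]
        refine N.smul_mem _ ?_
        have := ih (n - i) (by omega) (by omega)
        rwa [show n - (n - i) = i by omega] at this
      · exact N.zero_mem
  intro i hi
  have := key (n - i) (by omega)
  rwa [show n - (n - i) = i by omega] at this

lemma tri_inj {R : Type*} [CommRing R] {J : R⟦X⟧} (hJ : constantCoeff J = 1) {n : ℕ} {f g : Polynomial R}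
    (hf : f.natDegree ≤ n) (hg : g.natDegree ≤ n)
    (h : ∀ m ≤ n, coeff m (hmg n f J) = coeff m (hmg n g J)) : f = g := by
  have h1 := tri (A := R) (⊥ : Submodule R R) hJ (n := n) (f := f - g) (fun m hm => by
    have e : PowerSeries.map (algebraMap R R) J = J := by
      rw [Algebra.algebraMap_self]; rfl
    rw [e, hmg_sub, map_sub, h m hm, sub_self]; exact Submodule.zero_mem _)
  ext i
  by_cases hi : i ≤ n
  · have := h1 i hi
    rw [Submodule.mem_bot, Polynomial.coeff_sub, sub_eq_zero] at this
    exact this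
  · rw [Polynomial.coeff_eq_zero_of_natDegree_lt (by omega), Polynomial.coeff_eq_zero_of_natDegree_lt (by omega)]

lemma hmg_rep {y : ℂ → ℂ} {p : ℂ⟦X⟧} (hy : QR p (fun z => y z * qf z)) {n : ℕ} {f : Polynomial ℂ}
    (hf : f.natDegree ≤ n) : QR (hmg n f p) (fun z => f.eval (y z) * qf z ^ n) := by
  refine (QR.sum (Finset.range (n + 1)) fun i _ =>
    ((QR.const (f.coeff i)).mul (hy.pow i)).mul (QR.X.pow (n - i))).congr fun z hz => ?_
  rw [Polynomial.eval_eq_sum_range' (Nat.lt_succ_of_le hf), Finset.sum_mul]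
  refine Finset.sum_congr rfl fun i hi => ?_
  rw [Finset.mem_range] at hi
  rw [mul_pow]
  have : qf z ^ n = qf z ^ i * qf z ^ (n - i) := by rw [← pow_add]; congr 1; omega
  rw [this]; ring

lemma expand_inj {R : Type*} [CommRing R] {l : ℕ} (hl : l ≠ 0) {p q : R⟦X⟧}
    (h : PowerSeries.expand l hl p = PowerSeries.expand l hl q) : p = q := by
  ext m
  have := congrArg (coeff (l * m)) h
  rwa [PowerSeries.coeff_expand_mul, PowerSeries.coeff_expand_mul] at this

/-- algebraic integers -/
abbrev OO : Subalgebra ℤ ℂ := integralClosure ℤ ℂ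

noncomputable abbrev oc : OO⟦X⟧ →+* ℂ⟦X⟧ := PowerSeries.map (algebraMap OO ℂ)

lemma oc_zo (p : ℤ⟦X⟧) : oc (PowerSeries.map (Int.castRingHom OO) p) = zc p := by
  ext m
  simp

lemma red_poly {y : ℂ → ℂ} {J : ℤ⟦X⟧} (hJ : constantCoeff J = 1) (hy : QR (zc J) (fun z => y z * qf z))
    {n l : ℕ} (hl : l ≠ 0) {f : Polynomial ℂ} (hf : f.natDegree ≤ n) {S : OO⟦X⟧}
    (hS : QR (oc S) (fun z => f.eval (y (l * z)) * qf z ^ (l * n))) :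
    ∃ F : Polynomial OO, F.map (algebraMap OO ℂ) = f ∧ F.natDegree ≤ n ∧
      PowerSeries.expand l hl (hmg n F (PowerSeries.map (Int.castRingHom OO) J)) = S := by
  have h1 := (hmg_rep hy hf).expand hl
  have h2 : PowerSeries.expand l hl (hmg n f (zc J)) = oc S := by
    refine h1.unique hS fun z hz => ?_
    rw [qf_nat, ← pow_mul]
  have hJ' : constantCoeff (PowerSeries.map (Int.castRingHom OO) J) = 1 := by
    rw [← coeff_zero_eq_constantCoeff_apply, coeff_map, coeff_zero_eq_constantCoeff_apply, hJ]; simp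
  have h3 := tri (A := OO) (Subalgebra.toSubmodule (⊥ : Subalgebra OO ℂ)) hJ' (n := n) (f := f) (fun m _ => by
    have e : PowerSeries.map (algebraMap OO ℂ) (PowerSeries.map (Int.castRingHom OO) J) = zc J := oc_zo J
    rw [e, ← PowerSeries.coeff_expand_mul l hl, h2, coeff_map]
    exact ⟨_, rfl⟩)
  have h4 : ∀ i, ∃ c : OO, algebraMap OO ℂ c = f.coeff i := by
    intro i
    by_cases hi : i ≤ n
    · exact h3 i hi
    · exact ⟨0, by rw [Polynomial.coeff_eq_zero_of_natDegree_lt (by omega), map_zero]⟩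
  have h5 : f ∈ Polynomial.lifts (algebraMap OO ℂ) := by
    rw [Polynomial.lifts_iff_coeff_lifts]; exact h4
  have hinj : Function.Injective (algebraMap OO ℂ) := Subtype.val_injective
  obtain ⟨F, hF⟩ := (Polynomial.mem_lifts f).mp h5
  refine ⟨F, hF, ?_, ?_⟩
  · rw [← Polynomial.natDegree_map_eq_of_injective hinj, hF]; exact hf
  · apply PowerSeries.map_injective _ hinj
    show oc _ = oc _
    rw [← h2, PowerSeries.map_expand, hmg_map, hF]
    congr 2
end

section
open Complex PowerSeries
open UpperHalfPlane hiding I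
open scoped MatrixGroups ModularForm Topology

noncomputable abbrev zk (k : Type*) [CommRing k] : ℤ⟦X⟧ →+* k⟦X⟧ := PowerSeries.map (Int.castRingHom k)

lemma expand_char {k : Type*} [CommRing k] {l : ℕ} [ExpChar k l] (hl : l ≠ 0) (p : ℤ⟦X⟧) :
    PowerSeries.expand l hl (zk k p) = zk k p ^ l := by
  have h := MvPowerSeries.map_frobenius_expand l hl (f := (zk k p : MvPowerSeries Unit k))
  have h2 : PowerSeries.map (frobenius k l) (PowerSeries.expand l hl (zk k p)) = zk k p ^ l := h
  rw [← h2]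
  ext m
  rw [coeff_map, PowerSeries.coeff_expand]
  split_ifs with h
  · rw [coeff_map, eq_intCast, map_intCast]
  · simp

/-- the root of unity used for the Hecke translates -/
noncomputable def zl (l : ℕ) : ℂ := qf ((1 / l : ℝ) : ℂ)

lemma zl_pow {l : ℕ} (hl : l ≠ 0) : zl l ^ l = 1 := by
  have hl' : (l : ℂ) ≠ 0 := by exact_mod_cast hl
  rw [zl, ← qf_nat]
  have : (l : ℂ) * ((1 / l : ℝ) : ℂ) = ((1 : ℤ) : ℂ) := by push_cast; field_simp
  rw [this, qf_int]

lemma zl_b (l b : ℕ) : qf ((b / l : ℝ) : ℂ) = zl l ^ b := by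
  rw [zl, ← qf_nat]; congr 1; push_cast; ring

lemma zl_int {l : ℕ} (hl : l ≠ 0) : IsIntegral ℤ (zl l) :=
  IsIntegral.of_pow (n := l) (Nat.pos_of_ne_zero hl) (by rw [zl_pow hl]; exact isIntegral_one)

noncomputable def zO {l : ℕ} (hl : l ≠ 0) : OO := ⟨zl l, zl_int hl⟩

lemma zO_pow {l : ℕ} (hl : l ≠ 0) : zO hl ^ l = 1 := Subtype.ext (zl_pow hl)

lemma zO_red {k : Type*} [CommRing k] [IsReduced k] {l : ℕ} (hl : l ≠ 0) [ExpChar k l] (φ : OO →+* k) : φ (zO hl) = 1 := by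
  have h : (φ (zO hl)) ^ l = 1 := by rw [← map_pow, zO_pow, map_one]
  have h2 : (φ (zO hl) - 1) ^ l = 0 := by rw [sub_pow_expChar, h]; simp
  exact sub_eq_zero.mp (pow_eq_zero_iff hl |>.mp h2)

noncomputable abbrev zo : ℤ⟦X⟧ →+* OO⟦X⟧ := zk OO

lemma map_zo {k : Type*} [CommRing k] (φ : OO →+* k) (p : ℤ⟦X⟧) : PowerSeries.map φ (zo p) = zk k p := by
  ext m; simp

lemma map_resc {k : Type*} [CommRing k] [IsReduced k] {l : ℕ} (hl : l ≠ 0) [ExpChar k l] (φ : OO →+* k) (b : ℕ) (p : ℤ⟦X⟧) :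
    PowerSeries.map φ (rescale (zO hl ^ b) (zo p)) = zk k p := by
  rw [← rescale_map, map_pow, zO_red, one_pow, rescale_one, map_zo]; rfl

lemma oc_resc {l : ℕ} (hl : l ≠ 0) (b : ℕ) (p : ℤ⟦X⟧) :
    oc (rescale (zO hl ^ b) (zo p)) = rescale (qf ((b / l : ℝ) : ℂ)) (zc p) := by
  rw [← rescale_map, map_pow, zl_b, map_zo]; rfl

lemma oc_exp {l : ℕ} (hl : l ≠ 0) (p : ℤ⟦X⟧) :
    oc (PowerSeries.expand l hl (zo p)) = PowerSeries.expand l hl (zc p) := by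
  rw [PowerSeries.map_expand, oc_zo]

lemma mo_none {l : ℕ} (z : ℂ) : mo (Hm l none) z = l * z := by simp [mo, Hm]
lemma mo_some {l : ℕ} (b : Fin l) (z : ℂ) : mo (Hm l (some b)) z = (z + b) / l := by simp [mo, Hm]
lemma mo_some' {l : ℕ} (hl : l ≠ 0) (b : Fin l) (z : ℂ) : mo (Hm l (some b)) (l * z) = z + ((b / l : ℝ) : ℂ) := by
  have hl' : (l : ℂ) ≠ 0 := by exact_mod_cast hl
  rw [mo_some]; push_cast; field_simp

/-- the defining product -/
noncomputable def Gf (l : ℕ) (z : ℂ) : ℂ := ∏ i : Option (Fin l), (125 - yf z * yf (mo (Hm l i) z))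

lemma Hm_pos {l : ℕ} (hl : l ≠ 0) (i : Option (Fin l)) : 0 < (Hm l i).det := by
  rw [Hm_det]; exact_mod_cast Nat.pos_of_ne_zero hl

lemma Gf_inv {l : ℕ} (hl : l.Prime) (hl5 : l ≠ 5) {A : M2} (hA : G5 A) {z : ℂ} (hz : 0 < z.im) :
    Gf l (mo A z) = Gf l z := by
  obtain ⟨σ, hσ⟩ := hecke_right hl hA.1
  rw [Gf, Gf, ← Equiv.prod_comp σ (fun i => 125 - yf z * yf (mo (Hm l i) z))]
  refine Finset.prod_congr rfl fun i _ => ?_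
  obtain ⟨γ, h1, h2⟩ := hσ i
  have h3 : 5 ∣ γ 1 0 := five_of hl hl5 (B := Hm l i * A) (by
    rw [Matrix.mul_apply, Fin.sum_univ_two, Hm_10, zero_mul, zero_add]; exact hA.2.mul_left _) h2
  have hp := Hm_pos hl.ne_zero
  rw [yf_inv hA hz, ← mo_mul (hp i) hA.pos hz, h2, mo_mul (by omega) (hp _) hz, yf_inv ⟨h1, h3⟩ (mo_up (hp _) hz)]

lemma Gf_W {l : ℕ} (hl : l.Prime) (hl5 : l ≠ 5) {z : ℂ} (hz : 0 < z.im) :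
    Gf l (mo Wm z) = ∏ i : Option (Fin l), (125 - 125 / yf z * (125 / yf (mo (Hm l i) z))) := by
  obtain ⟨σ, hσ⟩ := hecke_W hl hl5
  rw [Gf, ← Equiv.prod_comp σ (fun i => (125 - 125 / yf z * (125 / yf (mo (Hm l i) z))))]
  refine Finset.prod_congr rfl fun i _ => ?_
  obtain ⟨γ, h1, h2⟩ := hσ i
  have h5 : (5 : ℤ) ∣ Hm l i 1 0 := by rw [Hm_10]; exact dvd_zero _
  have h3 : 5 ∣ γ 1 0 := five_of hl hl5 (B := wj (Hm l i)) ⟨-Hm l i 0 1, by simp [wj]⟩ h2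
  have hp := Hm_pos hl.ne_zero
  have hw : 0 < (wj (Hm l i)).det := by rw [wj_det h5]; exact hp i
  rw [yf_W' hz, ← mo_mul (hp i) Wm_pos hz, ← wj_mul h5, mo_mul Wm_pos hw hz, yf_W' (mo_up hw hz), h2,
    mo_mul (by omega) (hp _) hz, yf_inv ⟨h1, h3⟩ (mo_up (hp _) hz)]

lemma Gf_diff {l : ℕ} (hl : l.Prime) {z : ℂ} (hz : 0 < z.im) : DifferentiableAt ℂ (Gf l) z := by
  have : Gf l = fun z => ∏ i : Option (Fin l), (125 - yf z * yf (mo (Hm l i) z)) := rfl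
  rw [this]
  refine DifferentiableAt.fun_finset_prod fun i _ => ?_
  exact (differentiableAt_const _).sub ((yf_diff hz).mul
    ((yf_diff (mo_up (Hm_pos hl.ne_zero i) hz)).comp z (mo_diff (Hm_pos hl.ne_zero i) hz)))

lemma BI_of_mul {h : ℂ → ℂ} {l : ℕ} (hl : l ≠ 0) (hb : BI (fun z => h (l * z))) : BI h := by
  have hl' : (l : ℂ) ≠ 0 := by exact_mod_cast hl
  refine (hb.comp_div l (Nat.pos_of_ne_zero hl)).congr fun z _ => ?_
  show h (l * (z / l)) = h z
  rw [mul_div_cancel₀ _ hl']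

lemma Gf_S5 {l : ℕ} (hl : l.Prime) (hl5 : l ≠ 5) : S5 (Gf l) := by
  refine ⟨fun z hz => Gf_diff hl hz, fun A hA z hz => Gf_inv hl hl5 hA hz, ?_⟩
  obtain ⟨p, hp⟩ := yfinv_rep
  refine BI_of_mul hl.ne_zero ?_
  have hl' : (0:ℝ) < l := by exact_mod_cast hl.pos
  have hup : ∀ z : ℂ, 0 < z.im → 0 < ((l:ℂ) * z).im := fun z hz => by simpa using mul_pos hl' hz
  refine BI.congr (f := fun z => ∏ i : Option (Fin l), (125 - 125 / yf (l * z) * (125 / yf (mo (Hm l i) (l * z)))))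
    (BI.prod _ fun i _ => (BI.const 125).sub ?_) (fun z hz => (Gf_W hl hl5 (hup z hz)).symm)
  have h1 := (hp.BI.comp_mul l hl.pos)
  have h2 : BI (fun z => (yf (mo (Hm l i) (l * z)))⁻¹) := by
    rcases i with _ | b
    · refine (h1.comp_mul l hl.pos).congr fun z _ => ?_
      simp only [mo_none]
    · refine (hp.shift (b / l : ℝ)).BI.congr fun z _ => ?_
      rw [mo_some' hl.ne_zero]
  exact ((BI.const (125*125)).mul (h1.mul h2)).congr fun z _ => by simp only [div_eq_mul_inv]; ring
end

section
open Complex PowerSeries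
open UpperHalfPlane hiding I
open scoped MatrixGroups ModularForm Topology

noncomputable def GSn {l : ℕ} (hl : l ≠ 0) : OO⟦X⟧ :=
  C (125 : OO) * X ^ (l + l * l) - PowerSeries.expand l hl (zo PZ) * PowerSeries.expand l hl (PowerSeries.expand l hl (zo PZ))

noncomputable def GSs {l : ℕ} (hl : l ≠ 0) (b : ℕ) : OO⟦X⟧ :=
  C (125 : OO) * X ^ (l + 1) - C (zO hl ^ (b * (l - 1))) * (PowerSeries.expand l hl (zo PZ) * rescale (zO hl ^ b) (zo PZ))

noncomputable def GS {l : ℕ} (hl : l ≠ 0) : OO⟦X⟧ := GSn hl * ∏ b : Fin l, GSs hl b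

lemma oc125 : oc (C (125 : OO)) = C (125 : ℂ) := by
  rw [PowerSeries.map_C]; congr 1

lemma GSn_rep {l : ℕ} (hl : l ≠ 0) :
    QR (oc (GSn hl)) (fun z => (125 - yf (l * z) * yf (l * (l * z))) * qf z ^ (l + l * l)) := by
  rw [GSn, map_sub, map_mul, map_mul, oc125, map_pow, PowerSeries.map_X, oc_exp, PowerSeries.map_expand, oc_exp]
  refine (((QR.const 125).mul (QR.X.pow (l + l * l))).sub
    ((PZ_rep.expand hl).mul ((PZ_rep.expand hl).expand hl))).congr fun z hz => ?_
  rw [qf_nat, qf_nat, qf_nat, ← pow_mul, pow_add]; ring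

lemma zl_inv {l : ℕ} (hl : l ≠ 0) (b : ℕ) : zl l ^ (b * (l - 1)) * zl l ^ b = 1 := by
  have : b * (l - 1) + b = l * b := by
    obtain ⟨m, rfl⟩ := Nat.exists_eq_succ_of_ne_zero hl
    simp; ring
  rw [← pow_add, this, pow_mul, zl_pow hl, one_pow]

lemma GSs_rep {l : ℕ} (hl : l ≠ 0) (b : ℕ) :
    QR (oc (GSs hl b)) (fun z => (125 - yf (l * z) * yf (z + ((b / l : ℝ) : ℂ))) * qf z ^ (l + 1)) := by
  have e : oc (C (zO hl ^ (b * (l - 1)))) = C (zl l ^ (b * (l - 1))) := by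
    rw [PowerSeries.map_C]; congr 1
  rw [GSs, map_sub, map_mul, map_mul, map_mul, oc125, map_pow, PowerSeries.map_X, oc_exp, oc_resc, e]
  refine (((QR.const 125).mul (QR.X.pow (l + 1))).sub ((QR.const _).mul
    ((PZ_rep.expand hl).mul (PZ_rep.shift (b / l : ℝ))))).congr fun z hz => ?_
  rw [qf_nat, qf_add, zl_b, pow_add]
  linear_combination (-yf (l * z) * yf (z + ((b / l : ℝ) : ℂ)) * qf z ^ l * qf z) * zl_inv hl b

lemma GS_rep {l : ℕ} (hl : l ≠ 0) :
    QR (oc (GS hl)) (fun z => Gf l (l * z) * qf z ^ (l * (2 * l + 2))) := by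
  rw [GS, map_mul, map_prod]
  refine ((GSn_rep hl).mul (QR.prod Finset.univ fun (b : Fin l) _ => GSs_rep hl b)).congr fun z hz => ?_
  rw [Gf, Fintype.prod_option, mo_none]
  simp only [mo_some' hl, Finset.prod_mul_distrib, Finset.prod_const, Finset.card_univ, Fintype.card_fin]
  have : l * (2 * l + 2) = (l + l * l) + (l + 1) * l := by ring
  rw [this, pow_add (qf z) (l + l * l), pow_mul _ (l + 1) l]
  ring

lemma zk_const {k : Type*} [CommRing k] {p : ℤ⟦X⟧} (h : constantCoeff p = 1) : constantCoeff (zk k p) = 1 := by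
  rw [← coeff_zero_eq_constantCoeff_apply, coeff_map, coeff_zero_eq_constantCoeff_apply, h]; simp

lemma GS_const {l : ℕ} (hl : l ≠ 0) (hodd : Odd l) : constantCoeff (GS hl) = 1 := by
  have h1 : constantCoeff (zo PZ) = 1 := zk_const PZ_const
  have h2 : constantCoeff (GSn hl) = -1 := by
    simp [GSn, hl, PowerSeries.constantCoeff_expand, h1]
  have h3 : ∀ b, constantCoeff (GSs hl b) = -zO hl ^ (b * (l - 1)) := by
    intro b
    have : constantCoeff (rescale (zO hl ^ b) (zo PZ)) = 1 := by
      rw [← coeff_zero_eq_constantCoeff_apply, coeff_rescale, coeff_zero_eq_constantCoeff_apply, h1]; simp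
    simp [GSs, PowerSeries.constantCoeff_expand, h1, this]
  rw [GS, map_mul, map_prod, h2]
  simp only [h3]
  rw [Fin.prod_univ_eq_prod_range (fun b => -zO hl ^ (b * (l - 1))) l]
  have h4 : ∏ b ∈ Finset.range l, (-zO hl ^ (b * (l - 1))) = (-1) ^ l := by
    have : ∀ b, -zO hl ^ (b * (l - 1)) = -1 * (zO hl ^ (l - 1)) ^ b := fun b => by
      rw [← pow_mul, mul_comm (l - 1) b]; ring
    simp only [this, Finset.prod_mul_distrib, Finset.prod_const, Finset.card_range]
    rw [Finset.prod_pow_eq_pow_sum]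
    obtain ⟨m, hm⟩ := hodd
    have hs : ∑ i ∈ Finset.range l, i = l * m := by
      have := Finset.sum_range_id_mul_two l
      have h' : l - 1 = 2 * m := by omega
      rw [h'] at this
      linarith [mul_left_cancel₀ (two_ne_zero (α := ℕ)) (by linarith : 2 * ∑ i ∈ Finset.range l, i = 2 * (l * m))]
    rw [hs, ← pow_mul, ← mul_assoc, mul_comm (l - 1), mul_assoc, pow_mul, zO_pow, one_pow, mul_one]
  rw [h4, hodd.neg_one_pow]; ring

lemma hmg_add {R : Type*} [CommRing R] (n : ℕ) (f g : Polynomial R) (J : R⟦X⟧) :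
    hmg n (f + g) J = hmg n f J + hmg n g J := by
  simp only [hmg, Polynomial.coeff_add, map_add, add_mul, Finset.sum_add_distrib]

lemma hmg_sum {R ι : Type*} [CommRing R] (n : ℕ) (s : Finset ι) (f : ι → Polynomial R) (J : R⟦X⟧) :
    hmg n (∑ i ∈ s, f i) J = ∑ i ∈ s, hmg n (f i) J := by
  simp only [hmg, Polynomial.finsetSum_coeff, map_sum, Finset.sum_mul]
  exact Finset.sum_comm

lemma hmg_monomial {R : Type*} [CommRing R] {n i : ℕ} (hi : i ≤ n) (a : R) (J : R⟦X⟧) :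
    hmg n (Polynomial.monomial i a) J = C a * J ^ i * X ^ (n - i) := by
  rw [hmg, Finset.sum_eq_single i]
  · rw [Polynomial.coeff_monomial_same]
  · intro j _ hj
    rw [Polynomial.coeff_monomial_of_ne _ hj]; simp
  · intro h; simp at h; omega

lemma hmg_mul {R : Type*} [CommRing R] {n m : ℕ} {f g : Polynomial R} (hf : f.natDegree ≤ n)
    (hg : g.natDegree ≤ m) (J : R⟦X⟧) : hmg (n + m) (f * g) J = hmg n f J * hmg m g J := by
  have ef := f.as_sum_range' (n + 1) (by omega)
  have eg := g.as_sum_range' (m + 1) (by omega)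
  conv_lhs => rw [ef, eg, Finset.sum_mul_sum, hmg_sum]
  rw [hmg, hmg, Finset.sum_mul_sum]
  refine Finset.sum_congr rfl fun i hi => ?_
  rw [hmg_sum]
  refine Finset.sum_congr rfl fun j hj => ?_
  rw [Finset.mem_range] at hi hj
  rw [Polynomial.monomial_mul_monomial, hmg_monomial (by omega), map_mul, pow_add,
    show n + m - (i + j) = (n - i) + (m - j) by omega, pow_add]
  ring

lemma hmg_pow {R : Type*} [CommRing R] {n : ℕ} {f : Polynomial R} (hf : f.natDegree ≤ n) (J : R⟦X⟧) (m : ℕ) :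
    hmg (m * n) (f ^ m) J = hmg n f J ^ m := by
  induction m with
  | zero =>
    have := hmg_monomial (le_refl 0) (1 : R) J
    simpa using this
  | succ m ih =>
    rw [pow_succ, pow_succ, ← ih, show (m + 1) * n = m * n + n by ring, hmg_mul _ hf]
    exact Polynomial.natDegree_pow_le.trans (Nat.mul_le_mul_left _ hf)

lemma hmg_const {R : Type*} [CommRing R] {n : ℕ} {f : Polynomial R} {J : R⟦X⟧} (hJ : constantCoeff J = 1) :
    constantCoeff (hmg n f J) = f.coeff n := by
  rw [hmg, map_sum, Finset.sum_eq_single n]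
  · simp [hJ]
  · intro i hi hin
    rw [Finset.mem_range] at hi
    have : n - i ≠ 0 := by omega
    simp [this]
  · intro h; simp at h

lemma const_expand {R : Type*} [CommRing R] {l : ℕ} (hl : l ≠ 0) (p : R⟦X⟧) :
    constantCoeff (PowerSeries.expand l hl p) = constantCoeff p := PowerSeries.constantCoeff_expand _ _ _

lemma GS_red {k : Type*} [Field k] {l : ℕ} (hl : l ≠ 0) [ExpChar k l] (φ : OO →+* k) :
    PowerSeries.map φ (GS hl) =
      PowerSeries.expand l hl ((zk k PZ ^ (l + 1) - C 125 * X ^ (l + 1)) ^ 2) := by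
  have e125 : PowerSeries.map φ (C (125 : OO)) = C 125 := by
    rw [PowerSeries.map_C]; congr 1; exact map_ofNat φ 125
  have hfrob : (C (125 : k) : k⟦X⟧) ^ l = C 125 := by
    have := expand_char (k := k) hl (C 125)
    have e : zk k (C 125) = C 125 := by rw [PowerSeries.map_C]; congr 1; simp
    rw [e, PowerSeries.expand_C] at this
    exact this.symm
  rw [GS, map_mul, map_prod]
  have h1 : PowerSeries.map φ (GSn hl) = C 125 * X ^ (l + l * l) - zk k PZ ^ l * (zk k PZ ^ l) ^ l := by
    rw [GSn, map_sub, map_mul, map_mul, e125, map_pow, PowerSeries.map_X, PowerSeries.map_expand,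
      PowerSeries.map_expand, PowerSeries.map_expand, map_zo, expand_char, map_pow, expand_char]
  have h2 : ∀ b : ℕ, PowerSeries.map φ (GSs hl b) = C 125 * X ^ (l + 1) - zk k PZ ^ l * zk k PZ := by
    intro b
    rw [GSs, map_sub, map_mul, map_mul, map_mul, e125, map_pow, PowerSeries.map_X, PowerSeries.map_expand,
      map_resc, map_zo, expand_char, PowerSeries.map_C, map_pow, zO_red]
    simp
  simp only [h1, h2, Finset.prod_const, Finset.card_univ, Fintype.card_fin]
  have : ExpChar k⟦X⟧ l := expChar_of_injective_ringHom (PowerSeries.C_injective (R := k)) l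
  rw [sub_pow_expChar, mul_pow (C 125), hfrob, mul_pow, map_pow, map_sub, map_pow, map_mul, map_pow,
    PowerSeries.expand_X, PowerSeries.expand_C, expand_char]
  ring

theorem exists_G {l : ℕ} (hp : l.Prime) (hl5 : l ≠ 5) (hl2 : l ≠ 2) :
    ∃ G : Polynomial OO, G.natDegree ≤ 2 * l + 2 ∧ G.Monic ∧
      (∀ z : ℂ, 0 < z.im → (G.map (algebraMap OO ℂ)).eval (yf z) = Gf l z) ∧
      ∀ (k : Type) [Field k] [CharP k l] (φ : OO →+* k), G.map φ = (Polynomial.X ^ (l + 1) - Polynomial.C 125) ^ 2 := by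
  have hl := hp.ne_zero
  have hb : BI (fun z => Gf l z * qf z ^ (2 * l + 2)) := by
    refine BI_of_mul hl ((GS_rep hl).BI.congr fun z hz => ?_)
    rw [qf_nat, ← pow_mul]
  obtain ⟨f, hf, hfe⟩ := poly5 (Gf_S5 hp hl5) hb
  obtain ⟨G, hG, hGn, hGS⟩ := red_poly PZ_const PZ_rep hl hf (S := GS hl)
    ((GS_rep hl).congr fun z hz => by
      rw [hfe _ (by simpa using mul_pos (by exact_mod_cast hp.pos : (0:ℝ) < l) hz)])
  refine ⟨G, hGn, ?_, fun z hz => by rw [hG, hfe z hz], ?_⟩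
  · refine Polynomial.monic_of_natDegree_le_of_coeff_eq_one _ hGn ?_
    rw [← hmg_const (J := zo PZ) (zk_const PZ_const), ← const_expand hl, hGS, GS_const hl (hp.odd_of_ne_two hl2)]
  · intro k _ _ φ
    have : Fact l.Prime := ⟨hp⟩
    have : ExpChar k l := ExpChar.prime hp
    have h1 := GS_red hl φ
    rw [← hGS, PowerSeries.map_expand, hmg_map, map_zo] at h1
    have h2 := expand_inj hl h1
    have hd : ((Polynomial.X ^ (l + 1) - Polynomial.C 125 : Polynomial k)).natDegree = l + 1 :=
      Polynomial.natDegree_X_pow_sub_C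
    have hJ : constantCoeff (zk k PZ) = 1 := zk_const PZ_const
    refine tri_inj hJ ((Polynomial.natDegree_map_le).trans hGn) ?_ (fun m _ => congrArg (coeff m) ?_)
    · refine Polynomial.natDegree_pow_le.trans ?_
      rw [hd]; omega
    · rw [h2]
      rw [show 2 * l + 2 = 2 * (l + 1) by ring, hmg_pow hd.le, hmg_sub, ← Polynomial.monomial_zero_left,
        ← Polynomial.monomial_one_right_eq_X_pow, hmg_monomial le_rfl, hmg_monomial (Nat.zero_le _)]
      simp
end

section
open Complex PowerSeries
open UpperHalfPlane hiding I
open scoped MatrixGroups ModularForm Topology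

/-- quotient of discriminants attached to an isogeny -/
noncomputable def gd (B : M2) (z : ℂ) : ℂ := (B.det : ℂ) ^ 12 * DC (mo B z) / (dn B z ^ 12 * DC z)

lemma gd_left {γ B : M2} (hγ : γ.det = 1) (hB : 0 < B.det) {z : ℂ} (hz : 0 < z.im) :
    gd (γ * B) z = gd B z := by
  have hp : 0 < γ.det := by omega
  have h1 := dn_ne hB hz
  have h2 := dn_ne hp (mo_up hB hz)
  have h3 := DC_ne hz
  rw [gd, gd, mo_mul hp hB hz, DC_mo hγ (mo_up hB hz), dn_mul h1, Matrix.det_mul, hγ, one_mul]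
  field_simp

lemma gd_right {γ B : M2} (hγ : γ.det = 1) (hB : 0 < B.det) {z : ℂ} (hz : 0 < z.im) :
    gd B (mo γ z) = gd (B * γ) z := by
  have hp : 0 < γ.det := by omega
  have h1 := dn_ne hp hz
  have h2 := dn_ne hB (mo_up hp hz)
  have h3 := DC_ne hz
  rw [gd, gd, mo_mul hB hp hz, DC_mo hγ hz, dn_mul h1, Matrix.det_mul, hγ, mul_one]
  field_simp

lemma gd_perm {l : ℕ} (hl : l.Prime) {γ : M2} (hγ : γ.det = 1) {z : ℂ} (hz : 0 < z.im) :
    ∃ σ : Equiv.Perm (Option (Fin l)), ∀ i, gd (Hm l i) (mo γ z) = gd (Hm l (σ i)) z := by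
  obtain ⟨σ, hσ⟩ := hecke_right hl hγ
  refine ⟨σ, fun i => ?_⟩
  obtain ⟨δ, h1, h2⟩ := hσ i
  rw [gd_right hγ (Hm_pos hl.ne_zero i) hz, h2, gd_left h1 (Hm_pos hl.ne_zero _) hz]

/-- the characteristic polynomial -/
noncomputable def Ph (l : ℕ) (z : ℂ) : Polynomial ℂ :=
  ∏ i : Option (Fin l), (Polynomial.X - Polynomial.C (gd (Hm l i) z))

lemma Ph_inv {l : ℕ} (hl : l.Prime) {γ : M2} (hγ : γ.det = 1) {z : ℂ} (hz : 0 < z.im) :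
    Ph l (mo γ z) = Ph l z := by
  obtain ⟨σ, hσ⟩ := gd_perm hl hγ hz
  rw [Ph, Ph, ← Equiv.prod_comp σ (fun i => Polynomial.X - Polynomial.C (gd (Hm l i) z))]
  exact Finset.prod_congr rfl fun i _ => by rw [hσ i]

/-- coefficientwise series representation -/
def PQR (P : Polynomial ℂ⟦X⟧) (p : ℂ → Polynomial ℂ) : Prop := ∀ k, QR (P.coeff k) (fun z => (p z).coeff k)

lemma PQR.mul {P Q : Polynomial ℂ⟦X⟧} {p q : ℂ → Polynomial ℂ} (h : PQR P p) (h' : PQR Q q) :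
    PQR (P * Q) (fun z => p z * q z) := by
  intro k
  rw [Polynomial.coeff_mul]
  have := QR.sum (Finset.HasAntidiagonal.antidiagonal k) (p := fun x => P.coeff x.1 * Q.coeff x.2)
    (f := fun x z => (p z).coeff x.1 * (q z).coeff x.2) fun x _ => (h x.1).mul (h' x.2)
  exact this.congr fun z hz => (Polynomial.coeff_mul _ _ _).symm

lemma PQR.prod {ι : Type*} (s : Finset ι) {P : ι → Polynomial ℂ⟦X⟧} {p : ι → ℂ → Polynomial ℂ}
    (h : ∀ i ∈ s, PQR (P i) (p i)) : PQR (∏ i ∈ s, P i) (fun z => ∏ i ∈ s, p i z) := by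
  classical
  induction s using Finset.induction_on with
  | empty =>
    intro k
    simp only [Finset.prod_empty, Polynomial.coeff_one]
    split_ifs
    · exact QR.one
    · simpa using QR.const 0
  | insert a s ha ih =>
    simp only [Finset.prod_insert ha]
    exact (h a (Finset.mem_insert_self _ _)).mul (ih fun i hi => h i (Finset.mem_insert_of_mem hi))

lemma PQR.lin {a b : ℂ⟦X⟧} {f g : ℂ → ℂ} (h : QR a f) (h' : QR b g) :
    PQR (Polynomial.C a * Polynomial.X - Polynomial.C b) (fun z => Polynomial.C (f z) * Polynomial.X - Polynomial.C (g z)) := by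
  have e : ∀ {R : Type} [CommRing R] (a b : R) (k : ℕ), (Polynomial.C a * Polynomial.X - Polynomial.C b).coeff k =
      (if k = 1 then a else 0) - (if k = 0 then b else 0) := by
    intro R _ a b k
    rw [Polynomial.coeff_sub, Polynomial.coeff_C, Polynomial.coeff_C_mul, Polynomial.coeff_X]
    simp [eq_comm]
  intro k
  simp only [e]
  refine QR.sub ?_ ?_
  · split_ifs
    · exact h
    · simpa using QR.const 0
  · split_ifs
    · exact h'
    · simpa using QR.const 0

noncomputable def gSn {l : ℕ} (hl : l ≠ 0) : OO⟦X⟧ :=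
  C ((l : OO) ^ 12) * X ^ (l * l - l) * (PowerSeries.expand l hl (PowerSeries.expand l hl (zo (epZ ^ 24))) * PowerSeries.expand l hl (zo (epI ^ 24)))

noncomputable def gSs {l : ℕ} (hl : l ≠ 0) (b : ℕ) : OO⟦X⟧ :=
  C (zO hl ^ b) * (rescale (zO hl ^ b) (zo (epZ ^ 24)) * PowerSeries.expand l hl (zo (epI ^ 24)))

lemma ep24_rep : QR (zc (epZ ^ 24)) (fun z => ep (qf z) ^ 24) := by
  rw [map_pow]; exact epZ_rep.toQ.pow 24

lemma ep24I_rep : QR (zc (epI ^ 24)) (fun z => (ep (qf z) ^ 24)⁻¹) := by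
  rw [map_pow]; exact (epI_rep.pow 24).congr fun z _ => by rw [inv_pow]

lemma mul_up {l : ℕ} (hl : l ≠ 0) {z : ℂ} (hz : 0 < z.im) : 0 < ((l : ℂ) * z).im := by
  have : (0:ℝ) < l := by exact_mod_cast Nat.pos_of_ne_zero hl
  simpa using mul_pos this hz

lemma gSn_rep {l : ℕ} (hl : l ≠ 0) : QR (oc (gSn hl)) (fun z => gd (Hm l none) (l * z)) := by
  have e : oc (C ((l : OO) ^ 12)) = C ((l : ℂ) ^ 12) := by
    rw [PowerSeries.map_C]; congr 1
  rw [gSn, map_mul, map_mul, map_mul, e, map_pow oc X, PowerSeries.map_X, oc_exp, PowerSeries.map_expand, oc_exp]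
  refine (((QR.const _).mul (QR.X.pow _)).mul (((ep24_rep.expand hl).expand hl).mul (ep24I_rep.expand hl))).congr fun z hz => ?_
  have h1 := qf_ne z
  have h2 := epq_ne (mul_up hl hz)
  have h3 : dn (Hm l none) (l * z) = 1 := by simp [dn, Hm]
  rw [gd, mo_none, Hm_det, h3, DC, DC]
  have h4 : qf (l * (l * z)) = qf (l * z) * qf z ^ (l * l - l) := by
    rw [qf_nat, qf_nat, ← pow_mul, ← pow_add]; congr 1
    have := Nat.le_mul_self l; omega
  have h5 := qf_ne (l * z)
  push_cast
  generalize ep (qf (l * z)) = a at *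
  generalize ep (qf (l * (l * z))) = b at *
  rw [h4]
  field_simp

lemma gSs_rep {l : ℕ} (hl : l ≠ 0) (b : Fin l) :
    QR (oc (gSs hl b)) (fun z => gd (Hm l (some b)) (l * z) * qf z ^ (l - 1)) := by
  have e : oc (C (zO hl ^ (b : ℕ))) = C (zl l ^ (b : ℕ)) := by
    rw [PowerSeries.map_C]; congr 1
  rw [gSs, map_mul, map_mul, e, oc_resc, oc_exp]
  refine ((QR.const _).mul ((ep24_rep.shift (b / l : ℝ)).mul (ep24I_rep.expand hl))).congr fun z hz => ?_
  have h1 := qf_ne z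
  have h2 := epq_ne (mul_up hl hz)
  have hl' : (l : ℂ) ≠ 0 := by exact_mod_cast hl
  have h3 : dn (Hm l (some b)) (l * z) = l := by simp [dn, Hm]
  rw [gd, mo_some' hl, Hm_det, h3, DC, DC]
  have h4 : qf (l * z) = qf z * qf z ^ (l - 1) := by
    rw [qf_nat, ← pow_succ']; congr 1; omega
  have h5 := qf_ne (l * z)
  generalize ep (qf (l * z)) = a at *
  generalize ep (qf (z + ((b / l : ℝ) : ℂ))) = c at *
  rw [h4, qf_add, zl_b]
  push_cast
  field_simp

noncomputable def PsiO {l : ℕ} (hl : l ≠ 0) : Polynomial OO⟦X⟧ :=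
  (Polynomial.C 1 * Polynomial.X - Polynomial.C (gSn hl)) *
    ∏ b : Fin l, (Polynomial.C (X ^ (l - 1)) * Polynomial.X - Polynomial.C (gSs hl b))

lemma PsiO_rep {l : ℕ} (hl : l ≠ 0) :
    PQR ((PsiO hl).map oc) (fun z => Polynomial.C (qf z ^ (l * (l - 1))) * Ph l (l * z)) := by
  have h := (PQR.lin QR.one (gSn_rep hl)).mul (PQR.prod Finset.univ fun (b : Fin l) _ =>
    PQR.lin (QR.X.pow (l - 1)) (gSs_rep hl b))
  have e : (PsiO hl).map oc = (Polynomial.C 1 * Polynomial.X - Polynomial.C (oc (gSn hl))) *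
    ∏ b : Fin l, (Polynomial.C (X ^ (l - 1)) * Polynomial.X - Polynomial.C (oc (gSs hl b))) := by
    simp [PsiO, Polynomial.map_mul, Polynomial.map_prod]
  rw [e]
  intro k
  refine (h k).congr fun z hz => ?_
  have eP : Ph l (l * z) = ∏ i : Option (Fin l), (Polynomial.X - Polynomial.C (gd (Hm l i) (l * z))) := rfl
  congr 1
  beta_reduce
  rw [eP, Fintype.prod_option]
  have : ∀ b : Fin l, (Polynomial.C (qf z ^ (l - 1)) * Polynomial.X - Polynomial.C (gd (Hm l (some b)) (l * z) * qf z ^ (l - 1)))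
    = Polynomial.C (qf z ^ (l - 1)) * (Polynomial.X - Polynomial.C (gd (Hm l (some b)) (l * z))) := by
    intro b; rw [Polynomial.C_mul]; ring
  simp only [this, Finset.prod_mul_distrib, Finset.prod_const, Finset.card_univ, Fintype.card_fin]
  rw [← Polynomial.C_pow, ← pow_mul, mul_comm (l - 1) l, Polynomial.C_1]
  ring

lemma PsiO_red {k : Type*} [Field k] {l : ℕ} (hl : l ≠ 0) [CharP k l] [ExpChar k l] (φ : OO →+* k) :
    (PsiO hl).map (PowerSeries.map φ) = Polynomial.C (PowerSeries.expand l hl (X ^ (l - 1))) * Polynomial.X ^ (l + 1)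
      - Polynomial.C (PowerSeries.expand l hl (zk k epI ^ (24 * (l - 1)))) * Polynomial.X := by
  have h1 : PowerSeries.map φ (gSn hl) = 0 := by
    rw [gSn, map_mul, map_mul, PowerSeries.map_C]; simp [hl]
  have h2 : ∀ b : ℕ, PowerSeries.map φ (gSs hl b) = zk k (epZ ^ 24) * zk k (epI ^ 24) ^ l := by
    intro b
    rw [gSs, map_mul, map_mul, PowerSeries.map_C, map_pow, zO_red, map_resc, PowerSeries.map_expand, map_zo, expand_char]
    simp
  have e : (PsiO hl).map (PowerSeries.map φ) = (Polynomial.C 1 * Polynomial.X - Polynomial.C (PowerSeries.map φ (gSn hl))) *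
    ∏ b : Fin l, (Polynomial.C (X ^ (l - 1)) * Polynomial.X - Polynomial.C (PowerSeries.map φ (gSs hl b))) := by
    simp [PsiO, Polynomial.map_mul, Polynomial.map_prod]
  rw [e, h1]
  simp only [h2, Finset.prod_const, Finset.card_univ, Fintype.card_fin]
  have : ExpChar k⟦X⟧ l := expChar_of_injective_ringHom (PowerSeries.C_injective (R := k)) l
  have : ExpChar (Polynomial k⟦X⟧) l := expChar_of_injective_ringHom (Polynomial.C_injective (R := k⟦X⟧)) l
  have h3 : zk k epZ * zk k epI = 1 := by rw [← map_mul, epI_mul, map_one]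
  have h4 : zk k (epZ ^ 24) * zk k (epI ^ 24) ^ l = zk k epI ^ (24 * (l - 1)) := by
    obtain ⟨m, rfl⟩ := Nat.exists_eq_succ_of_ne_zero hl
    rw [map_pow, map_pow, pow_succ (zk k epI ^ 24) m, mul_comm (_ ^ m), ← mul_assoc, ← mul_pow, h3, one_pow, one_mul, ← pow_mul]
    rfl
  have h5 : PowerSeries.expand l hl (zk k epI ^ (24 * (l - 1))) = (zk k epI ^ (24 * (l - 1))) ^ l := by
    rw [map_pow, expand_char, ← pow_mul, ← pow_mul, mul_comm]
  rw [sub_pow_expChar, mul_pow, h4, h5, ← Polynomial.C_pow, ← Polynomial.C_pow, map_pow (PowerSeries.expand l hl),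
    PowerSeries.expand_X, ← pow_mul, ← pow_mul, ← pow_mul, mul_comm l (l - 1), Polynomial.C_1, Polynomial.C_0]
  ring
end

section
open Complex PowerSeries
open UpperHalfPlane hiding I
open scoped MatrixGroups ModularForm Topology

lemma Ph_diff {l : ℕ} (hl : l ≠ 0) (k : ℕ) {z : ℂ} (hz : 0 < z.im) :
    DifferentiableAt ℂ (fun z => (Ph l z).coeff k) z := by
  have hl' : (l : ℂ) ≠ 0 := by exact_mod_cast hl
  have hl'' : (0:ℝ) < l := by exact_mod_cast Nat.pos_of_ne_zero hl
  have e : (l : ℂ) * (z / l) = z := mul_div_cancel₀ _ hl'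
  have hz' : 0 < (z / l).im := by
    rw [Complex.div_natCast_im]; positivity
  have h1 := (PsiO_rep hl k).diff hz'
  simp only [Polynomial.coeff_C_mul] at h1
  have h2 : DifferentiableAt ℂ (fun w => (Ph l (l * w)).coeff k) (z / l) := by
    have h3 : DifferentiableAt ℂ (fun w => qf w ^ (l * (l - 1))) (z / l) := (qf_deriv _).differentiableAt.pow _
    refine (h1.div h3 (pow_ne_zero _ (qf_ne _))).congr_of_eventuallyEq (Filter.Eventually.of_forall fun w => ?_)
    exact (mul_div_cancel_left₀ _ (pow_ne_zero _ (qf_ne _))).symm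
  have h3 : DifferentiableAt ℂ (fun w : ℂ => w / l) z := differentiableAt_id.div_const _
  have h4 := DifferentiableAt.comp z (g := fun w => (Ph l (l * w)).coeff k) h2 h3
  refine h4.congr_of_eventuallyEq (Filter.Eventually.of_forall fun w => ?_)
  simp only [Function.comp, mul_div_cancel₀ w hl']

theorem exists_Phi {l : ℕ} (hp : l.Prime) :
    ∃ c : ℕ → Polynomial OO, (∀ k, (c k).natDegree ≤ l - 1) ∧
      (∀ k z, 0 < z.im → ((c k).map (algebraMap OO ℂ)).eval (jf z) = (Ph l z).coeff k) ∧
      (∀ m, (l : OO) ^ 12 ∣ (c 0).coeff m) ∧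
      ∀ (κ : Type) [Field κ] [CharP κ l] (φ : OO →+* κ),
        (c (l + 1)).map φ = 1 ∧ (∀ k, k ≠ l + 1 → k ≠ 1 → (c k).map φ = 0) ∧
        hmg (l - 1) (-(c 1).map φ) (zk κ JZ) = zk κ epI ^ (24 * (l - 1)) := by
  have hl := hp.ne_zero
  have hlp := hp.pos
  have hS : ∀ k, S1 (fun z => (Ph l z).coeff k) := fun k =>
    ⟨fun z hz => Ph_diff hl k hz, fun A hA z hz => by simp only [Ph_inv hp hA hz]⟩
  have hex : ∀ k, ∃ F : Polynomial OO, F.natDegree ≤ l - 1 ∧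
      (∀ z, 0 < z.im → (F.map (algebraMap OO ℂ)).eval (jf z) = (Ph l z).coeff k) ∧
      PowerSeries.expand l hl (hmg (l - 1) F (zo JZ)) = (PsiO hl).coeff k := by
    intro k
    have hr := PsiO_rep hl k
    simp only [Polynomial.coeff_C_mul, Polynomial.coeff_map] at hr
    have hb : BI (fun z => (Ph l z).coeff k * qf z ^ (l - 1)) := by
      refine BI_of_mul hl (hr.BI.congr fun z hz => ?_)
      rw [qf_nat, ← pow_mul]; ring
    obtain ⟨f, hf, hfe⟩ := poly1 (hS k) hb
    obtain ⟨F, hF, hFn, hFS⟩ := red_poly JZ_const JZ_rep hl hf (S := (PsiO hl).coeff k)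
      (hr.congr fun z hz => by
        have := hfe _ (mul_up hl hz)
        rw [← this]; ring)
    exact ⟨F, hFn, fun z hz => by rw [hF, ← hfe z hz], hFS⟩
  choose c hc1 hc2 hc3 using hex
  refine ⟨c, hc1, hc2, ?_, ?_⟩
  · intro m
    let ψ := Ideal.Quotient.mk (Ideal.span {(l : OO) ^ 12})
    have h1 := congrArg (PowerSeries.map ψ) (hc3 0)
    have h2 : PowerSeries.map ψ ((PsiO hl).coeff 0) = 0 := by
      have e : (PsiO hl).coeff 0 = - gSn hl * ∏ b : Fin l, (-gSs hl b) := by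
        rw [PsiO, Polynomial.coeff_zero_eq_eval_zero, Polynomial.eval_mul, Polynomial.eval_prod]
        simp
      have h0 : ψ ((l : OO) ^ 12) = 0 := Ideal.Quotient.eq_zero_iff_mem.mpr (Ideal.mem_span_singleton_self _)
      rw [e, map_mul, map_neg, gSn, map_mul, map_mul, PowerSeries.map_C, h0]
      simp
    rw [h2, PowerSeries.map_expand, hmg_map] at h1
    have h3 : hmg (l - 1) ((c 0).map ψ) (PowerSeries.map ψ (zo JZ)) = 0 := by
      apply expand_inj hl
      rw [h1, map_zero]
    have h4 : (c 0).map ψ = 0 := by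
      refine tri_inj (n := l - 1) (J := PowerSeries.map ψ (zo JZ)) ?_ (Polynomial.natDegree_map_le.trans (hc1 0)) (by simp) (fun m _ => ?_)
      · have : constantCoeff (zo JZ) = 1 := zk_const JZ_const
        rw [← coeff_zero_eq_constantCoeff_apply, PowerSeries.coeff_map, coeff_zero_eq_constantCoeff_apply, this, map_one]
      · rw [h3]; simp [hmg]
    have h5 := congrArg (fun p => Polynomial.coeff p m) h4
    simp only [Polynomial.coeff_map, Polynomial.coeff_zero] at h5
    exact Ideal.mem_span_singleton.mp (Ideal.Quotient.eq_zero_iff_mem.mp h5)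
  · intro κ _ _ φ
    have : Fact l.Prime := ⟨hp⟩
    have : ExpChar κ l := ExpChar.prime hp
    have hJ : constantCoeff (zk κ JZ) = 1 := zk_const JZ_const
    have h1 := PsiO_red hl φ
    have h2 : ∀ k, PowerSeries.expand l hl (hmg (l - 1) ((c k).map φ) (zk κ JZ)) =
        ((PsiO hl).map (PowerSeries.map φ)).coeff k := by
      intro k
      rw [Polynomial.coeff_map, ← hc3 k, PowerSeries.map_expand, hmg_map, map_zo]
    simp only [h1, Polynomial.coeff_sub, Polynomial.coeff_C_mul, Polynomial.coeff_X_pow, Polynomial.coeff_X] at h2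
    refine ⟨?_, ?_, ?_⟩
    · refine tri_inj hJ (Polynomial.natDegree_map_le.trans (hc1 _)) (by simp) (fun m _ => congrArg (coeff m) ?_)
      apply expand_inj hl
      rw [h2, if_pos rfl, if_neg (by omega), ← Polynomial.C_1, ← Polynomial.monomial_zero_left, hmg_monomial (Nat.zero_le _)]
      simp
    · intro k hk hk1
      refine tri_inj hJ (Polynomial.natDegree_map_le.trans (hc1 _)) (by simp) (fun m _ => congrArg (coeff m) ?_)
      apply expand_inj hl
      rw [h2, if_neg hk, if_neg (by omega)]
      simp [hmg]
    · apply expand_inj hl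
      have := h2 1
      rw [if_neg (by omega), if_pos rfl] at this
      have e : hmg (l - 1) (-(c 1).map φ) (zk κ JZ) = - hmg (l - 1) ((c 1).map φ) (zk κ JZ) := by
        simp [hmg]
      rw [e, map_neg, this]
      simp
end

section
open Complex PowerSeries
open UpperHalfPlane hiding I
open scoped MatrixGroups ModularForm Topology

/-- the point `z` is fixed by a matrix of determinant `5 l` normalising the level structure -/
def CM (l : ℕ) (a b c d : ℤ) (z : ℂ) : Prop :=
  a * d - 5 * b * c = l ∧ 5 * (a : ℂ) * z ^ 2 + 5 * (b + c) * z + d = 0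

lemma CM.swap {l : ℕ} {a b c d : ℤ} {z : ℂ} (h : CM l a b c d z) : CM l a c b d z :=
  ⟨by linarith [h.1], by linear_combination h.2⟩

lemma CM.a_ne {l : ℕ} (hl : l.Prime) (hl5 : l ≠ 5) {a b c d : ℤ} {z : ℂ} (hz : 0 < z.im) (h : CM l a b c d z) : a ≠ 0 := by
  rintro rfl
  obtain ⟨h1, h2⟩ := h
  have h3 := congrArg Complex.im h2
  have h4 := congrArg Complex.re h2
  simp at h3 h4
  have h5 : b + c = 0 := by
    rcases h3 with h3 | h3
    · exact_mod_cast h3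
    · exact absurd h3 hz.ne'
  have h6 : (b:ℝ) + c = 0 := by exact_mod_cast h5
  obtain rfl : c = -b := by omega
  have : (5:ℤ) ∣ l := ⟨b * b, by linarith⟩
  have h7 : l = 5 := ((Nat.prime_dvd_prime_iff_eq (by norm_num) hl).mp (by exact_mod_cast this)).symm
  exact hl5 h7

lemma CM.disc {l : ℕ} {a b c d : ℤ} {z : ℂ} (ha : a ≠ 0) (hz : 0 < z.im) (h : CM l a b c d z) : 5 * (b - c) ^ 2 < 4 * l := by
  obtain ⟨h1, h2⟩ := h
  have h3 := congrArg Complex.im h2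
  have h4 := congrArg Complex.re h2
  simp [sq] at h3 h4
  have ha' : (a:ℝ) ≠ 0 := by exact_mod_cast ha
  have h5 : 2 * a * z.re + (b + c) = 0 := by
    have : (2 * a * z.re + (b + c)) * (5 * z.im) = 0 := by linear_combination h3
    rcases mul_eq_zero.mp this with h | h
    · exact h
    · linarith
  have h6 : (0:ℝ) < (a * z.im) ^ 2 := by positivity
  have h7 : (d:ℝ) * a = 5 * (a * z.re) ^ 2 + 5 * (a * z.im) ^ 2 := by
    linear_combination a * h4 - 5 * a * z.re * h5
  have h8 : (a:ℝ) * d - 5 * b * c = l := by exact_mod_cast h1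
  have h9 : 4 * (a * z.re) ^ 2 = ((b:ℝ) + c) ^ 2 := by
    have : (b:ℝ) + c = - (2 * a * z.re) := by linarith
    rw [this]; ring
  have : 5 * ((b:ℝ) - c) ^ 2 < 4 * l := by nlinarith
  exact_mod_cast this

/-- the entries of `CM` as a matrix -/
def cmB (a b c d : ℤ) : M2 := !![a, b; 5 * c, d]

lemma cmB_det (a b c d : ℤ) : (cmB a b c d).det = a * d - 5 * b * c := by
  simp [cmB, Matrix.det_fin_two]; ring

lemma CM_of_root {l : ℕ} (hl : l.Prime) {z : ℂ} (hz : 0 < z.im) {i : Option (Fin l)}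
    (h : yf z * yf (mo (Hm l i) z) = 125) :
    ∃ a b c d : ℤ, CM l a b c d z ∧ ∃ γ, G5 γ ∧ cmB a b c d = γ * Hm l i := by
  have hH := Hm_pos hl.ne_zero i
  have h1 : yf (mo (Hm l i) z) = yf (mo Wm z) := by
    rw [yf_W' hz, ← h, mul_div_cancel_left₀ _ (yf_ne hz)]
  obtain ⟨γ, hγ, e⟩ := y_inj (mo_up hH hz) (W_up hz) h1
  rw [← mo_mul hγ.pos hH hz] at e
  obtain ⟨c, hc⟩ := hγ.2
  have hB0 : (γ * Hm l i) 1 0 = 5 * (c * Hm l i 0 0) := by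
    rw [Matrix.mul_apply, Fin.sum_univ_two, Hm_10, hc]; ring
  have eB : cmB ((γ * Hm l i) 0 0) ((γ * Hm l i) 0 1) (c * Hm l i 0 0) ((γ * Hm l i) 1 1) = γ * Hm l i := by
    refine ext2 ?_ ?_ ?_ ?_ <;> simp [cmB, hB0]
  refine ⟨_, _, _, _, ⟨?_, ?_⟩, γ, hγ, eB⟩
  · rw [← cmB_det, eB, Matrix.det_mul, hγ.1, one_mul, Hm_det]
  · have hdn := dn_ne (A := γ * Hm l i) (by rw [Matrix.det_mul, hγ.1, one_mul]; exact hH) hz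
    have h0 := ne_of_up hz
    rw [mo_W, mo_def, div_eq_div_iff hdn (by simp [h0]), dn, hB0] at e
    push_cast at e ⊢
    linear_combination e

lemma root_of_CM {l : ℕ} (hl : l.Prime) (hl5 : l ≠ 5) {z : ℂ} (hz : 0 < z.im) {a b c d : ℤ} (h : CM l a b c d z) :
    ∃ i γ, G5 γ ∧ cmB a b c d = γ * Hm l i ∧ yf z * yf (mo (Hm l i) z) = 125 := by
  have hdet : (cmB a b c d).det = l := by rw [cmB_det]; exact h.1
  obtain ⟨γ, i, h1, h2⟩ := hecke_rep hl hdet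
  have hγ : G5 γ := ⟨h1, five_of hl hl5 (by simp [cmB]) h2⟩
  refine ⟨i, γ, hγ, h2, ?_⟩
  have hH := Hm_pos hl.ne_zero i
  rw [← yf_inv hγ (mo_up hH hz), ← mo_mul hγ.pos hH hz, ← h2]
  have hB : 0 < (cmB a b c d).det := by rw [hdet]; exact_mod_cast hl.pos
  have e : mo (cmB a b c d) z = mo Wm z := by
    rw [mo_W, mo_def, div_eq_div_iff (dn_ne hB hz) (by simp [ne_of_up hz]), dn]
    simp only [cmB, Matrix.of_apply, Matrix.cons_val', Matrix.cons_val_zero, Matrix.cons_val_one, Matrix.cons_val_fin_one]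
    push_cast
    linear_combination h.2
  rw [e, yf_W' hz, mul_div_cancel₀ _ (yf_ne hz)]

lemma Gf_zero_iff {l : ℕ} (hl : l.Prime) (hl5 : l ≠ 5) {z : ℂ} (hz : 0 < z.im) :
    Gf l z = 0 ↔ ∃ a b c d, CM l a b c d z := by
  rw [Gf, Finset.prod_eq_zero_iff]
  constructor
  · rintro ⟨i, -, hi⟩
    obtain ⟨a, b, c, d, h, -⟩ := CM_of_root hl hz (i := i) (by linear_combination -hi)
    exact ⟨a, b, c, d, h⟩
  · rintro ⟨a, b, c, d, h⟩
    obtain ⟨i, γ, -, -, h3⟩ := root_of_CM hl hl5 hz h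
    exact ⟨i, Finset.mem_univ _, by rw [h3, sub_self]⟩

lemma OO5 : ((5 : OO) : ℂ) = 5 := rfl

/-- the integer data produced by `exists_Phi` at a point -/
lemma Ph_poly {l : ℕ} {c : ℕ → Polynomial OO}
    (hc : ∀ k z, 0 < z.im → ((c k).map (algebraMap OO ℂ)).eval (jf z) = (Ph l z).coeff k)
    {z : ℂ} (hz : 0 < z.im) {j : OO} (hj : jf z = j) (i : Option (Fin l)) :
    ∃ g : OO, (g : ℂ) = gd (Hm l i) z ∧ g ^ (l + 1) + ∑ k ∈ Finset.range (l + 1), (c k).eval j * g ^ k = 0 := by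
  have h1 : ∀ k, (((c k).eval j : OO) : ℂ) = (Ph l z).coeff k := by
    intro k
    rw [← hc k z hz, hj]
    exact (Polynomial.eval_map_apply (f := algebraMap OO ℂ) (p := c k) j).symm
  have hm : (Ph l z).Monic := Polynomial.monic_prod_of_monic _ _ fun i _ => Polynomial.monic_X_sub_C _
  have hd : (Ph l z).natDegree = l + 1 := by
    rw [Ph, Polynomial.natDegree_prod_of_monic _ _ fun i _ => Polynomial.monic_X_sub_C _]
    simp
  have hroot : (Ph l z).eval (gd (Hm l i) z) = 0 := by
    rw [Ph, Polynomial.eval_prod]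
    exact Finset.prod_eq_zero (Finset.mem_univ i) (by simp)
  have hlead : (Ph l z).coeff (l + 1) = 1 := by rw [← hd]; exact hm.coeff_natDegree
  rw [Polynomial.eval_eq_sum_range, hd, Finset.sum_range_succ, hlead, one_mul, add_comm] at hroot
  have hintg : IsIntegral OO (gd (Hm l i) z) := by
    refine ⟨Polynomial.X ^ (l + 1) + ∑ k ∈ Finset.range (l + 1), Polynomial.C ((c k).eval j) * Polynomial.X ^ k, ?_, ?_⟩
    · refine Polynomial.monic_X_pow_add ?_
      refine (Polynomial.degree_sum_le _ _).trans_lt ?_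
      rw [Finset.sup_lt_iff (WithBot.bot_lt_coe _)]
      intro k hk
      exact (Polynomial.degree_C_mul_X_pow_le _ _).trans_lt (by exact_mod_cast Finset.mem_range.mp hk)
    · rw [Polynomial.eval₂_add, Polynomial.eval₂_finsetSum, Polynomial.eval₂_X_pow, ← hroot]
      congr 1
      refine Finset.sum_congr rfl fun k _ => ?_
      rw [Polynomial.eval₂_mul, Polynomial.eval₂_C, Polynomial.eval₂_X_pow, ← h1]
      rfl
  obtain ⟨g, hg⟩ := (IsIntegralClosure.isIntegral_iff (A := OO) (R := ℤ) (B := ℂ)).mp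
    (isIntegral_trans (R := ℤ) (A := OO) _ hintg)
  have hg' : (g : ℂ) = gd (Hm l i) z := hg
  refine ⟨g, hg', ?_⟩
  apply Subtype.ext
  push_cast
  rw [hg', ← hroot]
  congr 1
  exact Finset.sum_congr rfl fun k _ => by rw [h1]

lemma OO_int {x : ℂ} (h : IsIntegral ℤ x) : ∃ g : OO, (g : ℂ) = x := ⟨⟨x, h⟩, rfl⟩

/-- the element `g` attached to a complex multiplication -/
lemma CM_g {l : ℕ} (hp : l.Prime) {C : ℕ → Polynomial OO}
    (hc : ∀ k z, 0 < z.im → ((C k).map (algebraMap OO ℂ)).eval (jf z) = (Ph l z).coeff k)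
    {z : ℂ} (hz : 0 < z.im) {a b c d : ℤ} (h : CM l a b c d z) {y j A : OO} (hy : yf z = y)
    (hj : jf (5 * z) = j) (hA : (A : ℂ) = 5 * a * z) :
    ∃ g : OO, g ^ (l + 1) + ∑ k ∈ Finset.range (l + 1), (C k).eval j * g ^ k = 0 ∧
      5 ^ 12 * g = (-A - 5 * c) ^ 12 * y ^ 4 := by
  let M : M2 := !![c, d; -a, -5 * b]
  have hdet : M.det = l := by
    have := h.1
    simp [M, Matrix.det_fin_two]; linarith
  have hpos : 0 < M.det := by rw [hdet]; exact_mod_cast hp.pos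
  have hdn : dn M (5 * z) = -A - 5 * b := by
    rw [hA]; simp [M, dn]; ring
  have hdn0 := dn_ne hpos (up5 hz)
  have hmo : mo M (5 * z) = z := by
    rw [mo_def, div_eq_iff hdn0, hdn, hA]
    simp only [M, Matrix.of_apply, Matrix.cons_val', Matrix.cons_val_zero, Matrix.cons_val_one, Matrix.cons_val_fin_one]
    linear_combination h.2
  obtain ⟨γ, i, h1, h2⟩ := hecke_rep hp hdet
  obtain ⟨g, hg, hg2⟩ := Ph_poly hc (up5 hz) hj i
  refine ⟨g, hg2, ?_⟩
  rw [← gd_left h1 (Hm_pos hp.ne_zero i) (up5 hz), ← h2, gd, hmo, hdet] at hg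
  apply Subtype.ext
  push_cast
  rw [← hy, hg, yf_pow hz, OO5]
  have h3 := DC_ne (up5 hz)
  have h4 : dn M (5 * z) * (-A - 5 * c) = - 5 * l := by
    rw [hdn, hA]
    have : (l : ℂ) = a * d - 5 * b * c := by exact_mod_cast h.1.symm
    rw [this]
    linear_combination 5 * a * h.2
  have h5 : dn M (5 * z) ^ 12 * (-A - 5 * c : ℂ) ^ 12 = 5 ^ 12 * l ^ 12 := by
    rw [← mul_pow, h4]; ring
  rw [← mul_div_assoc, ← mul_div_assoc, div_eq_div_iff (mul_ne_zero (pow_ne_zero _ hdn0) h3) h3]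
  push_cast
  linear_combination (-DC z * DC (5*z)) * h5

theorem ss_criterion {l : ℕ} (hp : l.Prime) (hl5 : l ≠ 5) {C : ℕ → Polynomial OO}
    (hc : ∀ k z, 0 < z.im → ((C k).map (algebraMap OO ℂ)).eval (jf z) = (Ph l z).coeff k)
    (hc0 : ∀ m, (l : OO) ^ 12 ∣ (C 0).coeff m)
    {κ : Type} [Field κ] [CharP κ l] {φ : OO →+* κ}
    (hφ : ∀ k, k ≠ l + 1 → k ≠ 1 → (C k).map φ = 0)
    {z : ℂ} (hz : 0 < z.im) {a b c d : ℤ} (h : CM l a b c d z) {y j : OO} (hy : yf z = y) (hy0 : φ y ≠ 0)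
    (hj : jf (5 * z) = j) : (-(C 1).map φ).eval (φ j) = 0 ↔ b = c := by
  have h50 : (5 : κ) ≠ 0 := by
    have : ((5 : ℕ) : κ) ≠ 0 := by
      rw [Ne, CharP.cast_eq_zero_iff κ l]
      intro h
      exact hl5 ((Nat.prime_dvd_prime_iff_eq hp (by norm_num)).mp h)
    exact_mod_cast this
  have hl0 : φ (l : OO) = 0 := by simp
  have hll : (l : ℂ) = a * d - 5 * b * c := by exact_mod_cast h.1.symm
  obtain ⟨A, hA⟩ : ∃ A : OO, (A : ℂ) = 5 * a * z := by
    refine OO_int ⟨Polynomial.X ^ 2 + (Polynomial.C (5 * (b + c)) * Polynomial.X + Polynomial.C (5 * a * d)), ?_, ?_⟩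
    · refine Polynomial.monic_X_pow_add ?_
      exact (Polynomial.degree_linear_le).trans_lt (by norm_num)
    · simp only [Polynomial.eval₂_add, Polynomial.eval₂_mul, Polynomial.eval₂_C, Polynomial.eval₂_X, Polynomial.eval₂_X_pow]
      simp only [eq_intCast]
      push_cast
      linear_combination 5 * a * h.2
  have hmm : (-A - 5 * b) * (-A - 5 * c) = -5 * (l : OO) := by
    apply Subtype.ext
    push_cast
    rw [hA, hll, OO5]
    linear_combination 5 * a * h.2
  have e1 : ∀ k, k ≠ l + 1 → k ≠ 1 → φ ((C k).eval j) = 0 := by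
    intro k hk hk1
    have := congrArg (Polynomial.eval (φ j)) (hφ k hk hk1)
    rwa [Polynomial.eval_map_apply, Polynomial.eval_zero] at this
  have e2 : ∀ g : OO, g ^ (l + 1) + ∑ k ∈ Finset.range (l + 1), (C k).eval j * g ^ k = 0 →
      φ g ^ (l + 1) = (-(C 1).map φ).eval (φ j) * φ g := by
    intro g hg
    have := congrArg φ hg
    rw [map_add, map_pow, map_sum, Finset.sum_eq_single 1, map_zero, map_mul, pow_one] at this
    · rw [Polynomial.eval_neg, Polynomial.eval_map_apply]
      linear_combination this
    · intro k hk hk1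
      rw [Finset.mem_range] at hk
      rw [map_mul, e1 k (by omega) hk1, zero_mul]
    · intro h; simp at h; exact absurd h hp.ne_zero
  constructor
  · intro h0
    have key : ∀ {b c : ℤ}, CM l a b c d z → φ A = - (5 * c) := by
      intro b c h
      obtain ⟨g, hg1, hg2⟩ := CM_g hp hc hz h hy hj hA
      have := e2 g hg1
      rw [h0, zero_mul] at this
      have hg0 : φ g = 0 := pow_eq_zero_iff (by omega) |>.mp this
      have h3 := congrArg φ hg2
      simp only [map_mul, map_pow, map_sub, map_neg, map_ofNat, map_intCast, hg0, mul_zero] at h3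
      have h4 := (mul_eq_zero.mp h3.symm).resolve_right (pow_ne_zero _ hy0)
      have h5 := pow_eq_zero_iff (by norm_num) |>.mp h4
      linear_combination -h5
    have k1 := key h
    have k2 := key h.swap
    have k3 : (((b - c : ℤ)) : κ) = 0 := by
      have : (5:κ) * ((b - c : ℤ) : κ) = 0 := by push_cast; linear_combination k2 - k1
      exact (mul_eq_zero.mp this).resolve_left h50
    rw [CharP.intCast_eq_zero_iff κ l] at k3
    have k4 := h.disc (h.a_ne hp hl5 hz) hz
    obtain ⟨e, he⟩ := k3
    by_contra hne
    have he0 : e ≠ 0 := by rintro rfl; apply hne; linarith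
    rw [he] at k4
    have : 1 ≤ e ^ 2 := by have := sq_pos_of_ne_zero he0 ; omega
    have : (2:ℤ) ≤ l := by exact_mod_cast hp.two_le
    nlinarith [mul_le_mul_of_nonneg_left ‹1 ≤ e ^ 2› (sq_nonneg (l:ℤ))]
  · intro hbc
    subst hbc
    by_contra hne
    have hA0 : φ (-A - 5 * b) = 0 := by
      have := congrArg φ hmm
      rw [map_mul, map_mul, hl0, mul_zero] at this
      rcases mul_eq_zero.mp this with h | h <;> exact h
    obtain ⟨g, hg1, hg2⟩ := CM_g hp hc hz h hy hj hA
    have hg0 : φ g = 0 := by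
      have h3 := congrArg φ hg2
      rw [map_mul, map_mul, map_pow φ (-A - 5 * b), hA0, map_pow, map_ofNat, zero_pow (by norm_num), zero_mul] at h3
      exact (mul_eq_zero.mp h3).resolve_left (pow_ne_zero _ h50)
    obtain ⟨w, hw⟩ : ∃ w : OO, w = g ^ l + ∑ k ∈ Finset.range l, (C (k + 1)).eval j * g ^ k := ⟨_, rfl⟩
    have hgw : g * w + (C 0).eval j = 0 := by
      rw [← hg1, hw, Finset.sum_range_succ', mul_add, Finset.mul_sum, pow_zero, mul_one, pow_succ', add_assoc]
      congr 2
      refine Finset.sum_congr rfl fun k _ => by ring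
    have hw0 : φ w = - (-(C 1).map φ).eval (φ j) := by
      rw [hw, map_add, map_pow, hg0, map_sum, Finset.sum_eq_single 0, zero_pow hp.ne_zero, zero_add,
        Polynomial.eval_neg, Polynomial.eval_map_apply, neg_neg]
      · simp
      · intro k _ hk
        rw [map_mul, map_pow, hg0, zero_pow hk, mul_zero]
      · intro h; simp at h; exact absurd h hp.ne_zero
    obtain ⟨e, he⟩ : (l : OO) ^ 12 ∣ (C 0).eval j := by
      rw [Polynomial.eval_eq_sum_range]
      exact Finset.dvd_sum fun m _ => (hc0 m).mul_right _
    have hl1 : (l : OO) ≠ 0 := by exact_mod_cast hp.ne_zero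
    have h51 : (5 : OO) ≠ 0 := by norm_num
    have k1 : (5:OO) ^ 12 * ((5:OO) ^ 12 * g ^ 2 - (l:OO) ^ 12 * y ^ 8) = 0 := by
      have : (-A - 5 * b) ^ 24 = 5 ^ 12 * (l : OO) ^ 12 := by
        have : (-A - 5 * b) ^ 24 = ((-A - 5 * b) * (-A - 5 * b)) ^ 12 := by ring
        rw [this, hmm]; ring
      have h2 : ((5:OO) ^ 12 * g) ^ 2 = (-A - 5 * b) ^ 24 * y ^ 8 := by rw [hg2]; ring
      rw [this] at h2
      linear_combination h2
    have k2 := (mul_eq_zero.mp k1).resolve_left (pow_ne_zero _ h51)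
    have k3 : (l:OO) ^ 12 * (y ^ 8 * w ^ 2 - 5 ^ 12 * (l:OO) ^ 12 * e ^ 2) = 0 := by
      have : g * w = - ((l:OO) ^ 12 * e) := by rw [← he]; linear_combination hgw
      have h2 : (g * w) ^ 2 = ((l:OO) ^ 12 * e) ^ 2 := by rw [this]; ring
      linear_combination -w ^ 2 * k2 + 5 ^ 12 * h2
    have k4 := (mul_eq_zero.mp k3).resolve_left (pow_ne_zero _ hl1)
    have k5 := congrArg φ k4
    rw [map_sub, map_mul, map_mul, map_mul, map_pow, map_pow, map_pow φ (l:OO), hl0, hw0, zero_pow (by norm_num)] at k5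
    simp [hy0] at k5
    exact hne (by simpa using k5)
end

section
open Complex PowerSeries

/-- coefficients of the Hasse invariant -/
def aH (n s m : ℕ) : ℤ :=
  (Nat.choose (2 * n + s) (2 * m + s) : ℤ) * (Nat.choose (2 * n - 2 * m) (n - m) : ℤ) * (-432) ^ (n - m)

lemma aH_rec {n s m : ℕ} (hm : m < n) :
    432 * ((2 * m + s + 2 : ℕ) : ℤ) * ((2 * m + s + 1 : ℕ) : ℤ) * aH n s (m + 1) = - ((n - m : ℕ) : ℤ) ^ 2 * aH n s m := by
  obtain ⟨j, rfl⟩ : ∃ j, n = m + (j + 1) := ⟨n - m - 1, by omega⟩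
  have e1 : m + (j + 1) - (m + 1) = j := by omega
  have e2 : m + (j + 1) - m = j + 1 := by omega
  have e3 : 2 * (m + (j + 1)) - 2 * (m + 1) = 2 * j := by omega
  have e4 : 2 * (m + (j + 1)) - 2 * m = 2 * (j + 1) := by omega
  rw [aH, aH, e1, e2, e3, e4, show 2 * (m + 1) + s = (2 * m + s + 1) + 1 by ring]
  set N := 2 * (m + (j + 1)) + s with hN
  have h1 := Nat.choose_succ_right_eq N (2 * m + s)
  have h2 := Nat.choose_succ_right_eq N (2 * m + s + 1)
  have h3 := Nat.succ_mul_centralBinom_succ j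
  rw [Nat.centralBinom, Nat.centralBinom] at h3
  rw [show N - (2 * m + s) = 2 * (j + 1) by omega] at h1
  rw [show N - (2 * m + s + 1) = 2 * j + 1 by omega] at h2
  have g1 : ((N.choose (2 * m + s + 1) : ℕ) : ℤ) * ((2 * m + s + 1 : ℕ) : ℤ) = N.choose (2 * m + s) * (2 * (j + 1)) := by exact_mod_cast h1
  have g2 : ((N.choose (2 * m + s + 1 + 1) : ℕ) : ℤ) * ((2 * m + s + 2 : ℕ) : ℤ) = N.choose (2 * m + s + 1) * (2 * j + 1) := by exact_mod_cast h2
  have g3 : ((j:ℤ) + 1) * ((2 * (j + 1)).choose (j + 1) : ℕ) = 2 * (2 * j + 1) * ((2 * j).choose j : ℕ) := by exact_mod_cast h3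
  rw [pow_succ (-432 : ℤ) j]
  generalize (-432 : ℤ) ^ j = w
  push_cast at g1 g2 g3 ⊢
  generalize ((N.choose (2 * m + s + 1) : ℕ) : ℤ) = A at *
  generalize ((N.choose (2 * m + s + 1 + 1) : ℕ) : ℤ) = B at *
  generalize ((N.choose (2 * m + s) : ℕ) : ℤ) = D at *
  generalize (((2 * j).choose j : ℕ) : ℤ) = E at *
  generalize (((2 * (j + 1)).choose (j + 1) : ℕ) : ℤ) = F at *
  linear_combination 432 * (2 * m + s + 1 : ℤ) * E * w * g2 + 432 * (2 * j + 1 : ℤ) * E * w * g1 - 432 * (j + 1 : ℤ) * D * w * g3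

section ode
variable {k : Type*} [CommRing k]

lemma thS_U (R : k⟦X⟧) (b : ℕ) :
    ∃ S U : k⟦X⟧, U = (b : k⟦X⟧) * ((b : k⟦X⟧) - 1) * R ^ (b - 2) ∧ S * R = b * R ^ b ∧ U * R = ((b : k⟦X⟧) - 1) * S ∧
      thS (R ^ b) = S * thS R ∧ thS S = U * thS R := by
  refine ⟨b * R ^ (b - 1), (b : k⟦X⟧) * ((b : k⟦X⟧) - 1) * R ^ (b - 2), rfl, ?_, ?_, thS_pow R b, ?_⟩
  · rcases b with _ | b
    · simp
    · simp [pow_succ, mul_assoc]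
  · rcases b with _ | _ | b
    · simp
    · simp
    · simp [pow_succ]; ring
  · rw [thS_mul, thS_natCast, thS_pow]
    rcases b with _ | _ | b
    · simp
    · simp
    · simp; ring

variable {P Q R D : k⟦X⟧} (hP : 12 * thS P = P ^ 2 - Q) (hQ : 3 * thS Q = P * Q - R)
  (hR : 2 * thS R = P * R - Q ^ 2) (hD : thS D = D * P) (hE : 1728 * D = Q ^ 3 - R ^ 2)
include hP hQ hR hD hE

lemma thS2_0 (b e : ℕ) (h : 12 * (e : k⟦X⟧) + 6 * b + 1 = 0) :
    144 * thS (thS (R ^ b * D ^ e)) = Q * (144 * e ^ 2 * R ^ b * D ^ e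
      + 144 * 432 * ((b : k⟦X⟧) * ((b : k⟦X⟧) - 1) * R ^ (b - 2)) * D ^ (e + 1)) := by
  obtain ⟨S, U, hU, h1, h2, h3, h4⟩ := thS_U R b
  have h5 : thS (D ^ e) = e * P * D ^ e := by
    rw [thS_pow, hD]
    rcases e with _ | e
    · simp
    · simp [pow_succ]; ring
  have h6 : 2 * thS (thS R) = P * thS R + R * thS P - 2 * Q * thS Q := by
    have := congrArg thS hR
    rw [thS_mul, thS_sub, thS_mul, thS_pow, show (2 : k⟦X⟧) = ((2:ℕ) : k⟦X⟧) by norm_num, thS_natCast] at this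
    push_cast at this
    linear_combination this
  have e1 : thS ((e : k⟦X⟧) * P * D ^ e) = e * P * (e * P * D ^ e) + D ^ e * (e * thS P) := by
    rw [thS_mul, h5, thS_mul (e : k⟦X⟧), thS_natCast]; ring
  have e2 : thS (S * thS R) = S * thS (thS R) + thS R * (U * thS R) := by
    rw [thS_mul, h4]
  rw [← hU, thS_mul, h5, h3, thS_add, thS_mul, thS_mul (D ^ e), e1, e2, h5, h3]
  rw [pow_succ D e]
  generalize R ^ b = W at *
  generalize D ^ e = V at *
  generalize thS (thS R) = r2 at *
  generalize thS R = r1 at *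
  generalize thS Q = q1 at *
  generalize thS P = p1 at *
  generalize (b : k⟦X⟧) = β at *
  generalize (e : k⟦X⟧) = ε at *
  linear_combination 12 * V * W * ε * hP + 144 * ε * P * V * S * hR + 72 * V * S * h6 + 36 * V * S * P * hR
    + 6 * V * S * R * hP - 48 * V * S * Q * hQ + 36 * V * U * (2 * r1 + P * R - Q ^ 2) * hR
    + (144 * ε * P ^ 2 * V + 42 * P ^ 2 * V + 42 * Q * V) * h1 + 36 * V * P ^ 2 * (R * h2 + (β - 1) * h1)
    - 72 * V * P * Q ^ 2 * h2 - 36 * Q * U * V * hE + 36 * Q * V * (R * h2 + (β - 1) * h1)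
    + (W * V * P ^ 2 * (12 * ε + 6 * β) - 12 * S * Q ^ 2 * P * V + W * Q * V * (6 * β - 12 * ε)) * h

lemma thS2_1 (b e : ℕ) (h : 12 * (e : k⟦X⟧) + 6 * b + 5 = 0) :
    144 * thS (thS (Q * (R ^ b * D ^ e))) = Q ^ 2 * (144 * e ^ 2 * R ^ b * D ^ e
      + 144 * 432 * ((b : k⟦X⟧) * ((b : k⟦X⟧) - 1) * R ^ (b - 2)) * D ^ (e + 1)) := by
  obtain ⟨S, U, hU, h1, h2, h3, h4⟩ := thS_U R b
  have h5 : thS (D ^ e) = e * P * D ^ e := by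
    rw [thS_pow, hD]
    rcases e with _ | e
    · simp
    · simp [pow_succ]; ring
  have h6 : 2 * thS (thS R) = P * thS R + R * thS P - 2 * Q * thS Q := by
    have := congrArg thS hR
    rw [thS_mul, thS_sub, thS_mul, thS_pow, show (2 : k⟦X⟧) = ((2:ℕ) : k⟦X⟧) by norm_num, thS_natCast] at this
    push_cast at this
    linear_combination this
  have h7 : 3 * thS (thS Q) = P * thS Q + Q * thS P - thS R := by
    have := congrArg thS hQ
    rw [thS_mul, thS_sub, thS_mul, show (3 : k⟦X⟧) = ((3:ℕ) : k⟦X⟧) by norm_num, thS_natCast] at this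
    push_cast at this
    linear_combination this
  have e1 : thS ((e : k⟦X⟧) * P * D ^ e) = e * P * (e * P * D ^ e) + D ^ e * (e * thS P) := by
    rw [thS_mul, h5, thS_mul (e : k⟦X⟧), thS_natCast]; ring
  have e2 : thS (S * thS R) = S * thS (thS R) + thS R * (U * thS R) := by
    rw [thS_mul, h4]
  have e3 : thS (R ^ b * D ^ e) = R ^ b * (e * P * D ^ e) + D ^ e * (S * thS R) := by
    rw [thS_mul, h5, h3]
  have e4 : thS (thS (R ^ b * D ^ e)) = R ^ b * (e * P * (e * P * D ^ e) + D ^ e * (e * thS P))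
      + (e * P * D ^ e) * (S * thS R) + (D ^ e * (S * thS (thS R) + thS R * (U * thS R))
      + (S * thS R) * (e * P * D ^ e)) := by
    rw [e3, thS_add, thS_mul, thS_mul (D ^ e), e1, e2, h5, h3]
  rw [← hU, thS_mul, thS_add, thS_mul, thS_mul _ (thS Q), e4, e3]
  rw [pow_succ D e]
  clear e1 e2 e3 e4
  generalize R ^ b = W at *
  generalize D ^ e = V at *
  generalize thS (thS R) = r2 at *
  generalize thS (thS Q) = q2 at *
  generalize thS R = r1 at *
  generalize thS Q = q1 at *
  generalize thS P = p1 at *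
  generalize (b : k⟦X⟧) = β at *
  generalize (e : k⟦X⟧) = ε at *
  linear_combination Q * (12 * V * W * ε * hP + 144 * ε * P * V * S * hR + 72 * V * S * h6 + 36 * V * S * P * hR
    + 6 * V * S * R * hP - 48 * V * S * Q * hQ + 36 * V * U * (2 * r1 + P * R - Q ^ 2) * hR
    + (144 * ε * P ^ 2 * V + 42 * P ^ 2 * V + 42 * Q * V) * h1 + 36 * V * P ^ 2 * (R * h2 + (β - 1) * h1)
    - 72 * V * P * Q ^ 2 * h2 - 36 * Q * U * V * hE + 36 * Q * V * (R * h2 + (β - 1) * h1))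
    + 96 * V * (W * ε * P + S * r1) * hQ + 48 * V * S * (P * Q - R) * hR
    + V * (48 * P ^ 2 * Q - 48 * P * R + 48 * Q ^ 2) * h1
    + 48 * V * W * h7 + 4 * V * W * Q * hP + 16 * V * W * P * hQ - 24 * V * W * hR
    + (Q * W * V * P ^ 2 * (12 * ε + 6 * β + 4) - 12 * S * Q ^ 3 * P * V - 8 * W * R * P * V + W * Q ^ 2 * V * (6 * β - 12 * ε + 4)) * h

/-- second-order equation for the Hasse invariant, summed -/
lemma thS2_sum (l n r s : ℕ) (hr : r = 0 ∨ r = 1) (hl : (l : k⟦X⟧) = 0) (h : 12 * n + 6 * s + 4 * r + 1 = l) (hs : s = 0 ∨ s = 1) :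
    144 * thS (thS (Q ^ r * ∑ m ∈ Finset.range (n + 1), ((aH n s m : ℤ) : k⟦X⟧) * (R ^ (2 * m + s) * D ^ (n - m)))) = 0 := by
  have hsum : ∀ (f : ℕ → k⟦X⟧) N, thS (∑ m ∈ Finset.range N, f m) = ∑ m ∈ Finset.range N, thS (f m) := by
    intro f N
    induction N with
    | zero => simp [thS]
    | succ N ih => rw [Finset.sum_range_succ, Finset.sum_range_succ, thS_add, ih]
  have hintg : ∀ (a : ℤ) (f : k⟦X⟧), thS ((a : k⟦X⟧) * f) = a * thS f := by
    intro a f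
    rw [thS_mul]
    have : thS (a : k⟦X⟧) = 0 := by simp [thS]
    rw [this]; ring
  have key : ∀ m ∈ Finset.range (n + 1), 144 * thS (thS (Q ^ r * (R ^ (2 * m + s) * D ^ (n - m)))) =
      Q ^ (r + 1) * (144 * ((n - m : ℕ) : k⟦X⟧) ^ 2 * R ^ (2 * m + s) * D ^ (n - m)
      + 144 * 432 * (((2 * m + s : ℕ) : k⟦X⟧) * (((2 * m + s : ℕ) : k⟦X⟧) - 1) * R ^ (2 * m + s - 2)) * D ^ ((n - m) + 1)) := by
    intro m hm
    have hm' : m ≤ n := by simpa [Nat.lt_succ_iff] using hm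
    rcases hr with rfl | rfl
    · have := thS2_0 hP hQ hR hD hE (2 * m + s) (n - m) (by
        rw [← hl, ← h]; push_cast [hm']; ring)
      simpa using this
    · have := thS2_1 hP hQ hR hD hE (2 * m + s) (n - m) (by
        rw [← hl, ← h]; push_cast [hm']; ring)
      simpa using this
  rw [Finset.mul_sum, hsum, hsum, Finset.mul_sum]
  have : ∀ m ∈ Finset.range (n + 1), 144 * thS (thS (Q ^ r * (((aH n s m : ℤ) : k⟦X⟧) * (R ^ (2 * m + s) * D ^ (n - m))))) =
      144 * Q ^ (r + 1) * (((aH n s m : ℤ) : k⟦X⟧) * ((n - m : ℕ) : k⟦X⟧) ^ 2 * R ^ (2 * m + s) * D ^ (n - m))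
      + 144 * Q ^ (r + 1) * (432 * ((aH n s m : ℤ) : k⟦X⟧) * (((2 * m + s : ℕ) : k⟦X⟧) * (((2 * m + s : ℕ) : k⟦X⟧) - 1) * R ^ (2 * m + s - 2)) * D ^ ((n - m) + 1)) := by
    intro m hm
    rw [mul_left_comm, hintg, hintg, mul_left_comm, key m hm]
    ring
  rw [Finset.sum_congr rfl this, Finset.sum_add_distrib, ← Finset.mul_sum, ← Finset.mul_sum, ← mul_add,
    Finset.sum_range_succ _ n, Finset.sum_range_succ' _ n]
  have z1 : ((n - n : ℕ) : k⟦X⟧) = 0 := by simp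
  have z2 : (((2 * 0 + s : ℕ) : k⟦X⟧) * (((2 * 0 + s : ℕ) : k⟦X⟧) - 1)) = 0 := by
    rcases hs with rfl | rfl <;> simp
  rw [z1, z2]
  have : ∑ m ∈ Finset.range n, (((aH n s m : ℤ) : k⟦X⟧) * ((n - m : ℕ) : k⟦X⟧) ^ 2 * R ^ (2 * m + s) * D ^ (n - m))
      + ∑ m ∈ Finset.range n, (432 * ((aH n s (m + 1) : ℤ) : k⟦X⟧) * (((2 * (m + 1) + s : ℕ) : k⟦X⟧) * (((2 * (m + 1) + s : ℕ) : k⟦X⟧) - 1) * R ^ (2 * (m + 1) + s - 2)) * D ^ ((n - (m + 1)) + 1)) = 0 := by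
    rw [← Finset.sum_add_distrib]
    refine Finset.sum_eq_zero fun m hm => ?_
    have hm' : m < n := by simpa using hm
    have e := congrArg (Int.cast : ℤ → k⟦X⟧) (aH_rec (s := s) hm')
    rw [show n - (m + 1) + 1 = n - m by omega, show 2 * (m + 1) + s - 2 = 2 * m + s by omega]
    rw [Int.cast_mul, Int.cast_mul, Int.cast_mul, Int.cast_mul, Int.cast_neg, Int.cast_pow] at e
    rw [Int.cast_natCast, Int.cast_natCast, Int.cast_natCast] at e
    push_cast at e ⊢
    linear_combination R ^ (2 * m + s) * D ^ (n - m) * e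
  linear_combination (144 * Q ^ (r + 1)) * this
end ode
end

section
open Complex PowerSeries

/-- the supersingular polynomial to the 12th power, in terms of j -/
noncomputable def hpol (κ : Type*) [Field κ] (n r s : ℕ) : Polynomial κ :=
  Polynomial.X ^ (4 * r) * (Polynomial.X - Polynomial.C 1728) ^ (6 * s) *
    (∑ m ∈ Finset.range (n + 1), Polynomial.C ((aH n s m : ℤ) : κ) * (Polynomial.X - Polynomial.C 1728) ^ m) ^ 12

lemma natC (κ : Type*) [Field κ] (a : ℕ) [a.AtLeastTwo] : C (OfNat.ofNat a : κ) = (OfNat.ofNat a : κ⟦X⟧) :=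
  map_ofNat (C (R := κ)) a

lemma zkn (κ : Type*) [Field κ] (a : ℕ) [a.AtLeastTwo] : zk κ (OfNat.ofNat a) = OfNat.ofNat a :=
  map_ofNat (zk κ) a

lemma hasse_pow {κ : Type} [Field κ] {l n r s : ℕ} [CharP κ l] (hp : l.Prime) (h5 : 5 < l) (hr : r = 0 ∨ r = 1)
    (hs : s = 0 ∨ s = 1) (h : 12 * n + 6 * s + 4 * r + 1 = l) {P Q R D : κ⟦X⟧}
    (hP : 12 * thS P = P ^ 2 - Q) (hQ : 3 * thS Q = P * Q - R)
    (hR : 2 * thS R = P * R - Q ^ 2) (hD : thS D = D * P) (hE : 1728 * D = Q ^ 3 - R ^ 2)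
    (hQ0 : constantCoeff Q = 1) (hR0 : constantCoeff R = 1) (hD0 : constantCoeff D = 0) :
    ∃ g : κ⟦X⟧, (Q ^ r * ∑ m ∈ Finset.range (n + 1), ((aH n s m : ℤ) : κ⟦X⟧) * (R ^ (2 * m + s) * D ^ (n - m))) = 1 + X ^ l * g := by
  have h0 : (l : κ⟦X⟧) = 0 := by
    have : (l : κ) = 0 := CharP.cast_eq_zero κ l
    rw [← map_natCast (C (R := κ)), this, map_zero]
  have h1 := thS2_sum hP hQ hR hD hE l n r s hr h0 h hs
  set H := Q ^ r * ∑ m ∈ Finset.range (n + 1), ((aH n s m : ℤ) : κ⟦X⟧) * (R ^ (2 * m + s) * D ^ (n - m)) with hH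
  have hc : constantCoeff H = 1 := by
    rw [hH, map_mul, map_pow, hQ0, one_pow, one_mul, map_sum, Finset.sum_range_succ, Finset.sum_eq_zero]
    · simp [aH, hR0]
    · intro m hm
      have : n - m ≠ 0 := by have := Finset.mem_range.mp hm; omega
      rw [map_mul, map_mul, map_pow, map_pow, hD0, zero_pow this]; ring
  have key : X ^ l ∣ H - 1 := by
    rw [X_pow_dvd_iff]
    intro m hm
    rcases m with _ | m
    · rw [map_sub, coeff_zero_eq_constantCoeff_apply, hc]; simp
    · rw [map_sub, coeff_one, if_neg (by omega), sub_zero]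
      have h2 := congrArg (coeff (m + 1)) h1
      rw [← natC κ 144, coeff_C_mul, thS_coeff, thS_coeff, map_zero] at h2
      have n1 : ((m + 1 : ℕ) : κ) ≠ 0 := by
        intro e
        have := (CharP.cast_eq_zero_iff κ l _).mp e
        exact absurd (Nat.le_of_dvd (by omega) this) (by omega)
      have n2 : (144 : κ) ≠ 0 := by
        intro e
        have e' : ((144 : ℕ) : κ) = 0 := by exact_mod_cast e
        have := (CharP.cast_eq_zero_iff κ l _).mp e'
        rw [show 144 = 2 ^ 4 * 3 ^ 2 by norm_num, hp.dvd_mul] at this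
        rcases this with h | h
        · exact absurd (Nat.le_of_dvd (by omega) (hp.dvd_of_dvd_pow h)) (by omega)
        · exact absurd (Nat.le_of_dvd (by omega) (hp.dvd_of_dvd_pow h)) (by omega)
      simpa only [mul_eq_zero, n1, n2, false_or] using h2
  obtain ⟨g, hg⟩ := key
  exact ⟨g, by linear_combination hg⟩

theorem hpol_eq {κ : Type} [Field κ] {l n r s : ℕ} [CharP κ l] (hp : l.Prime) (h5 : 5 < l) (hr : r = 0 ∨ r = 1)
    (hs : s = 0 ∨ s = 1) (h : 12 * n + 6 * s + 4 * r + 1 = l) {f : Polynomial κ} (hf : f.natDegree ≤ l - 1)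
    (hf2 : hmg (l - 1) f (zk κ JZ) = zk κ epI ^ (24 * (l - 1))) : f = hpol κ n r s := by
  have mm : ∀ p : ℤ⟦X⟧, zk κ (thS p) = thS (zk κ p) := fun p => thS_map _ p
  have kn : ∀ a : ℕ, zk κ (a : ℤ⟦X⟧) = a := fun a => map_natCast _ a
  have hP : 12 * thS (zk κ E2Z) = zk κ E2Z ^ 2 - zk κ E4Z := by
    have := congrArg (zk κ) th_E2Z
    rw [map_mul, zkn κ 12] at this
    simpa [mm] using this
  have hQ : 3 * thS (zk κ E4Z) = zk κ E2Z * zk κ E4Z - zk κ E6Z := by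
    have := congrArg (zk κ) th_E4Z
    rw [map_mul, zkn κ 3] at this
    simpa [mm] using this
  have hR : 2 * thS (zk κ E6Z) = zk κ E2Z * zk κ E6Z - zk κ E4Z ^ 2 := by
    have := congrArg (zk κ) th_E6Z
    rw [map_mul, zkn κ 2] at this
    simpa [mm] using this
  have hD : thS (zk κ DCZ) = zk κ DCZ * zk κ E2Z := by
    have := congrArg (zk κ) th_DCZ
    simpa [mm] using this
  have hE : 1728 * zk κ DCZ = zk κ E4Z ^ 3 - zk κ E6Z ^ 2 := by
    have := congrArg (zk κ) DCZ_E
    rw [map_mul, zkn κ 1728] at this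
    simpa [mm] using this
  have hX : zk κ DCZ * zk κ epI ^ 24 = X := by
    have : DCZ * epI ^ 24 = X := by
      rw [DCZ, mul_assoc, ← mul_pow, epI_mul]; simp
    rw [← map_pow, ← map_mul, this]; simp [zk]
  have hJ : zk κ JZ = zk κ E4Z ^ 3 * zk κ epI ^ 24 := by simp [JZ]
  have hD0 : constantCoeff (zk κ DCZ) = 0 := by simp [zk, DCZ]
  obtain ⟨g, hg⟩ := hasse_pow hp h5 hr hs h hP hQ hR hD hE (zk_const E4Z_0) (zk_const E6Z_0) hD0
  have hJ0 : constantCoeff (zk κ JZ) = 1 := zk_const JZ_const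
  generalize zk κ JZ = J at *
  generalize zk κ E4Z = Q at *
  generalize zk κ E6Z = R at *
  generalize zk κ DCZ = D at *
  generalize zk κ epI = ei at *
  have d1 : (Polynomial.X : Polynomial κ).natDegree ≤ 1 := Polynomial.natDegree_X_le
  have d2 : (Polynomial.X - Polynomial.C (1728 : κ)).natDegree ≤ 1 := Polynomial.natDegree_X_sub_C_le _
  have d3 : (∑ m ∈ Finset.range (n + 1), Polynomial.C ((aH n s m : ℤ) : κ) * (Polynomial.X - Polynomial.C 1728) ^ m).natDegree ≤ n := by
    refine Polynomial.natDegree_sum_le_of_forall_le _ _ fun m hm => ?_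
    have := Finset.mem_range.mp hm
    refine (Polynomial.natDegree_C_mul_le _ _).trans ?_
    rw [Polynomial.natDegree_pow, Polynomial.natDegree_X_sub_C]; omega
  have k1 : hmg 1 Polynomial.X J = J := by
    rw [← Polynomial.monomial_one_one_eq_X, hmg_monomial le_rfl]; simp
  have k2 : hmg 1 (Polynomial.X - Polynomial.C (1728 : κ)) J = R ^ 2 * ei ^ 24 := by
    rw [hmg_sub, k1, ← Polynomial.monomial_zero_left, hmg_monomial (Nat.zero_le _), hJ, ← hX,
      natC κ 1728]
    linear_combination (-ei ^ 24) * hE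
  have k3 : hmg n (∑ m ∈ Finset.range (n + 1), Polynomial.C ((aH n s m : ℤ) : κ) * (Polynomial.X - Polynomial.C 1728) ^ m) J
      = (∑ m ∈ Finset.range (n + 1), ((aH n s m : ℤ) : κ⟦X⟧) * (R ^ (2 * m) * D ^ (n - m))) * (ei ^ 24) ^ n := by
    rw [hmg_sum, Finset.sum_mul]
    refine Finset.sum_congr rfl fun m hm => ?_
    have hm' : m ≤ n := by have := Finset.mem_range.mp hm; omega
    have e1 := hmg_pow d2 J m
    rw [mul_one, k2] at e1
    have e2 := hmg_mul (Polynomial.natDegree_C_mul_le ((aH n s m : ℤ) : κ) 1 |>.trans (by simp) : (Polynomial.C ((aH n s m : ℤ) : κ) * 1).natDegree ≤ n - m)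
      ((Polynomial.natDegree_pow_le_of_le m d2) : ((Polynomial.X - Polynomial.C (1728:κ)) ^ m).natDegree ≤ m * 1) J
    rw [mul_one, mul_one, e1, ← Polynomial.monomial_zero_left, hmg_monomial (Nat.zero_le _), Nat.sub_add_cancel hm', ← hX] at e2
    rw [← Polynomial.monomial_zero_left, e2, mul_pow D, show C ((aH n s m : ℤ) : κ) = ((aH n s m : ℤ) : κ⟦X⟧) by simp]
    rw [Nat.sub_zero]
    have : (ei ^ 24) ^ n = (ei ^ 24) ^ (n - m) * (ei ^ 24) ^ m := by rw [← pow_add]; congr 1; omega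
    rw [this]; ring
  have dd1 : (Polynomial.X ^ (4 * r) : Polynomial κ).natDegree ≤ 4 * r * 1 := Polynomial.natDegree_pow_le_of_le _ d1
  have dd2 : ((Polynomial.X - Polynomial.C (1728 : κ)) ^ (6 * s)).natDegree ≤ 6 * s * 1 := Polynomial.natDegree_pow_le_of_le _ d2
  have dd3 := Polynomial.natDegree_pow_le_of_le 12 d3
  have hl1 : l - 1 = 4 * r * 1 + 6 * s * 1 + 12 * n := by omega
  have dd : (hpol κ n r s).natDegree ≤ l - 1 := by
    rw [hl1, hpol]
    exact Polynomial.natDegree_mul_le_of_le (Polynomial.natDegree_mul_le_of_le dd1 dd2) dd3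
  have kk : hmg (l - 1) (hpol κ n r s) J = ei ^ (24 * (l - 1)) * (1 + X ^ l * g) ^ 12 := by
    rw [← hg, pow_mul, hl1, hpol, hmg_mul (Polynomial.natDegree_mul_le_of_le dd1 dd2) dd3, hmg_mul dd1 dd2,
      hmg_pow d1, hmg_pow d2, hmg_pow d3, k1, k2, k3, hJ]
    have : ∑ m ∈ Finset.range (n + 1), ((aH n s m : ℤ) : κ⟦X⟧) * (R ^ (2 * m + s) * D ^ (n - m)) =
        R ^ s * ∑ m ∈ Finset.range (n + 1), ((aH n s m : ℤ) : κ⟦X⟧) * (R ^ (2 * m) * D ^ (n - m)) := by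
      rw [Finset.mul_sum]
      refine Finset.sum_congr rfl fun m hm => ?_
      ring
    rw [this]
    generalize ∑ m ∈ Finset.range (n + 1), ((aH n s m : ℤ) : κ⟦X⟧) * (R ^ (2 * m) * D ^ (n - m)) = sg
    generalize ei ^ 24 = w
    ring
  refine tri_inj hJ0 hf dd fun m hm => ?_
  rw [hf2, kk]
  obtain ⟨g', hg'⟩ : ∃ g', (1 + X ^ l * g) ^ 12 = 1 + X ^ l * g' := by
    have : (1 + X ^ l * g) - 1 ∣ (1 + X ^ l * g) ^ 12 - 1 ^ 12 := sub_dvd_pow_sub_pow _ _ _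
    obtain ⟨a, ha⟩ := this
    exact ⟨g * a, by linear_combination ha⟩
  rw [hg', mul_add, mul_one, map_add, mul_left_comm, coeff_X_pow_mul', if_neg (by omega), add_zero]
end

section
open Polynomial



section
/-- parameters -/
def rr (l : ℕ) : ℕ := if l % 3 = 2 then 1 else 0
/-- parameters -/
def ss (l : ℕ) : ℕ := if l % 4 = 3 then 1 else 0

lemma rr_or (l : ℕ) : rr l = 0 ∨ rr l = 1 := by unfold rr; split <;> simp
lemma ss_or (l : ℕ) : ss l = 0 ∨ ss l = 1 := by unfold ss; split <;> simp

lemma l_eq {l : ℕ} (hp : l.Prime) (h5 : 5 < l) : 12 * (l / 12) + 6 * ss l + 4 * rr l + 1 = l := by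
  have h2 : l % 2 ≠ 0 := fun h => by
    have := (Nat.prime_dvd_prime_iff_eq Nat.prime_two hp).mp (Nat.dvd_of_mod_eq_zero h); omega
  have h3 : l % 3 ≠ 0 := fun h => by
    have := (Nat.prime_dvd_prime_iff_eq Nat.prime_three hp).mp (Nat.dvd_of_mod_eq_zero h); omega
  unfold rr ss
  split <;> split <;> omega

/-- supersingularity in terms of `y` -/
def SSy (κ : Type*) [Field κ] (l : ℕ) (y : κ) : Prop :=
  (hpol κ (l / 12) (rr l) (ss l)).eval ((y ^ 2 + 10 * y + 5) ^ 3 / y) = 0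

lemma hasse_eval {κ : Type*} [Field κ] (l : ℕ) (f : ZMod l →+* κ) (x : κ) :
    (hasseInvariant5 l).eval₂ f x = (x ^ 4 + 12 * x ^ 3 + 14 * x ^ 2 - 12 * x + 1) ^ rr l *
      ((x ^ 2 + 1) * (x ^ 4 + 18 * x ^ 3 + 74 * x ^ 2 - 18 * x + 1)) ^ ss l *
      ∑ m ∈ Finset.range (l / 12 + 1), ((aH (l / 12) (ss l) m : ℤ) : κ) *
        ((x ^ 4 + 12 * x ^ 3 + 14 * x ^ 2 - 12 * x + 1) ^ 3 - 1728 * (x ^ 5 * (1 - 11 * x - x ^ 2))) ^ m *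
        (x ^ 5 * (1 - 11 * x - x ^ 2)) ^ (l / 12 - m) := by
  have e : ∀ (a : ℕ) [a.AtLeastTwo], (OfNat.ofNat a : Polynomial (ZMod l)).eval₂ f x = OfNat.ofNat a := fun a _ => by
    rw [← Polynomial.coe_eval₂RingHom, map_ofNat]
  simp only [hasseInvariant5, eval₂_mul, eval₂_pow, eval₂_add, eval₂_sub, eval₂_X, eval₂_one, eval₂_finsetSum,
    eval₂_natCast, eval₂_neg, e]
  congr 1
  refine Finset.sum_congr rfl fun m hm => ?_
  rw [aH]; push_cast; rfl

lemma hasse_iff {κ : Type*} [Field κ] (l : ℕ) (f : ZMod l →+* κ) {x y : κ} (hx : x ≠ 0) (hy : y ≠ 0)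
    (h : y * x = 1 - 11 * x - x ^ 2) : (hasseInvariant5 l).eval₂ f x = 0 ↔ SSy κ l y := by
  rw [hasse_eval, SSy, hpol]
  set c4 := x ^ 4 + 12 * x ^ 3 + 14 * x ^ 2 - 12 * x + 1 with hc4
  set c6 := (x ^ 2 + 1) * (x ^ 4 + 18 * x ^ 3 + 74 * x ^ 2 - 18 * x + 1) with hc6
  set D := x ^ 5 * (1 - 11 * x - x ^ 2) with hD
  have hD' : D = x ^ 6 * y := by rw [hD, ← h]; ring
  have hD0 : D ≠ 0 := by rw [hD']; positivity
  have e4 : c4 = x ^ 2 * (y ^ 2 + 10 * y + 5) := by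
    rw [hc4]; linear_combination (-(y * x) - (1 - 11 * x - x ^ 2) - 10 * x) * h
  have ej : (y ^ 2 + 10 * y + 5) ^ 3 / y = c4 ^ 3 / D := by
    rw [hD', e4]; field_simp
  have e6 : c4 ^ 3 - 1728 * D = c6 ^ 2 := by rw [hc4, hD, hc6]; ring
  have ej2 : c4 ^ 3 / D - 1728 = c6 ^ 2 / D := by rw [← e6]; field_simp
  have es : ∑ m ∈ Finset.range (l / 12 + 1), ((aH (l / 12) (ss l) m : ℤ) : κ) * (c4 ^ 3 - 1728 * D) ^ m * D ^ (l / 12 - m)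
      = D ^ (l / 12) * ∑ m ∈ Finset.range (l / 12 + 1), ((aH (l / 12) (ss l) m : ℤ) : κ) * (c6 ^ 2 / D) ^ m := by
    rw [Finset.mul_sum]
    refine Finset.sum_congr rfl fun m hm => ?_
    have hm' : m ≤ l / 12 := by have := Finset.mem_range.mp hm; omega
    rw [e6, div_pow, ← Nat.sub_add_cancel hm', pow_add, Nat.add_sub_cancel]
    field_simp
  have e1728 : ((1728 : κ[X]).eval (c4 ^ 3 / D)) = 1728 := by simp
  rw [ej, es]
  simp only [eval_mul, eval_pow, eval_X, eval_sub, eval_C, eval_finset_sum, ej2]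
  generalize ∑ m ∈ Finset.range (l / 12 + 1), ((aH (l / 12) (ss l) m : ℤ) : κ) * (c6 ^ 2 / D) ^ m = σ
  rcases rr_or l with hr | hr <;> rcases ss_or l with hs | hs <;> rw [hr, hs] <;> simp [hD0]
end
end

section
open Complex
open UpperHalfPlane hiding I
open scoped MatrixGroups ModularForm Topology

lemma ell_deriv {e : M2} (he : G5 e) {p : ℂ} (hp : 0 < p.im) (h1 : mo e p = p) (h2 : dn e p = I) :
    yf p ^ 2 + 22 * yf p + 125 = 0 := by
  by_contra hne
  have h0 := thy_ne hp hne
  have d1 : HasDerivAt yf (deriv yf p) (mo e p) := by rw [h1]; exact (yf_diff hp).hasDerivAt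
  have d2 := d1.comp p (mo_deriv he.pos hp)
  have d3 : HasDerivAt yf (deriv yf p * ((e.det : ℂ) / dn e p ^ 2)) p := by
    refine d2.congr_of_eventuallyEq ?_
    filter_upwards [(isOpen_lt continuous_const Complex.continuous_im).mem_nhds hp] with z hz
    exact (yf_inv he hz).symm
  have := d3.deriv
  rw [h2, he.1, I_sq] at this
  apply h0
  have h3 : 2 * deriv yf p = 0 := by
    push_cast at this
    linear_combination this
  simpa using h3

lemma tr0_false {l : ℕ} (hl : l.Prime) (hl5 : l ≠ 5) {z : ℂ} (hz : 0 < z.im) {a b d : ℤ} (h : CM l a b b d z)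
    {M : M2} (hM : M.det = 1) (ht : M.trace = 0) (hf : mo M z = z) : False := by
  have ha := h.a_ne hl hl5 hz
  have hd := dn_ne (by rw [hM]; norm_num : 0 < M.det) hz
  rw [mo_def, div_eq_iff hd, dn] at hf
  rw [Matrix.trace_fin_two] at ht
  rw [Matrix.det_fin_two] at hM
  obtain ⟨h1, h2⟩ := h
  generalize M 0 0 = p at *
  generalize M 0 1 = q at *
  generalize M 1 0 = r at *
  have h11 : M 1 1 = -p := by omega
  rw [h11] at hf hM
  push_cast at hf h2
  have him := congrArg Complex.im hf
  have hre := congrArg Complex.re hf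
  have him2 := congrArg Complex.im h2
  have hre2 := congrArg Complex.re h2
  simp [sq] at him hre him2 hre2
  have hz' := hz.ne'
  have e1 : (p : ℝ) = r * z.re := by
    have : z.im * ((p : ℝ) - r * z.re) = 0 := by linear_combination him / 2
    rcases mul_eq_zero.mp this with h | h
    · exact absurd h hz'
    · linarith
  have e2 : (a : ℝ) * z.re = -b := by
    have : z.im * ((a : ℝ) * z.re + b) = 0 := by linear_combination him2 / 10
    rcases mul_eq_zero.mp this with h | h
    · exact absurd h hz'
    · linarith
  have e3 : (a : ℤ) * p = -b * r := by
    have : (a : ℝ) * p = -b * r := by rw [e1]; linear_combination r * e2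
    exact_mod_cast this
  have e4 : 5 * a * q = - d * r := by
    have : (5 * a * q : ℝ) = - d * r := by
      have e3' : (a : ℝ) * p = -b * r := by exact_mod_cast e3
      linear_combination 5 * a * hre + r * hre2 - 10 * z.re * e3'
    exact_mod_cast this
  have key : (l : ℤ) * r ^ 2 = 5 * a ^ 2 := by
    rw [← h1]
    linear_combination (5 * a ^ 2) * hM + 5 * (a * p - b * r) * e3 + a * r * e4
  have hr : r ≠ 0 := by
    rintro rfl
    have : a ^ 2 = 0 := by linarith
    exact ha (pow_eq_zero_iff (two_ne_zero) |>.mp this)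
  have hdv : r ^ 2 ∣ (5 * a) ^ 2 := ⟨5 * l, by linear_combination (-5) * key⟩
  rw [Int.pow_dvd_pow_iff two_ne_zero] at hdv
  obtain ⟨m, hm⟩ := hdv
  have hm2 : (5 * l : ℤ) = m ^ 2 := by
    have : r ^ 2 * (5 * l - m ^ 2 : ℤ) = 0 := by linear_combination 5 * key + (5 * a + r * m) * hm
    rcases mul_eq_zero.mp this with h | h
    · exact absurd (pow_eq_zero_iff two_ne_zero |>.mp h) hr
    · linarith
  have hlp : Prime (l : ℤ) := Nat.prime_iff_prime_int.mp hl
  obtain ⟨k, rfl⟩ : (l : ℤ) ∣ m := hlp.dvd_of_dvd_pow (n := 2) ⟨5, by rw [← hm2]; ring⟩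
  have h5 : (5 : ℤ) = l * k ^ 2 := by
    have : (l : ℤ) * (5 - l * k ^ 2) = 0 := by linear_combination hm2
    rcases mul_eq_zero.mp this with h | h
    · exact absurd h hlp.ne_zero
    · linarith
  have : (l : ℤ) ∣ ((5 : ℕ) : ℤ) := ⟨k ^ 2, by exact_mod_cast h5⟩
  exact hl5 ((Nat.prime_dvd_prime_iff_eq hl (by norm_num)).mp (Int.natCast_dvd_natCast.mp this))

lemma ell_ne {l : ℕ} (hl : l.Prime) (hl5 : l ≠ 5) {z : ℂ} (hz : 0 < z.im) {a b d : ℤ} (h : CM l a b b d z) :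
    yf z ^ 2 + 22 * yf z + 125 ≠ 0 := by
  intro h0
  have h1 := ell_deriv G5_e1 e1_fix.1 e1_fix.2.1 e1_fix.2.2
  have h2 : mo Wm ((2 + I) / 5) = (-2 + I) / 5 := by
    rw [mo_W]
    have : (2 + I : ℂ) ≠ 0 := fun h => by simpa using congrArg Complex.re h
    field_simp
    ring_nf; simp; ring
  have h3 := yf_W' e1_fix.1
  rw [h2, eq_div_iff (yf_ne e1_fix.1)] at h3
  have hcase : (yf z - yf ((2 + I) / 5)) * (yf z - yf ((-2 + I) / 5)) = 0 := by
    have : yf ((2 + I) / 5) * ((yf z - yf ((2 + I) / 5)) * (yf z - yf ((-2 + I) / 5))) = 0 := by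
      linear_combination yf ((2 + I) / 5) * h0 - yf z * h1 + (yf ((2 + I) / 5) - yf z) * h3
    exact (mul_eq_zero.mp this).resolve_left (yf_ne e1_fix.1)
  have fin : ∀ {e : M2} {p : ℂ}, G5 e → 0 < p.im → mo e p = p → e.trace = 0 → yf p = yf z → False := by
    intro e p he hp hf ht hy
    obtain ⟨γ, hγ, hγz⟩ := y_inj hp hz hy
    have hγa : γ.adjugate * γ = 1 := by rw [Matrix.adjugate_mul, hγ.1, one_smul]
    refine tr0_false hl hl5 hz h (M := γ * e * γ.adjugate) (((hγ.mul he).mul hγ.adj).1) ?_ ?_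
    · rw [Matrix.mul_assoc, Matrix.trace_mul_comm, Matrix.mul_assoc, hγa, Matrix.mul_one, ht]
    · have h4 : mo γ.adjugate z = p := by
        rw [← hγz, ← mo_mul hγ.adj.pos hγ.pos hp, hγa, mo_one]
      rw [mo_mul (hγ.mul he).pos hγ.adj.pos hz, h4, mo_mul hγ.pos he.pos hp, hf, hγz]
  rcases mul_eq_zero.mp hcase with h | h
  · exact fin G5_e1 e1_fix.1 e1_fix.2.1 (by simp [e1m, Matrix.trace_fin_two]) (sub_eq_zero.mp h).symm
  · exact fin G5_e2 e2_fix.1 e2_fix.2.1 (by simp [e2m, Matrix.trace_fin_two]) (sub_eq_zero.mp h).symm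

/-- the vanishing factor has nonzero derivative -/
lemma fac_deriv {l : ℕ} (hl : l.Prime) (hl5 : l ≠ 5) {z : ℂ} (hz : 0 < z.im) {a b d : ℤ} (h : CM l a b b d z)
    {i : Option (Fin l)} {γ : M2} (hγ : G5 γ) (hB : cmB a b b d = γ * Hm l i) :
    deriv (fun w => 125 - yf w * yf (mo (Hm l i) w)) z ≠ 0 := by
  have hy' := thy_ne hz (ell_ne hl hl5 hz h)
  have hH := Hm_pos hl.ne_zero i
  have hBd : (cmB a b b d).det = l := by rw [cmB_det]; exact h.1
  have hBp : 0 < (cmB a b b d).det := by rw [hBd]; exact_mod_cast hl.pos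
  set A : M2 := Wm * cmB a b b d with hA
  have hAd : A.det = 5 * l := by rw [hA, Matrix.det_mul, Wm_det, hBd]
  have hAp : 0 < A.det := by rw [hAd]; have := hl.pos; positivity
  have hA' : A = !![-5 * b, -d; 5 * a, 5 * b] := by
    rw [hA, Wm, cmB]; ext i j; fin_cases i <;> fin_cases j <;> simp [Matrix.mul_apply, Fin.sum_univ_two]
  have hdn : dn A z = 5 * a * z + 5 * b := by rw [hA', dn]; simp
  have hdn0 := dn_ne hAp hz
  have hAz : mo A z = z := by
    rw [mo_def, div_eq_iff hdn0, hdn, hA']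
    simp
    linear_combination (-1) * h.2
  have hdn2 : dn A z ^ 2 = -(5 * l) := by
    have h1 : ((a * d - 5 * b * b : ℤ) : ℂ) = l := by rw [h.1]; simp
    push_cast at h1
    rw [hdn]; linear_combination 5 * a * h.2 - 5 * h1
  have hk : HasDerivAt (fun w => yf (mo A w)) (-deriv yf z) z := by
    have d1 : HasDerivAt yf (deriv yf z) (mo A z) := by rw [hAz]; exact (yf_diff hz).hasDerivAt
    have d2 := d1.comp z (mo_deriv hAp hz)
    rw [hdn2, hAd] at d2
    have hl0 : (l : ℂ) ≠ 0 := by exact_mod_cast hl.ne_zero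
    have : deriv yf z * (((5 * l : ℤ) : ℂ) / (-(5 * l : ℂ))) = - deriv yf z := by
      push_cast; field_simp
    rw [this] at d2
    exact d2
  have hF : HasDerivAt (fun w => 125 - yf w * (125 / yf (mo A w)))
      (-(deriv yf z * (125 / yf (mo A z)) + yf z * ((0 * yf (mo A z) - 125 * (-deriv yf z)) / yf (mo A z) ^ 2))) z := by
    have hne : yf (mo A z) ≠ 0 := yf_ne (mo_up hAp hz)
    have := ((yf_diff hz).hasDerivAt.mul ((hasDerivAt_const z (125 : ℂ)).div hk hne)).const_sub 125
    exact this
  have heq : (fun w => 125 - yf w * yf (mo (Hm l i) w)) =ᶠ[𝓝 z] (fun w => 125 - yf w * (125 / yf (mo A w))) := by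
    filter_upwards [(isOpen_lt continuous_const Complex.continuous_im).mem_nhds hz] with w hw
    have e1 : yf (mo (cmB a b b d) w) = yf (mo (Hm l i) w) := by
      rw [hB, mo_mul hγ.pos hH hw, yf_inv hγ (mo_up hH hw)]
    have e2 : yf (mo A w) = 125 / yf (mo (cmB a b b d) w) := by
      rw [hA, mo_mul Wm_pos hBp hw, yf_W' (mo_up hBp hw)]
    have hne := yf_ne (mo_up hBp hw)
    rw [e2, e1]
    rw [e1] at hne
    field_simp
  rw [heq.deriv_eq, hF.deriv, hAz]
  have hne := yf_ne hz
  have : -(deriv yf z * (125 / yf z) + yf z * ((0 * yf z - 125 * (-deriv yf z)) / yf z ^ 2)) = -250 * deriv yf z / yf z := by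
    field_simp; ring
  rw [this]
  simp [hne, hy']

/-- two supersingular CM structures at the same point give the same index -/
lemma cm_index {l : ℕ} (hl : l.Prime) (hl5 : l ≠ 5) {z : ℂ} (hz : 0 < z.im) {a b d a' b' d' : ℤ} (h : CM l a b b d z)
    (h' : CM l a' b' b' d' z) {i i' : Option (Fin l)} {γ γ' : M2} (hγ : G5 γ) (hB : cmB a b b d = γ * Hm l i)
    (hγ' : G5 γ') (hB' : cmB a' b' b' d' = γ' * Hm l i') : i = i' := by
  have ha := h.a_ne hl hl5 hz
  have h1 := h.1
  have h1' := h'.1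
  have h2 := h.2
  have h2' := h'.2
  have him := congrArg Complex.im h2
  have hre := congrArg Complex.re h2
  have him2 := congrArg Complex.im h2'
  have hre2 := congrArg Complex.re h2'
  simp [sq] at him hre him2 hre2
  have e1 : (a : ℝ) * z.re = -b := by
    have : z.im * ((a : ℝ) * z.re + b) = 0 := by linear_combination him / 10
    rcases mul_eq_zero.mp this with h | h
    · exact absurd h hz.ne'
    · linarith
  have e2 : (a' : ℝ) * z.re = -b' := by
    have : z.im * ((a' : ℝ) * z.re + b') = 0 := by linear_combination him2 / 10
    rcases mul_eq_zero.mp this with h | h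
    · exact absurd h hz.ne'
    · linarith
  have f1 : a' * b = a * b' := by
    have : (a' * b : ℝ) = a * b' := by linear_combination a' * e1 - a * e2
    exact_mod_cast this
  have f2 : a' * d = a * d' := by
    have f1' : (a' * b : ℝ) = a * b' := by exact_mod_cast f1
    have : (a' * d : ℝ) = a * d' := by linear_combination a' * hre - a * hre2 - 10 * z.re * f1'
    exact_mod_cast this
  have f3 : a' ^ 2 = a ^ 2 := by
    have hl0 : (l : ℤ) ≠ 0 := by exact_mod_cast hl.ne_zero
    apply mul_left_cancel₀ hl0
    linear_combination (-a' ^ 2) * h1 + a ^ 2 * h1' + a * a' * f2 - 5 * (a' * b + a * b') * f1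
  have hadj : γ.adjugate * γ = 1 := by rw [Matrix.adjugate_mul, hγ.1, one_smul]
  have hi : Hm l i = γ.adjugate * cmB a b b d := by rw [hB, ← Matrix.mul_assoc, hadj, Matrix.one_mul]
  rcases sq_eq_sq_iff_eq_or_eq_neg.mp f3 with h | h
  · subst h
    have g1 := mul_left_cancel₀ ha f1
    have g2 := mul_left_cancel₀ ha f2
    refine hecke_uniq hl (γ := γ.adjugate * γ') ?_
    rw [hi, g1, g2, hB', Matrix.mul_assoc]
  · subst h
    have g1 : b = -b' := mul_left_cancel₀ ha (by linarith)
    have g2 : d = -d' := mul_left_cancel₀ ha (by linarith)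
    refine hecke_uniq hl (γ := -(γ.adjugate * γ')) ?_
    have : cmB a b b d = - cmB (-a) b' b' d' := by
      rw [g1, g2]; ext i j; fin_cases i <;> fin_cases j <;> simp [cmB]
    rw [hi, this, hB', Matrix.neg_mul, Matrix.mul_neg, Matrix.mul_assoc]
end

section
open Complex
open UpperHalfPlane hiding I
open scoped MatrixGroups ModularForm Topology

lemma OO_of_root {G : Polynomial OO} (hG : G.Monic) {w : ℂ} (h : (G.map (algebraMap OO ℂ)).eval w = 0) :
    ∃ y : OO, w = y := by
  have h1 : IsIntegral OO w := ⟨G, hG, by rwa [← Polynomial.eval_map]⟩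
  have h2 : IsIntegral ℤ w := isIntegral_trans (A := OO) w h1
  exact ⟨⟨w, h2⟩, rfl⟩

lemma Gf_W_zero {l : ℕ} (hl : l.Prime) (hl5 : l ≠ 5) {z : ℂ} (hz : 0 < z.im) (h : Gf l z = 0) : Gf l (mo Wm z) = 0 := by
  rw [Gf, Finset.prod_eq_zero_iff] at h
  obtain ⟨i, hi, h0⟩ := h
  rw [Gf_W hl hl5 hz]
  refine Finset.prod_eq_zero hi ?_
  have n1 := yf_ne hz
  have n2 := yf_ne (mo_up (Hm_pos hl.ne_zero i) hz)
  field_simp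
  linear_combination (-125) * h0

lemma OO_y {l : ℕ} (hl : l.Prime) (h5 : 5 < l) {z : ℂ} (hz : 0 < z.im) (h : Gf l z = 0) :
    ∃ y y' : OO, yf z = y ∧ y * y' = 125 ∧ yf (mo Wm z) = y' := by
  obtain ⟨G, -, hG, hev, -⟩ := exists_G hl (by omega) (by omega)
  obtain ⟨y, hy⟩ := OO_of_root hG ((hev z hz).trans h)
  have hz' := mo_up Wm_pos hz
  obtain ⟨y', hy'⟩ := OO_of_root hG ((hev _ hz').trans (Gf_W_zero hl (by omega) hz h))
  refine ⟨y, y', hy, ?_, hy'⟩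
  apply Subtype.ext
  show (y : ℂ) * (y' : ℂ) = 125
  rw [← hy, ← hy', yf_W' hz, mul_div_cancel₀ _ (yf_ne hz)]

section
variable {l : ℕ} (hl : l.Prime) (h5 : 5 < l) {κ : Type} [Field κ] [CharP κ l] (φ : OO →+* κ)
include hl h5

lemma cast_ne {a : ℕ} (h : ∀ p, p.Prime → p ∣ a → p ≤ 5) : (a : κ) ≠ 0 := by
  intro e
  have := h l hl ((CharP.cast_eq_zero_iff κ l a).mp e)
  omega

lemma five_ne : (5 : κ) ≠ 0 := by
  have := cast_ne hl h5 (κ := κ) (a := 5) (fun p hp h => Nat.le_of_dvd (by norm_num) h)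
  exact_mod_cast this

lemma two_ne : (2 : κ) ≠ 0 := by
  have := cast_ne hl h5 (κ := κ) (a := 2) (fun p hp h => (Nat.le_of_dvd (by norm_num) h).trans (by norm_num))
  exact_mod_cast this

lemma c125_ne : (125 : κ) ≠ 0 := by
  have := pow_ne_zero 3 (five_ne hl h5 (κ := κ))
  norm_num at this; exact this

lemma phi_y {y y' : OO} (h : y * y' = 125) : φ y * φ y' = 125 := by
  rw [← map_mul, h, map_ofNat]

lemma phi_y_ne {y y' : OO} (h : y * y' = 125) : φ y ≠ 0 := by
  intro h0
  have := phi_y hl h5 φ h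
  rw [h0, zero_mul] at this
  exact c125_ne hl h5 this.symm

/-- supersingular iff trace zero -/
theorem SSy_iff {z : ℂ} (hz : 0 < z.im) {a b c d : ℤ} (h : CM l a b c d z) {y : OO} (hy : yf z = y) :
    SSy κ l (φ y) ↔ b = c := by
  have hG : Gf l z = 0 := (Gf_zero_iff hl (by omega) hz).mpr ⟨a, b, c, d, h⟩
  obtain ⟨y1, y', hy1, hyy, -⟩ := OO_y hl h5 hz hG
  obtain rfl : y1 = y := Subtype.ext (hy1.symm.trans hy)
  obtain ⟨C, hdeg, hc, hc0, hred⟩ := exists_Phi hl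
  obtain ⟨r1, r2, r3⟩ := hred κ φ
  have hpol := hpol_eq hl h5 (rr_or l) (ss_or l) (l_eq hl h5) (by
    rw [Polynomial.natDegree_neg]; exact Polynomial.natDegree_map_le.trans (hdeg 1)) r3
  have hy0 := phi_y_ne hl h5 φ hyy
  set j : OO := y1 ^ 5 + 30 * y1 ^ 4 + 315 * y1 ^ 3 + 1300 * y1 ^ 2 + 1575 * y1 + 750 + y' with hj
  have hjy : j * y1 = (y1 ^ 2 + 10 * y1 + 5) ^ 3 := by rw [hj]; linear_combination hyy
  have hjf : jf (5 * z) = j := by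
    have e := jf_five hz
    have e2 := congrArg (Subtype.val : OO → ℂ) hjy
    have e3 : (j : ℂ) * (y1 : ℂ) = ((y1 : ℂ) ^ 2 + 10 * (y1 : ℂ) + 5) ^ 3 := e2
    rw [← hy1, ← e] at e3
    exact (mul_right_cancel₀ (yf_ne hz) e3).symm
  rw [← ss_criterion hl (by omega) hc hc0 r2 hz h hy1 hy0 hjf, hpol, SSy]
  have : φ j = (φ y1 ^ 2 + 10 * φ y1 + 5) ^ 3 / φ y1 := by
    rw [eq_div_iff hy0, ← map_mul, hjy, map_pow, map_add, map_add, map_mul, map_pow, map_ofNat, map_ofNat]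
  rw [this]

/-- the roots of `G` -/
theorem exists_R : ∃ R : Multiset OO, R.map φ = 2 • (Polynomial.X ^ (l + 1) - Polynomial.C (125 : κ)).roots ∧
    (∀ y : OO, y ∈ R ↔ ∃ z, 0 < z.im ∧ yf z = y ∧ Gf l z = 0) ∧
    (∀ (y : OO) (z : ℂ), 0 < z.im → yf z = y → Gf l z = 0 → deriv (Gf l) z ≠ 0 → R.count y = 1) ∧
    (∀ (y : OO) (z : ℂ), 0 < z.im → yf z = y → Gf l z = 0 → deriv yf z ≠ 0 → deriv (Gf l) z = 0 → 2 ≤ R.count y) := by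
  obtain ⟨G, hdeg, hG, hev, hred⟩ := exists_G hl (by omega) (by omega)
  have hGc := hG.map (algebraMap OO ℂ)
  have hinj : Function.Injective (algebraMap OO ℂ) := Subtype.val_injective
  obtain ⟨R, hR⟩ : ∃ R : Multiset OO, R.map (algebraMap OO ℂ) = (G.map (algebraMap OO ℂ)).roots := by
    have : ∀ s : Multiset ℂ, (∀ x ∈ s, ∃ y : OO, x = y) → ∃ R : Multiset OO, R.map (algebraMap OO ℂ) = s := by
      intro s
      induction s using Multiset.induction_on with
      | empty => exact fun _ => ⟨0, rfl⟩
      | cons a s ih =>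
        intro h
        obtain ⟨R, hR⟩ := ih fun x hx => h x (Multiset.mem_cons_of_mem hx)
        obtain ⟨y, rfl⟩ := h a (Multiset.mem_cons_self _ _)
        exact ⟨y ::ₘ R, by rw [Multiset.map_cons, hR]; rfl⟩
    exact this _ fun x hx => OO_of_root hG (Polynomial.isRoot_of_mem_roots hx)
  have hprod : G = (R.map fun a => Polynomial.X - Polynomial.C a).prod := by
    apply Polynomial.map_injective _ hinj
    rw [(IsAlgClosed.splits (G.map (algebraMap OO ℂ))).eq_prod_roots_of_monic hGc, ← hR, Polynomial.map_multiset_prod,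
      Multiset.map_map, Multiset.map_map]
    congr 2
    ext1 a
    simp
  have hroots : G.roots = R := by rw [hprod, Polynomial.roots_multiset_prod_X_sub_C]
  have hmem : ∀ (y : OO) (z : ℂ), 0 < z.im → yf z = y → (G.eval y = 0 ↔ Gf l z = 0) := by
    intro y z hz hy
    rw [← hev z hz, hy, show (y : ℂ) = algebraMap OO ℂ y from rfl, Polynomial.eval_map_apply]
    exact (map_eq_zero_iff _ hinj).symm
  have hder : ∀ (y : OO) (z : ℂ), 0 < z.im → yf z = y →
      deriv (Gf l) z = algebraMap OO ℂ ((Polynomial.derivative G).eval y) * deriv yf z := by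
    intro y z hz hy
    have e : Gf l =ᶠ[𝓝 z] fun w => (G.map (algebraMap OO ℂ)).eval (yf w) := by
      filter_upwards [(isOpen_lt continuous_const Complex.continuous_im).mem_nhds hz] with w hw
      exact (hev w hw).symm
    rw [e.deriv_eq]
    have := ((G.map (algebraMap OO ℂ)).hasDerivAt (yf z)).comp z (yf_diff hz).hasDerivAt
    have h2 := this.deriv
    rw [Polynomial.derivative_map, hy, show (y : ℂ) = algebraMap OO ℂ y from rfl, Polynomial.eval_map_apply] at h2
    exact h2
  have hG0 : G ≠ 0 := hG.ne_zero
  have hmap : R.map φ = 2 • (Polynomial.X ^ (l + 1) - Polynomial.C (125 : κ)).roots := by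
    have e := hred κ φ
    rw [hprod, Polynomial.map_multiset_prod, Multiset.map_map] at e
    have e2 := congrArg Polynomial.roots e
    rw [Polynomial.roots_pow] at e2
    rw [← e2, ← Polynomial.roots_multiset_prod_X_sub_C (R.map φ), Multiset.map_map]
    simp
  refine ⟨R, hmap, ?_, ?_, ?_⟩
  · intro y
    rw [← hroots, Polynomial.mem_roots hG0, Polynomial.IsRoot]
    constructor
    · intro h
      have hy0 : (y : ℂ) ≠ 0 := by
        intro h0
        have h0' : y = 0 := Subtype.ext h0
        have : φ y ∈ R.map φ := Multiset.mem_map_of_mem _ (by rw [← hroots, Polynomial.mem_roots hG0]; exact h)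
        rw [hmap, Multiset.mem_nsmul_of_ne_zero (by norm_num)] at this
        have := Polynomial.isRoot_of_mem_roots this
        simp [h0', c125_ne hl h5] at this
      obtain ⟨z, hz, hy⟩ := y_surj hy0
      exact ⟨z, hz, hy, (hmem y z hz hy).mp h⟩
    · rintro ⟨z, hz, hy, h⟩
      exact (hmem y z hz hy).mpr h
  · intro y z hz hy h0 hd
    rw [hder y z hz hy] at hd
    rw [← hroots, Polynomial.count_roots]
    have h1 : 0 < G.rootMultiplicity y := (Polynomial.rootMultiplicity_pos hG0).mpr ((hmem y z hz hy).mpr h0)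
    have h2 : ¬ 1 < G.rootMultiplicity y := by
      rw [Polynomial.one_lt_rootMultiplicity_iff_isRoot hG0]
      rintro ⟨-, h⟩
      rw [Polynomial.IsRoot] at h
      rw [h] at hd
      simp at hd
    omega
  · intro y z hz hy h0 hy' hd
    rw [hder y z hz hy] at hd
    rw [← hroots, Polynomial.count_roots]
    refine (Polynomial.one_lt_rootMultiplicity_iff_isRoot hG0).mpr ⟨(hmem y z hz hy).mpr h0, ?_⟩
    have := (mul_eq_zero.mp hd).resolve_right hy'
    exact (map_eq_zero_iff _ hinj).mp this
end

lemma Gf_deriv_ss {l : ℕ} (hl : l.Prime) (h5 : 5 < l) {κ : Type} [Field κ] [CharP κ l] (φ : OO →+* κ) {z : ℂ} (hz : 0 < z.im)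
    {a b d : ℤ} (h : CM l a b b d z) : deriv (Gf l) z ≠ 0 := by
  have hl5 : l ≠ 5 := by omega
  obtain ⟨i, γ, hγ, hB, hi⟩ := root_of_CM hl hl5 hz h
  obtain ⟨y, y', hy, -, -⟩ := OO_y hl h5 hz ((Gf_zero_iff hl hl5 hz).mpr ⟨a, b, b, d, h⟩)
  have hss : SSy κ l (φ y) := (SSy_iff hl h5 φ hz h hy).mpr rfl
  have hother : ∀ j, j ≠ i → 125 - yf z * yf (mo (Hm l j) z) ≠ 0 := by
    intro j hj h0
    obtain ⟨a', b', c', d', h', γ', hγ', hB'⟩ := CM_of_root hl hz (i := j) (by linear_combination -h0)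
    obtain rfl : b' = c' := (SSy_iff hl h5 φ hz h' hy).mp hss
    exact hj (cm_index hl hl5 hz h' h hγ' hB' hγ hB)
  have e : Gf l = fun z => ∏ i : Option (Fin l), (125 - yf z * yf (mo (Hm l i) z)) := rfl
  have hd : ∀ i ∈ (Finset.univ : Finset (Option (Fin l))),
      DifferentiableAt ℂ (fun w => 125 - yf w * yf (mo (Hm l i) w)) z := fun i _ => (differentiableAt_const _).sub ((yf_diff hz).mul
    ((yf_diff (mo_up (Hm_pos hl.ne_zero i) hz)).comp z (mo_diff (Hm_pos hl.ne_zero i) hz)))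
  rw [e, deriv_fun_finsetProd hd]
  rw [Finset.sum_eq_single i]
  · rw [smul_eq_mul]
    refine mul_ne_zero (Finset.prod_ne_zero_iff.mpr fun j hj => hother j (Finset.ne_of_mem_erase hj)) (fac_deriv hl hl5 hz h hγ hB)
  · intro j _ hj
    rw [Finset.prod_eq_zero (Finset.mem_erase.mpr ⟨hj.symm, Finset.mem_univ i⟩), zero_smul]
    rw [hi, sub_self]
  · intro h; exact absurd (Finset.mem_univ i) h

/-- values of `y` at the trace zero CM points -/
def TT (l : ℕ) : Set ℂ := {w | ∃ (z : ℂ) (a b d : ℤ), 0 < z.im ∧ CM l a b b d z ∧ yf z = w}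

theorem count_T {l : ℕ} (hl : l.Prime) (h5 : 5 < l) {κ : Type} [Field κ] [CharP κ l] (φ : OO →+* κ) :
    (TT l).ncard = 2 * {y : κ | y ^ (l + 1) = 125 ∧ SSy κ l y}.ncard := by
  classical
  have hl5 : l ≠ 5 := by omega
  obtain ⟨R, hR, hmem, hc1, -⟩ := exists_R hl h5 φ
  have hsep : (Polynomial.X ^ (l + 1) - Polynomial.C (125 : κ)).roots.Nodup := by
    apply Polynomial.nodup_roots
    apply Polynomial.separable_X_pow_sub_C _ _ (c125_ne hl h5)
    simp
  have hnd : (R.filter (SSy κ l ∘ φ)).Nodup := by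
    rw [Multiset.nodup_iff_count_le_one]
    intro y
    by_cases hy : SSy κ l (φ y)
    · rw [Multiset.count_filter_of_pos (p := SSy κ l ∘ φ) hy]
      by_cases hyR : y ∈ R
      · obtain ⟨z, hz, hyz, h0⟩ := (hmem y).mp hyR
        obtain ⟨a, b, c, d, h⟩ := (Gf_zero_iff hl hl5 hz).mp h0
        obtain rfl : b = c := (SSy_iff hl h5 φ hz h hyz).mp hy
        exact (hc1 y z hz hyz h0 (Gf_deriv_ss hl h5 φ hz h)).le
      · rw [Multiset.count_eq_zero_of_notMem hyR]; norm_num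
    · rw [Multiset.count_filter_of_neg (p := SSy κ l ∘ φ) hy]; norm_num
  have hT : TT l = (algebraMap OO ℂ) '' ((R.filter (SSy κ l ∘ φ)).toFinset : Set OO) := by
    ext w
    simp only [TT, Set.mem_ofPred_eq, Set.mem_image, Finset.mem_coe, Multiset.mem_toFinset, Multiset.mem_filter]
    constructor
    · rintro ⟨z, a, b, d, hz, h, rfl⟩
      have h0 := (Gf_zero_iff hl hl5 hz).mpr ⟨a, b, b, d, h⟩
      obtain ⟨y, y', hy, -, -⟩ := OO_y hl h5 hz h0
      exact ⟨y, ⟨(hmem y).mpr ⟨z, hz, hy, h0⟩, (SSy_iff hl h5 φ hz h hy).mpr rfl⟩, hy.symm⟩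
    · rintro ⟨y, ⟨hyR, hy⟩, rfl⟩
      obtain ⟨z, hz, hyz, h0⟩ := (hmem y).mp hyR
      obtain ⟨a, b, c, d, h⟩ := (Gf_zero_iff hl hl5 hz).mp h0
      obtain rfl : b = c := (SSy_iff hl h5 φ hz h hyz).mp hy
      exact ⟨z, a, b, d, hz, h, hyz⟩
  have hinj : Function.Injective (algebraMap OO ℂ) := Subtype.val_injective
  rw [hT, Set.ncard_image_of_injective _ hinj, Set.ncard_coe_finset,
    Multiset.toFinset_card_of_nodup hnd, ← Multiset.card_map φ, ← Multiset.filter_map, hR, Multiset.filter_nsmul,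
    Multiset.card_nsmul, ← Multiset.toFinset_card_of_nodup (hsep.filter _), ← Set.ncard_coe_finset]
  congr 2
  ext y
  have hne : (Polynomial.X ^ (l + 1) - Polynomial.C (125 : κ)) ≠ 0 := Polynomial.X_pow_sub_C_ne_zero (by omega) _
  simp only [Finset.mem_coe, Multiset.mem_toFinset, Multiset.mem_filter, Polynomial.mem_roots hne, Set.mem_ofPred_eq,
    Polynomial.IsRoot]
  simp [sub_eq_zero]
end

section
open Complex
open UpperHalfPlane hiding I
open scoped MatrixGroups ModularForm Topology

/-- a field of characteristic `l` receiving the algebraic integers -/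
theorem exists_kappa {l : ℕ} (hl : l.Prime) :
    ∃ (κ : Type) (_ : Field κ) (_ : CharP κ l) (_ : IsAlgClosed κ), Nonempty (OO →+* κ) := by
  have hne : Ideal.span {(l : OO)} ≠ ⊤ := by
    rw [Ne, Ideal.span_singleton_eq_top]
    intro h
    obtain ⟨u, hu⟩ := h.exists_right_inv
    have h2 : (l : ℂ) * (u : ℂ) = 1 := congrArg (Subtype.val : OO → ℂ) hu
    have h3 : (u : ℂ) = algebraMap ℚ ℂ ((l : ℚ)⁻¹) := by
      rw [map_inv₀, map_natCast]
      exact eq_inv_of_mul_eq_one_right h2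
    have h4 : IsIntegral ℤ ((l : ℚ)⁻¹) := by
      have := u.2
      rw [show (u : ℂ) = algebraMap ℚ ℂ ((l : ℚ)⁻¹) from h3] at this
      exact (isIntegral_algebraMap_iff (algebraMap ℚ ℂ).injective).mp this
    obtain ⟨n, hn⟩ := IsIntegrallyClosed.isIntegral_iff.mp h4
    have h5 : (l : ℚ) * (n : ℚ) = 1 := by
      have : (n : ℚ) = (l : ℚ)⁻¹ := by simpa using hn
      rw [this]; exact mul_inv_cancel₀ (by exact_mod_cast hl.ne_zero)
    have h6 : (l : ℤ) * n = 1 := by exact_mod_cast h5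
    have h7 : (l : ℤ) ∣ 1 := ⟨n, h6.symm⟩
    have h8 : l ∣ 1 := by exact_mod_cast h7
    exact hl.one_lt.ne' (Nat.dvd_one.mp h8)
  obtain ⟨M, hM, hle⟩ := Ideal.exists_le_maximal _ hne
  letI : Field (OO ⧸ M) := Ideal.Quotient.field M
  let f : OO →+* AlgebraicClosure (OO ⧸ M) := (algebraMap (OO ⧸ M) _).comp (Ideal.Quotient.mk M)
  refine ⟨AlgebraicClosure (OO ⧸ M), inferInstance, ?_, inferInstance, ⟨f⟩⟩
  have h0 : ((l : ℕ) : AlgebraicClosure (OO ⧸ M)) = 0 := by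
    have h1 : (l : OO) ∈ M := hle (Ideal.mem_span_singleton_self _)
    have h2 : f l = 0 := by
      show (algebraMap (OO ⧸ M) _) (Ideal.Quotient.mk M (l : OO)) = 0
      rw [Ideal.Quotient.eq_zero_iff_mem.mpr h1, map_zero]
    rwa [map_natCast] at h2
  obtain ⟨p, hp⟩ := CharP.exists (AlgebraicClosure (OO ⧸ M))
  have hd := (CharP.cast_eq_zero_iff (AlgebraicClosure (OO ⧸ M)) p l).mp h0
  rcases (Nat.dvd_prime hl).mp hd with h | h
  · subst h
    exact absurd rfl (CharP.char_ne_one (AlgebraicClosure (OO ⧸ M)) 1)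
  · subst h; exact hp

lemma not_dvd_sub {l : ℕ} {a b c d : ℤ} {z : ℂ} (hl : l.Prime) (hl5 : l ≠ 5) (hz : 0 < z.im) (h : CM l a b c d z) (hbc : b ≠ c) :
    ¬ (l : ℤ) ∣ b - c := by
  rintro ⟨k, hk⟩
  have h1 := h.disc (h.a_ne hl hl5 hz) hz
  have hk0 : k ≠ 0 := by rintro rfl; exact hbc (by linarith)
  have h2 : 1 ≤ k ^ 2 := by have := sq_pos_of_pos (abs_pos.mpr hk0); rw [sq_abs] at this; omega
  have h3 : (2 : ℤ) ≤ l := by exact_mod_cast hl.two_le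
  rw [hk] at h1
  have h4 : (l : ℤ) ^ 2 * 1 ≤ l ^ 2 * k ^ 2 := mul_le_mul_of_nonneg_left h2 (by positivity)
  nlinarith

lemma two_index {l : ℕ} (hl : l.Prime) (hl5 : l ≠ 5) {z : ℂ} (hz : 0 < z.im) {a b c d : ℤ} (h : CM l a b c d z) (hbc : b ≠ c) 
    {i : Option (Fin l)} {γ γ' : M2} (hγ' : G5 γ') (hB : cmB a b c d = γ * Hm l i)
    (hB' : cmB a c b d = γ' * Hm l i) : False := by
  have hnd := not_dvd_sub hl hl5 hz h hbc
  have hlp := Nat.prime_iff_prime_int.mp hl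
  have hg : γ'.adjugate * γ' = 1 := by rw [Matrix.adjugate_mul, hγ'.1, one_smul]
  have e1 : Hm l i = γ'.adjugate * cmB a c b d := by rw [hB', ← Matrix.mul_assoc, hg, Matrix.one_mul]
  set δ := γ * γ'.adjugate with hδ
  have e2 : cmB a b c d = δ * cmB a c b d := by rw [hB, e1, ← Matrix.mul_assoc]
  have e3 : cmB a b c d * (cmB a c b d).adjugate = (l : ℤ) • δ := by
    rw [e2, Matrix.mul_assoc, Matrix.mul_adjugate, cmB_det, show a * d - 5 * c * b = l by linarith [h.1]]
    rw [Matrix.mul_smul, Matrix.mul_one]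
  have ent : ∀ i j, (l : ℤ) ∣ (cmB a b c d * (cmB a c b d).adjugate) i j := by
    intro i j; rw [e3]; exact ⟨δ i j, by simp⟩
  have f00 := ent 0 0
  have f01 := ent 0 1
  have f10 := ent 1 0
  have f11 := ent 1 1
  simp [cmB, Matrix.adjugate_fin_two, Matrix.mul_apply, Fin.sum_univ_two] at f00 f01 f10 f11
  have h5 : ¬ (l : ℤ) ∣ 5 := by
    intro h
    have : l ∣ 5 := by exact_mod_cast h
    exact hl5 ((Nat.prime_dvd_prime_iff_eq hl (by norm_num)).mp this)
  have ha : (l : ℤ) ∣ a := by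
    have : (l : ℤ) ∣ a * (b - c) := by convert f01 using 1; ring
    exact (hlp.dvd_or_dvd this).resolve_right hnd
  have hd : (l : ℤ) ∣ d := by
    have : (l : ℤ) ∣ 5 * d * (b - c) := by
      obtain ⟨k, hk⟩ := f10
      exact ⟨-k, by linear_combination (-1) * hk⟩
    exact ((hlp.dvd_or_dvd ((hlp.dvd_or_dvd this).resolve_right hnd))).resolve_left h5
  have key : ∀ {x : ℤ}, (l : ℤ) ∣ a * d - 5 * x * x → (l : ℤ) ∣ x := by
    intro x hx
    have h1 : (l : ℤ) ∣ 5 * x * x := by have := dvd_sub (ha.mul_right d) hx; simpa using this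
    rcases hlp.dvd_or_dvd h1 with h | h
    · exact (hlp.dvd_or_dvd h).resolve_left h5
    · exact h
  have hb : (l : ℤ) ∣ b := key (by convert f00 using 1; ring)
  have hc : (l : ℤ) ∣ c := key (by convert f11 using 1; ring)
  obtain ⟨a', rfl⟩ := ha
  obtain ⟨b', rfl⟩ := hb
  obtain ⟨c', rfl⟩ := hc
  obtain ⟨d', rfl⟩ := hd
  have h1 := h.1
  have h2 : (l : ℤ) * (l * (a' * d' - 5 * b' * c')) = l * 1 := by linarith
  have h3 := mul_left_cancel₀ hlp.ne_zero h2
  exact hlp.not_isUnit (IsUnit.of_mul_eq_one _ h3)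

lemma Gf_deriv_zero {l : ℕ} (hl : l.Prime) (hl5 : l ≠ 5) {z : ℂ} (hz : 0 < z.im) {a b c d : ℤ} (h : CM l a b c d z) (hbc : b ≠ c) :
    deriv (Gf l) z = 0 := by
  obtain ⟨i, γ, hγ, hB, hi⟩ := root_of_CM hl hl5 hz h
  obtain ⟨j, γ', hγ', hB', hj⟩ := root_of_CM hl hl5 hz h.swap
  have hij : i ≠ j := by rintro rfl; exact two_index hl hl5 hz h hbc hγ' hB hB'
  have e : Gf l = fun z => ∏ i : Option (Fin l), (125 - yf z * yf (mo (Hm l i) z)) := rfl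
  have hd : ∀ i ∈ (Finset.univ : Finset (Option (Fin l))),
      DifferentiableAt ℂ (fun w => 125 - yf w * yf (mo (Hm l i) w)) z := fun i _ => (differentiableAt_const _).sub ((yf_diff hz).mul
    ((yf_diff (mo_up (Hm_pos hl.ne_zero i) hz)).comp z (mo_diff (Hm_pos hl.ne_zero i) hz)))
  rw [e, deriv_fun_finsetProd hd]
  refine Finset.sum_eq_zero fun k _ => ?_
  by_cases hk : k = i
  · rw [Finset.prod_eq_zero (i := j) (Finset.mem_erase.mpr ⟨fun h => hij (hk.symm.trans h.symm), Finset.mem_univ _⟩), zero_smul]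
    rw [hj, sub_self]
  · rw [Finset.prod_eq_zero (i := i) (Finset.mem_erase.mpr ⟨fun h => hk h.symm, Finset.mem_univ _⟩), zero_smul]
    rw [hi, sub_self]

/-- fixed points of the Fricke involution -/
lemma fricke_fix {z : ℂ} (hz : 0 < z.im) (h : yf (mo Wm z) = yf z) : ∃ p q r s, CM 1 p q r s z := by
  obtain ⟨A, hA, e⟩ := y_inj hz (W_up hz) h.symm
  obtain ⟨r, hr⟩ := hA.2
  have hd := hA.1
  rw [Matrix.det_fin_two, hr] at hd
  refine ⟨A 0 0, A 0 1, r, A 1 1, by push_cast; linarith, ?_⟩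
  rw [mo_def, mo_W, div_eq_iff (dn_ne hA.pos hz), dn, hr] at e
  have := ne_of_up hz
  field_simp at e
  push_cast at e
  linear_combination e

lemma fricke_rel {l : ℕ} {z : ℂ} (hz : 0 < z.im) {a b c d p q r s : ℤ} (h : CM l a b c d z) (h' : CM 1 p q r s z) :
    ∃ k : ℤ, k ^ 2 + 5 * (b - c) ^ 2 = 4 * l := by
  have hi : ∀ {u v : ℤ}, (u : ℂ) * z + v = 0 → u = 0 ∧ v = 0 := by
    intro u v e
    have h1 := congrArg Complex.im e
    have h2 := congrArg Complex.re e
    simp at h1 h2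
    have hu : u = 0 := h1.resolve_right hz.ne'
    subst hu
    simp at h2
    exact ⟨rfl, h2⟩
  have hp : p ≠ 0 := by
    rintro rfl
    have h2 := h'.2
    have h3 := hi (u := 5 * (q + r)) (v := s) (by push_cast; linear_combination h2)
    have h1 := h'.1
    have : r = -q := by omega
    subst this
    push_cast at h1
    have : 5 * (q * q) = 1 := by linarith
    omega
  have hqr : q = r := by
    have := h'.disc hp hz
    push_cast at this
    have h3 : (q - r) ^ 2 = 0 := by
      have := sq_nonneg (q - r); omega
    have := pow_eq_zero_iff (two_ne_zero) |>.mp h3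
    omega
  subst hqr
  have e := hi (u := 5 * (p * (b + c) - 2 * q * a)) (v := p * d - a * s) (by
    push_cast; linear_combination p * h.2 - a * h'.2)
  have e1 : p * (b + c) = 2 * q * a := by omega
  have e2 : p * d = a * s := by omega
  have d1 := h'.1
  have d2 := h.1
  push_cast at d1
  refine ⟨2 * a * s - 5 * q * (b + c), ?_⟩
  have hk : p * (2 * a * s - 5 * q * (b + c)) = 2 * a := by linear_combination 2 * a * d1 - 5 * q * e1
  have : p ^ 2 * ((2 * a * s - 5 * q * (b + c)) ^ 2 + 5 * (b - c) ^ 2 - 4 * l) = 0 := by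
    have e3 : p ^ 2 * (2 * a * s - 5 * q * (b + c)) ^ 2 = 4 * a ^ 2 := by rw [← mul_pow, hk]; ring
    linear_combination e3 - 4 * a ^ 2 * d1 - 4 * p ^ 2 * (-d2) - 4 * p * a * e2 + 5 * (p * (b + c) + 2 * q * a) * e1 
  have h0 := (mul_eq_zero.mp this).resolve_left (pow_ne_zero 2 hp)
  linarith

lemma sq5_mod {l : ℕ} (hl : l.Prime) (h5 : 5 < l) (hm : l % 5 = 4) : ∃ s : ZMod l, s ^ 2 = 5 := by
  haveI : Fact l.Prime := ⟨hl⟩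
  haveI : Fact (Nat.Prime 5) := ⟨by norm_num⟩
  have h := (ZMod.exists_sq_eq_prime_iff_of_mod_four_eq_one (p := 5) (q := l) (by norm_num) (by rintro rfl; norm_num at hm)).mp (by
    have : (l : ZMod 5) = 4 := by
      have : ((l : ℕ) : ZMod 5) = ((4 : ℕ) : ZMod 5) := (ZMod.natCast_eq_natCast_iff _ _ _).mpr hm
      simpa using this
    rw [this]
    exact ⟨2, by norm_num⟩)
  obtain ⟨s, hs⟩ := h
  exact ⟨s, by rw [sq, ← hs]; norm_num⟩

lemma no_fricke {l : ℕ} (hl : l.Prime) (h5 : 5 < l) (hm : l % 5 = 4) (h4 : l % 4 = 3) {k m : ℤ} (h : k ^ 2 + 5 * m ^ 2 = 4 * l)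
    (hmn : ¬ (l : ℤ) ∣ m) : False := by
  haveI : Fact l.Prime := ⟨hl⟩
  obtain ⟨s, hs⟩ := sq5_mod hl h5 hm
  have hm0 : (m : ZMod l) ≠ 0 := by rwa [Ne, ZMod.intCast_zmod_eq_zero_iff_dvd]
  have hs0 : s ≠ 0 := by
    rintro rfl
    have h2 : (5 : ZMod l) = 0 := by rw [← hs]; ring
    have h3 := (ZMod.natCast_eq_zero_iff 5 l).mp (by exact_mod_cast h2)
    have := Nat.le_of_dvd (by norm_num) h3
    omega
  have e : (k : ZMod l) ^ 2 + 5 * (m : ZMod l) ^ 2 = 0 := by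
    have := congrArg (Int.cast : ℤ → ZMod l) h
    push_cast at this
    simpa using this
  have h1 : ((k : ZMod l) / (s * m)) ^ 2 = -1 := by
    rw [div_pow, div_eq_iff (pow_ne_zero 2 (mul_ne_zero hs0 hm0)), mul_pow, hs]
    linear_combination e
  exact (ZMod.mod_four_ne_three_of_sq_eq_neg_one h1) h4

theorem ss_pm {l : ℕ} (hl : l.Prime) (h5 : 5 < l) (hm : l % 5 = 4) (h4 : l % 4 = 3) {κ : Type} [Field κ] [CharP κ l] (φ : OO →+* κ)
    {y : κ} (hy : y ^ 2 = 125) (hy2 : y ^ (l + 1) = 125) : SSy κ l y := by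
  classical
  have hl5 : l ≠ 5 := by omega
  obtain ⟨R, hR, hmem, -, hc2⟩ := exists_R hl h5 φ
  have hne : (Polynomial.X ^ (l + 1) - Polynomial.C (125 : κ)) ≠ 0 := Polynomial.X_pow_sub_C_ne_zero (by omega) _
  have hyr : y ∈ (Polynomial.X ^ (l + 1) - Polynomial.C (125 : κ)).roots := by
    rw [Polynomial.mem_roots hne]; simp [hy2]
  have hsep : (Polynomial.X ^ (l + 1) - Polynomial.C (125 : κ)).roots.Nodup := by
    apply Polynomial.nodup_roots
    apply Polynomial.separable_X_pow_sub_C _ _ (c125_ne hl h5)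
    simp
  have hcount : (R.map φ).count y = 2 := by
    rw [hR, Multiset.count_nsmul, Multiset.count_eq_one_of_mem hsep hyr]
  have hyR : y ∈ R.map φ := by rw [← Multiset.count_pos, hcount]; norm_num
  obtain ⟨y1, hy1, rfl⟩ := Multiset.mem_map.mp hyR
  obtain ⟨z, hz, hyz, h0⟩ := (hmem y1).mp hy1
  obtain ⟨a, b, c, d, h⟩ := (Gf_zero_iff hl hl5 hz).mp h0
  rw [SSy_iff hl h5 φ hz h hyz]
  by_contra hbc
  have hd := Gf_deriv_zero hl hl5 hz h hbc
  obtain ⟨y1', y', hy1', hyy, hy'⟩ := OO_y hl h5 hz h0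
  obtain rfl : y1' = y1 := Subtype.ext (hy1'.symm.trans hyz)
  have hφ := phi_y hl h5 φ hyy
  have hφ0 := phi_y_ne hl h5 φ hyy
  have hφ' : φ y' = φ y1' := mul_left_cancel₀ hφ0 (by rw [hφ, ← hy]; ring)
  have hyd : deriv yf z ≠ 0 := by
    apply thy_ne hz
    intro e
    rw [hyz] at e
    have e1 : y1' ^ 2 + 22 * y1' + 125 = 0 := Subtype.ext e
    have e2 := congrArg φ e1
    rw [map_add, map_add, map_mul, map_pow, map_ofNat, map_ofNat, map_zero, hy] at e2
    have e3 : (16 * 125 : κ) = 0 := by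
      have : (22 * φ y1') ^ 2 = (-250) ^ 2 := by rw [show 22 * φ y1' = -250 by linear_combination e2]
      rw [mul_pow, hy] at this
      linear_combination -this 
    have : ((2000 : ℕ) : κ) ≠ 0 := cast_ne hl h5 (fun p hp h => by
      rw [show 2000 = 2 ^ 4 * 5 ^ 3 by norm_num] at h
      rcases (Nat.Prime.dvd_mul hp).mp h with h | h
      · exact (Nat.le_of_dvd (by norm_num) (hp.dvd_of_dvd_pow h)).trans (by norm_num)
      · exact Nat.le_of_dvd (by norm_num) (hp.dvd_of_dvd_pow h))
    apply this
    push_cast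
    linear_combination e3
  have hc := hc2 y1' z hz hyz h0 hyd hd
  have hyR' : y' ∈ R := (hmem y').mpr ⟨_, W_up hz, hy', Gf_W_zero hl hl5 hz h0⟩
  by_cases hE : y' = y1'
  · obtain ⟨p, q, r, s, hf⟩ := fricke_fix hz (by rw [hy', hE, hyz])
    obtain ⟨k, hk⟩ := fricke_rel hz h hf
    exact no_fricke hl h5 hm h4 hk (not_dvd_sub hl hl5 hz h hbc)
  · have h3 : Multiset.replicate 2 y1' + {y'} ≤ R := by
      rw [Multiset.le_iff_count]
      intro x
      rw [Multiset.count_add, Multiset.count_replicate, Multiset.count_singleton]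
      by_cases hx : y1' = x
      · subst hx
        simp [Ne.symm hE, hc]
      · by_cases hx' : x = y'
        · subst hx'; simp [hx]; exact Multiset.one_le_count_iff_mem.mpr hyR'
        · simp [hx, hx']
    have h4 := Multiset.count_le_of_le (φ y1') (Multiset.map_le_map (f := φ) h3)
    rw [hcount, Multiset.map_add, Multiset.map_replicate, Multiset.map_singleton, hφ'] at h4
    simp at h4
end

section
open Complex
open UpperHalfPlane hiding I
open scoped MatrixGroups ModularForm Topology

/-- Thue's lemma -/
lemma thue {l : ℕ} (hl : l.Prime) (r : ZMod l) :
    ∃ x y : ℤ, (x ≠ 0 ∨ y ≠ 0) ∧ x ^ 2 < l ∧ y ^ 2 < l ∧ (x : ZMod l) = r * y := by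
  have : NeZero l := ⟨hl.ne_zero⟩
  set s := Nat.sqrt l with hs
  have h1 : l < (s + 1) * (s + 1) := Nat.lt_succ_sqrt l
  have h2 : s * s < l := by
    rcases (Nat.sqrt_le l).lt_or_eq with h | h
    · exact h
    · exfalso
      have : IsSquare l := ⟨_, h.symm⟩
      exact hl.prime.not_isSquare this
  let f : Fin (s + 1) × Fin (s + 1) → ZMod l := fun p => (p.1 : ℕ) - r * (p.2 : ℕ)
  obtain ⟨p, q, hpq, e⟩ := Fintype.exists_ne_map_eq_of_card_lt f (by
    rw [ZMod.card, Fintype.card_prod, Fintype.card_fin]; exact h1)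
  refine ⟨(p.1 : ℕ) - (q.1 : ℕ), (p.2 : ℕ) - (q.2 : ℕ), ?_, ?_, ?_, ?_⟩
  · by_contra hc
    push Not at hc
    apply hpq
    ext <;> omega
  · have a1 := p.1.2; have a2 := q.1.2
    have b1 : |((p.1 : ℕ) : ℤ) - (q.1 : ℕ)| ≤ s := by rw [abs_le]; omega
    rw [← sq_abs]
    have b2 : (s * s : ℤ) < l := by exact_mod_cast h2
    have := abs_nonneg (((p.1 : ℕ) : ℤ) - (q.1 : ℕ))
    nlinarith
  · have a1 := p.2.2; have a2 := q.2.2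
    have b1 : |((p.2 : ℕ) : ℤ) - (q.2 : ℕ)| ≤ s := by rw [abs_le]; omega
    rw [← sq_abs]
    have b2 : (s * s : ℤ) < l := by exact_mod_cast h2
    have := abs_nonneg (((p.2 : ℕ) : ℤ) - (q.2 : ℕ))
    nlinarith
  · simp only [f] at e
    push_cast
    linear_combination e

lemma two_sq {l : ℕ} (hl : l.Prime) (h5 : 5 < l) (hm : l % 5 = 4) (h4 : l % 4 = 1) : 
    ∃ x y : ℤ, x ^ 2 + 5 * y ^ 2 = l := by
  have : Fact l.Prime := ⟨hl⟩
  obtain ⟨s, hs⟩ := sq5_mod hl h5 hm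
  obtain ⟨t, ht⟩ := ZMod.exists_sq_eq_neg_one_iff.mpr (show l % 4 ≠ 3 by omega)
  obtain ⟨x, y, h0, hx, hy, e⟩ := thue hl (s * t)
  have hd : (l : ℤ) ∣ x ^ 2 + 5 * y ^ 2 := by
    rw [← ZMod.intCast_zmod_eq_zero_iff_dvd]
    push_cast
    rw [e, mul_pow, mul_pow, hs, sq t, ← ht]; ring
  obtain ⟨k, hk⟩ := hd
  have hlp : (0 : ℤ) < l := by exact_mod_cast hl.pos
  have hk1 : 0 < k := by
    have : 0 < x ^ 2 + 5 * y ^ 2 := by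
      rcases h0 with h | h
      · have := sq_pos_of_ne_zero h; nlinarith [sq_nonneg y]
      · have := sq_pos_of_ne_zero h; nlinarith [sq_nonneg x]
    rw [hk] at this
    exact pos_of_mul_pos_right this hlp.le
  have hk6 : k < 6 := by nlinarith
  obtain ⟨m, hm'⟩ : ∃ m : ℤ, (l : ℤ) = 5 * m + 4 := ⟨l / 5, by omega⟩
  have hx5 : x ^ 2 % 5 = 4 * k % 5 := by rw [hm'] at hk; have : x ^ 2 = 4 * k + 5 * (m * k - y ^ 2) := by linarith
                                         omega
  have hx5' : x ^ 2 % 5 = 0 ∨ x ^ 2 % 5 = 1 ∨ x ^ 2 % 5 = 4 := by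
    rw [sq, Int.mul_emod]
    have h1 := Int.emod_nonneg x (by norm_num : (5 : ℤ) ≠ 0)
    have h2 := Int.emod_lt_of_pos x (by norm_num : (0 : ℤ) < 5)
    interval_cases x % 5 <;> simp
  interval_cases k
  · exact ⟨x, y, by linarith⟩
  · omega
  · omega
  · have hx2 : x ^ 2 % 4 = x % 2 := by
      rcases Int.even_or_odd' x with ⟨c, rfl | rfl⟩
      · ring_nf; omega
      · ring_nf; omega
    have hy2 : y ^ 2 % 4 = y % 2 := by
      rcases Int.even_or_odd' y with ⟨c, rfl | rfl⟩
      · ring_nf; omega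
      · ring_nf; omega
    obtain ⟨c, rfl⟩ : (2 : ℤ) ∣ x := by omega
    obtain ⟨d, rfl⟩ : (2 : ℤ) ∣ y := by omega
    exact ⟨c, d, by linarith⟩
  · have : (5 : ℤ) ∣ x := (Int.prime_iff_natAbs_prime.mpr (by norm_num) : Prime (5 : ℤ)).dvd_of_dvd_pow (n := 2) (by omega)
    obtain ⟨c, rfl⟩ := this
    exact ⟨y, c, by linarith⟩

/-- the second fixed point -/
noncomputable def z6 : ℂ := -1 / 2 + z5 / 2

lemma z6_im : z6.im = z5.im / 2 := by
  simp [z6, Complex.div_ofNat_im]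

lemma z5_sq : 5 * z5 ^ 2 + 1 = 0 := by
  have h := z5_W
  rw [mo_W] at h
  have h0 := ne_of_up z5_up
  rw [div_eq_iff (by simpa using h0)] at h
  linear_combination -h

lemma z6_sq : 10 * z6 ^ 2 + 10 * z6 + 3 = 0 := by
  rw [z6]; linear_combination z5_sq / 2

lemma z6_up : 0 < z6.im := by rw [z6_im]; have := z5_up; positivity

lemma yf_fix {z : ℂ} (hz : 0 < z.im) {p q s : ℤ} (h : CM 1 p q q s z) : yf z ^ 2 = 125 := by
  have hd := h.1
  have hA : G5 !![p, q; 5 * q, s] := ⟨by rw [Matrix.det_fin_two]; simp; push_cast at hd; linarith, by simp⟩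
  have e : mo !![p, q; 5 * q, s] z = mo Wm z := by
    have h0 := dn_ne hA.pos hz
    rw [mo_def, mo_W, div_eq_iff h0]
    have := ne_of_up hz
    simp [dn]
    field_simp
    linear_combination h.2
  have h1 := yf_inv hA hz
  rw [e, yf_W' hz, div_eq_iff (yf_ne hz)] at h1
  rw [h1]; ring

lemma yf_z6 : yf z6 ^ 2 = 125 := yf_fix z6_up (p := 2) (q := 1) (s := 3) ⟨by norm_num, by push_cast; linear_combination z6_sq⟩

lemma z5_ne : yf z6 ≠ yf z5 := by
  intro h
  obtain ⟨A, hA, e⟩ := y_inj z5_up z6_up h.symm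
  obtain ⟨r, hr⟩ := hA.2
  have h0 := dn_ne hA.pos z5_up
  have hd := hA.1
  rw [Matrix.det_fin_two, hr] at hd
  rw [mo_def, div_eq_iff h0, z6, dn, hr] at e
  have hi : ∀ {u v : ℤ}, (u : ℂ) * z5 + v = 0 → u = 0 ∧ v = 0 := by
    intro u v e
    have h1 := congrArg Complex.im e
    have h2 := congrArg Complex.re e
    simp at h1 h2
    have hu : u = 0 := h1.resolve_right z5_up.ne'
    subst hu
    simp at h2
    exact ⟨rfl, h2⟩
  push_cast at e
  have := hi (u := 2 * A 0 0 + 5 * r - A 1 1) (v := 2 * A 0 1 + A 1 1 + r) (by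
    push_cast
    linear_combination 2 * e + r * z5_sq)
  generalize A 0 0 = p at *
  generalize A 0 1 = q at *
  generalize A 1 1 = s at *
  obtain ⟨g1, g2⟩ := this
  have : s ^ 2 + 5 * r ^ 2 = 2 := by
    have h1 : 2 * p = s - 5 * r := by linarith
    have h2 : 2 * q = -s - r := by linarith
    linear_combination 2 * hd - s * h1 + 5 * r * h2
  have hr0 : r = 0 := by
    by_contra h
    have := sq_pos_of_ne_zero h
    nlinarith [sq_nonneg s]
  subst hr0
  have h3 : s ^ 2 = 2 := by linarith
  have : s ≤ 1 := by nlinarith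
  have : -1 ≤ s := by nlinarith
  interval_cases s <;> omega

theorem ord_pm {l : ℕ} (hl : l.Prime) (h5 : 5 < l) (hm : l % 5 = 4) (h4 : l % 4 = 1) {κ : Type} [Field κ] [CharP κ l] (φ : OO →+* κ)
    {y : κ} (hy : y ^ 2 = 125) : ¬ SSy κ l y := by
  have hl5 : l ≠ 5 := by omega
  obtain ⟨m, n, hmn⟩ := two_sq hl h5 hm h4
  have hn0 : n ≠ 0 := by
    rintro rfl
    have : IsSquare (l : ℤ) := ⟨m, by rw [← hmn]; ring⟩
    exact (Nat.prime_iff_prime_int.mp hl).not_isSquare this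
  have c5 : CM l m n (-n) m z5 := ⟨by linarith, by push_cast; linear_combination m * z5_sq⟩
  have c6 : CM l (2 * m) (m - n) (m + n) (3 * m) z6 := ⟨by linarith, by push_cast; linear_combination m * z6_sq⟩
  obtain ⟨y1, -, e1, -, -⟩ := OO_y hl h5 z5_up ((Gf_zero_iff hl hl5 z5_up).mpr ⟨_, _, _, _, c5⟩)
  obtain ⟨y2, -, e2, -, -⟩ := OO_y hl h5 z6_up ((Gf_zero_iff hl hl5 z6_up).mpr ⟨_, _, _, _, c6⟩)
  have s5 := (SSy_iff hl h5 φ z5_up c5 e1).not.mpr (by omega)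
  have s6 := (SSy_iff hl h5 φ z6_up c6 e2).not.mpr (by omega)
  have q1 : y1 ^ 2 = 125 := Subtype.ext (by show (y1 : ℂ) ^ 2 = 125; rw [← e1]; exact yf_z5)
  have q12 : y2 = -y1 := by
    apply Subtype.ext
    show (y2 : ℂ) = -(y1 : ℂ)
    rw [← e1, ← e2]
    exact (sq_eq_sq_iff_eq_or_eq_neg.mp (yf_z6.trans yf_z5.symm)).resolve_left z5_ne
  have q2 : φ y1 ^ 2 = 125 := by rw [← map_pow, q1, map_ofNat]
  rcases sq_eq_sq_iff_eq_or_eq_neg.mp (hy.trans q2.symm) with h | h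
  · rwa [h]
  · rw [h, ← map_neg, ← q12]; exact s6
end

section
open Complex

lemma rat_int {r : ℚ} (h : IsIntegral ℤ (r : ℂ)) : ∃ n : ℤ, r = n := by
  have h' : IsIntegral ℤ (algebraMap ℚ ℂ r) := by simpa using h
  have h4 : IsIntegral ℤ r := (isIntegral_algebraMap_iff (algebraMap ℚ ℂ).injective).mp h'
  obtain ⟨n, hn⟩ := IsIntegrallyClosed.isIntegral_iff.mp h4
  exact ⟨n, by simpa using hn.symm⟩

section
variable {K : Type} [Field K] [NumberField K] {l : ℕ} {θ : K} (hl : l.Prime) (h5 : 5 < l) (hθ : θ ^ 2 = -((5 * l : ℕ) : K))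
  (hK : Module.finrank ℚ K = 2)

include hl hθ in
lemma K_ind {p q : ℚ} (h : (p : K) + q * θ = 0) : p = 0 ∧ q = 0 := by
  have hq : q = 0 := by
    by_contra hq
    have hq' : (q : K) ≠ 0 := by exact_mod_cast hq
    have e : (q : K) ^ 2 * (-((5 * l : ℕ) : K)) = (p : K) ^ 2 := by
      rw [← hθ]; linear_combination (q * θ - p) * h
    have e2 : q ^ 2 * (-((5 * l : ℕ) : ℚ)) = p ^ 2 := by exact_mod_cast e
    have : (0 : ℚ) < ((5 * l : ℕ) : ℚ) := by have := hl.pos; exact_mod_cast (by positivity)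
    have := sq_pos_of_ne_zero hq
    nlinarith [sq_nonneg p]
  subst hq
  refine ⟨?_, rfl⟩
  simpa using h

include hl hθ in
lemma K_uniq {p q p' q' : ℚ} (h : (p : K) + q * θ = p' + q' * θ) : p = p' ∧ q = q' := by
  have := K_ind hl hθ (p := p - p') (q := q - q') (by push_cast; linear_combination h)
  exact ⟨by linarith [this.1], by linarith [this.2]⟩

include hl hθ hK in
lemma K_coord (x : K) : ∃ p q : ℚ, x = p + q * θ := by
  have hli : LinearIndependent ℚ ![(1 : K), θ] := by
    rw [LinearIndependent.pair_iff]
    intro s t h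
    rw [Algebra.smul_def, Algebra.smul_def, mul_one] at h
    exact K_ind hl hθ (by simpa using h)
  have hs := hli.span_eq_top_of_card_eq_finrank (by simp [hK])
  have hx : x ∈ Submodule.span ℚ (Set.range ![(1 : K), θ]) := by rw [hs]; trivial
  simp only [Matrix.range_cons, Matrix.range_empty, Set.union_empty, Set.singleton_union] at hx
  obtain ⟨p, q, h⟩ := Submodule.mem_span_pair.mp hx
  refine ⟨p, q, ?_⟩
  rw [← h, Algebra.smul_def, Algebra.smul_def, mul_one]; simp

include hl hθ in
lemma exists_sigma : ∃ σ : K →+* ℂ, 0 < (σ θ).im ∧ (σ θ).re = 0 := by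
  obtain ⟨σ⟩ := (inferInstance : Nonempty (K →+* ℂ))
  have h1 : (σ θ) ^ 2 = -((5 * l : ℕ) : ℂ) := by rw [← map_pow, hθ, map_neg, map_natCast]
  have hl0 : (0 : ℝ) < l := by exact_mod_cast hl.pos
  have hre := congrArg Complex.re h1
  have him := congrArg Complex.im h1
  rw [sq] at hre him
  simp at hre him
  have hi : (σ θ).im ≠ 0 := by
    intro h; rw [h] at hre; nlinarith [mul_self_nonneg (σ θ).re]
  have hr : (σ θ).re = 0 := by
    have : (σ θ).re * (σ θ).im = 0 := by linarith
    exact (mul_eq_zero.mp this).resolve_right hi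
  rcases lt_or_gt_of_ne hi with h | h
  · refine ⟨(starRingEnd ℂ).comp σ, ?_, ?_⟩ <;> simp [hr, h]
  · exact ⟨σ, h, hr⟩

include hl h5 hθ hK in
lemma K_int {x : K} (hx : IsIntegral ℤ x) : ∃ P Q : ℤ, 2 * x = P + Q * θ ∧ (4 : ℤ) ∣ P ^ 2 + 5 * l * Q ^ 2 := by
  obtain ⟨p, q, rfl⟩ := K_coord hl hθ hK x
  obtain ⟨σ, hσ, hσ'⟩ := exists_sigma hl hθ
  have h1 : (σ θ) ^ 2 = -((5 * l : ℕ) : ℂ) := by rw [← map_pow, hθ, map_neg, map_natCast]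
  have hc : (starRingEnd ℂ) (σ θ) = - σ θ := by
    apply Complex.ext <;> simp [hσ']
  have i1 : IsIntegral ℤ ((p : ℂ) + q * σ θ) := by
    have := map_isIntegral_int σ hx
    simpa using this
  have i2 : IsIntegral ℤ ((p : ℂ) - q * σ θ) := by
    have := map_isIntegral_int (starRingEnd ℂ) i1
    simpa [hc, sub_eq_add_neg] using this
  obtain ⟨P, hP⟩ := rat_int (r := 2 * p) (by
    have := i1.add i2
    have e : (p : ℂ) + q * σ θ + (p - q * σ θ) = ((2 * p : ℚ) : ℂ) := by push_cast; ring
    rwa [e] at this)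
  obtain ⟨M, hM⟩ := rat_int (r := p ^ 2 + 5 * l * q ^ 2) (by
    have := i1.mul i2
    have e : ((p : ℂ) + q * σ θ) * (p - q * σ θ) = ((p ^ 2 + 5 * l * q ^ 2 : ℚ) : ℂ) := by
      push_cast at h1 ⊢; linear_combination -(q : ℂ) ^ 2 * h1
    rwa [e] at this)
  obtain ⟨S, hS⟩ := rat_int (r := 5 * l * (2 * q)) (by
    refine IsIntegral.of_pow (n := 2) (by norm_num) ?_
    have e : ((5 * l * (2 * q) : ℚ) : ℂ) ^ 2 = ((5 * l * (4 * M - P ^ 2) : ℤ) : ℂ) := by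
      have : (5 * l * (2 * q) : ℚ) ^ 2 = 5 * l * (4 * M - P ^ 2) := by rw [← hP, ← hM]; ring
      exact_mod_cast congrArg (Rat.cast : ℚ → ℂ) this
    rw [e]
    exact isIntegral_algebraMap (R := ℤ) (A := ℂ) (x := 5 * l * (4 * M - P ^ 2)))
  have eS : S ^ 2 = 5 * l * (4 * M - P ^ 2) := by
    have : (S : ℚ) ^ 2 = 5 * l * (4 * M - P ^ 2) := by rw [← hS, ← hP, ← hM]; ring
    exact_mod_cast this
  have hlp := Nat.prime_iff_prime_int.mp hl
  have h5p : Prime (5 : ℤ) := Int.prime_iff_natAbs_prime.mpr (by norm_num)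
  have d5 : (5 : ℤ) ∣ S := h5p.dvd_of_dvd_pow (n := 2) (by rw [eS]; exact ⟨l * (4 * M - P ^ 2), by ring⟩)
  have dl : (l : ℤ) ∣ S := hlp.dvd_of_dvd_pow (n := 2) (by rw [eS]; exact ⟨5 * (4 * M - P ^ 2), by ring⟩)
  have hco : IsCoprime (5 : ℤ) l := by
    have : Nat.Coprime 5 l := (Nat.coprime_primes (by norm_num) hl).mpr (by omega)
    exact_mod_cast Nat.isCoprime_iff_coprime.mpr this
  obtain ⟨Q, hQ⟩ := hco.mul_dvd d5 dl
  have hl0 : (l : ℚ) ≠ 0 := by exact_mod_cast hl.ne_zero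
  have hq : 2 * q = Q := by
    have : (5 * l : ℚ) * (2 * q) = 5 * l * Q := by rw [hS, hQ]; push_cast; ring
    exact mul_left_cancel₀ (by positivity) this
  refine ⟨P, Q, ?_, M, ?_⟩
  · have h2 : (2 : K) * p = P := by exact_mod_cast congrArg (Rat.cast : ℚ → K) hP
    have h3 : (2 : K) * q = Q := by exact_mod_cast congrArg (Rat.cast : ℚ → K) hq
    linear_combination h2 + θ * h3
  · have : (P : ℚ) ^ 2 + 5 * l * Q ^ 2 = 4 * M := by rw [← hP, ← hq, ← hM]; ring
    exact_mod_cast this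

include hl h5 hθ hK in
lemma K_unit {v w : K} (hv : IsIntegral ℤ v) (hw : IsIntegral ℤ w) (h : v * w = 1) : v = 1 ∨ v = -1 := by
  obtain ⟨P, Q, e, d⟩ := K_int hl h5 hθ hK hv
  obtain ⟨P', Q', e', d'⟩ := K_int hl h5 hθ hK hw
  have h1 := K_uniq hl hθ (p := P * P' - 5 * l * Q * Q') (q := P * Q' + Q * P') (p' := 4) (q' := 0) (by
    push_cast at hθ ⊢
    have : (2 * v) * (2 * w) = 4 := by linear_combination 4 * h
    rw [e, e'] at this
    linear_combination this - Q * Q' * hθ)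
  have e1 : P * P' - 5 * l * Q * Q' = 4 := by exact_mod_cast h1.1
  have e2 : P * Q' + Q * P' = 0 := by exact_mod_cast h1.2
  have hN : (P ^ 2 + 5 * l * Q ^ 2) * (P' ^ 2 + 5 * l * Q' ^ 2) = 16 := by
    have : (P ^ 2 + 5 * l * Q ^ 2) * (P' ^ 2 + 5 * l * Q' ^ 2) = (P * P' - 5 * l * Q * Q') ^ 2 + 5 * l * (P * Q' + Q * P') ^ 2 := by
      ring
    rw [this, e1, e2]; ring
  have hn : 0 ≤ P ^ 2 + 5 * l * Q ^ 2 := by positivity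
  have hn' : 0 ≤ P' ^ 2 + 5 * l * Q' ^ 2 := by positivity
  obtain ⟨m, hm⟩ := d
  obtain ⟨m', hm'⟩ := d'
  rw [hm] at hN hn
  rw [hm'] at hN hn'
  have hmm : m * m' = 1 := by nlinarith
  have hm1 : m = 1 := by
    rcases Int.mul_eq_one_iff_eq_one_or_neg_one.mp hmm with h | h <;> omega
  subst hm1
  have hl' : (5 : ℤ) < l := by exact_mod_cast h5
  have hQ : Q = 0 := by
    by_contra hQ
    have := sq_pos_of_ne_zero hQ
    nlinarith [sq_nonneg P]
  subst hQ
  have hP : (P - 2) * (P + 2) = 0 := by linarith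
  rcases mul_eq_zero.mp hP with h | h
  · left
    have : P = 2 := by omega
    subst this
    push_cast at e
    linear_combination e / 2
  · right
    have : P = -2 := by omega
    subst this
    push_cast at e
    linear_combination e / 2

include hl h5 hθ hK in
lemma K_int1 (h4 : l % 4 = 1) {x : K} (hx : IsIntegral ℤ x) : ∃ m n : ℤ, x = m + n * θ := by
  obtain ⟨P, Q, e, d⟩ := K_int hl h5 hθ hK hx
  obtain ⟨k, hk⟩ : ∃ k : ℤ, (l : ℤ) = 4 * k + 1 := ⟨l / 4, by omega⟩
  have d2 : (4 : ℤ) ∣ P ^ 2 + Q ^ 2 := by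
    obtain ⟨t, ht⟩ := d
    exact ⟨t - (5 * k + 1) * Q ^ 2, by rw [hk] at ht; linarith⟩
  have sq4 : ∀ y : ℤ, y ^ 2 % 4 = y % 2 := by
    intro y
    rcases Int.even_or_odd' y with ⟨c, rfl | rfl⟩
    · ring_nf; omega
    · ring_nf; omega
  have s1 := sq4 P
  have s2 := sq4 Q
  obtain ⟨m, rfl⟩ : (2 : ℤ) ∣ P := by omega
  obtain ⟨n, rfl⟩ : (2 : ℤ) ∣ Q := by omega
  refine ⟨m, n, ?_⟩
  push_cast at e
  linear_combination e / 2

include hl h5 hθ hK in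
lemma K_int3 (h4 : l % 4 = 3) {x : K} (hx : IsIntegral ℤ x) : ∃ m n : ℤ, x = m + n * ((1 + θ) / 2) := by
  obtain ⟨P, Q, e, d⟩ := K_int hl h5 hθ hK hx
  obtain ⟨k, hk⟩ : ∃ k : ℤ, (l : ℤ) = 4 * k + 3 := ⟨l / 4, by omega⟩
  have d2 : (4 : ℤ) ∣ P ^ 2 - Q ^ 2 := by
    obtain ⟨t, ht⟩ := d
    exact ⟨t - (5 * k + 4) * Q ^ 2, by rw [hk] at ht; linarith⟩
  have sq4 : ∀ y : ℤ, y ^ 2 % 4 = y % 2 := by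
    intro y
    rcases Int.even_or_odd' y with ⟨c, rfl | rfl⟩
    · ring_nf; omega
    · ring_nf; omega
  have s1 := sq4 P
  have s2 := sq4 Q
  obtain ⟨m, hm⟩ : (2 : ℤ) ∣ P - Q := by omega
  refine ⟨m, Q, ?_⟩
  have hm' : (P : K) - Q = 2 * m := by exact_mod_cast congrArg (Int.cast : ℤ → K) hm
  linear_combination (e + hm') / 2

include hθ in
lemma th_int : IsIntegral ℤ θ := by
  refine IsIntegral.of_pow (n := 2) (by norm_num) ?_
  rw [hθ]
  have := isIntegral_algebraMap (R := ℤ) (A := K) (x := -((5 * l : ℕ) : ℤ))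
  simpa using this

include hθ in
lemma om_sq {k : ℤ} (hk : (1 + 5 * l : ℤ) = 4 * k) : ((1 + θ) / 2) ^ 2 = (1 + θ) / 2 - k := by
  have : (1 + 5 * l : K) = 4 * k := by exact_mod_cast congrArg (Int.cast : ℤ → K) hk
  push_cast at hθ
  linear_combination hθ / 4 - this / 4

include hθ in
lemma om_int (h4 : l % 4 = 3) : IsIntegral ℤ ((1 + θ) / 2) := by
  obtain ⟨k, hk⟩ : ∃ k : ℤ, (1 + 5 * l : ℤ) = 4 * k := ⟨(1 + 5 * l) / 4, by omega⟩
  have e := om_sq hθ hk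
  refine ⟨Polynomial.X ^ 2 - Polynomial.X + Polynomial.C k, by monicity!, ?_⟩
  rw [Polynomial.eval₂_add, Polynomial.eval₂_sub, Polynomial.eval₂_X_pow, Polynomial.eval₂_X, Polynomial.eval₂_C, e]
  simp
end
end

section
open Complex

section
variable {K : Type} [Field K]

/-- the additive group generated by two elements -/
def lt (α β : K) : AddSubgroup K where
  carrier := {x | ∃ m n : ℤ, x = m * α + n * β}
  zero_mem' := ⟨0, 0, by simp⟩
  add_mem' := by
    rintro _ _ ⟨m, n, rfl⟩ ⟨m', n', rfl⟩
    exact ⟨m + m', n + n', by push_cast; ring⟩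
  neg_mem' := by
    rintro _ ⟨m, n, rfl⟩
    exact ⟨-m, -n, by push_cast; ring⟩

lemma mem_lt {α β x : K} : x ∈ lt α β ↔ ∃ m n : ℤ, x = m * α + n * β := Iff.rfl

/-- homothety -/
def hmt (L L' : AddSubgroup K) : Prop := ∃ v : K, v ≠ 0 ∧ ∀ x, x ∈ L ↔ v * x ∈ L'

lemma hmt.refl (L : AddSubgroup K) : hmt L L := ⟨1, one_ne_zero, fun x => by rw [one_mul]⟩
lemma hmt.symm {L L' : AddSubgroup K} (h : hmt L L') : hmt L' L := by
  obtain ⟨v, hv, h⟩ := h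
  exact ⟨v⁻¹, inv_ne_zero hv, fun x => by rw [h, mul_inv_cancel_left₀ hv]⟩
lemma hmt.trans {L L' L'' : AddSubgroup K} (h : hmt L L') (h' : hmt L' L'') : hmt L L'' := by
  obtain ⟨v, hv, h⟩ := h
  obtain ⟨w, hw, h'⟩ := h'
  exact ⟨w * v, mul_ne_zero hw hv, fun x => by rw [h, h', mul_assoc]⟩

/-- independence over the integers -/
def Ind (α β : K) : Prop := ∀ m n : ℤ, (m : K) * α + n * β = 0 → m = 0 ∧ n = 0

lemma Ind.eq {α β : K} (h : Ind α β) {m n m' n' : ℤ} (e : (m : K) * α + n * β = m' * α + n' * β) : m = m' ∧ n = n' := by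
  have := h (m - m') (n - n') (by push_cast; linear_combination e)
  omega

lemma Ind.left {α β : K} (h : Ind α β) : α ≠ 0 := by
  rintro rfl
  have := (h 1 0 (by simp)).1
  omega

def Good (L : AddSubgroup K) : Prop := ∃ α β, Ind α β ∧ L = lt α β

lemma hmt.good {L L' : AddSubgroup K} (h : hmt L L') (hL : Good L) : Good L' := by
  obtain ⟨v, hv, h⟩ := h
  obtain ⟨α, β, hi, rfl⟩ := hL
  refine ⟨v * α, v * β, ?_, ?_⟩
  · intro m n e
    refine hi m n (mul_left_cancel₀ hv (by linear_combination e))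
  · ext x
    have := h (v⁻¹ * x)
    rw [mul_inv_cancel_left₀ hv] at this
    rw [← this, mem_lt, mem_lt]
    constructor
    · rintro ⟨m, n, e⟩; exact ⟨m, n, by rw [inv_mul_eq_iff_eq_mul₀ hv] at e; rw [e]; ring⟩
    · rintro ⟨m, n, e⟩; exact ⟨m, n, by rw [inv_mul_eq_iff_eq_mul₀ hv, e]; ring⟩

/-- the CM point in the field -/
def zt (θ : K) (a b : ℤ) : K := (θ - 5 * b) / (5 * a)

variable [NumberField K] {l : ℕ} {θ : K} (hl : l.Prime) (h5 : 5 < l) (hθ : θ ^ 2 = -((5 * l : ℕ) : K))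

lemma zt_eq {a b : ℤ} (ha : 0 < a) : 5 * a * zt θ a b + 5 * b = θ := by
  have : (5 : K) * a ≠ 0 := mul_ne_zero (by norm_num) (by exact_mod_cast ha.ne')
  rw [zt, mul_div_cancel₀ _ this]; ring

include hθ in
lemma zt_th {a b d : ℤ} (ha : 0 < a) (h : a * d - 5 * b ^ 2 = l) : θ * zt θ a b = -5 * b * zt θ a b - d := by
  have e := zt_eq (θ := θ) (b := b) ha
  have h' : (a * d - 5 * b ^ 2 : K) = l := by exact_mod_cast congrArg (Int.cast : ℤ → K) h
  have : (5 : K) * a ≠ 0 := mul_ne_zero (by norm_num) (by exact_mod_cast ha.ne')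
  apply mul_left_cancel₀ this
  push_cast at hθ
  linear_combination (θ + 5 * b) * e + hθ + 5 * h'

include hl hθ in
lemma zt_ind {a b : ℤ} (ha : 0 < a) : Ind 1 (zt θ a b) := by
  intro m n e
  have h1 := zt_eq (θ := θ) (b := b) ha
  have := K_ind hl hθ (p := 5 * a * m - 5 * b * n) (q := n) (by push_cast; linear_combination 5 * a * e - n * h1)
  have hn : n = 0 := by exact_mod_cast this.2
  subst hn
  refine ⟨?_, rfl⟩
  simpa using e

lemma zt_im {σ : K →+* ℂ} (hσ : 0 < (σ θ).im) {a b : ℤ} (ha : 0 < a) : 0 < (σ (zt θ a b)).im := by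
  have e := congrArg σ (zt_eq (θ := θ) (b := b) ha)
  rw [map_add, map_mul, map_mul, map_mul, map_intCast, map_intCast, map_ofNat] at e
  have e2 := congrArg Complex.im e
  simp at e2
  have ha' : (0 : ℝ) < a := by exact_mod_cast ha
  rw [← e2] at hσ
  exact pos_of_mul_pos_right hσ (by positivity)

include hl h5 hθ in
theorem yf_hmt {σ : K →+* ℂ} (hσ : 0 < (σ θ).im) {a b d a' b' d' : ℤ} (ha : 0 < a) (h : a * d - 5 * b ^ 2 = l)
    (ha' : 0 < a') (h' : a' * d' - 5 * b' ^ 2 = l) :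
    yf (σ (zt θ a b)) = yf (σ (zt θ a' b')) ↔ hmt (lt 1 (zt θ a b)) (lt 1 (zt θ a' b')) := by
  have hz := zt_im (b := b) hσ ha
  have hz' := zt_im (b := b') hσ ha'
  have hθz := zt_th hθ ha' h'
  have eθ := zt_eq (θ := θ) (b := b) ha
  have eθ' := zt_eq (θ := θ) (b := b') ha'
  have hi' : Ind 1 (zt θ a' b') := zt_ind hl hθ ha'
  generalize zt θ a b = ζ at *
  generalize zt θ a' b' = ζ' at *
  constructor
  · intro e
    obtain ⟨A, hA, e⟩ := y_inj hz hz' e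
    have hd0 := dn_ne hA.pos hz
    rw [mo_def, div_eq_iff hd0] at e
    obtain ⟨r, hr⟩ := hA.2
    have hdet := hA.1
    rw [Matrix.det_fin_two, hr] at hdet
    rw [dn, hr] at e hd0
    generalize A 0 0 = p at *
    generalize A 0 1 = q at *
    generalize A 1 1 = s at *
    have e1 : p * ζ + q = ζ' * (5 * r * ζ + s) := by
      apply σ.injective
      simp only [map_add, map_mul, map_intCast, map_ofNat]
      push_cast at e
      exact e
    have hv : (5 * r * ζ + s : K) ≠ 0 := by
      intro h0
      apply hd0
      have := congrArg σ h0
      simp only [map_add, map_mul, map_intCast, map_ofNat, map_zero] at this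
      push_cast
      exact this
    have hdet' : (p * s - q * (5 * r) : K) = 1 := by exact_mod_cast congrArg (Int.cast : ℤ → K) hdet
    apply hmt.symm
    refine ⟨5 * r * ζ + s, hv, fun x => ⟨?_, ?_⟩⟩
    · rintro ⟨m, n, rfl⟩
      exact ⟨m * s + n * q, 5 * m * r + n * p, by push_cast; linear_combination -n * e1⟩
    · rintro ⟨m, n, hx⟩
      refine ⟨m * p - n * q, -5 * r * m + s * n, mul_left_cancel₀ hv ?_⟩
      rw [hx]
      push_cast
      linear_combination -(m + n * ζ) * hdet' + (-5 * r * m + s * n) * e1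
  · rintro ⟨v, hv, H⟩
    obtain ⟨s, r, hs⟩ := (H 1).mp ⟨1, 0, by simp⟩
    obtain ⟨q, p, hp⟩ := (H ζ).mp ⟨0, 1, by simp⟩
    obtain ⟨m, n, hm⟩ := (H (v⁻¹ * 1)).mpr (by rw [mul_inv_cancel_left₀ hv]; exact ⟨1, 0, by simp⟩)
    obtain ⟨m', n', hm'⟩ := (H (v⁻¹ * ζ')).mpr (by rw [mul_inv_cancel_left₀ hv]; exact ⟨0, 1, by simp⟩)
    rw [inv_mul_eq_iff_eq_mul₀ hv] at hm hm'
    have g1 := hi'.eq (m := 1) (n := 0) (m' := m * s + n * q) (n' := m * r + n * p) (by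
      push_cast; linear_combination hm + m * hs + n * hp)
    have g2 := hi'.eq (m := 0) (n := 1) (m' := m' * s + n' * q) (n' := m' * r + n' * p) (by
      push_cast; linear_combination hm' + m' * hs + n' * hp)
    have hunit : (p * s - q * r) * (m * n' - n * m') = 1 := by
      obtain ⟨f1, f2⟩ := g1
      obtain ⟨f3, f4⟩ := g2
      have : (p * s - q * r) * (m * n' - n * m') = (m * s + n * q) * (m' * r + n' * p) - (m * r + n * p) * (m' * s + n' * q) := by
        ring
      rw [this, ← f1, ← f2, ← f3, ← f4]; norm_num
    have g3 := hi'.eq (m := 5 * a * q + 5 * b * s) (n := 5 * a * p + 5 * b * r) (m' := 5 * b' * s - d' * r)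
      (n' := 5 * a' * s - 5 * b' * r) (by
      push_cast
      linear_combination v * eθ - v * eθ' - 5 * a * hp - 5 * b * hs + (5 * a' * ζ' + 5 * b') * hs + r * ζ' * eθ' + r * hθz)
    obtain ⟨f1, f2⟩ := g3
    have hl0 : (0 : ℤ) < l := by exact_mod_cast hl.pos
    have h5r : (5 : ℤ) ∣ r := by
      have h5p : Prime (5 : ℤ) := Int.prime_iff_natAbs_prime.mpr (by norm_num)
      have : (5 : ℤ) ∣ d' * r := ⟨b' * s - a * q - b * s, by linarith⟩
      rcases h5p.dvd_or_dvd this with h | h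
      · exfalso
        have h6 : (5 : ℤ) ∣ l := by rw [← h']; exact dvd_sub (h.mul_left _) ⟨b' ^ 2, rfl⟩
        have h7 : 5 ∣ l := by exact_mod_cast h6
        have := (Nat.prime_dvd_prime_iff_eq (by norm_num) hl).mp h7
        omega
      · exact h
    have hpos : 0 < p * s - q * r := by
      have hrs : r ≠ 0 ∨ s ≠ 0 := by
        by_contra hc
        push Not at hc
        rw [hc.1, hc.2] at hs
        simp at hs
        exact hv hs
      have k1 : (5 * a' * (5 * a)) * (p * s - q * r) = (5 * a' * s - 5 * b' * r) ^ 2 + 5 * l * r ^ 2 := by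
        rw [← h']
        linear_combination 5 * a' * s * f2 - 5 * a' * r * f1
      have k2 : 0 < (5 * a' * s - 5 * b' * r) ^ 2 + 5 * l * r ^ 2 := by
        by_cases hr0 : r = 0
        · subst hr0
          have hs0 : s ≠ 0 := by simpa using hrs
          have : 5 * a' * s ≠ 0 := by positivity
          have := sq_pos_of_ne_zero this
          simpa using this
        · have := sq_pos_of_ne_zero hr0
          positivity
      rw [← k1] at k2
      exact pos_of_mul_pos_right k2 (by positivity)
    have hdet : p * s - q * r = 1 := by
      rcases Int.mul_eq_one_iff_eq_one_or_neg_one.mp hunit with h | h <;> omega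
    have hA : G5 !![p, q; r, s] := ⟨by rw [Matrix.det_fin_two]; simpa using hdet, by simpa using h5r⟩
    have hfin : mo !![p, q; r, s] (σ ζ') = σ ζ := by
      have h0 := dn_ne hA.pos hz'
      rw [mo_def, div_eq_iff h0]
      simp only [dn, Matrix.of_apply, Matrix.cons_val', Matrix.cons_val_zero, Matrix.cons_val_one]
      have : p * ζ' + q = ζ * (r * ζ' + s) := by linear_combination -hp + ζ * hs
      have := congrArg σ this
      simpa using this
    rw [← hfin, yf_inv hA hz']

include hl hθ in
lemma core_S {L : AddSubgroup K} {α β : K} (h0 : α ≠ 0) (hL : L = lt α β) {a b r : ℤ} (e1 : θ * α = 5 * b * α + 5 * a * β)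
    (e3 : 25 * b ^ 2 + 5 * a * r = -5 * l) :
    ∃ a b d : ℤ, 0 < a ∧ a * d - 5 * b ^ 2 = l ∧ hmt (lt 1 (zt θ a b)) L := by
  have ha : a ≠ 0 := by
    rintro rfl
    have : (0 : ℤ) < l := by exact_mod_cast hl.pos
    nlinarith [sq_nonneg b]
  have ha' : (a : K) ≠ 0 := by exact_mod_cast ha
  rcases lt_or_gt_of_ne ha with hneg | hpos
  · refine ⟨-a, b, r, by omega, by linarith, α, h0, fun x => ?_⟩
    have hz : α * zt θ (-a) b = -β := by
      rw [zt]; push_cast; field_simp; linear_combination (-1) * e1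
    rw [hL, mem_lt, mem_lt]
    constructor
    · rintro ⟨m, n, rfl⟩
      exact ⟨m, -n, by push_cast; linear_combination n * hz⟩
    · rintro ⟨m, n, hx⟩
      exact ⟨m, -n, mul_left_cancel₀ h0 (by rw [hx]; push_cast; linear_combination n * hz)⟩
  · refine ⟨a, b, -r, by omega, by linarith, α, h0, fun x => ?_⟩
    have hz : α * zt θ a b = β := by
      rw [zt]; field_simp; linear_combination e1
    rw [hL, mem_lt, mem_lt]
    constructor
    · rintro ⟨m, n, rfl⟩
      exact ⟨m, n, by linear_combination n * hz⟩
    · rintro ⟨m, n, hx⟩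
      exact ⟨m, n, mul_left_cancel₀ h0 (by rw [hx]; linear_combination -n * hz)⟩

include hl hθ in
theorem exists_zt {L : AddSubgroup K} (hL : Good L) (hs : ∀ x ∈ L, θ * x ∈ L) :
    ∃ a b d : ℤ, 0 < a ∧ a * d - 5 * b ^ 2 = l ∧ hmt (lt 1 (zt θ a b)) L := by
  obtain ⟨α, β, hi, rfl⟩ := hL
  obtain ⟨p, q, e1⟩ := hs α ⟨1, 0, by simp⟩
  obtain ⟨r, t, e2⟩ := hs β ⟨0, 1, by simp⟩
  have g := hi.eq (m := -5 * l) (n := 0) (m' := p ^ 2 + q * r) (n' := q * (p + t)) (by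
    push_cast at hθ ⊢
    linear_combination (-α) * hθ + (θ + p) * e1 + q * e2)
  obtain ⟨g1, g2⟩ := g
  have hl0 : (0 : ℤ) < l := by exact_mod_cast hl.pos
  have hq : q ≠ 0 := by rintro rfl; nlinarith [sq_nonneg p]
  have ht : t = -p := by
    rcases mul_eq_zero.mp g2.symm with h | h
    · exact absurd h hq
    · omega
  subst ht
  have h5p : Prime (5 : ℤ) := Int.prime_iff_natAbs_prime.mpr (by norm_num)
  by_cases hq5 : (5 : ℤ) ∣ q
  · obtain ⟨a, rfl⟩ := hq5
    have : (5 : ℤ) ∣ p := h5p.dvd_of_dvd_pow (n := 2) ⟨-l - a * r, by linarith⟩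
    obtain ⟨b, rfl⟩ := this
    refine core_S hl hθ hi.left rfl (a := a) (b := b) (r := r) (by rw [e1]; push_cast; ring) (by linarith)
  · obtain ⟨k, b, hk⟩ : ∃ k b : ℤ, k * q - p = 5 * b := by
      have hco : IsCoprime (5 : ℤ) q := (h5p.coprime_iff_not_dvd).mpr hq5
      obtain ⟨u, w, huw⟩ := hco
      exact ⟨p * w, -p * u, by linear_combination p * huw⟩
    have g3 : (5 * b) ^ 2 + (r + 2 * k * p - k ^ 2 * q) * q = -5 * l := by rw [← hk, g1]; ring
    have : (5 : ℤ) ∣ r + 2 * k * p - k ^ 2 * q := by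
      have : (5 : ℤ) ∣ (r + 2 * k * p - k ^ 2 * q) * q := ⟨-l - 5 * b ^ 2, by linarith⟩
      exact (h5p.dvd_or_dvd this).resolve_right hq5
    obtain ⟨a, ha⟩ := this
    rw [ha] at g3
    have hk' : (k * q - p : K) = 5 * b := by exact_mod_cast congrArg (Int.cast : ℤ → K) hk
    have ha' : (r + 2 * k * p - k ^ 2 * q : K) = 5 * a := by exact_mod_cast congrArg (Int.cast : ℤ → K) ha
    refine core_S hl hθ (α := β + k * α) (β := α) ?_ ?_ (a := a) (b := b) (r := q) ?_ (by linarith)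
    · intro h
      have := (hi k 1 (by push_cast; linear_combination h)).2
      omega
    · ext x
      rw [mem_lt, mem_lt]
      constructor
      · rintro ⟨m, n, rfl⟩; exact ⟨n, m - n * k, by push_cast; ring⟩
      · rintro ⟨m, n, rfl⟩; exact ⟨n + m * k, m, by push_cast; ring⟩
    · rw [← hk', ← ha']
      push_cast at e2
      linear_combination k * e1 + e2
end
end

section
open NumberField

section
variable {K : Type} [Field K] [NumberField K] {l : ℕ} {θ : K} (hl : l.Prime) (h5 : 5 < l) (hθ : θ ^ 2 = -((5 * l : ℕ) : K))
  (hK : Module.finrank ℚ K = 2)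

include hl h5 in
lemma mem_TT {σ : K →+* ℂ} (hσ : 0 < (σ θ).im) (hσ2 : (σ θ).re = 0) (hθ : θ ^ 2 = -((5 * l : ℕ) : K)) {w : ℂ} :
    w ∈ TT l ↔ ∃ a b d : ℤ, 0 < a ∧ a * d - 5 * b ^ 2 = l ∧ w = yf (σ (zt θ a b)) := by
  have hs : (σ θ) ^ 2 = -(5 * l : ℂ) := by
    rw [← map_pow, hθ, map_neg, map_natCast]; push_cast; rfl
  constructor
  · rintro ⟨z, a, b, d, hz, h, rfl⟩
    have ha := CM.a_ne hl (by omega) hz h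
    have key : ∀ a b d : ℤ, 0 < a → CM l a b b d z → ∃ a b d : ℤ, 0 < a ∧ a * d - 5 * b ^ 2 = l ∧ yf z = yf (σ (zt θ a b)) := by
      intro a b d ha h
      refine ⟨a, b, d, ha, by linarith [h.1], ?_⟩
      congr 1
      have h1 : ((a * d - 5 * b * b : ℤ) : ℂ) = l := by rw [h.1]; push_cast; rfl
      push_cast at h1
      have e : (5 * a * z + 5 * b - σ θ) * (5 * a * z + 5 * b + σ θ) = 0 := by
        linear_combination (5 * a) * h.2 - 5 * h1 - hs
      have ha' : (0 : ℝ) < a := by exact_mod_cast ha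
      have ha2 : (a : ℂ) ≠ 0 := by exact_mod_cast ha.ne'
      have e3 : 5 * a * z + 5 * b = σ θ := by
        rcases mul_eq_zero.mp e with e | e
        · linear_combination e
        · exfalso
          have := congrArg Complex.im e
          simp at this
          nlinarith [mul_pos ha' hz]
      rw [zt, map_div₀, map_sub, map_mul, map_mul, map_intCast, map_intCast, map_ofNat, ← e3]
      field_simp
      ring
    rcases lt_or_gt_of_ne ha with hn | hp
    · exact key (-a) (-b) (-d) (by omega) ⟨by linarith [h.1], by push_cast; linear_combination -h.2⟩
    · exact key a b d hp h
  · rintro ⟨a, b, d, ha, h, rfl⟩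
    refine ⟨_, a, b, d, zt_im hσ ha, ⟨by linarith [h], ?_⟩, rfl⟩
    have e := zt_th hθ ha h
    have e1 := zt_eq (θ := θ) (b := b) ha
    have e2 : 5 * (a : K) * zt θ a b ^ 2 + 5 * (b + b) * zt θ a b + d = 0 := by
      linear_combination e + zt θ a b * e1
    have := congrArg σ e2
    simpa only [map_add, map_mul, map_pow, map_intCast, map_ofNat, map_zero] using this

include hl h5 hθ in
theorem exists_Y : ∃ Y : AddSubgroup K → ℂ,
    (∀ L, Good L → (∀ x ∈ L, θ * x ∈ L) → Y L ∈ TT l) ∧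
    (∀ L L', Good L → (∀ x ∈ L, θ * x ∈ L) → Good L' → (∀ x ∈ L', θ * x ∈ L') → (Y L = Y L' ↔ hmt L L')) ∧
    ∀ w ∈ TT l, ∃ L, Good L ∧ (∀ x ∈ L, θ * x ∈ L) ∧ Y L = w := by
  obtain ⟨σ, hσ, hσ2⟩ := exists_sigma hl hθ
  have hex : ∀ L : AddSubgroup K, ∃ w, Good L → (∀ x ∈ L, θ * x ∈ L) → ∃ a b d : ℤ, 0 < a ∧ a * d - 5 * b ^ 2 = l ∧ hmt (lt 1 (zt θ a b)) L ∧ w = yf (σ (zt θ a b)) := by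
    intro L
    by_cases h : Good L ∧ (∀ x ∈ L, θ * x ∈ L)
    · obtain ⟨a, b, d, h1, h2, h3⟩ := exists_zt hl hθ h.1 h.2
      exact ⟨_, fun _ _ => ⟨a, b, d, h1, h2, h3, rfl⟩⟩
    · exact ⟨0, fun h1 h2 => absurd ⟨h1, h2⟩ h⟩
  choose Y hY using hex
  have hinj : ∀ L L', Good L → (∀ x ∈ L, θ * x ∈ L) → Good L' → (∀ x ∈ L', θ * x ∈ L') → (Y L = Y L' ↔ hmt L L') := by
    intro L L' h1 h2 h3 h4
    obtain ⟨a, b, d, ha, h, hh, e⟩ := hY L h1 h2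
    obtain ⟨a', b', d', ha', h', hh', e'⟩ := hY L' h3 h4
    rw [e, e', yf_hmt hl h5 hθ hσ ha h ha' h']
    exact ⟨fun h => hh.symm.trans (h.trans hh'), fun h => hh.trans (h.trans hh'.symm)⟩
  refine ⟨Y, ?_, hinj, ?_⟩
  · intro L h1 h2
    obtain ⟨a, b, d, ha, h, hh, e⟩ := hY L h1 h2
    exact (mem_TT hl h5 hσ hσ2 hθ).mpr ⟨a, b, d, ha, h, e⟩
  · intro w hw
    obtain ⟨a, b, d, ha, h, e⟩ := (mem_TT hl h5 hσ hσ2 hθ).mp hw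
    have g : Good (lt 1 (zt θ a b)) := ⟨_, _, zt_ind hl hθ ha, rfl⟩
    have s : ∀ x ∈ lt 1 (zt θ a b), θ * x ∈ lt 1 (zt θ a b) := by
      rintro x ⟨m, n, rfl⟩
      have e := zt_th hθ ha h
      have e1 := zt_eq (θ := θ) (b := b) ha
      refine ⟨5 * b * m - d * n, 5 * a * m - 5 * b * n, ?_⟩
      push_cast
      linear_combination n * e - m * e1
    refine ⟨_, g, s, ?_⟩
    obtain ⟨a', b', d', ha', h', hh', e'⟩ := hY _ g s
    rw [e, e', yf_hmt hl h5 hθ hσ ha' h' ha h]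
    exact hh'

def OSt (L : AddSubgroup K) : Prop := ∀ x : K, IsIntegral ℤ x → ∀ y ∈ L, x * y ∈ L

/-- the image of an ideal -/
def iL (J : Ideal (𝓞 K)) : AddSubgroup K where
  carrier := {x | ∃ a ∈ J, (a : K) = x}
  zero_mem' := ⟨0, J.zero_mem, by simp⟩
  add_mem' := by
    rintro _ _ ⟨a, ha, rfl⟩ ⟨b, hb, rfl⟩
    exact ⟨a + b, J.add_mem ha hb, by simp⟩
  neg_mem' := by
    rintro _ ⟨a, ha, rfl⟩
    exact ⟨-a, J.neg_mem ha, by simp⟩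

lemma ok_add (a b : 𝓞 K) : ((a + b : 𝓞 K) : K) = a + b := rfl
lemma ok_mul (a b : 𝓞 K) : ((a * b : 𝓞 K) : K) = a * b := rfl
lemma ok_ex {x : K} (hx : IsIntegral ℤ x) : ∃ a : 𝓞 K, (a : K) = x := ⟨⟨x, hx⟩, rfl⟩

lemma mem_iL {J : Ideal (𝓞 K)} {x : K} : x ∈ iL J ↔ ∃ a ∈ J, (a : K) = x := Iff.rfl

lemma coe_mem_iL {J : Ideal (𝓞 K)} {a : 𝓞 K} : (a : K) ∈ iL J ↔ a ∈ J := by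
  rw [mem_iL]
  constructor
  · rintro ⟨b, hb, e⟩
    rwa [← RingOfIntegers.coe_injective e]
  · exact fun h => ⟨a, h, rfl⟩

lemma iL_st (J : Ideal (𝓞 K)) : OSt (iL J) := by
  rintro x hx _ ⟨a, ha, rfl⟩
  obtain ⟨b, rfl⟩ := ok_ex hx
  exact ⟨b * a, J.mul_mem_left _ ha, ok_mul b a⟩

include hK in
lemma iL_good {J : Ideal (𝓞 K)} (hJ : J ≠ ⊥) : Good (iL J) := by
  have hc : Fintype.card (Module.Free.ChooseBasisIndex ℤ (𝓞 K)) = 2 := by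
    rw [← Module.finrank_eq_card_chooseBasisIndex, RingOfIntegers.rank, hK]
  let B := (RingOfIntegers.basis K).reindex (Fintype.equivFinOfCardEq hc)
  let C := Ideal.selfBasis B J hJ
  refine ⟨((C 0 : 𝓞 K) : K), ((C 1 : 𝓞 K) : K), ?_, ?_⟩
  · intro m n h
    have e : m • C 0 + n • C 1 = 0 := by
      apply Subtype.ext
      apply RingOfIntegers.coe_injective
      simpa using h
    have := Fintype.linearIndependent_iff.mp C.linearIndependent ![m, n] (by simpa [Fin.sum_univ_two] using e)
    exact ⟨by simpa using this 0, by simpa using this 1⟩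
  · ext x
    rw [mem_lt]
    constructor
    · rintro ⟨a, ha, rfl⟩
      have := C.sum_repr ⟨a, ha⟩
      rw [Fin.sum_univ_two] at this
      have h2 := congrArg (fun z : J => ((z : 𝓞 K) : K)) this
      exact ⟨C.repr ⟨a, ha⟩ 0, C.repr ⟨a, ha⟩ 1, by rw [← show _ = (a : K) from h2]; simp⟩
    · rintro ⟨m, n, rfl⟩
      exact ⟨_, (m • C 0 + n • C 1).2, by simp⟩

lemma exists_ideal {L : AddSubgroup K} (hL : Good L) (hs : OSt L) : ∃ J : Ideal (𝓞 K), J ≠ ⊥ ∧ hmt L (iL J) := by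
  obtain ⟨α, β, hi, rfl⟩ := hL
  classical
  obtain ⟨n, hn, h⟩ := exists_integral_multiples ℤ ℚ ({α, β} : Finset K)
  have hα := h α (by simp)
  have hβ := h β (by simp)
  have hn' : (n : K) ≠ 0 := by exact_mod_cast hn
  rw [zsmul_eq_mul] at hα hβ
  let J : Ideal (𝓞 K) :=
    { carrier := {a | (n : K)⁻¹ * a ∈ lt α β}
      zero_mem' := by simp [AddSubgroup.zero_mem]
      add_mem' := by
        intro a b ha hb
        simp only [Set.mem_ofPred_eq] at ha hb ⊢
        rw [ok_add, mul_add]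
        exact AddSubgroup.add_mem _ ha hb
      smul_mem' := by
        intro c a ha
        simp only [Set.mem_ofPred_eq] at ha ⊢
        have := hs c c.2 _ ha
        rw [smul_eq_mul, ok_mul, mul_left_comm]
        exact this }
  have hm : ∀ a : 𝓞 K, a ∈ J ↔ (n : K)⁻¹ * a ∈ lt α β := fun a => Iff.rfl
  refine ⟨J, ?_, n, hn', ?_⟩
  · intro h0
    obtain ⟨a, ea⟩ := ok_ex hα
    have : a ∈ J := by
      rw [hm, ea]
      exact ⟨1, 0, by simp [inv_mul_cancel_left₀ hn']⟩
    rw [h0, Ideal.mem_bot] at this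
    rw [this] at ea
    exact mul_ne_zero hn' hi.left (by rw [← ea]; rfl)
  · intro x
    constructor
    · rintro ⟨p, q, rfl⟩
      have hintg : IsIntegral ℤ ((n : K) * (p * α + q * β)) := by
        have : (n : K) * (p * α + q * β) = p • (n * α) + q • (n * β) := by simp; ring
        rw [this]
        exact (hα.smul p).add (hβ.smul q)
      obtain ⟨a, ea⟩ := ok_ex hintg
      refine ⟨a, ?_, ea⟩
      rw [hm, ea]
      refine ⟨p, q, ?_⟩
      exact inv_mul_cancel_left₀ hn' _
    · rintro ⟨a, ha, e⟩
      rw [hm, e, inv_mul_cancel_left₀ hn'] at ha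
      exact ha

include hK in
theorem exists_I : ∃ I : ClassGroup (𝓞 K) → AddSubgroup K, (∀ C, Good (I C)) ∧ (∀ C, OSt (I C)) ∧
    (∀ C C', hmt (I C) (I C') → C = C') ∧ ∀ L, Good L → OSt L → ∃ C, hmt L (I C) := by
  choose J hJ using ClassGroup.mk0_surjective (R := 𝓞 K)
  have hne : ∀ J : nonZeroDivisors (Ideal (𝓞 K)), (J : Ideal (𝓞 K)) ≠ ⊥ := fun J => nonZeroDivisors.coe_ne_zero J
  have key : ∀ J J' : nonZeroDivisors (Ideal (𝓞 K)), hmt (iL (J : Ideal (𝓞 K))) (iL (J' : Ideal (𝓞 K))) ↔ ClassGroup.mk0 J = ClassGroup.mk0 J' := by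
    intro J J'
    rw [ClassGroup.mk0_eq_mk0_iff]
    constructor
    · rintro ⟨v, hv, h⟩
      obtain ⟨a, b, hb, e⟩ := IsFractionRing.div_surjective (A := 𝓞 K) v
      have hb0 : b ≠ 0 := nonZeroDivisors.ne_zero hb
      have hb' : (b : K) ≠ 0 := by simpa using hb0
      have ha0 : a ≠ 0 := by
        rintro rfl
        apply hv; rw [← e]; simp
      have e' : (a : K) = v * b := by rw [← e]; field_simp
      refine ⟨a, b, ha0, hb0, ?_⟩
      ext x
      rw [Ideal.mem_span_singleton_mul, Ideal.mem_span_singleton_mul]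
      constructor
      · rintro ⟨z, hz, rfl⟩
        obtain ⟨w, hw, e2⟩ := (h z).mp (coe_mem_iL.mpr hz)
        refine ⟨w, hw, RingOfIntegers.coe_injective ?_⟩
        simp only [ok_mul]
        rw [e2, e']; ring
      · rintro ⟨z, hz, rfl⟩
        obtain ⟨w, hw, e2⟩ := (h (v⁻¹ * z)).mpr (by rw [mul_inv_cancel_left₀ hv]; exact coe_mem_iL.mpr hz)
        refine ⟨w, hw, RingOfIntegers.coe_injective ?_⟩
        simp only [ok_mul]
        rw [e2, e']; field_simp
    · rintro ⟨a, b, ha, hb, h⟩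
      have hb' : (b : K) ≠ 0 := by simpa using hb
      have ha' : (a : K) ≠ 0 := by simpa using ha
      have key : ∀ x : K, (x ∈ iL (J : Ideal (𝓞 K)) → (a / b : K) * x ∈ iL (J' : Ideal (𝓞 K))) := by
        rintro _ ⟨z, hz, rfl⟩
        have : a * z ∈ Ideal.span {a} * (J : Ideal (𝓞 K)) := Ideal.mem_span_singleton_mul.mpr ⟨z, hz, rfl⟩
        rw [h, Ideal.mem_span_singleton_mul] at this
        obtain ⟨w, hw, e⟩ := this
        refine ⟨w, hw, ?_⟩
        have := congrArg (fun z : 𝓞 K => (z : K)) e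
        simp only [ok_mul] at this
        field_simp
        linear_combination this
      have key2 : ∀ x : K, (x ∈ iL (J' : Ideal (𝓞 K)) → (b / a : K) * x ∈ iL (J : Ideal (𝓞 K))) := by
        rintro _ ⟨z, hz, rfl⟩
        have : b * z ∈ Ideal.span {b} * (J' : Ideal (𝓞 K)) := Ideal.mem_span_singleton_mul.mpr ⟨z, hz, rfl⟩
        rw [← h, Ideal.mem_span_singleton_mul] at this
        obtain ⟨w, hw, e⟩ := this
        refine ⟨w, hw, ?_⟩
        have := congrArg (fun z : 𝓞 K => (z : K)) e
        simp only [ok_mul] at this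
        field_simp
        linear_combination this
      refine ⟨a / b, div_ne_zero ha' hb', fun x => ⟨key x, fun hx => ?_⟩⟩
      have := key2 _ hx
      rwa [← mul_assoc, div_mul_div_cancel₀ ha', div_self hb', one_mul] at this
  refine ⟨fun C => iL (J C : Ideal (𝓞 K)), fun C => iL_good hK (hne _), fun C => iL_st _, ?_, ?_⟩
  · intro C C' h
    have := (key _ _).mp h
    rwa [hJ, hJ] at this
  · intro L h1 h2
    obtain ⟨I, hI, h⟩ := exists_ideal h1 h2
    let I' : nonZeroDivisors (Ideal (𝓞 K)) := ⟨I, mem_nonZeroDivisors_of_ne_zero hI⟩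
    refine ⟨ClassGroup.mk0 I', h.trans ?_⟩
    exact (key I' _).mpr (hJ _).symm

/-- a multiplier of a lattice is integral -/
lemma mult_int {L : AddSubgroup K} (hL : Good L) {v : K} (h : ∀ x ∈ L, v * x ∈ L) : IsIntegral ℤ v := by
  obtain ⟨α, β, hi, rfl⟩ := hL
  obtain ⟨p, q, e1⟩ := h α ⟨1, 0, by simp⟩
  obtain ⟨r, s, e2⟩ := h β ⟨0, 1, by simp⟩
  have e : v ^ 2 - (p + s) * v + (p * s - q * r) = 0 := by
    apply mul_right_cancel₀ hi.left
    linear_combination (v - s) * e1 + q * e2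
  refine ⟨Polynomial.X ^ 2 - Polynomial.C (p + s) * Polynomial.X + Polynomial.C (p * s - q * r), by monicity!, ?_⟩
  simp only [Polynomial.eval₂_add, Polynomial.eval₂_sub, Polynomial.eval₂_mul, Polynomial.eval₂_X_pow, Polynomial.eval₂_X, Polynomial.eval₂_C]
  simpa using e

include hl h5 hθ hK in
lemma mult_unit {L : AddSubgroup K} (hL : Good L) {v : K} (h0 : v ≠ 0) (h : ∀ x, x ∈ L ↔ v * x ∈ L) : v = 1 ∨ v = -1 := by
  refine K_unit hl h5 hθ hK (mult_int hL fun x hx => (h x).mp hx) (mult_int hL (v := v⁻¹) fun x hx => ?_) (mul_inv_cancel₀ h0)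
  rw [h, mul_inv_cancel_left₀ h0]; exact hx

include hl h5 hθ hK in
theorem count_TT1 (h4 : l % 4 = 1) : (TT l).ncard = classNumber K := by
  obtain ⟨Y, hY1, hY2, hY3⟩ := exists_Y hl h5 hθ
  obtain ⟨I, hI1, hI2, hI3, hI4⟩ := exists_I hK
  have hst : ∀ C, ∀ x ∈ I C, θ * x ∈ I C := fun C x hx => hI2 C θ (th_int hθ) x hx
  have e : TT l = (fun C => Y (I C)) '' Set.univ := by
    ext w
    constructor
    · intro hw
      obtain ⟨L, g, s, rfl⟩ := hY3 w hw
      have hO : OSt L := by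
        intro x hx y hy
        obtain ⟨m, n, rfl⟩ := K_int1 hl h5 hθ hK h4 hx
        have : ((m : K) + n * θ) * y = m • y + n • (θ * y) := by simp; ring
        rw [this]
        exact add_mem (zsmul_mem hy m) (zsmul_mem (s y hy) n)
      obtain ⟨C, hC⟩ := hI4 L g hO
      exact ⟨C, trivial, ((hY2 _ _ g s (hI1 C) (hst C)).mpr hC).symm⟩
    · rintro ⟨C, -, rfl⟩
      exact hY1 _ (hI1 C) (hst C)
  rw [e, Set.ncard_image_of_injective _ (fun C C' h => hI3 C C' ((hY2 _ _ (hI1 C) (hst C) (hI1 C') (hst C')).mp h)), Set.ncard_univ,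
    Nat.card_eq_fintype_card, classNumber]
end
end

section
open NumberField

section
variable {K : Type} [Field K] [CharZero K]

/-- sublattice of index at most two -/
def Fs (α β : K) (i j : ZMod 2) : AddSubgroup K where
  carrier := {x | ∃ m n : ℤ, x = m * α + n * β ∧ i * m + j * n = 0}
  zero_mem' := ⟨0, 0, by simp, by simp⟩
  add_mem' := by
    rintro _ _ ⟨m, n, rfl, h⟩ ⟨m', n', rfl, h'⟩
    exact ⟨m + m', n + n', by push_cast; ring, by push_cast; linear_combination h + h'⟩
  neg_mem' := by
    rintro _ ⟨m, n, rfl, h⟩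
    exact ⟨-m, -n, by push_cast; ring, by push_cast; linear_combination -h⟩

lemma mem_Fs {α β : K} (hi : Ind α β) {i j : ZMod 2} {m n : ℤ} : (m : K) * α + n * β ∈ Fs α β i j ↔ i * m + j * n = 0 := by
  constructor
  · rintro ⟨m', n', e, h⟩
    obtain ⟨rfl, rfl⟩ := hi.eq e
    exact h
  · exact fun h => ⟨m, n, rfl, h⟩

lemma Fs_le {α β : K} {i j : ZMod 2} : Fs α β i j ≤ lt α β := by
  rintro _ ⟨m, n, rfl, -⟩
  exact ⟨m, n, rfl⟩

lemma two_mem_Fs {α β x : K} {i j : ZMod 2} (hx : x ∈ lt α β) : 2 * x ∈ Fs α β i j := by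
  obtain ⟨m, n, rfl⟩ := hx
  refine ⟨2 * m, 2 * n, by push_cast; ring, ?_⟩
  have : (2 : ZMod 2) = 0 := rfl
  push_cast
  rw [this]; ring

lemma zm2 (n : ℤ) : (n : ZMod 2) = 0 ∧ (∃ k, n = 2 * k) ∨ (n : ZMod 2) = 1 ∧ ∃ k, n = 2 * k + 1 := by
  rcases Int.even_or_odd' n with ⟨k, rfl | rfl⟩
  · left; exact ⟨by push_cast; rw [show (2 : ZMod 2) = 0 from rfl, zero_mul], k, rfl⟩
  · right; exact ⟨by push_cast; rw [show (2 : ZMod 2) = 0 from rfl, zero_mul, zero_add], k, rfl⟩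

/-- subgroups between `2G` and `G` -/
lemma sub2 {α β : K} (hi : Ind α β) {M : AddSubgroup K} (h1 : ∀ x ∈ lt α β, 2 * x ∈ M) (h2 : M ≤ lt α β) :
    M = lt (2 * α) (2 * β) ∨ ∃ i j, M = Fs α β i j := by
  have red : ∀ m n k k' : ℤ, ((m + 2 * k : ℤ) : K) * α + (n + 2 * k' : ℤ) * β ∈ M ↔ (m : K) * α + n * β ∈ M := by
    intro m n k k'
    have e : ((m + 2 * k : ℤ) : K) * α + (n + 2 * k' : ℤ) * β = m * α + n * β + 2 * (k * α + k' * β) := by push_cast; ring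
    rw [e]
    exact AddSubgroup.add_mem_cancel_right _ (h1 _ ⟨k, k', rfl⟩)
  have r00 : ∀ k k' : ℤ, ((2 * k : ℤ) : K) * α + (2 * k' : ℤ) * β ∈ M := by
    intro k k'
    have := red 0 0 k k'
    simp only [zero_add, Int.cast_zero, zero_mul, AddSubgroup.zero_mem, iff_true] at this
    exact this
  have r10 : ∀ k k' : ℤ, ((2 * k + 1 : ℤ) : K) * α + (2 * k' : ℤ) * β ∈ M ↔ α ∈ M := by
    intro k k'
    have := red 1 0 k k'
    rw [add_comm 1, zero_add] at this
    rw [this]; simp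
  have r01 : ∀ k k' : ℤ, ((2 * k : ℤ) : K) * α + (2 * k' + 1 : ℤ) * β ∈ M ↔ β ∈ M := by
    intro k k'
    have := red 0 1 k k'
    rw [add_comm 1, zero_add] at this
    rw [this]; simp
  have r11 : ∀ k k' : ℤ, ((2 * k + 1 : ℤ) : K) * α + (2 * k' + 1 : ℤ) * β ∈ M ↔ α + β ∈ M := by
    intro k k'
    have := red 1 1 k k'
    rw [add_comm 1, add_comm 1] at this
    rw [this]; simp
  have ab : α ∈ M → (β ∈ M ↔ α + β ∈ M) := fun h => (AddSubgroup.add_mem_cancel_left M h).symm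
  have ba : β ∈ M → (α ∈ M ↔ α + β ∈ M) := fun h => (AddSubgroup.add_mem_cancel_right M h).symm
  have fin : ∀ i j : ZMod 2, (i = 0 ↔ α ∈ M) → (j = 0 ↔ β ∈ M) → (i + j = 0 ↔ α + β ∈ M) → M = Fs α β i j := by
    intro i j c1 c2 c3
    have main : ∀ m n : ℤ, (m : K) * α + n * β ∈ M ↔ i * m + j * n = 0 := by
      intro m n
      rcases zm2 m with ⟨e, k, rfl⟩ | ⟨e, k, rfl⟩ <;> rcases zm2 n with ⟨e', k', rfl⟩ | ⟨e', k', rfl⟩ <;> rw [e, e']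
      · simp only [r00]; simp
      · rw [r01]; simpa using c2.symm
      · rw [r10]; simpa using c1.symm
      · rw [r11]; simpa using c3.symm
    ext x
    constructor
    · intro hx
      obtain ⟨m, n, rfl⟩ := h2 hx
      exact ⟨m, n, rfl, (main m n).mp hx⟩
    · rintro ⟨m, n, rfl, h⟩
      exact (main m n).mpr h
  have d11 : (1 : ZMod 2) + 1 = 0 := rfl
  by_cases ha : α ∈ M
  · by_cases hb : β ∈ M
    · exact Or.inr ⟨0, 0, fin _ _ (by simp [ha]) (by simp [hb]) (by simp [(ab ha).mp hb])⟩
    · have := fun h => hb ((ab ha).mpr h)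
      exact Or.inr ⟨0, 1, fin _ _ (by simp [ha]) (by simp [hb]) (by simp; exact this)⟩
  · by_cases hb : β ∈ M
    · have := fun h => ha ((ba hb).mpr h)
      exact Or.inr ⟨1, 0, fin _ _ (by simp [ha]) (by simp [hb]) (by simp; exact this)⟩
    · by_cases hc : α + β ∈ M
      · exact Or.inr ⟨1, 1, fin _ _ (by simp [ha]) (by simp [hb]) (by simp [hc, d11])⟩
      · left
        ext x
        constructor
        · intro hx
          obtain ⟨m, n, rfl⟩ := h2 hx
          rcases zm2 m with ⟨e, k, rfl⟩ | ⟨e, k, rfl⟩ <;> rcases zm2 n with ⟨e', k', rfl⟩ | ⟨e', k', rfl⟩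
          · exact ⟨k, k', by push_cast; ring⟩
          · rw [r01] at hx; exact absurd hx hb
          · rw [r10] at hx; exact absurd hx ha
          · rw [r11] at hx; exact absurd hx hc
        · rintro ⟨k, k', rfl⟩
          have := r00 k k'
          have e : (k : K) * (2 * α) + k' * (2 * β) = ((2 * k : ℤ) : K) * α + (2 * k' : ℤ) * β := by push_cast; ring
          rw [e]; exact this

lemma ind2 {α β : K} (hi : Ind α β) : Ind (2 * α) (2 * β) := by
  intro m n h
  have := hi (2 * m) (2 * n) (by push_cast; linear_combination h)
  omega

lemma Fs_good {α β : K} (hi : Ind α β) (i j : ZMod 2) : Good (Fs α β i j) := by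
  have h01 : ∀ x : ZMod 2, x = 0 ∨ x = 1 := by decide
  rcases h01 i with rfl | rfl <;> rcases h01 j with rfl | rfl
  · refine ⟨α, β, hi, ?_⟩
    ext x
    constructor
    · exact fun h => Fs_le h
    · rintro ⟨m, n, rfl⟩; rw [mem_Fs hi]; simp
  · refine ⟨α, 2 * β, ?_, ?_⟩
    · intro m n h
      have := hi m (2 * n) (by push_cast; linear_combination h)
      omega
    · ext x
      constructor
      · rintro ⟨m, n, rfl, h⟩
        rcases zm2 n with ⟨e, k, rfl⟩ | ⟨e, k, rfl⟩
        · exact ⟨m, k, by push_cast; ring⟩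
        · rw [e] at h; simp at h
      · rintro ⟨m, n, rfl⟩
        exact ⟨m, 2 * n, by push_cast; ring, by push_cast; rw [show (2 : ZMod 2) = 0 from rfl]; ring⟩
  · refine ⟨2 * α, β, ?_, ?_⟩
    · intro m n h
      have := hi (2 * m) n (by push_cast; linear_combination h)
      omega
    · ext x
      constructor
      · rintro ⟨m, n, rfl, h⟩
        rcases zm2 m with ⟨e, k, rfl⟩ | ⟨e, k, rfl⟩
        · exact ⟨k, n, by push_cast; ring⟩
        · rw [e] at h; simp at h
      · rintro ⟨m, n, rfl⟩
        exact ⟨2 * m, n, by push_cast; ring, by push_cast; rw [show (2 : ZMod 2) = 0 from rfl]; ring⟩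
  · refine ⟨α + β, 2 * β, ?_, ?_⟩
    · intro m n h
      have := hi m (m + 2 * n) (by push_cast; linear_combination h)
      omega
    · ext x
      constructor
      · rintro ⟨m, n, rfl, h⟩
        rw [one_mul, one_mul, ← Int.cast_add] at h
        rcases zm2 (m + n) with ⟨e, k, hk⟩ | ⟨e, k, -⟩
        · obtain rfl : n = 2 * k - m := by omega
          exact ⟨m, k - m, by push_cast; ring⟩
        · rw [e] at h; simp at h
      · rintro ⟨m, n, rfl⟩
        refine ⟨m, m + 2 * n, by push_cast; ring, ?_⟩
        have : ∀ m : ZMod 2, m + m = 0 := by decide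
        push_cast
        linear_combination this m + this n

lemma good2 {L H : AddSubgroup K} (hL : Good L) (h1 : L ≤ H) (h2 : ∀ x ∈ H, 2 * x ∈ L) : Good H := by
  obtain ⟨α, β, hi, rfl⟩ := hL
  let M : AddSubgroup K :=
    { carrier := {x | ∃ y ∈ H, x = 2 * y}
      zero_mem' := ⟨0, H.zero_mem, by simp⟩
      add_mem' := by
        rintro _ _ ⟨a, ha, rfl⟩ ⟨b, hb, rfl⟩
        exact ⟨a + b, H.add_mem ha hb, by ring⟩
      neg_mem' := by
        rintro _ ⟨a, ha, rfl⟩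
        exact ⟨-a, H.neg_mem ha, by ring⟩ }
  have hm : ∀ x, x ∈ M ↔ ∃ y ∈ H, x = 2 * y := fun x => Iff.rfl
  have hM : Good M := by
    rcases sub2 hi (M := M) (fun x hx => ⟨x, h1 hx, rfl⟩) (by rintro _ ⟨y, hy, rfl⟩; exact h2 y hy) with h | ⟨i, j, h⟩
    · exact ⟨_, _, ind2 hi, h⟩
    · rw [h]; exact Fs_good hi i j
  have : hmt H M := by
    refine ⟨2, two_ne_zero, fun x => ?_⟩
    rw [hm]
    constructor
    · exact fun h => ⟨x, h, rfl⟩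
    · rintro ⟨y, hy, e⟩
      rwa [mul_left_cancel₀ two_ne_zero e]
  exact this.symm.good hM

end
end

section
open NumberField

section
variable {K : Type} [Field K] [NumberField K] {l : ℕ} {θ : K} (hl : l.Prime) (h5 : 5 < l) (hθ : θ ^ 2 = -((5 * l : ℕ) : K))
  (hK : Module.finrank ℚ K = 2)

/-- `J = L + ω L` -/
def Hull (θ : K) (L J : AddSubgroup K) : Prop := ∀ x, x ∈ J ↔ ∃ a ∈ L, ∃ b ∈ L, x = a + (1 + θ) / 2 * b

/-- indices of the relevant sublattices -/
def idx (q r : ZMod 2) : Finset (ZMod 2 × ZMod 2) :=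
  Finset.univ.filter fun x => (x.1 = 0 ∧ x.2 = 0) ∨ q * x.2 + r * x.1 + x.1 * x.2 = 1

lemma idx1 : ∀ q r : ZMod 2, q * r = 1 → (idx q r).card = 4 := by decide
lemma idx0 : ∀ q r : ZMod 2, q * r = 0 → (idx q r).card = 2 := by decide

lemma zq1 : ∀ i j p q r : ZMod 2, q * j + r * i + i * j = 1 → i * (p * j + r * i) + j * (q * j + (1 - p) * i) = 1 := by decide
lemma zq0 : ∀ i j : ZMod 2, ¬ (i = 0 ∧ j = 0) → ∀ q r : ZMod 2, q * j + r * i + i * j ≠ 1 → ∀ p m n : ZMod 2, i * m + j * n = 0 →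
  i * (p * m + r * n) + j * (q * m + (1 - p) * n) = 0 := by decide
lemma zq2 : ∀ i j : ZMod 2, i * j + j * i = 0 := by decide
lemma zq3 : ∀ x : ZMod 2, x = 0 ∨ x = 1 := by decide

include hl hθ in
lemma loc (h4 : l % 4 = 3) {J : AddSubgroup K} (hJ : Good J) (hs : OSt J) :
    ∃ (F : ZMod 2 × ZMod 2 → AddSubgroup K) (A : Finset (ZMod 2 × ZMod 2)),
      A.card = (if l % 8 = 7 then 4 else 2) ∧
      (∀ i ∈ A, Good (F i) ∧ (∀ x ∈ F i, θ * x ∈ F i) ∧ Hull θ (F i) J) ∧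
      (∀ i ∈ A, ∀ i' ∈ A, F i = F i' → i = i') ∧
      ∀ L, (∀ x ∈ L, θ * x ∈ L) → Hull θ L J → ∃ i ∈ A, L = F i := by
  obtain ⟨k, hk⟩ : ∃ k : ℤ, (1 + 5 * l : ℤ) = 4 * k := ⟨(1 + 5 * l) / 4, by omega⟩
  obtain ⟨α, β, hi, rfl⟩ := hJ
  have hω := om_sq hθ hk
  have hωi : IsIntegral ℤ ((1 + θ) / 2 : K) := om_int hθ h4
  have hθω : θ = 2 * ((1 + θ) / 2) - 1 := by ring
  set ω : K := (1 + θ) / 2 with hωd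
  obtain ⟨p, q, e1⟩ := hs ω hωi α ⟨1, 0, by simp⟩
  obtain ⟨r, s, e2⟩ := hs ω hωi β ⟨0, 1, by simp⟩
  have g := hi.eq (m := p - k) (n := q) (m' := p ^ 2 + q * r) (n' := q * (p + s)) (by
    push_cast
    linear_combination -e1 * (1 - ω) + p * e1 + q * e2 - α * hω)
  have hq : q ≠ 0 := by
    rintro rfl
    have h1 : ω = p := mul_right_cancel₀ hi.left (by rw [e1]; simp)
    have := (K_ind hl hθ (p := 1 - 2 * p) (q := 1) (by push_cast; rw [hωd] at h1; linear_combination 2 * h1)).2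
    norm_num at this
  have hps : s = 1 - p := by
    have : q * (p + s - 1) = 0 := by linarith [g.2]
    rcases mul_eq_zero.mp this with h | h
    · exact absurd h hq
    · linarith
  subst hps
  have hmul : ∀ m n : ℤ, ω * (m * α + n * β) = ((p * m + r * n : ℤ) : K) * α + (q * m + (1 - p) * n : ℤ) * β := by
    intro m n
    push_cast at e2 ⊢
    linear_combination m * e1 + n * e2
  have hqr : (q : ZMod 2) * r = k := by
    have h1 : ((p - k : ℤ) : ZMod 2) = ((p ^ 2 + q * r : ℤ) : ZMod 2) := by rw [g.1]
    push_cast at h1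
    have : ∀ p k q r : ZMod 2, p - k = p ^ 2 + q * r → q * r = k := by decide
    exact this _ _ _ _ h1
  refine ⟨fun i => Fs α β i.1 i.2, idx q r, ?_, ?_, ?_, ?_⟩
  · split_ifs with h8
    · apply idx1
      rw [hqr]
      obtain ⟨t, rfl⟩ : ∃ t, k = 2 * t + 1 := ⟨k / 2, by omega⟩
      push_cast; rw [show (2 : ZMod 2) = 0 from rfl]; ring
    · apply idx0
      rw [hqr]
      obtain ⟨t, rfl⟩ : ∃ t, k = 2 * t := ⟨k / 2, by omega⟩
      push_cast; rw [show (2 : ZMod 2) = 0 from rfl]; ring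
  · rintro ⟨i, j⟩ hij
    simp only [idx, Finset.mem_filter, Finset.mem_univ, true_and] at hij
    dsimp only
    refine ⟨Fs_good hi i j, ?_, ?_⟩
    · rintro x hx
      have h1 : ω * x ∈ lt α β := hs ω hωi x (Fs_le hx)
      have h2 := two_mem_Fs (i := i) (j := j) h1
      have : θ * x = 2 * (ω * x) - x := by rw [hωd]; ring
      rw [this]
      exact sub_mem h2 hx
    · intro x
      constructor
      · rintro ⟨m, n, rfl⟩
        rcases hij with ⟨rfl, rfl⟩ | hQ
        · exact ⟨m * α + n * β, (mem_Fs hi).mpr (by simp), 0, zero_mem _, by simp⟩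
        · rcases zq3 (i * m + j * n) with h0 | h0
          · exact ⟨_, (mem_Fs hi).mpr h0, 0, zero_mem _, by simp⟩
          · obtain ⟨i', rfl⟩ := ZMod.intCast_surjective i
            obtain ⟨j', rfl⟩ := ZMod.intCast_surjective j
            have hw : (j' : K) * α + i' * β ∈ Fs α β i' j' := (mem_Fs hi).mpr (zq2 _ _)
            have hz := zq1 _ _ p _ _ hQ
            refine ⟨((m - (p * j' + r * i') : ℤ) : K) * α + (n - (q * j' + (1 - p) * i') : ℤ) * β, (mem_Fs hi).mpr ?_, _, hw, ?_⟩
            · push_cast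
              linear_combination h0 - hz
            · rw [← hωd, hmul]; push_cast; ring
      · rintro ⟨a, ha, b, hb, rfl⟩
        exact add_mem (Fs_le ha) (hs _ hωi _ (Fs_le hb))
  · rintro ⟨i, j⟩ - ⟨i', j'⟩ - h
    dsimp only at h
    have hall : ∀ m n : ℤ, i * m + j * n = 0 ↔ i' * m + j' * n = 0 := by
      intro m n
      rw [← mem_Fs hi, ← mem_Fs hi, h]
    have a1 := hall 1 0
    have a2 := hall 0 1
    simp only [Int.cast_one, Int.cast_zero, mul_one, mul_zero, add_zero, zero_add] at a1 a2
    have : ∀ i i' : ZMod 2, (i = 0 ↔ i' = 0) → i = i' := by decide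
    rw [this _ _ a1, this _ _ a2]
  · intro L hst hH
    have hH' : ∀ x, x ∈ lt α β ↔ ∃ a ∈ L, ∃ b ∈ L, x = a + ω * b := hH
    have hle : L ≤ lt α β := fun x hx => (hH' x).mpr ⟨x, hx, 0, zero_mem _, by simp⟩
    have h2L : ∀ x ∈ lt α β, 2 * x ∈ L := by
      intro x hx
      obtain ⟨a, ha, b, hb, rfl⟩ := (hH' x).mp hx
      have : 2 * (a + ω * b) = a + a + b + θ * b := by rw [hωd]; ring
      rw [this]
      exact add_mem (add_mem (add_mem ha ha) hb) (hst b hb)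
    rcases sub2 hi h2L hle with rfl | ⟨i, j, rfl⟩
    · exfalso
      obtain ⟨a, ⟨m, n, rfl⟩, b, ⟨m', n', rfl⟩, e⟩ := (hH' α).mp ⟨1, 0, by simp⟩
      have e3 := hmul m' n'
      have := (hi.eq (m := 1) (n := 0) (m' := 2 * (m + (p * m' + r * n'))) (n' := 2 * (n + (q * m' + (1 - p) * n'))) (by
        push_cast at e3 ⊢; linear_combination e + 2 * e3)).1
      omega
    · refine ⟨(i, j), ?_, rfl⟩
      simp only [idx, Finset.mem_filter, Finset.mem_univ, true_and]
      by_contra hcon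
      push Not at hcon
      have hn0 : ¬ (i = 0 ∧ j = 0) := fun h => hcon.1 h.1 h.2
      have hall : ∀ m n : ℤ, i * m + j * n = 0 := by
        intro m n
        rw [← mem_Fs hi]
        obtain ⟨a, ha, b, ⟨m', n', rfl, hb⟩, e⟩ := (hH' (m * α + n * β)).mp ⟨m, n, rfl⟩
        rw [e]
        refine add_mem ha ?_
        rw [hmul, mem_Fs hi]
        push_cast
        exact zq0 i j hn0 _ _ hcon.2 _ _ _ hb
      have a1 := hall 1 0
      have a2 := hall 0 1
      simp at a1 a2
      exact hn0 ⟨a1, a2⟩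

include hl h5 hθ hK in
theorem count_TT3 (h4 : l % 4 = 3) : (TT l).ncard = (if l % 8 = 7 then 4 else 2) * classNumber K := by
  obtain ⟨Y, hY1, hY2, hY3⟩ := exists_Y hl h5 hθ
  obtain ⟨I, hI1, hI2, hI3, hI4⟩ := exists_I hK
  obtain ⟨k, hk⟩ : ∃ k : ℤ, (1 + 5 * l : ℤ) = 4 * k := ⟨(1 + 5 * l) / 4, by omega⟩
  have hω := om_sq hθ hk
  choose F A hA hF hinj hsurj using fun C => loc hl hθ h4 (hI1 C) (hI2 C)
  let S : Finset ((_ : ClassGroup (𝓞 K)) × (ZMod 2 × ZMod 2)) := Finset.univ.sigma A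
  have hS : ∀ c, c ∈ S ↔ c.2 ∈ A c.1 := by intro c; simp [S]
  have himg : TT l = (fun c : ((_ : ClassGroup (𝓞 K)) × (ZMod 2 × ZMod 2)) => Y (F c.1 c.2)) '' (S : Set _) := by
    ext w
    constructor
    · intro hw
      obtain ⟨L, g, s, rfl⟩ := hY3 w hw
      let H : AddSubgroup K :=
        { carrier := {x | ∃ a ∈ L, ∃ b ∈ L, x = a + (1 + θ) / 2 * b}
          zero_mem' := ⟨0, zero_mem _, 0, zero_mem _, by simp⟩
          add_mem' := by
            rintro _ _ ⟨a, ha, b, hb, rfl⟩ ⟨c, hc, d, hd, rfl⟩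
            exact ⟨a + c, add_mem ha hc, b + d, add_mem hb hd, by ring⟩
          neg_mem' := by
            rintro _ ⟨a, ha, b, hb, rfl⟩
            exact ⟨-a, neg_mem ha, -b, neg_mem hb, by ring⟩ }
      have hHm : Hull θ L H := fun x => Iff.rfl
      have hHg : Good H := by
        refine good2 g (fun x hx => ⟨x, hx, 0, zero_mem _, by simp⟩) ?_
        rintro _ ⟨a, ha, b, hb, rfl⟩
        have : 2 * (a + (1 + θ) / 2 * b) = a + a + b + θ * b := by ring
        rw [this]
        exact add_mem (add_mem (add_mem ha ha) hb) (s b hb)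
      have hHs : OSt H := by
        intro x hx y hy
        obtain ⟨m, n, rfl⟩ := K_int3 hl h5 hθ hK h4 hx
        have hωy : (1 + θ) / 2 * y ∈ H := by
          obtain ⟨a, ha, b, hb, rfl⟩ := hy
          refine ⟨-(k • b), neg_mem (zsmul_mem hb k), a + b, add_mem ha hb, ?_⟩
          rw [zsmul_eq_mul]
          linear_combination b * hω
        have : ((m : K) + n * ((1 + θ) / 2)) * y = m • y + n • ((1 + θ) / 2 * y) := by simp; ring
        rw [this]
        exact add_mem (zsmul_mem hy m) (zsmul_mem hωy n)
      obtain ⟨C, v, hv, hC⟩ := hI4 H hHg hHs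
      let L' : AddSubgroup K :=
        { carrier := {x | v⁻¹ * x ∈ L}
          zero_mem' := by rw [Set.mem_ofPred_eq, mul_zero]; exact zero_mem L
          add_mem' := by
            intro a b ha hb
            rw [Set.mem_ofPred_eq] at ha hb ⊢
            rw [mul_add]; exact add_mem ha hb
          neg_mem' := by
            intro a ha
            rw [Set.mem_ofPred_eq] at ha ⊢
            rw [mul_neg]; exact neg_mem ha }
      have hL' : ∀ x, x ∈ L' ↔ v⁻¹ * x ∈ L := fun x => Iff.rfl
      have hh : hmt L L' := ⟨v, hv, fun x => by rw [hL', inv_mul_cancel_left₀ hv]⟩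
      have s' : ∀ x ∈ L', θ * x ∈ L' := by
        intro x hx
        rw [hL'] at hx ⊢
        rw [mul_left_comm]; exact s _ hx
      have hH' : Hull θ L' (I C) := by
        intro x
        have := hC (v⁻¹ * x)
        rw [mul_inv_cancel_left₀ hv] at this
        rw [← this, hHm]
        constructor
        · rintro ⟨a, ha, b, hb, e⟩
          refine ⟨v * a, by rwa [hL', inv_mul_cancel_left₀ hv], v * b, by rwa [hL', inv_mul_cancel_left₀ hv], ?_⟩
          rw [inv_mul_eq_iff_eq_mul₀ hv] at e
          rw [e]; ring
        · rintro ⟨a, ha, b, hb, rfl⟩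
          exact ⟨_, ha, _, hb, by ring⟩
      obtain ⟨i, hi, e⟩ := hsurj C L' s' hH'
      refine ⟨⟨C, i⟩, ?_, ?_⟩
      · rw [Finset.mem_coe, hS]; exact hi
      · dsimp only
        rw [← e]
        exact ((hY2 _ _ g s (hh.good g) s').mpr hh).symm
    · rintro ⟨⟨C, i⟩, hc, rfl⟩
      rw [Finset.mem_coe, hS] at hc
      exact hY1 _ (hF C i hc).1 (hF C i hc).2.1
  have hinjS : Set.InjOn (fun c : ((_ : ClassGroup (𝓞 K)) × (ZMod 2 × ZMod 2)) => Y (F c.1 c.2)) (S : Set _) := by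
    rintro ⟨C, i⟩ hc ⟨C', i'⟩ hc' h
    rw [Finset.mem_coe, hS] at hc hc'
    dsimp only at h hc hc'
    obtain ⟨g, s, u⟩ := hF C i hc
    obtain ⟨g', s', u'⟩ := hF C' i' hc'
    obtain ⟨v, hv, hm⟩ := (hY2 _ _ g s g' s').mp h
    have hJ : ∀ x, x ∈ I C ↔ v * x ∈ I C' := by
      intro x
      rw [u, u']
      constructor
      · rintro ⟨a, ha, b, hb, rfl⟩
        exact ⟨_, (hm a).mp ha, _, (hm b).mp hb, by ring⟩
      · rintro ⟨a, ha, b, hb, e⟩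
        refine ⟨v⁻¹ * a, ?_, v⁻¹ * b, ?_, ?_⟩
        · rwa [hm, mul_inv_cancel_left₀ hv]
        · rwa [hm, mul_inv_cancel_left₀ hv]
        · apply mul_left_cancel₀ hv
          rw [e, mul_add, mul_inv_cancel_left₀ hv, mul_left_comm, mul_inv_cancel_left₀ hv]
    obtain rfl := hI3 C C' ⟨v, hv, hJ⟩
    have : F C i = F C i' := by
      ext x
      rw [hm]
      rcases mult_unit hl h5 hθ hK (hI1 C) hv hJ with rfl | rfl
      · rw [one_mul]
      · rw [neg_one_mul, neg_mem_iff]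
    rw [hinj C i hc i' hc' this]
  rw [himg, hinjS.ncard_image, Set.ncard_coe_finset, Finset.card_sigma, Finset.sum_congr rfl (fun C _ => hA C),
    Finset.sum_const, Finset.card_univ, smul_eq_mul, mul_comm, classNumber]
end
end

section
open Polynomial

section
variable {l : ℕ} (hl : l.Prime) (h5 : 5 < l) {κ : Type} [Field κ] [CharP κ l]

include hl in
lemma fix_range {x : κ} (f : ZMod l →+* κ) (hx : x ^ l = x) : ∃ a, f a = x := by
  haveI : Fact l.Prime := ⟨hl⟩
  classical
  have h := FiniteField.roots_X_pow_card_sub_X (ZMod l)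
  have h2 : (X ^ l - X : (ZMod l)[X]) = ∏ a : ZMod l, (X - C a) := by
    have hm : (X ^ l - X : (ZMod l)[X]).Monic := by
      apply monic_X_pow_sub
      rw [degree_X]; exact_mod_cast hl.one_lt
    have hd : (X ^ l - X : (ZMod l)[X]).natDegree = l := FiniteField.X_pow_card_sub_X_natDegree_eq _ hl.one_lt
    have := prod_multiset_X_sub_C_of_monic_of_roots_card_eq hm (by
      rw [hd]; rw [ZMod.card] at h; rw [h]; simp [ZMod.card])
    rw [ZMod.card] at h
    rw [h] at this
    exact this.symm
  have h3 := congrArg (eval₂ f x) h2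
  rw [eval₂_finsetProd] at h3
  simp only [eval₂_sub, eval₂_pow, eval₂_X, eval₂_C] at h3
  rw [hx, sub_self, eq_comm, Finset.prod_eq_zero_iff] at h3
  obtain ⟨a, -, ha⟩ := h3
  exact ⟨a, by linear_combination -ha⟩

include hl in
lemma fix_map (f : ZMod l →+* κ) (a : ZMod l) : f a ^ l = f a := by
  haveI : Fact l.Prime := ⟨hl⟩
  rw [← map_pow, ZMod.pow_card]

include hl in
lemma exists_Fr : ∃ F : κ →+* κ, (∀ x, F x = x ^ l) := by
  haveI : Fact l.Prime := ⟨hl⟩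
  haveI : ExpChar κ l := ExpChar.prime hl
  exact ⟨frobenius κ l, fun x => frobenius_def l x⟩

include hl in
lemma irr_iff {u v : ZMod l} : Irreducible (X ^ 2 + C u * X + C v) ↔ ∀ a : ZMod l, a ^ 2 + u * a + v ≠ 0 := by
  haveI : Fact l.Prime := ⟨hl⟩
  have hd : (X ^ 2 + C u * X + C v : (ZMod l)[X]).natDegree = 2 := by compute_degree!
  have hm : (X ^ 2 + C u * X + C v : (ZMod l)[X]).Monic := by monicity!
  rw [hm.irreducible_iff_roots_eq_zero_of_degree_le_three (by omega) (by omega), Multiset.eq_zero_iff_forall_notMem]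
  refine forall_congr' fun a => ?_
  rw [mem_roots hm.ne_zero, IsRoot.def]
  simp

include hl in
lemma dvd_of_root (f : ZMod l →+* κ) {q H : (ZMod l)[X]} (hq : Irreducible q) {x : κ} (h1 : q.eval₂ f x = 0) (h2 : H.eval₂ f x = 0) : q ∣ H := by
  haveI : Fact l.Prime := ⟨hl⟩
  rcases hq.isCoprime_or_dvd H with ⟨a, b, h⟩ | h
  · have := congrArg (eval₂ f x) h
    rw [eval₂_add, eval₂_mul, eval₂_mul, h1, h2, eval₂_one] at this
    simp at this
  · exact h

include hl h5 in
/-- the condition on `(u, v)` as a quadratic equation -/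
lemma cond_iff (hm : l % 5 = 4) {u v : ZMod l} :
    (∃ e : ZMod l, e ^ 2 + e = 1 ∧ u = e ^ 5 * (v - 1)) ↔ u ^ 2 + 11 * u * (v - 1) - (v - 1) ^ 2 = 0 := by
  haveI : Fact l.Prime := ⟨hl⟩
  obtain ⟨s, hs⟩ := sq5_mod hl h5 hm
  have h2 : (2 : ZMod l) ≠ 0 := two_ne hl h5
  constructor
  · rintro ⟨e, he, rfl⟩
    have : e ^ 5 = 5 * e - 3 := by linear_combination (e ^ 3 - e ^ 2 + 2 * e - 3) * he
    rw [this]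
    linear_combination 25 * (v - 1) ^ 2 * he
  · intro h
    have key : ∀ s : ZMod l, s ^ 2 = 5 → ((-1 + s) / 2) ^ 2 + (-1 + s) / 2 = 1 ∧ ((-1 + s) / 2) ^ 5 = (5 * s - 11) / 2 := by
      intro s hs
      have he : ((-1 + s) / 2) ^ 2 + (-1 + s) / 2 = 1 := by field_simp; linear_combination hs
      refine ⟨he, ?_⟩
      have : ((-1 + s) / 2) ^ 5 = 5 * ((-1 + s) / 2) - 3 := by
        generalize (-1 + s) / 2 = e at he
        linear_combination (e ^ 3 - e ^ 2 + 2 * e - 3) * he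
      rw [this]; field_simp; ring
    have e : (u - (5 * s - 11) / 2 * (v - 1)) * (u - (5 * -s - 11) / 2 * (v - 1)) = 0 := by
      field_simp
      linear_combination 4 * h - 25 * (v - 1) ^ 2 * hs
    rcases mul_eq_zero.mp e with e | e
    · obtain ⟨k1, k2⟩ := key s hs
      exact ⟨_, k1, by rw [k2]; linear_combination e⟩
    · obtain ⟨k1, k2⟩ := key (-s) (by rw [neg_sq, hs])
      exact ⟨_, k1, by rw [k2]; linear_combination e⟩

end
end

section
open Polynomial

section
variable {l : ℕ} (hl : l.Prime) (h5 : 5 < l) {κ : Type} [Field κ] [CharP κ l]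

include hl h5 in
lemma frob_two (hm : l % 5 = 4) (f : ZMod l →+* κ) (F : κ →+* κ) (hF : ∀ x, F x = x ^ l) {x : κ}
    (h : (x + F x) ^ 2 - 11 * (x + F x) * (x * F x - 1) - (x * F x - 1) ^ 2 = 0) : F (F x) = x := by
  haveI : Fact l.Prime := ⟨hl⟩
  obtain ⟨s, hs⟩ := sq5_mod hl h5 hm
  have h2 : (2 : κ) ≠ 0 := two_ne hl h5
  have key : ∀ s : ZMod l, s ^ 2 = 5 → x + F x + (5 * f s - 11) / 2 * (x * F x - 1) = 0 → F (F x) = x := by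
    intro s hs h
    have hfs : (f s) ^ 2 = 5 := by rw [← map_pow, hs, map_ofNat]
    obtain ⟨E, hE⟩ : ∃ E, E = (5 * f s - 11) / 2 := ⟨_, rfl⟩
    have hE2 : E ^ 2 + 11 * E - 1 = 0 := by
      rw [hE]; field_simp; linear_combination 25 * hfs
    have hFE : F E = E := by
      rw [hE, map_div₀, map_sub, map_mul, map_ofNat, map_ofNat, map_ofNat, hF (f s), fix_map hl]
    rw [← hE] at h
    have h' := congrArg F h
    rw [map_add, map_mul, map_sub, map_mul, map_add, map_one, map_zero, hFE] at h'
    have e : (x - F (F x)) * (1 + E * F x) = 0 := by linear_combination h - h'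
    rcases mul_eq_zero.mp e with e | e
    · linear_combination -e
    · exfalso
      have e1 : F x = E := by linear_combination h - x * e
      rw [e1] at e
      apply c125_ne hl h5 (κ := κ)
      linear_combination (121 : κ) * e - (11 * E + 2) * (hE2 - e)
  have hfs : (f s) ^ 2 = 5 := by rw [← map_pow, hs, map_ofNat]
  have e : (x + F x + (5 * f s - 11) / 2 * (x * F x - 1)) * (x + F x + (5 * f (-s) - 11) / 2 * (x * F x - 1)) = 0 := by
    rw [map_neg]
    field_simp
    linear_combination 4 * h - 25 * (x * F x - 1) ^ 2 * hfs
  rcases mul_eq_zero.mp e with e | e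
  · exact key s hs e
  · exact key (-s) (by rw [neg_sq, hs]) e

include hl h5 in
theorem P_count [IsAlgClosed κ] (hm : l % 5 = 4) (W : Finset κ)
    (hW : ∀ x, x ∈ W ↔ x ≠ 0 ∧ x ^ l ≠ x ∧ ∃ y, y * x = 1 - 11 * x - x ^ 2 ∧ y ^ (l + 1) = 125 ∧ SSy κ l y) :
    2 * {uv : ZMod l × ZMod l |
        Irreducible (X ^ 2 + C uv.1 * X + C uv.2) ∧
        (X ^ 2 + C uv.1 * X + C uv.2) ∣ hasseInvariant5 l ∧
        ∃ e : ZMod l, e ^ 2 + e = 1 ∧ uv.1 = e ^ 5 * (uv.2 - 1)}.ncard = W.card := by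
  haveI : Fact l.Prime := ⟨hl⟩
  classical
  obtain ⟨F, hF⟩ := exists_Fr hl (κ := κ)
  let f : ZMod l →+* κ := ZMod.castHom (dvd_refl l) κ
  have hinv : ∀ x : κ, ∃ a : ZMod l, x ^ l = x → f a = x := by
    intro x
    by_cases h : x ^ l = x
    · obtain ⟨a, ha⟩ := fix_range hl f h
      exact ⟨a, fun _ => ha⟩
    · exact ⟨0, fun h' => absurd h' h⟩
  choose inv hinv using hinv
  set P := {uv : ZMod l × ZMod l |
        Irreducible (X ^ 2 + C uv.1 * X + C uv.2) ∧
        (X ^ 2 + C uv.1 * X + C uv.2) ∣ hasseInvariant5 l ∧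
        ∃ e : ZMod l, e ^ 2 + e = 1 ∧ uv.1 = e ^ 5 * (uv.2 - 1)} with hP
  have hPf : P.Finite := Set.toFinite P
  -- elements of `W`
  have hWx : ∀ x ∈ W, (x + F x) ^ 2 - 11 * (x + F x) * (x * F x - 1) - (x * F x - 1) ^ 2 = 0 := by
    intro x hx
    obtain ⟨h0, h1, y, hy, hy2, -⟩ := (hW x).mp hx
    have hy' := congrArg F hy
    rw [map_mul, map_sub, map_sub, map_mul, map_pow, map_one, map_ofNat] at hy'
    have : F y * y = 125 := by rw [hF, ← pow_succ, hy2]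
    linear_combination (1 - 11 * F x - F x ^ 2) * hy + y * x * hy' - x * F x * this
  have hWF : ∀ x ∈ W, F (F x) = x := fun x hx => frob_two hl h5 hm f F hF (hWx x hx)
  have hg : ∀ x ∈ W, ∃ u v : ZMod l, f u = -(x + F x) ∧ f v = x * F x ∧ inv (-(x + F x)) = u ∧ inv (x * F x) = v := by
    intro x hx
    have h := hWF x hx
    refine ⟨_, _, hinv _ ?_, hinv _ ?_, rfl, rfl⟩
    · rw [← hF, map_neg, map_add, h, add_comm]
    · rw [← hF, map_mul, h, mul_comm]
  have hev : ∀ (u v : ZMod l) (x : κ), (X ^ 2 + C u * X + C v : (ZMod l)[X]).eval₂ f x = x ^ 2 + f u * x + f v := by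
    intro u v x; simp
  -- the map lands in `P`
  have hmaps : ∀ x ∈ W, (inv (-(x + F x)), inv (x * F x)) ∈ P := by
    intro x hx
    obtain ⟨u, v, hu, hv, eu, ev⟩ := hg x hx
    obtain ⟨h0, h1, y, hy, hy2, hss⟩ := (hW x).mp hx
    rw [eu, ev, hP]
    show Irreducible (X ^ 2 + C u * X + C v) ∧ _ ∧ ∃ e : ZMod l, e ^ 2 + e = 1 ∧ u = e ^ 5 * (v - 1)
    have hirr : Irreducible (X ^ 2 + C u * X + C v) := by
      rw [irr_iff hl]
      intro a ha
      have := congrArg f ha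
      rw [map_add, map_add, map_mul, map_pow, map_zero, hu, hv] at this
      have e : (f a - x) * (f a - F x) = 0 := by linear_combination this
      have hfa := fix_map hl f a
      rcases mul_eq_zero.mp e with e | e
      · have : x = f a := by linear_combination -e
        rw [this] at h1; exact h1 hfa
      · have : F x = F (f a) := by rw [hF (f a), hfa]; linear_combination -e
        have : x = f a := F.injective this
        rw [this] at h1; exact h1 hfa
    refine ⟨hirr, ?_, ?_⟩
    · refine dvd_of_root hl f hirr (x := x) ?_ ?_
      · rw [hev, hu, hv]; ring
      · have hy0 : y ≠ 0 := by
          rintro rfl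
          rw [zero_pow (by omega)] at hy2
          exact c125_ne hl h5 hy2.symm
        exact (hasse_iff l f h0 hy0 hy).mpr hss
    · rw [cond_iff hl h5 hm]
      apply f.injective
      rw [map_sub, map_add, map_mul, map_mul, map_pow, map_pow, map_sub, map_ofNat, map_one, map_zero, hu, hv]
      linear_combination hWx x hx
  have hcard := Finset.card_eq_sum_card_fiberwise (s := W) (t := hPf.toFinset) (f := fun x => (inv (-(x + F x)), inv (x * F x)))
    (fun x hx => by rw [Finset.mem_coe, Set.Finite.mem_toFinset]; exact hmaps x hx)
  rw [hcard, Finset.sum_congr rfl (g := fun _ => 2), Finset.sum_const, smul_eq_mul, mul_comm, Set.ncard_eq_toFinset_card P hPf]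
  rintro ⟨u, v⟩ huv
  rw [Set.Finite.mem_toFinset] at huv
  obtain ⟨hirr, hdvd, hc⟩ := huv
  dsimp only at hirr hdvd hc
  rw [cond_iff hl h5 hm] at hc
  rw [irr_iff hl] at hirr
  obtain ⟨x, hx⟩ := IsAlgClosed.exists_root (X ^ 2 + C (f u) * X + C (f v) : κ[X]) (by
    rw [show (X ^ 2 + C (f u) * X + C (f v) : κ[X]).degree = 2 by compute_degree!]; norm_num)
  have hx' : x ^ 2 + f u * x + f v = 0 := by simpa [IsRoot.def] using hx
  have hirr' : ∀ z : κ, z ^ 2 + f u * z + f v = 0 → z ^ l ≠ z := by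
    intro z hz h
    obtain ⟨a, rfl⟩ := fix_range hl f h
    apply hirr a
    apply f.injective
    rw [map_add, map_add, map_mul, map_pow, map_zero]; exact hz
  have hxl := hirr' x hx'
  have hFx : F x ^ 2 + f u * F x + f v = 0 := by
    have := congrArg F hx'
    rw [map_add, map_add, map_mul, map_pow, map_zero, hF (f u), hF (f v), fix_map hl, fix_map hl] at this
    exact this
  have hu : f u = -(x + F x) := by
    have : (x - F x) * (x + F x + f u) = 0 := by linear_combination hx' - hFx
    rcases mul_eq_zero.mp this with h | h
    · exact absurd (by rw [← hF]; linear_combination -h) hxl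
    · linear_combination h
  have hv : f v = x * F x := by rw [hu] at hx'; linear_combination hx'
  have hfu : (f u) ^ l = f u := fix_map hl f u
  have hfv : (f v) ^ l = f v := fix_map hl f v
  have hFF : F (F x) = x := by
    have := congrArg F hu
    rw [hF (f u), hfu, map_neg, map_add, hu] at this
    linear_combination this
  have hx0 : x ≠ 0 := by
    rintro rfl; exact hxl (zero_pow hl.ne_zero)
  have hcond := congrArg f hc
  rw [map_sub, map_add, map_mul, map_mul, map_pow, map_pow, map_sub, map_ofNat, map_one, map_zero, hu, hv] at hcond
  obtain ⟨y, hy⟩ : ∃ y, y * x = 1 - 11 * x - x ^ 2 := ⟨(1 - 11 * x - x ^ 2) / x, div_mul_cancel₀ _ hx0⟩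
  have hFx0 : F x ≠ 0 := by rw [hF]; exact pow_ne_zero _ hx0
  have hyy : y ^ (l + 1) = 125 := by
    have hy' := congrArg F hy
    rw [map_mul, map_sub, map_sub, map_mul, map_pow, map_one, map_ofNat] at hy'
    rw [pow_succ, ← hF]
    apply mul_right_cancel₀ (mul_ne_zero hx0 hFx0)
    linear_combination (1 - 11 * F x - F x ^ 2) * hy + y * x * hy' - hcond
  have hy0 : y ≠ 0 := by
    rintro rfl
    rw [zero_pow (by omega)] at hyy
    exact c125_ne hl h5 hyy.symm
  have hss : SSy κ l y := by
    rw [← hasse_iff l f hx0 hy0 hy]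
    obtain ⟨g, hg⟩ := hdvd
    rw [hg, eval₂_mul, hev, hx', zero_mul]
  have hxW : x ∈ W := (hW x).mpr ⟨hx0, hxl, y, hy, hyy, hss⟩
  have hFxW : F x ∈ W := by
    refine (hW _).mpr ⟨hFx0, hirr' _ hFx, F y, ?_, ?_, ?_⟩
    · have hy' := congrArg F hy
      rw [map_mul, map_sub, map_sub, map_mul, map_pow, map_one, map_ofNat] at hy'
      exact hy'
    · rw [← map_pow, hyy, map_ofNat]
    · have hy' := congrArg F hy
      rw [map_mul, map_sub, map_sub, map_mul, map_pow, map_one, map_ofNat] at hy'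
      rw [← hasse_iff l f hFx0 ((map_ne_zero F).mpr hy0) hy']
      obtain ⟨g, hg⟩ := hdvd
      rw [hg, eval₂_mul, hev, hFx, zero_mul]
  have hfib : (W.filter fun z => (inv (-(z + F z)), inv (z * F z)) = (u, v)) = {x, F x} := by
    ext z
    rw [Finset.mem_filter, Finset.mem_insert, Finset.mem_singleton, Prod.mk.injEq]
    constructor
    · rintro ⟨hz, e1, e2⟩
      obtain ⟨u', v', hu', hv', eu, ev⟩ := hg z hz
      rw [e1] at eu; rw [e2] at ev
      rw [← eu, hu] at hu'
      rw [← ev, hv] at hv'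
      have : (z - x) * (z - F x) = 0 := by linear_combination z * hu' + hv'
      rcases mul_eq_zero.mp this with h | h
      · left; linear_combination h
      · right; linear_combination h
    · have k1 : inv (-(x + F x)) = u := f.injective (by rw [hinv _ (by rw [← hu, hfu]), hu])
      have k2 : inv (x * F x) = v := f.injective (by rw [hinv _ (by rw [← hv, hfv]), hv])
      rintro (rfl | rfl)
      · exact ⟨hxW, k1, k2⟩
      · refine ⟨hFxW, ?_, ?_⟩
        · rw [hFF, add_comm]; exact k1
        · rw [hFF, mul_comm]; exact k2
  rw [hfib]
  exact Finset.card_pair (fun h => hxl (by rw [← hF]; exact h.symm))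
end
end

section
open Polynomial

section
variable {l : ℕ} (hl : l.Prime) (h5 : 5 < l) {κ : Type} [Field κ] [CharP κ l]

include hl in
lemma inv_fix {x : κ} (hx : x ≠ 0) : (-x⁻¹) ^ l = -x⁻¹ ↔ x ^ l = x := by
  obtain ⟨F, hF⟩ := exists_Fr hl (κ := κ)
  rw [← hF, ← hF, map_neg, map_inv₀, neg_inj, inv_inj]

include hl h5 in
lemma N_sum [IsAlgClosed κ] (hm : l % 5 = 4) (V : Finset κ) (hV : ∀ y, y ∈ V ↔ y ^ (l + 1) = 125 ∧ SSy κ l y)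
    (ρ : κ → κ) (hρ : ∀ y, ρ y ^ 2 + (y + 11) * ρ y - 1 = 0) [DecidableEq κ] :
    2 * {uv : ZMod l × ZMod l |
        Irreducible (X ^ 2 + C uv.1 * X + C uv.2) ∧
        (X ^ 2 + C uv.1 * X + C uv.2) ∣ hasseInvariant5 l ∧
        ∃ e : ZMod l, e ^ 2 + e = 1 ∧ uv.1 = e ^ 5 * (uv.2 - 1)}.ncard =
      ∑ y ∈ V, if ρ y ^ l = ρ y then 0 else if ρ y ^ 2 = -1 then 1 else 2 := by
  have hρ0 : ∀ y, ρ y ≠ 0 := by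
    intro y h
    have := hρ y
    rw [h] at this
    norm_num at this
  have hroot : ∀ x y : κ, x ^ 2 + (y + 11) * x - 1 = 0 ↔ x = ρ y ∨ x = -(ρ y)⁻¹ := by
    intro x y
    have e : (x ^ 2 + (y + 11) * x - 1) = (x - ρ y) * (x + (ρ y)⁻¹) := by
      have h0 := hρ0 y
      field_simp
      linear_combination x * hρ y
    rw [e, mul_eq_zero, sub_eq_zero, add_eq_zero_iff_eq_neg]
  let W : Finset κ := (V.biUnion fun y => {ρ y, -(ρ y)⁻¹}).filter fun x => x ^ l ≠ x
  have hx0 : ∀ x y : κ, x ^ 2 + (y + 11) * x - 1 = 0 → x ≠ 0 := by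
    rintro x y h rfl
    norm_num at h
  have hWm : ∀ x, x ∈ W ↔ (∃ y ∈ V, x ^ 2 + (y + 11) * x - 1 = 0) ∧ x ^ l ≠ x := by
    intro x
    simp only [W, Finset.mem_filter, Finset.mem_biUnion, Finset.mem_insert, Finset.mem_singleton, hroot]
  have hW : ∀ x, x ∈ W ↔ x ≠ 0 ∧ x ^ l ≠ x ∧ ∃ y, y * x = 1 - 11 * x - x ^ 2 ∧ y ^ (l + 1) = 125 ∧ SSy κ l y := by
    intro x
    rw [hWm]
    constructor
    · rintro ⟨⟨y, hy, e⟩, h⟩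
      exact ⟨hx0 x y e, h, y, by linear_combination e, (hV y).mp hy⟩
    · rintro ⟨-, h, y, e, hy⟩
      exact ⟨⟨y, (hV y).mpr hy, by linear_combination e⟩, h⟩
  rw [P_count hl h5 hm W hW]
  have hYe : ∀ x y : κ, x ^ 2 + (y + 11) * x - 1 = 0 → x⁻¹ - 11 - x = y := by
    intro x y h
    have := hx0 x y h
    field_simp
    linear_combination -h
  rw [Finset.card_eq_sum_card_fiberwise (s := W) (t := V) (f := fun x => x⁻¹ - 11 - x)]
  · refine Finset.sum_congr rfl fun y hy => ?_
    have hfib : W.filter (fun x => x⁻¹ - 11 - x = y) = ({ρ y, -(ρ y)⁻¹} : Finset κ).filter fun x => x ^ l ≠ x := by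
      ext x
      rw [Finset.mem_filter, hWm, Finset.mem_filter, Finset.mem_insert, Finset.mem_singleton, ← hroot]
      constructor
      · rintro ⟨⟨⟨y', hy', e⟩, h⟩, e2⟩
        rw [hYe x y' e] at e2
        rw [e2] at e
        exact ⟨e, h⟩
      · rintro ⟨e, h⟩
        exact ⟨⟨⟨y, hy, e⟩, h⟩, hYe x y e⟩
    rw [hfib]
    have hi := inv_fix hl (hρ0 y)
    split_ifs with h1 h2
    · rw [Finset.card_eq_zero, Finset.filter_eq_empty_iff]
      intro x hx
      rw [Finset.mem_insert, Finset.mem_singleton] at hx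
      rcases hx with rfl | rfl
      · simpa using h1
      · simpa using hi.mpr h1
    · have e : -(ρ y)⁻¹ = ρ y := by
        have h0 := hρ0 y
        field_simp; linear_combination -h2
      rw [e, Finset.pair_eq_singleton, Finset.filter_singleton, if_pos h1, Finset.card_singleton]
    · rw [Finset.filter_true_of_mem, Finset.card_pair]
      · intro e
        apply h2
        have h0 := hρ0 y
        have : ρ y * ρ y = ρ y * -(ρ y)⁻¹ := by rw [← e]
        rw [sq, this, mul_neg, mul_inv_cancel₀ h0]
      · intro x hx
        rw [Finset.mem_insert, Finset.mem_singleton] at hx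
        rcases hx with rfl | rfl
        · exact h1
        · exact fun h => h1 (hi.mp h)
  · intro x hx
    rw [Finset.mem_coe, hWm] at hx
    obtain ⟨⟨y, hy, e⟩, -⟩ := hx
    rw [Finset.mem_coe]
    show x⁻¹ - 11 - x ∈ V
    rw [hYe x y e]; exact hy

include hl in
lemma V_fin : {y : κ | y ^ (l + 1) = 125 ∧ SSy κ l y}.Finite := by
  classical
  refine Set.Finite.subset (X ^ (l + 1) - C 125 : κ[X]).roots.toFinset.finite_toSet ?_
  rintro y ⟨h, -⟩
  rw [Finset.mem_coe, Multiset.mem_toFinset, mem_roots (X_pow_sub_C_ne_zero (Nat.succ_pos l) _), IsRoot.def]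
  simp [h]

include hl h5 in
lemma rho_rat [IsAlgClosed κ] (hm : l % 5 = 4) (h4 : l % 4 = 3) {y ρ : κ} (hy : y ^ 2 = 125) (hy2 : y ^ l = y)
    (hρ : ρ ^ 2 + (y + 11) * ρ - 1 = 0) : ρ ^ l = ρ := by
  obtain ⟨F, hF⟩ := exists_Fr hl (κ := κ)
  have h2 : (2 : κ) ≠ 0 := two_ne hl h5
  have h5' : (5 : κ) ≠ 0 := five_ne hl h5
  obtain ⟨s, rfl⟩ : ∃ s, y = 5 * s := ⟨y / 5, by field_simp⟩
  have hs : s ^ 2 = 5 := by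
    apply mul_left_cancel₀ (pow_ne_zero 2 h5'); linear_combination hy
  have hFs : F s = s := by
    rw [← hF, map_mul, map_ofNat] at hy2
    exact mul_left_cancel₀ h5' hy2
  obtain ⟨i, hi⟩ := IsAlgClosed.exists_pow_nat_eq (-1 : κ) (n := 2) (by norm_num)
  have hFi : F i = -i := by
    obtain ⟨k, hk⟩ : ∃ k, l = 2 * (2 * k + 1) + 1 := ⟨l / 4, by omega⟩
    rw [hF, hk, pow_succ, pow_mul, hi, pow_succ, pow_mul]
    norm_num
  obtain ⟨η, hη⟩ := IsAlgClosed.exists_root (X ^ 2 - C ((-1 - s) / 2) * X + 1 : κ[X]) (by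
    rw [show (X ^ 2 - C ((-1 - s) / 2) * X + 1 : κ[X]).degree = 2 by compute_degree!]; norm_num)
  have hη' : η ^ 2 - (-1 - s) / 2 * η + 1 = 0 := by simpa [IsRoot.def] using hη
  obtain ⟨c, hc⟩ : ∃ c, c = (-1 - s) / 2 := ⟨_, rfl⟩
  have hsc : s = -1 - 2 * c := by rw [hc]; field_simp; ring
  rw [← hc] at hη'
  have hcc : c ^ 2 + c = 1 := by rw [hc]; field_simp; linear_combination hs
  have hη4 : η ^ 4 + η ^ 3 + η ^ 2 + η + 1 = 0 := by
    linear_combination (η ^ 2 + (1 + c) * η + 1) * hη' + η ^ 2 * hcc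
  have hη5 : η ^ 5 = 1 := by linear_combination (η - 1) * hη4
  have hη0 : η ≠ 0 := by rintro rfl; norm_num at hη4
  have hFη : F η = η ^ 4 := by
    obtain ⟨k, hk⟩ : ∃ k, l = 5 * k + 4 := ⟨l / 5, by omega⟩
    rw [hF, hk, pow_add, pow_mul, hη5, one_pow, one_mul]
  have hηc : η + η ^ 4 = c := by
    apply mul_left_cancel₀ hη0
    linear_combination hη' + hη5
  have ht : (i * (η ^ 3 - η ^ 2)) ^ 2 = 2 - c := by
    linear_combination (η ^ 3 - η ^ 2) ^ 2 * hi - η * hη5 + 2 * hη5 - hηc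
  have hFt : F (i * (η ^ 3 - η ^ 2)) = i * (η ^ 3 - η ^ 2) := by
    rw [map_mul, map_sub, map_pow, map_pow, hFi, hFη]
    linear_combination (-i) * (η ^ 7 + η ^ 2 - η ^ 3) * hη5
  generalize i * (η ^ 3 - η ^ 2) = t at ht hFt
  -- a square root of the discriminant
  obtain ⟨d, hd⟩ : ∃ d, d = s * (3 + s) * t := ⟨_, rfl⟩
  have hFd : F d = d := by
    rw [hd, map_mul, map_mul, map_add, map_ofNat, hFs, hFt]
  have hd2 : d ^ 2 = (5 * s + 11) ^ 2 + 4 := by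
    have ht' : t ^ 2 = (5 + s) / 2 := by rw [ht, hc]; field_simp; ring
    rw [hd, mul_pow, ht']
    field_simp
    linear_combination (s ^ 3 + 11 * s ^ 2 + 44 * s + 50) * hs
  have e : (2 * ρ + (5 * s + 11) - d) * (2 * ρ + (5 * s + 11) + d) = 0 := by
    linear_combination 4 * hρ - hd2
  have hF2 : F (2 * ρ) = 2 * ρ := by
    rcases mul_eq_zero.mp e with e | e
    · rw [show 2 * ρ = d - (5 * s + 11) by linear_combination e]
      rw [map_sub, map_add, map_mul, hFd, hFs, map_ofNat, map_ofNat]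
    · rw [show 2 * ρ = -d - (5 * s + 11) by linear_combination e]
      rw [map_sub, map_neg, map_add, map_mul, hFd, hFs, map_ofNat, map_ofNat]
  rw [map_mul, map_ofNat, hF] at hF2
  exact mul_left_cancel₀ h2 hF2
end
end

section
open Polynomial

section
variable {l : ℕ} (hl : l.Prime) (h5 : 5 < l) {κ : Type} [Field κ] [CharP κ l]

include hl in
lemma rat_y {y ρ : κ} (hρ : ρ ^ 2 + (y + 11) * ρ - 1 = 0) (h : ρ ^ l = ρ) : y ^ l = y := by
  obtain ⟨F, hF⟩ := exists_Fr hl (κ := κ)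
  have h0 : ρ ≠ 0 := by rintro rfl; norm_num at hρ
  have e : y = ρ⁻¹ - 11 - ρ := by
    field_simp
    linear_combination hρ
  rw [← hF, e, map_sub, map_sub, map_inv₀, map_ofNat, hF ρ, h]

lemma sq_neg_one_iff {y ρ : κ} (h2 : (2 : κ) ≠ 0) (hρ : ρ ^ 2 + (y + 11) * ρ - 1 = 0) :
    ρ ^ 2 = -1 ↔ (y + 11) ^ 2 = -4 := by
  have h0 : ρ ≠ 0 := by rintro rfl; norm_num at hρ
  constructor
  · intro h
    have e : y + 11 = -2 * ρ := by
      apply mul_right_cancel₀ h0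
      linear_combination hρ + h
    rw [e]; linear_combination 4 * h
  · intro h
    have e : (2 * ρ + (y + 11)) ^ 2 = 0 := by linear_combination 4 * hρ + h
    have e2 : 2 * ρ + (y + 11) = 0 := by simpa using e
    linear_combination -hρ + ρ * e2

include hl h5 in
lemma ss_i [IsAlgClosed κ] (h4 : l % 4 = 3) {y : κ} (hy : (y + 11) ^ 2 = -4) :
    y ^ (l + 1) = 125 ∧ SSy κ l y := by
  obtain ⟨F, hF⟩ := exists_Fr hl (κ := κ)
  have h2 : (2 : κ) ≠ 0 := two_ne hl h5
  obtain ⟨x, hx⟩ : ∃ x : κ, y = -11 - 2 * x := ⟨-(y + 11) / 2, by field_simp; ring⟩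
  have hi : x ^ 2 = -1 := by
    apply mul_left_cancel₀ (pow_ne_zero 2 h2)
    rw [hx] at hy
    linear_combination hy
  have hFx : F x = -x := by
    obtain ⟨k, hk⟩ : ∃ k, l = 2 * (2 * k + 1) + 1 := ⟨l / 4, by omega⟩
    rw [hF, hk, pow_succ, pow_mul, hi, pow_succ, pow_mul]
    norm_num
  have h125 : y ^ (l + 1) = 125 := by
    rw [pow_succ, ← hF, hx, map_sub, map_neg, map_mul, map_ofNat, map_ofNat, hFx]
    linear_combination -4 * hi
  refine ⟨h125, ?_⟩
  have hx0 : x ≠ 0 := by rintro rfl; norm_num at hi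
  have hy0 : y ≠ 0 := by
    rintro rfl
    rw [zero_pow (by omega)] at h125
    exact c125_ne hl h5 h125.symm
  refine (hasse_iff l (ZMod.castHom (dvd_refl l) κ) hx0 hy0 (by rw [hx]; linear_combination -hi)).mp ?_
  have hs : ss l = 1 := by simp [ss, h4]
  rw [hasse_eval, hs, hi]
  simp

end

theorem main_count {l : ℕ} (hl : Nat.Prime l) (hl5 : 5 < l) (hmod5 : l % 5 = 4)
    (K : Type) [Field K] [NumberField K] (θ : K)
    (hθ : θ ^ 2 = -((5 * l : ℕ) : K))
    (hK : Module.finrank ℚ K = 2)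
    (N : ℕ)
    (hN : N = {uv : ZMod l × ZMod l |
        Irreducible (X ^ 2 + C uv.1 * X + C uv.2) ∧
        (X ^ 2 + C uv.1 * X + C uv.2) ∣ hasseInvariant5 l ∧
        ∃ e : ZMod l, e ^ 2 + e = 1 ∧ uv.1 = e ^ 5 * (uv.2 - 1)}.ncard) :
    (l % 4 = 1 → 2 * N = NumberField.classNumber K) ∧
    (l % 8 = 3 → (N : ℤ) = (NumberField.classNumber K : ℤ) - 3) ∧
    (l % 8 = 7 → (N : ℤ) = 2 * (NumberField.classNumber K : ℤ) - 3) := by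
  classical
  obtain ⟨κ, _, _, _, ⟨φ⟩⟩ := exists_kappa hl
  have h2 : (2 : κ) ≠ 0 := two_ne hl hl5
  have h5' : (5 : κ) ≠ 0 := five_ne hl hl5
  have hex : ∀ y : κ, ∃ r : κ, r ^ 2 + (y + 11) * r - 1 = 0 := by
    intro y
    obtain ⟨r, hr⟩ := IsAlgClosed.exists_root (X ^ 2 + C (y + 11) * X - 1 : κ[X]) (by
      rw [show (X ^ 2 + C (y + 11) * X - 1 : κ[X]).degree = 2 by compute_degree!]; norm_num)
    exact ⟨r, by simpa [IsRoot.def] using hr⟩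
  choose ρ hρ using hex
  obtain ⟨V, hV⟩ : ∃ V : Finset κ, V = (V_fin hl (κ := κ)).toFinset := ⟨_, rfl⟩
  have hVm : ∀ y, y ∈ V ↔ y ^ (l + 1) = 125 ∧ SSy κ l y := by
    intro y; rw [hV]; simp
  have hcard : {y : κ | y ^ (l + 1) = 125 ∧ SSy κ l y}.ncard = V.card := by
    rw [hV, Set.ncard_eq_toFinset_card _ (V_fin hl)]
  have hsum := N_sum hl hl5 hmod5 V hVm ρ hρ
  rw [← hN] at hsum
  have hT := count_T hl hl5 φ
  rw [hcard] at hT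
  have hrat : ∀ y ∈ V, ρ y ^ l = ρ y → y ^ 2 = 125 := by
    intro y hy h
    have h1 := rat_y hl (hρ y) h
    have h3 := ((hVm y).mp hy).1
    rw [pow_succ, h1] at h3
    rw [sq, h3]
  have case3 : l % 4 = 3 → N + 3 = V.card := by
    intro h4
    obtain ⟨s, hs⟩ := sq5_mod hl hl5 hmod5
    obtain ⟨f, hf⟩ : ∃ f : ZMod l →+* κ, f = ZMod.castHom (dvd_refl l) κ := ⟨_, rfl⟩
    obtain ⟨F, hF⟩ := exists_Fr hl (κ := κ)
    have hσF : F (f s) = f s := by rw [hF, fix_map hl]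
    have hσ2 : (f s) ^ 2 = 5 := by rw [← map_pow, hs, map_ofNat]
    generalize f s = σ at hσF hσ2
    have hσ0 : σ ≠ 0 := by rintro rfl; norm_num at hσ2; exact h5' hσ2.symm
    obtain ⟨i, hi⟩ := IsAlgClosed.exists_pow_nat_eq (-1 : κ) (n := 2) (by norm_num)
    have hi0 : i ≠ 0 := by rintro rfl; norm_num at hi
    have hV0 : ∀ y, y ∈ ({5 * σ, -(5 * σ)} : Finset κ) ↔ y ^ 2 = 125 := by
      intro y
      rw [Finset.mem_insert, Finset.mem_singleton, show (125 : κ) = (5 * σ) ^ 2 by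
        rw [mul_pow, hσ2]; norm_num, sq_eq_sq_iff_eq_or_eq_neg]
    have hV1 : ∀ y, y ∈ ({-11 + 2 * i, -11 - 2 * i} : Finset κ) ↔ (y + 11) ^ 2 = -4 := by
      intro y
      rw [Finset.mem_insert, Finset.mem_singleton, show (-4 : κ) = (2 * i) ^ 2 by
        rw [mul_pow, hi]; norm_num, sq_eq_sq_iff_eq_or_eq_neg, ← eq_sub_iff_add_eq, ← eq_sub_iff_add_eq]
      rw [show 2 * i - 11 = -11 + 2 * i by ring, show -(2 * i) - 11 = -11 - 2 * i by ring]
    have hl125 : ∀ y : κ, y ^ 2 = 125 → y ^ l = y := by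
      intro y hy
      rcases Finset.mem_insert.mp ((hV0 y).mpr hy) with rfl | h
      · rw [← hF, map_mul, map_ofNat, hσF]
      · rw [Finset.mem_singleton.mp h, ← hF, map_neg, map_mul, map_ofNat, hσF]
    have hs0 : ({5 * σ, -(5 * σ)} : Finset κ) ⊆ V := by
      intro y hy
      rw [hV0] at hy
      have h1 : y ^ (l + 1) = 125 := by rw [pow_succ, hl125 y hy, ← sq, hy]
      exact (hVm y).mpr ⟨h1, ss_pm hl hl5 hmod5 h4 φ hy h1⟩
    have hs1 : ({-11 + 2 * i, -11 - 2 * i} : Finset κ) ⊆ V := by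
      intro y hy
      rw [hV1] at hy
      exact (hVm y).mpr (ss_i hl hl5 h4 hy)
    have hc0 : ({5 * σ, -(5 * σ)} : Finset κ).card = 2 := by
      apply Finset.card_pair
      intro h
      have : 2 * (5 * σ) = 0 := by linear_combination h
      simp [h2, h5', hσ0] at this
    have hc1 : ({-11 + 2 * i, -11 - 2 * i} : Finset κ).card = 2 := by
      apply Finset.card_pair
      intro h
      have : 2 * (2 * i) = 0 := by linear_combination h
      simp [h2, hi0] at this
    have hdis : ∀ y : κ, y ^ 2 = 125 → (y + 11) ^ 2 = -4 → False := by
      intro y h h'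
      have e1 : 22 * y = -250 := by linear_combination h' - h
      have e2 : (2 : κ) ^ 4 * 5 ^ 3 = 0 := by
        linear_combination 484 * h - (22 * y - 250) * e1
      simp [h2, h5'] at e2
    generalize ({5 * σ, -(5 * σ)} : Finset κ) = V0 at *
    generalize ({-11 + 2 * i, -11 - 2 * i} : Finset κ) = V1 at *
    have hpt : ∀ y ∈ V, (if ρ y ^ l = ρ y then 0 else if ρ y ^ 2 = -1 then 1 else 2) +
        ((if y ∈ V0 then 2 else 0) + (if y ∈ V1 then 1 else 0)) = 2 := by
      intro y hy
      by_cases h0 : y ^ 2 = 125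
      · have hr := rho_rat hl hl5 hmod5 h4 h0 (hl125 y h0) (hρ y)
        rw [if_pos hr, if_pos ((hV0 y).mpr h0), if_neg (fun h => hdis y h0 ((hV1 y).mp h))]
      · have hr : ¬ ρ y ^ l = ρ y := fun h => h0 (hrat y hy h)
        rw [if_neg hr, if_neg (fun h => h0 ((hV0 y).mp h))]
        by_cases h1 : (y + 11) ^ 2 = -4
        · rw [if_pos ((sq_neg_one_iff h2 (hρ y)).mpr h1), if_pos ((hV1 y).mpr h1)]
        · rw [if_neg (fun h => h1 ((sq_neg_one_iff h2 (hρ y)).mp h)), if_neg (fun h => h1 ((hV1 y).mp h))]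
    have hS := Finset.sum_congr (rfl : V = V) hpt
    rw [Finset.sum_add_distrib, ← hsum, Finset.sum_add_distrib, ← Finset.sum_filter, ← Finset.sum_filter,
      Finset.filter_mem_eq_inter, Finset.filter_mem_eq_inter, Finset.inter_eq_right.mpr hs0,
      Finset.inter_eq_right.mpr hs1, Finset.sum_const, Finset.sum_const, Finset.sum_const, hc0, hc1] at hS
    simp only [smul_eq_mul] at hS
    omega
  refine ⟨fun h4 => ?_, fun h8 => ?_, fun h8 => ?_⟩
  · have hpt : ∀ y ∈ V, (if ρ y ^ l = ρ y then 0 else if ρ y ^ 2 = -1 then 1 else 2) = 2 := by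
      intro y hy
      have hr : ¬ ρ y ^ l = ρ y := fun h => ord_pm hl hl5 hmod5 h4 φ (hrat y hy h) ((hVm y).mp hy).2
      rw [if_neg hr, if_neg]
      intro h
      apply hr
      obtain ⟨k, hk⟩ : ∃ k, l = 2 * (2 * k) + 1 := ⟨l / 4, by omega⟩
      rw [hk, pow_succ, pow_mul, h, pow_mul]
      norm_num
    rw [Finset.sum_congr rfl hpt, Finset.sum_const, smul_eq_mul] at hsum
    have := count_TT1 hl hl5 hθ hK h4
    omega
  · have h3 := case3 (by omega)
    have := count_TT3 hl hl5 hθ hK (by omega)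
    rw [if_neg (by omega)] at this
    omega
  · have h3 := case3 (by omega)
    have := count_TT3 hl hl5 hθ hK (by omega)
    rw [if_pos h8] at this
    omega
end

open Polynomial

/-- Theorem 1.1 B of Morton's paper: for a prime `l > 5`, `l ≡ 4 (mod 5)`, the number `N`
of pairs `(u,v) ∈ 𝔽_l²` such that `x² + u·x + v` is irreducible over `𝔽_l`, divides the
Hasse invariant `Ĥ_{5,l}(x)`, and `u = e⁵(v−1)` for some root `e` of `e² + e = 1`, satisfies
`2N = h(−5l)` if `l ≡ 1 (mod 4)`, `N = h(−5l) − 3` if `l ≡ 3 (mod 8)` and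
`N = 2h(−5l) − 3` if `l ≡ 7 (mod 8)`. -/
theorem quadratic_factors_of_hasse_invariant_count_four_mod_five
    (l : ℕ) (hl : Nat.Prime l) (hl5 : 5 < l)
    (hmod5 : l % 5 = 4)
    (K : Type) [Field K] [NumberField K] (θ : K)
    (hθ : θ ^ 2 = -((5 * l : ℕ) : K))
    (hK : Module.finrank ℚ K = 2)
    (N : ℕ)
    (hN : N = {uv : ZMod l × ZMod l |
        Irreducible (X ^ 2 + C uv.1 * X + C uv.2) ∧
        (X ^ 2 + C uv.1 * X + C uv.2) ∣ hasseInvariant5 l ∧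
        ∃ e : ZMod l, e ^ 2 + e = 1 ∧ uv.1 = e ^ 5 * (uv.2 - 1)}.ncard) :
    (l % 4 = 1 → 2 * N = NumberField.classNumber K) ∧
    (l % 8 = 3 → (N : ℤ) = (NumberField.classNumber K : ℤ) - 3) ∧
    (l % 8 = 7 → (N : ℤ) = 2 * (NumberField.classNumber K : ℤ) - 3) := by
  exact main_count hl hl5 hmod5 K θ hθ hK N hN
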